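/- Let d ≥ 5, n ≥ 4 and let U_0 be an n-element configuration in Z^d. There exist a real number b = b(n) > 0 and a random time θ, finite P_{U_0}-almost surely, with the following property: there is a clustering C of U_θ such that the natural clustering (C_θ, C_{θ+1}, …) of (U_θ, U_{θ+1}, …) with C satisfies C_t ∈ 𝒞(U_t, a_{t−θ}, b) for all t ≥ θ, where a_s = s^{1/2 − n^{−100}} + 100n. -/

import Mathlib

open MeasureTheory

namespace HATFormal

/-- Points of the lattice `ℤ^d`. -/
abbrev Pt (d : ℕ) := Fin d → ℤ

/-- The `2d` unit steps of the simple random walk on `ℤ^d`. -/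
def Dir (d : ℕ) : Set (Pt d) :=
  {s | ∃ i : Fin d, s = Pi.single i 1 ∨ s = Pi.single i (-1)}

/-- The position, after `t` steps, of the walk started at `x` with steps `s`. -/
def wpos (d : ℕ) (x : Pt d) {T : ℕ} (s : Fin T → Pt d) (t : ℕ) : Pt d :=
  x + ∑ i ∈ Finset.univ.filter (fun i : Fin T => (i : ℕ) < t), s i

/-- The probability of an event `P` of the first `T` steps of simple random walk on `ℤ^d`. -/
noncomputable def prob (d T : ℕ) (P : (Fin T → Pt d) → Prop) : ℝ :=
  (Nat.card {s : Fin T → Pt d // (∀ i, s i ∈ Dir d) ∧ P s} : ℝ) / ((2 * d : ℕ) : ℝ) ^ T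

open Classical in
/-- `esc d A x = P_x(τ_A = ∞)` if `x ∈ A`, and `0` otherwise. -/
noncomputable def esc (d : ℕ) (A : Set (Pt d)) (x : Pt d) : ℝ :=
  if x ∈ A then ⨅ T : ℕ, prob d T (fun s => ∀ t, 1 ≤ t → t ≤ T → wpos d x s t ∉ A) else 0

/-- The capacity of `A`. -/
noncomputable def capa (d : ℕ) (A : Set (Pt d)) : ℝ := ∑' x : A, esc d A (x : Pt d)

/-- The harmonic measure `H_A(x) = esc_A(x) / cap_A`. -/
noncomputable def harm (d : ℕ) (A : Set (Pt d)) (x : Pt d) : ℝ := esc d A x / capa d A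

/-- `P_x(τ_W < ∞)`. -/
noncomputable def retProb (d : ℕ) (W : Set (Pt d)) (x : Pt d) : ℝ :=
  ∑' t : ℕ, prob d t (fun s => 1 ≤ t ∧ wpos d x s t ∈ W ∧
    ∀ u, 1 ≤ u → u < t → wpos d x s u ∉ W)

/-- `P_x(τ_W < ∞ and S_{τ_W − 1} = y)`. -/
noncomputable def hitFrom (d : ℕ) (W : Set (Pt d)) (x y : Pt d) : ℝ :=
  ∑' t : ℕ, prob d t (fun s => 1 ≤ t ∧ wpos d x s t ∈ W ∧ wpos d x s (t - 1) = y ∧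
    ∀ u, 1 ≤ u → u < t → wpos d x s u ∉ W)

/-- `P_x(τ_W < ∞ and S_{τ_W} ∈ T)`. -/
noncomputable def firstHitIn (d : ℕ) (W T : Set (Pt d)) (x : Pt d) : ℝ :=
  ∑' t : ℕ, prob d t (fun s => 1 ≤ t ∧ wpos d x s t ∈ W ∧ wpos d x s t ∈ T ∧
    ∀ u, 1 ≤ u → u < t → wpos d x s u ∉ W)

/-- `P_x(S_{τ_W − 1} = y ∣ τ_W < ∞)`. -/
noncomputable def transP (d : ℕ) (W : Set (Pt d)) (x y : Pt d) : ℝ :=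
  hitFrom d W x y / retProb d W x

/-- The Green's function of simple random walk on `ℤ^d`. -/
noncomputable def green (d : ℕ) (x : Pt d) : ℝ :=
  ∑' t : ℕ, prob d t (fun s => wpos d x s t = 0)

/-- Configurations: finite subsets of `ℤ^d`. -/
abbrev Conf (d : ℕ) := Finset (Pt d)

/-- `p_U(x, y)`, the probability that HAT activates at `x` and transports to `y`. -/
noncomputable def pHAT (d : ℕ) (U : Conf d) (x y : Pt d) : ℝ :=
  harm d (↑U) x * transP d ((↑U : Set (Pt d)) \ {x}) x y

open Classical in
/-- The transition probabilities of HAT. -/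
noncomputable def hatProb (d : ℕ) (U V : Conf d) : ℝ :=
  if V = U then ∑' z : Pt d, pHAT d U z z
  else ∑' x : Pt d, ∑' y : Pt d,
    if x ∈ U ∧ x ≠ y ∧ V = insert y (U.erase x) then pHAT d U x y else 0

instance (d : ℕ) : MeasurableSpace (Conf d) := ⊤

/-- `μ` is the law of HAT started from `U`. -/
def IsHATLaw (d : ℕ) (U : Conf d) (μ : Measure (ℕ → Conf d)) : Prop :=
  IsProbabilityMeasure μ ∧
  ∀ (t : ℕ) (u : ℕ → Conf d),
    μ {ω | ∀ s ≤ t, ω s = u s} =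
      (if u 0 = U then 1 else 0) *
        ∏ s ∈ Finset.range t, ENNReal.ofReal (hatProb d (u s) (u (s + 1)))

/-- A signed permutation plus translation of `ℤ^d`. -/
def SymImage (d : ℕ) (σ : Equiv.Perm (Fin d)) (ε : Fin d → ℤ) (v : Pt d) (x : Pt d) : Pt d :=
  fun i => v i + ε i * x (σ i)

/-- `SymEq d U V` holds when `V = gU` for a symmetry `g` of `ℤ^d`. -/
def SymEq (d : ℕ) (U V : Conf d) : Prop :=
  ∃ (σ : Equiv.Perm (Fin d)) (ε : Fin d → ℤ) (v : Pt d),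
    (∀ i, ε i = 1 ∨ ε i = -1) ∧ V = U.image (SymImage d σ ε v)

/-- Euclidean distance on `ℤ^d`. -/
noncomputable def dist0 (d : ℕ) (x y : Pt d) : ℝ :=
  Real.sqrt (∑ i, ((x i : ℝ) - (y i : ℝ)) ^ 2)

/-- Euclidean distance between finite subsets of `ℤ^d`. -/
noncomputable def setDist (d : ℕ) (A B : Finset (Pt d)) : ℝ :=
  sInf {r : ℝ | ∃ x ∈ A, ∃ y ∈ B, r = dist0 d x y}

/-- Euclidean diameter of a finite subset of `ℤ^d`. -/
noncomputable def diam0 (d : ℕ) (A : Finset (Pt d)) : ℝ :=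
  sSup {r : ℝ | ∃ x ∈ A, ∃ y ∈ A, r = dist0 d x y}

/-- Lattice (nearest-neighbor) adjacency in `ℤ^d`. -/
def latAdj (d : ℕ) (x y : Pt d) : Prop := (∑ i, (x i - y i).natAbs) = 1

/-- Exterior lattice boundary of a set. -/
def bdry (d : ℕ) (A : Set (Pt d)) : Set (Pt d) := {z | z ∉ A ∧ ∃ w ∈ A, latAdj d z w}

/-- Non-isolated configurations: some exposed element has a lattice neighbor in the set. -/
def NonIso (d : ℕ) (U : Conf d) : Prop :=
  ∃ x ∈ U, 0 < esc d (↑U) x ∧ ∃ y ∈ U, latAdj d x y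

/-- `C` is a clustering (ordered partition into nonempty clusters) of `U`. -/
def IsClusteringOf (d : ℕ) {k : ℕ} (C : Fin k → Finset (Pt d)) (U : Finset (Pt d)) : Prop :=
  (∀ i, (C i).Nonempty) ∧ (∀ i j, i ≠ j → Disjoint (C i) (C j)) ∧
    Finset.univ.biUnion C = U

/-- `C^{≠ i}`, the union of the clusters other than `i`. -/
def others (d : ℕ) {k : ℕ} (C : Fin k → Finset (Pt d)) (i : Fin k) : Finset (Pt d) :=
  Finset.univ.biUnion fun j => if j = i then ∅ else C j

/-- The separation of a clustering. -/
noncomputable def sep (d : ℕ) {k : ℕ} (C : Fin k → Finset (Pt d)) : ℝ :=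
  ⨅ i, setDist d (C i) (others d C i)

/-- `(a, b)` separated dimer-or-trimer (DOT) clusterings. -/
def IsDOT (d : ℕ) {k : ℕ} (C : Fin k → Finset (Pt d)) (a b : ℝ) : Prop :=
  (∀ i, (C i).card = 2 ∨ (C i).card = 3) ∧ a ≤ sep d C ∧
    ∀ i, diam0 d (C i) ≤ b * Real.log (setDist d (C i) (others d C i))

/-- Clusterings with an unspecified number of clusters. -/
abbrev ClusteringS (d : ℕ) := Σ k : ℕ, Fin k → Finset (Pt d)

/-- `π(C)`, the union of the clusters of `C`. -/
def confOf (d : ℕ) (C : ClusteringS d) : Conf d := Finset.univ.biUnion C.2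

/-- `C ∈ 𝒞(U, a, b)`. -/
def InC (d : ℕ) (U : Conf d) (a b : ℝ) (C : ClusteringS d) : Prop :=
  IsClusteringOf d C.2 U ∧ IsDOT d C.2 a b

/-- `U ∈ 𝒰_{d,n}(a, b)`. -/
def InU (d n : ℕ) (a b : ℝ) (U : Conf d) : Prop :=
  U.card = n ∧ ∃ C : ClusteringS d, InC d U a b C

/-- `C` is a clustering of an `n`-element configuration. -/
def IsClusteringConf (d n : ℕ) (C : ClusteringS d) : Prop :=
  (∀ i, (C.2 i).Nonempty) ∧ (∀ i j, i ≠ j → Disjoint (C.2 i) (C.2 j)) ∧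
    (confOf d C).card = n

open Classical in
/-- One step of the natural clustering. -/
noncomputable def clustStep (d : ℕ) (Ut Ut1 : Conf d) (C : ClusteringS d) : ClusteringS d :=
  if Ut1 = Ut then C
  else if h : ∃ p : Pt d × Pt d × Fin C.1,
      Ut \ Ut1 = {p.1} ∧ Ut1 \ Ut = {p.2.1} ∧ p.1 ∈ C.2 p.2.2 then
    ⟨C.1, Function.update C.2 h.choose.2.2
      (insert h.choose.2.1 ((C.2 h.choose.2.2).erase h.choose.1))⟩
  else ⟨1, fun _ => Ut1⟩

/-- The natural clustering of the trajectory `ω` with initial clustering `C0`. -/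
noncomputable def natClust (d : ℕ) (ω : ℕ → Conf d) (C0 : ClusteringS d) : ℕ → ClusteringS d
  | 0 => C0
  | t + 1 => clustStep d (ω t) (ω (t + 1)) (natClust d ω C0 t)

/-- `a_s = s^{1/2 − n^{−100}} + 100 n`. -/
noncomputable def aSep (n s : ℕ) : ℝ :=
  (s : ℝ) ^ ((1 : ℝ) / 2 - (n : ℝ) ^ (-(100 : ℝ))) + 100 * n

/-- `C^{i, x, y}`: remove `x` from cluster `i` of `C` and add `y` to that cluster. -/
def updC (d : ℕ) (C : ClusteringS d) (i : Fin C.1) (x y : Pt d) : ClusteringS d :=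
  ⟨C.1, Function.update C.2 i (insert y ((C.2 i).erase x))⟩

open Classical in
/-- The transition probabilities of the lifting of HAT to clusterings. -/
noncomputable def liftProb (d : ℕ) (E0 E1 : ClusteringS d) : ℝ :=
  ∑' x : Pt d, ∑' y : Pt d,
    if ∃ i : Fin E0.1, x ∈ E0.2 i ∧ E1 = updC d E0 i x y
    then pHAT d (confOf d E0) x y else 0

/-- The capacity of a clustering: the sum of the capacities of its clusters. -/
noncomputable def capS (d : ℕ) (C : ClusteringS d) : ℝ := ∑ i, capa d (↑(C.2 i))

/-- `H_C(i, x) = esc_{C^i}(x) / cap_C`. -/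
noncomputable def harmS (d : ℕ) (C : ClusteringS d) (i : Fin C.1) (x : Pt d) : ℝ :=
  esc d (↑(C.2 i)) x / capS d C

/-- `q_C(i, x, y)`. -/
noncomputable def qIHAT (d : ℕ) (C : ClusteringS d) (i : Fin C.1) (x y : Pt d) : ℝ :=
  harmS d C i x * transP d ((↑(C.2 i) : Set (Pt d)) \ {x}) x y

open Classical in
/-- The transition probabilities of intracluster HAT (IHAT). -/
noncomputable def ihatProb (d : ℕ) (D E : ClusteringS d) : ℝ :=
  ∑' x : Pt d, ∑' y : Pt d, ∑ i : Fin D.1,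
    if x ∈ D.2 i ∧ E = updC d D i x y then qIHAT d D i x y else 0

instance (d : ℕ) : MeasurableSpace (ClusteringS d) := ⊤

open Classical in
/-- `μ` is the law of the lifted HAT chain started from `E0`. -/
def IsLiftLaw (d : ℕ) (E0 : ClusteringS d) (μ : Measure (ℕ → ClusteringS d)) : Prop :=
  IsProbabilityMeasure μ ∧
  ∀ (t : ℕ) (u : ℕ → ClusteringS d),
    μ {ω | ∀ s ≤ t, ω s = u s} =
      (if u 0 = E0 then 1 else 0) *
        ∏ s ∈ Finset.range t, ENNReal.ofReal (liftProb d (u s) (u (s + 1)))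

open Classical in
/-- `μ` is the law of intracluster HAT started from `D0`. -/
def IsIHATLaw (d : ℕ) (D0 : ClusteringS d) (μ : Measure (ℕ → ClusteringS d)) : Prop :=
  IsProbabilityMeasure μ ∧
  ∀ (t : ℕ) (u : ℕ → ClusteringS d),
    μ {ω | ∀ s ≤ t, ω s = u s} =
      (if u 0 = D0 then 1 else 0) *
        ∏ s ∈ Finset.range t, ENNReal.ofReal (ihatProb d (u s) (u (s + 1)))

/-- `Pairs(E0, E1)`. -/
def Pairs (d : ℕ) (E0 E1 : ClusteringS d) : Set (Pt d × Pt d) :=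
  {p | 0 < pHAT d (confOf d E0) p.1 p.2 ∧
    ∃ i : Fin E0.1, p.1 ∈ E0.2 i ∧ E1 = updC d E0 i p.1 p.2}

/-- `Triples(E0, E1)`. -/
def Triples (d : ℕ) (E0 E1 : ClusteringS d) : Set (Fin E0.1 × Pt d × Pt d) :=
  {q | 0 < qIHAT d E0 q.1 q.2.1 q.2.2 ∧ E1 = updC d E0 q.1 q.2.1 q.2.2}

/-- The first standard basis vector of `ℤ^d`. -/
def e1v (d : ℕ) : Pt d := fun i => if (i : ℕ) = 0 then 1 else 0

/-- Reference dimers and trimers. -/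
def Ref (d : ℕ) : Set (Finset (Pt d)) :=
  {A | ∃ x : Pt d, A = {x, x + e1v d} ∨ A = {x, x + e1v d, x + e1v d + e1v d}}

/-- *-adjacency in `ℤ^d`: distinct points differing by at most one in each coordinate. -/
def starAdj (d : ℕ) (x y : Pt d) : Prop := x ≠ y ∧ ∀ i, (x i - y i).natAbs ≤ 1

/-- The *-visible boundary of `A`. -/
def visBdry (d : ℕ) (A : Finset (Pt d)) : Set (Pt d) :=
  {x | (∃ y ∈ A, starAdj d x y) ∧
    ∃ γ : ℕ → Pt d, γ 0 = x ∧ (∀ t, latAdj d (γ t) (γ (t + 1))) ∧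
      (∀ t, γ t ∉ A) ∧ ∀ r : ℝ, ∃ t, r < dist0 d (γ t) 0}

/-- `A` is connected in the nearest-neighbor graph of `ℤ^d`. -/
def LatConnected (d : ℕ) (A : Finset (Pt d)) : Prop :=
  ∀ x ∈ A, ∀ y ∈ A, ∃ (L : ℕ) (γ : ℕ → Pt d), γ 0 = x ∧ γ L = y ∧
    (∀ t < L, latAdj d (γ t) (γ (t + 1))) ∧ ∀ t ≤ L, γ t ∈ A

/-- Strict lexicographic order on `ℤ^d`. -/
def lexLt (d : ℕ) (x y : Pt d) : Prop :=
  ∃ i : Fin d, (∀ j, j < i → x j = y j) ∧ x i < y i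

/-- `x` is the lex (least) element of `A`. -/
def IsLex (d : ℕ) (A : Finset (Pt d)) (x : Pt d) : Prop :=
  x ∈ A ∧ ∀ y ∈ A, y ≠ x → lexLt d x y

/-! ### Simple random walk basics -/

/-- index of the steps -/
abbrev Stp (d : ℕ) := Fin d × Bool

/-- the step with a given index -/
def stp {d : ℕ} (k : Stp d) : Pt d := Pi.single k.1 (if k.2 then 1 else -1)

lemma stp_mem {d : ℕ} (k : Stp d) : stp k ∈ Dir d := by
  rcases k with ⟨i, b⟩
  cases b
  · exact ⟨i, Or.inr (by simp [stp])⟩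
  · exact ⟨i, Or.inl (by simp [stp])⟩

lemma stp_inj {d : ℕ} : Function.Injective (stp (d := d)) := by
  rintro ⟨i, b⟩ ⟨j, c⟩ h
  have h1 := congrFun h i
  have h2 := congrFun h j
  by_cases hij : i = j
  · subst hij
    simp [stp] at h1
    cases b <;> cases c <;> simp_all
  · simp [stp, hij] at h1
    cases b <;> simp_all

lemma mem_dir_iff {d : ℕ} (s : Pt d) : s ∈ Dir d ↔ ∃ k, stp k = s := by
  constructor
  · rintro ⟨i, h | h⟩
    · exact ⟨(i, true), by simp [stp, h]⟩
    · exact ⟨(i, false), by simp [stp, h]⟩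
  · rintro ⟨k, rfl⟩; exact stp_mem k

/-- the equivalence of steps and indices -/
noncomputable def stpEquiv (d : ℕ) : Stp d ≃ {s : Pt d // s ∈ Dir d} :=
  Equiv.ofBijective (fun k => ⟨stp k, stp_mem k⟩) ⟨fun a b h => stp_inj (by simpa using h),
    fun ⟨s, hs⟩ => by obtain ⟨k, hk⟩ := (mem_dir_iff s).1 hs; exact ⟨k, by simp [hk]⟩⟩

open Classical in
lemma prob_eq (d T : ℕ) (P : (Fin T → Pt d) → Prop) :
    prob d T P = (∑ s : Fin T → Stp d, if P (fun i => stp (s i)) then (1:ℝ) else 0)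
      / ((2 * d : ℕ) : ℝ) ^ T := by
  unfold prob
  congr 1
  rw [Finset.sum_boole]
  norm_cast
  rw [← Fintype.card_subtype, ← Nat.card_eq_fintype_card]
  symm
  refine Nat.card_congr (Equiv.ofBijective
    (fun s => ⟨fun i => stp (s.1 i), fun i => stp_mem _, s.2⟩) ⟨?_, ?_⟩)
  · intro a b h
    ext1
    funext i
    have := congrFun (congrArg Subtype.val h) i
    exact stp_inj this
  · rintro ⟨s, hs, hP⟩
    choose k hk using fun i => (mem_dir_iff (s i)).1 (hs i)
    have : (fun i => stp (k i)) = s := funext hk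
    exact ⟨⟨k, by rw [this]; exact hP⟩, by simp [this]⟩

lemma prob_zero (d : ℕ) (P : (Fin 0 → Pt d) → Prop) (h : P (fun i => i.elim0)) :
    prob d 0 P = 1 := by
  classical
  rw [prob_eq]
  simp only [pow_zero, div_one, Finset.univ_unique, Finset.sum_singleton]
  rw [if_pos]
  convert h using 1

lemma prob_congr {d T : ℕ} {P Q : (Fin T → Pt d) → Prop} (h : ∀ s, P s ↔ Q s) :
    prob d T P = prob d T Q := by
  congr 1; funext s; exact propext (h s)

lemma prob_false {d T : ℕ} {P : (Fin T → Pt d) → Prop} (h : ∀ s, ¬ P s) :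
    prob d T P = 0 := by
  classical
  rw [prob_eq]; simp [h]

lemma prob_succ (d T : ℕ) (P : (Fin (T+1) → Pt d) → Prop) :
    prob d (T+1) P = (∑ k : Stp d, prob d T (fun s => P (Fin.cons (stp k) s))) / (2 * d : ℝ) := by
  classical
  rw [prob_eq]
  simp_rw [prob_eq]
  rw [← Finset.sum_div, div_div, pow_succ]
  push_cast
  congr 1
  rw [← (Fin.consEquiv (fun _ => Stp d)).sum_comp, Fintype.sum_prod_type]
  refine Finset.sum_congr rfl fun k _ => Finset.sum_congr rfl fun s _ => ?_
  have : (fun i => stp ((Fin.consEquiv (fun _ => Stp d)) (k, s) i))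
      = (Fin.cons (stp k) (fun i => stp (s i)) : Fin (T+1) → Pt d) := by
    funext i
    refine Fin.cases ?_ (fun j => ?_) i <;> simp [Fin.consEquiv]
  rw [this]

lemma wpos_cons {d T : ℕ} (x e : Pt d) (s : Fin T → Pt d) (t : ℕ) :
    wpos d x (Fin.cons e s : Fin (T+1) → Pt d) (t+1) = wpos d (x+e) s t := by
  unfold wpos
  rw [Finset.sum_filter, Finset.sum_filter, Fin.sum_univ_succ]
  simp [add_assoc]

lemma wpos_zero {d T : ℕ} (x : Pt d) (s : Fin T → Pt d) : wpos d x s 0 = x := by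
  simp [wpos]

/-- average over neighbours -/
noncomputable def avg {d : ℕ} (f : Pt d → ℝ) (x : Pt d) : ℝ :=
  (∑ k : Stp d, f (x + stp k)) / (2 * d : ℝ)

open Classical in
/-- first hit at time `t+1` with weight `q prev land`. -/
noncomputable def fh {d : ℕ} (W : Set (Pt d)) (q : Pt d → Pt d → ℝ) : ℕ → Pt d → ℝ
  | 0, x => (∑ k : Stp d, if x + stp k ∈ W then q x (x + stp k) else 0) / (2 * d : ℝ)
  | t+1, x => (∑ k : Stp d, if x + stp k ∈ W then 0 else fh W q t (x + stp k)) / (2 * d : ℝ)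

open Classical in
/-- weight given by a condition on the previous point -/
noncomputable def qAt {d : ℕ} (Q : Pt d → Prop) : Pt d → Pt d → ℝ := fun p _ => if Q p then 1 else 0

open Classical in
lemma fh_eq_prob {d : ℕ} (W : Set (Pt d)) (Q : Pt d → Prop) (t : ℕ) (x : Pt d) :
    prob d (t+1) (fun s => wpos d x s (t+1) ∈ W ∧ Q (wpos d x s t) ∧
      ∀ u, 1 ≤ u → u < t+1 → wpos d x s u ∉ W) = fh W (qAt Q) t x := by
  induction t generalizing x with
  | zero =>
    rw [prob_succ, fh]
    try simp only [qAt]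
    congr 1
    refine Finset.sum_congr rfl fun k _ => ?_
    simp only [wpos_cons, wpos_zero]
    by_cases h1 : x + stp k ∈ W
    · by_cases h2 : Q x
      · rw [if_pos h1, if_pos h2, prob_zero]
        exact ⟨h1, h2, fun u h h' => by omega⟩
      · rw [if_pos h1, if_neg h2]; exact prob_false fun s h => h2 h.2.1
    · rw [if_neg h1]; exact prob_false fun s h => h1 h.1
  | succ t ih =>
    rw [prob_succ, fh]
    congr 1
    refine Finset.sum_congr rfl fun k _ => ?_
    simp only [wpos_cons]
    split_ifs with h1
    · refine prob_false fun s h => ?_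
      have := h.2.2 1 le_rfl (by omega)
      have h3 := wpos_cons x (stp k) s 0
      rw [wpos_zero] at h3
      exact this (by rw [h3]; exact h1)
    · rw [← ih]
      refine prob_congr fun s => and_congr Iff.rfl (and_congr Iff.rfl ?_)
      constructor
      · intro h u hu hu'
        have := h (u+1) (by omega) (by omega)
        rwa [wpos_cons] at this
      · intro h u hu hu'
        obtain ⟨u, rfl⟩ : ∃ v, u = v + 1 := ⟨u-1, by omega⟩
        rw [wpos_cons]
        rcases Nat.eq_zero_or_pos u with rfl | hpos
        · rwa [wpos_zero]
        · exact h u hpos (by omega)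

/-- the probability to avoid `W` at times `1..T` -/
noncomputable def av {d : ℕ} (W : Set (Pt d)) (T : ℕ) (x : Pt d) : ℝ :=
  prob d T (fun s => ∀ t, 1 ≤ t → t ≤ T → wpos d x s t ∉ W)

lemma av_zero {d : ℕ} (W : Set (Pt d)) (x : Pt d) : av W 0 x = 1 :=
  prob_zero _ _ (fun t h h' => by omega)

open Classical in
lemma av_succ {d : ℕ} (W : Set (Pt d)) (T : ℕ) (x : Pt d) :
    av W (T+1) x = (∑ k : Stp d, if x + stp k ∈ W then 0 else av W T (x + stp k)) / (2 * d : ℝ) := by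
  unfold av
  rw [prob_succ]
  congr 1
  refine Finset.sum_congr rfl fun k _ => ?_
  split_ifs with h1
  · refine prob_false fun s h => ?_
    have := h 1 le_rfl (by omega)
    have h3 := wpos_cons x (stp k) s 0
    rw [wpos_zero] at h3
    exact this (by rw [h3]; exact h1)
  · refine prob_congr fun s => ?_
    constructor
    · intro h u hu hu'
      have := h (u+1) (by omega) (by omega)
      rwa [wpos_cons] at this
    · intro h u hu hu'
      obtain ⟨u, rfl⟩ : ∃ v, u = v + 1 := ⟨u-1, by omega⟩
      rw [wpos_cons]
      rcases Nat.eq_zero_or_pos u with rfl | hpos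
      · rwa [wpos_zero]
      · exact h u hpos (by omega)

/-- partial sums of first hit weights -/
noncomputable def psum {d : ℕ} (W : Set (Pt d)) (q : Pt d → Pt d → ℝ) (T : ℕ) (x : Pt d) : ℝ :=
  ∑ t ∈ Finset.range T, fh W q t x

open Classical in
lemma psum_succ {d : ℕ} (W : Set (Pt d)) (q : Pt d → Pt d → ℝ) (T : ℕ) (x : Pt d) :
    psum W q (T+1) x = (∑ k : Stp d, if x + stp k ∈ W then q x (x + stp k)
      else psum W q T (x + stp k)) / (2 * d : ℝ) := by
  unfold psum
  rw [Finset.sum_range_succ']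
  simp only [fh]
  rw [← Finset.sum_div, ← add_div, Finset.sum_comm, ← Finset.sum_add_distrib]
  congr 1
  refine Finset.sum_congr rfl fun k _ => ?_
  split_ifs <;> simp

lemma fh_nonneg {d : ℕ} {W : Set (Pt d)} {q : Pt d → Pt d → ℝ} (hq : ∀ a b, 0 ≤ q a b) (t : ℕ)
    (x : Pt d) : 0 ≤ fh W q t x := by
  induction t generalizing x with
  | zero => rw [fh]; refine div_nonneg (Finset.sum_nonneg fun k _ => ?_) (by positivity)
            split_ifs; exacts [hq _ _, le_rfl]
  | succ t ih => rw [fh]; refine div_nonneg (Finset.sum_nonneg fun k _ => ?_) (by positivity)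
                 split_ifs; exacts [le_rfl, ih _]

lemma fh_mono {d : ℕ} {W : Set (Pt d)} {q q' : Pt d → Pt d → ℝ} (hq : ∀ a, ∀ b ∈ W, q a b ≤ q' a b)
    (t : ℕ) (x : Pt d) : fh W q t x ≤ fh W q' t x := by
  induction t generalizing x with
  | zero => rw [fh, fh]; gcongr with k; split_ifs with h; exacts [hq _ _ h, le_rfl]
  | succ t ih => rw [fh, fh]; gcongr with k; split_ifs; exacts [le_rfl, ih _]

lemma card_stp (d : ℕ) : (Fintype.card (Stp d) : ℝ) = 2 * d := by
  simp [Stp, mul_comm]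

lemma psum_add_av {d : ℕ} (hd : 0 < d) (W : Set (Pt d)) (T : ℕ) (x : Pt d) :
    psum W (fun _ _ => 1) T x + av W T x = 1 := by
  classical
  have hd' : (0:ℝ) < 2 * d := by positivity
  induction T generalizing x with
  | zero => simp [psum, av_zero]
  | succ T ih =>
    rw [psum_succ, av_succ, ← add_div, ← Finset.sum_add_distrib, div_eq_one_iff_eq hd'.ne',
      ← card_stp]
    rw [Finset.sum_congr rfl (g := fun _ => (1:ℝ))]
    · simp
    · intro k _
      split_ifs
      · simp
      · exact ih _

lemma av_nonneg {d : ℕ} (W : Set (Pt d)) (T : ℕ) (x : Pt d) : 0 ≤ av W T x := by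
  unfold av prob; positivity

/-- comparison with a superharmonic function, partial sums -/
lemma psum_le {d : ℕ} {W : Set (Pt d)} {q : Pt d → Pt d → ℝ} {G : Pt d → ℝ}
    (hG : ∀ x, 0 ≤ G x) (hs : ∀ x, x ∉ W → avg G x ≤ G x) (hW : ∀ a, ∀ w ∈ W, q a w ≤ G w)
    (T : ℕ) (x : Pt d) : psum W q T x ≤ avg G x := by
  classical
  induction T generalizing x with
  | zero =>
    simp only [psum, Finset.range_zero, Finset.sum_empty, avg]
    exact div_nonneg (Finset.sum_nonneg fun k _ => hG _) (by positivity)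
  | succ T ih =>
    rw [psum_succ, avg]
    gcongr with k
    split_ifs with h
    · exact hW _ _ h
    · exact (ih _).trans (hs _ h)

/-- total first-hit weight -/
noncomputable def Hit {d : ℕ} (W : Set (Pt d)) (q : Pt d → Pt d → ℝ) (x : Pt d) : ℝ :=
  ∑' t, fh W q t x

/-- bounded weight -/
def BW {d : ℕ} (q : Pt d → Pt d → ℝ) : Prop := ∀ a b, 0 ≤ q a b ∧ q a b ≤ 1

lemma bw_one {d : ℕ} : BW (d := d) (fun _ _ => 1) := fun _ _ => ⟨zero_le_one, le_rfl⟩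

lemma psum_le_one {d : ℕ} (hd : 0 < d) {W : Set (Pt d)} {q : Pt d → Pt d → ℝ} (hq : BW q) (T : ℕ)
    (x : Pt d) : psum W q T x ≤ 1 := by
  have h1 := psum_add_av hd W T x
  have h2 := av_nonneg W T x
  have h3 : psum W q T x ≤ psum W (fun _ _ => 1) T x :=
    Finset.sum_le_sum fun t _ => fh_mono (fun a b _ => (hq a b).2) t x
  linarith

lemma fh_summable {d : ℕ} (hd : 0 < d) {W : Set (Pt d)} {q : Pt d → Pt d → ℝ} (hq : BW q)
    (x : Pt d) : Summable (fun t => fh W q t x) :=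
  summable_of_sum_range_le (fun t => fh_nonneg (fun a b => (hq a b).1) t x)
    (fun T => psum_le_one hd hq T x)

lemma psum_tendsto {d : ℕ} (hd : 0 < d) {W : Set (Pt d)} {q : Pt d → Pt d → ℝ} (hq : BW q)
    (x : Pt d) : Filter.Tendsto (fun T => psum W q T x) Filter.atTop (nhds (Hit W q x)) :=
  (fh_summable hd hq x).hasSum.tendsto_sum_nat

lemma Hit_le_of_psum {d : ℕ} (hd : 0 < d) {W : Set (Pt d)} {q : Pt d → Pt d → ℝ} (hq : BW q)
    {x : Pt d} {c : ℝ} (h : ∀ T, psum W q T x ≤ c) : Hit W q x ≤ c :=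
  le_of_tendsto' (psum_tendsto hd hq x) h

lemma Hit_nonneg {d : ℕ} {W : Set (Pt d)} {q : Pt d → Pt d → ℝ} (hq : BW q) (x : Pt d) :
    0 ≤ Hit W q x := tsum_nonneg fun t => fh_nonneg (fun a b => (hq a b).1) t x

lemma Hit_le_one {d : ℕ} (hd : 0 < d) {W : Set (Pt d)} {q : Pt d → Pt d → ℝ} (hq : BW q)
    (x : Pt d) : Hit W q x ≤ 1 := Hit_le_of_psum hd hq fun T => psum_le_one hd hq T x

lemma Hit_mono {d : ℕ} (hd : 0 < d) {W : Set (Pt d)} {q q' : Pt d → Pt d → ℝ} (hq : BW q)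
    (hq' : BW q') (h : ∀ a, ∀ b ∈ W, q a b ≤ q' a b) (x : Pt d) : Hit W q x ≤ Hit W q' x :=
  (fh_summable hd hq x).tsum_le_tsum (fun t => fh_mono h t x) (fh_summable hd hq' x)

open Classical in
lemma Hit_step {d : ℕ} (hd : 0 < d) {W : Set (Pt d)} {q : Pt d → Pt d → ℝ} (hq : BW q)
    (x : Pt d) : Hit W q x = (∑ k : Stp d, if x + stp k ∈ W then q x (x + stp k)
      else Hit W q (x + stp k)) / (2 * d : ℝ) := by
  have h1 : Filter.Tendsto (fun T => psum W q (T+1) x) Filter.atTop (nhds (Hit W q x)) :=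
    (Filter.tendsto_add_atTop_iff_nat 1).2 (psum_tendsto hd hq x)
  refine tendsto_nhds_unique h1 ?_
  simp_rw [psum_succ]
  refine Filter.Tendsto.div_const (tendsto_finsetSum _ fun k _ => ?_) _
  split_ifs
  · exact tendsto_const_nhds
  · exact psum_tendsto hd hq _

lemma Hit_le {d : ℕ} (hd : 0 < d) {W : Set (Pt d)} {q : Pt d → Pt d → ℝ} (hq : BW q) {G : Pt d → ℝ}
    (hG : ∀ x, 0 ≤ G x) (hs : ∀ x, x ∉ W → avg G x ≤ G x) (hW : ∀ a, ∀ w ∈ W, q a w ≤ G w)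
    (x : Pt d) : Hit W q x ≤ avg G x :=
  Hit_le_of_psum hd hq fun T => psum_le hG hs hW T x

lemma Hit_add {d : ℕ} (hd : 0 < d) {W : Set (Pt d)} {q r : Pt d → Pt d → ℝ} (hq : BW q)
    (hr : BW r) (x : Pt d) : Hit W (fun a b => q a b + r a b) x = Hit W q x + Hit W r x := by
  unfold Hit
  rw [← (fh_summable hd hq x).tsum_add (fh_summable hd hr x)]
  congr 1; funext t
  induction t generalizing x with
  | zero =>
    simp only [fh]; rw [← add_div, ← Finset.sum_add_distrib]; congr 1
    refine Finset.sum_congr rfl fun k _ => ?_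
    split_ifs <;> simp
  | succ t ih =>
    simp only [fh]; rw [← add_div, ← Finset.sum_add_distrib]; congr 1
    refine Finset.sum_congr rfl fun k _ => ?_
    split_ifs
    · simp
    · exact ih _

lemma retProb_eq {d : ℕ} (hd : 0 < d) (W : Set (Pt d)) (x : Pt d) :
    retProb d W x = Hit W (fun _ _ => 1) x := by
  classical
  unfold retProb Hit
  have key : ∀ t, prob d (t+1) (fun s => 1 ≤ t+1 ∧ wpos d x s (t+1) ∈ W ∧
    ∀ u, 1 ≤ u → u < t+1 → wpos d x s u ∉ W) = fh W (fun _ _ => 1) t x := by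
    intro t
    have := fh_eq_prob W (fun _ => True) t x
    rw [show (qAt (d := d) fun _ => True) = fun _ _ => 1 by funext a b; simp [qAt]] at this
    rw [← this]
    exact prob_congr fun s => by simp
  rw [tsum_eq_zero_add']
  · rw [prob_false (by simp)]
    simp only [zero_add]
    exact tsum_congr key
  · simp_rw [key]; exact fh_summable hd bw_one x

lemma bw_qAt {d : ℕ} (Q : Pt d → Prop) : BW (d := d) (qAt Q) := by
  intro a b; unfold qAt; split_ifs <;> simp

lemma hitFrom_eq {d : ℕ} (hd : 0 < d) (W : Set (Pt d)) (x y : Pt d) :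
    hitFrom d W x y = Hit W (qAt (· = y)) x := by
  unfold hitFrom Hit
  have key : ∀ t, prob d (t+1) (fun s => 1 ≤ t+1 ∧ wpos d x s (t+1) ∈ W ∧
      wpos d x s (t + 1 - 1) = y ∧
    ∀ u, 1 ≤ u → u < t+1 → wpos d x s u ∉ W) = fh W (qAt (· = y)) t x := by
    intro t
    rw [← fh_eq_prob W (fun p => p = y) t x]
    exact prob_congr fun s => by simp
  rw [tsum_eq_zero_add']
  · rw [prob_false (by simp)]
    simp only [zero_add]
    exact tsum_congr key
  · simp_rw [key]; exact fh_summable hd (bw_qAt _) x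

lemma av_antitone {d : ℕ} (hd : 0 < d) (W : Set (Pt d)) (x : Pt d) : Antitone (fun T => av W T x) := by
  refine antitone_nat_of_succ_le fun T => ?_
  have h1 := psum_add_av hd W T x
  have h2 := psum_add_av hd W (T+1) x
  have h3 : psum W (fun _ _ => 1) T x ≤ psum W (fun _ _ => 1) (T+1) x := by
    unfold psum; rw [Finset.sum_range_succ]
    have := fh_nonneg (W := W) (q := fun _ _ => 1) (fun _ _ => zero_le_one) T x
    linarith
  linarith

lemma esc_eq {d : ℕ} (hd : 0 < d) (A : Set (Pt d)) {x : Pt d} (hx : x ∈ A) :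
    esc d A x = 1 - Hit A (fun _ _ => 1) x := by
  unfold esc
  rw [if_pos hx]
  have h1 : Filter.Tendsto (fun T => av A T x) Filter.atTop (nhds (1 - Hit A (fun _ _ => 1) x)) := by
    have := (psum_tendsto hd (bw_one) (W := A) x).const_sub 1
    refine this.congr fun T => ?_
    have := psum_add_av hd A T x
    linarith
  refine tendsto_nhds_unique (tendsto_atTop_ciInf (av_antitone hd A x) ⟨0, ?_⟩) h1
  rintro _ ⟨T, rfl⟩; exact av_nonneg _ _ _

lemma esc_nonneg {d : ℕ} (hd : 0 < d) (A : Set (Pt d)) (x : Pt d) : 0 ≤ esc d A x := by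
  by_cases hx : x ∈ A
  · rw [esc_eq hd A hx]; linarith [Hit_le_one hd (bw_one) (W := A) x]
  · unfold esc; rw [if_neg hx]

lemma esc_le_one {d : ℕ} (hd : 0 < d) (A : Set (Pt d)) (x : Pt d) : esc d A x ≤ 1 := by
  by_cases hx : x ∈ A
  · rw [esc_eq hd A hx]; linarith [Hit_nonneg (bw_one) (W := A) x]
  · unfold esc; rw [if_neg hx]; exact zero_le_one

/-! ### Superharmonic functions and hitting estimates -/

/-- squared Euclidean norm -/
noncomputable def nsq {d : ℕ} (x : Pt d) : ℝ := ∑ i, (x i : ℝ) ^ 2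

lemma nsq_nonneg {d : ℕ} (x : Pt d) : 0 ≤ nsq x := Finset.sum_nonneg fun i _ => sq_nonneg _

lemma nsq_stp {d : ℕ} (x : Pt d) (k : Stp d) :
    nsq (x + stp k) = nsq x + (if k.2 then 2 * (x k.1 : ℝ) else -(2 * (x k.1 : ℝ))) + 1 := by
  unfold nsq
  have h : ∀ i, (((x + stp k) i : ℤ) : ℝ) ^ 2 = (x i : ℝ) ^ 2 +
      (if i = k.1 then (if k.2 then 2 * (x k.1 : ℝ) else -(2 * (x k.1 : ℝ))) + 1 else 0) := by
    intro i
    by_cases hi : i = k.1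
    · subst hi
      simp only [Pi.add_apply, stp, Pi.single_eq_same, if_true]
      split_ifs <;> push_cast <;> ring
    · simp [stp, hi]
  rw [Finset.sum_congr rfl fun i _ => h i, Finset.sum_add_distrib]
  simp [add_assoc]

lemma coord_sq_le {d : ℕ} (x : Pt d) (i : Fin d) : (x i : ℝ) ^ 2 ≤ nsq x :=
  Finset.single_le_sum (f := fun i => (x i : ℝ) ^ 2) (fun i _ => sq_nonneg _) (Finset.mem_univ i)

lemma sum_stp {d : ℕ} (f : Stp d → ℝ) : ∑ k, f k = ∑ i, (f (i, true) + f (i, false)) := by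
  rw [Fintype.sum_prod_type]; simp

lemma taylor32 {u η : ℝ} (h1 : 1/2 ≤ u) (h2 : u ≤ 3/2) (hη : η = u^2 - 1) :
    1 / u^3 ≤ 1 - 3/2 * η + 15/8 * η^2 - 35/16 * η^3 + 1100 * η^4 := by
  have hu : 0 < u := by linarith
  rw [div_le_iff₀ (by positivity)]
  have key : 1 - (1 - 3/2 * η + 15/8 * η^2 - 35/16 * η^3) * u^3
      = (u-1)^4 * ((35*u^5+140*u^4+215*u^3+160*u^2+64*u+16)/16) := by
    subst hη; ring
  have h4 : (u-1)^4 ≤ η^4 := by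
    have : η^4 = (u-1)^4 * (u+1)^4 := by subst hη; ring
    rw [this]
    exact le_mul_of_one_le_right (by positivity) (one_le_pow₀ (by linarith))
  have hQ : (35*u^5+140*u^4+215*u^3+160*u^2+64*u+16)/16 ≤ 1100 * u^3 := by
    have e5 : u^5 ≤ u^3 * (9/4) := by
      have : u^5 = u^3 * u^2 := by ring
      rw [this]; gcongr; nlinarith
    have e4 : u^4 ≤ u^3 * (3/2) := by
      have : u^4 = u^3 * u := by ring
      rw [this]; gcongr
    have e2 : u^2 ≤ u^3 * 2 := by
      have : u^3 * 2 = u^2 * (u*2) := by ring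
      rw [this]; exact le_mul_of_one_le_right (by positivity) (by linarith)
    have e1 : u ≤ u^3 * 4 := by
      have : u^3 * 4 = u * ((u*2)^2) := by ring
      rw [this]; exact le_mul_of_one_le_right (by positivity) (one_le_pow₀ (by linarith))
    have e0 : 1 ≤ u^3 * 8 := by
      have : u^3 * 8 = (u*2)^3 := by ring
      rw [this]; exact one_le_pow₀ (by linarith)
    nlinarith [pow_pos hu 3]
  have : (u-1)^4 * ((35*u^5+140*u^4+215*u^3+160*u^2+64*u+16)/16) ≤ η^4 * (1100 * u^3) :=
    mul_le_mul h4 hQ (by positivity) (by positivity)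
  linarith

/-- the shifted norm -/
noncomputable def SS {d : ℕ} (K : ℝ) (x : Pt d) : ℝ := nsq x + K

/-- superharmonic function -/
noncomputable def gg {d : ℕ} (K : ℝ) (x : Pt d) : ℝ := 1 / (Real.sqrt (SS K x)) ^ 3

lemma SS_pos {d : ℕ} {K : ℝ} (hK : 0 < K) (x : Pt d) : 0 < SS K x := by
  unfold SS; linarith [nsq_nonneg x]

lemma gg_pos {d : ℕ} {K : ℝ} (hK : 0 < K) (x : Pt d) : 0 < gg K x := by
  have := SS_pos hK x
  unfold gg; positivity

/-- relative increment -/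
lemma eta_bound {a S : ℝ} (hS : 100 ≤ S) (ha : a^2 ≤ S) : |(2*a+1)/S| ≤ 3 / Real.sqrt S ∧
    ((2*a+1)/S)^2 ≤ 9 / S ∧ |(2*a+1)/S| ≤ 1/2 := by
  have hS0 : 0 < S := by linarith
  have hr : 10 ≤ Real.sqrt S := by
    rw [show (10:ℝ) = Real.sqrt (10^2) by rw [Real.sqrt_sq]; norm_num]
    exact Real.sqrt_le_sqrt (by linarith)
  have ha' : |a| ≤ Real.sqrt S := Real.abs_le_sqrt ha
  have h1 : |(2*a+1)/S| ≤ 3 / Real.sqrt S := by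
    rw [abs_div, abs_of_pos hS0, div_le_div_iff₀ hS0 (by linarith)]
    have : |2*a+1| ≤ 3 * Real.sqrt S := by
      rw [abs_le] at ha' ⊢; constructor <;> linarith
    nlinarith [Real.mul_self_sqrt hS0.le]
  refine ⟨h1, ?_, h1.trans ?_⟩
  · rw [← sq_abs]
    calc |(2*a+1)/S|^2 ≤ (3 / Real.sqrt S)^2 := by gcongr
      _ = 9 / S := by rw [div_pow, Real.sq_sqrt hS0.le]; norm_num
  · rw [div_le_div_iff₀ (by linarith) (by norm_num)]; linarith

lemma f32_ratio {S S' : ℝ} (hS : 0 < S) (h : |(S' - S) / S| ≤ 1/2) :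
    1 / (Real.sqrt S')^3 ≤ 1 / (Real.sqrt S)^3 * (1 - 3/2 * ((S'-S)/S) + 15/8 * ((S'-S)/S)^2
      - 35/16 * ((S'-S)/S)^3 + 1100 * ((S'-S)/S)^4) := by
  set η := (S'-S)/S with hη
  have hS' : S' = S * (1 + η) := by rw [hη]; field_simp; ring
  rw [abs_le] at h
  have h1 : 0 < 1 + η := by linarith
  set u := Real.sqrt (1+η)
  have hu2 : u^2 = 1 + η := Real.sq_sqrt h1.le
  have hu0 : 0 ≤ u := Real.sqrt_nonneg _
  rw [hS', Real.sqrt_mul hS.le, mul_pow, one_div_mul_eq_div, ← div_div, div_right_comm]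
  gcongr
  exact taylor32 (by nlinarith) (by nlinarith) (by linarith)

lemma gg_super {d : ℕ} (hd : 5 ≤ d) {K : ℝ} (hK : 15000 * (d:ℝ) ≤ K) (x : Pt d) :
    avg (gg K) x ≤ gg K x * (1 - 1 / (SS K x)^2) := by
  have hd' : (5:ℝ) ≤ d := by exact_mod_cast hd
  have hS : 100 ≤ SS K x := by unfold SS; linarith [nsq_nonneg x]
  set S := SS K x with hSd
  have hS0 : 0 < S := by linarith
  have hg := gg_pos (show 0 < K by linarith) x
  have one : ∀ i, gg K (x + stp (i,true)) + gg K (x + stp (i,false)) ≤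
      gg K x * (2 - 3 / S + (15 * (x i:ℝ)^2 + 178204) / S^2) := by
    intro i
    have hxi : (x i : ℝ)^2 ≤ S := (coord_sq_le x i).trans (by rw [hSd]; unfold SS; linarith)
    obtain ⟨_, a2, a3⟩ := eta_bound hS hxi
    obtain ⟨_, b2, b3⟩ := eta_bound (a := -(x i:ℝ)) hS (by simpa using hxi)
    have e1 : SS K (x + stp (i,true)) - S = 2 * x i + 1 := by
      rw [hSd]; unfold SS; rw [nsq_stp]; simp; ring
    have e2 : SS K (x + stp (i,false)) - S = 2 * (-(x i:ℝ)) + 1 := by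
      rw [hSd]; unfold SS; rw [nsq_stp]; simp; ring
    have r1 := f32_ratio (S' := SS K (x + stp (i,true))) hS0 (by rw [e1]; exact a3)
    have r2 := f32_ratio (S' := SS K (x + stp (i,false))) hS0 (by rw [e2]; exact b3)
    rw [e1] at r1; rw [e2] at r2
    have hgx : gg K x = 1 / (Real.sqrt S)^3 := rfl
    unfold gg at *
    refine (add_le_add r1 r2).trans ?_
    rw [← mul_add]
    refine mul_le_mul_of_nonneg_left ?_ hg.le
    set p := (2 * (x i:ℝ) + 1)/S with hp
    set m := (2 * (-(x i:ℝ)) + 1)/S with hm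
    have hp4 : p^4 ≤ 81 / S^2 := by
      have : p^4 = (p^2)^2 := by ring
      rw [this]
      calc (p^2)^2 ≤ (9/S)^2 := by gcongr
        _ = 81/S^2 := by rw [div_pow]; norm_num
    have hm4 : m^4 ≤ 81 / S^2 := by
      have : m^4 = (m^2)^2 := by ring
      rw [this]
      calc (m^2)^2 ≤ (9/S)^2 := by gcongr
        _ = 81/S^2 := by rw [div_pow]; norm_num
    have s1 : p + m = 2 / S := by rw [hp, hm]; field_simp; ring
    have s2 : p^2 + m^2 = (8 * (x i:ℝ)^2 + 2)/S^2 := by rw [hp, hm]; field_simp; ring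
    have s3 : 0 ≤ p^3 + m^3 := by
      have : p^3 + m^3 = (24 * (x i:ℝ)^2 + 2)/S^3 := by rw [hp, hm]; field_simp; ring
      rw [this]; positivity
    have e3 : 2 - 3 / S + (15 * (x i:ℝ)^2 + 178204) / S^2 =
      2 - 3/2 * (2/S) + 15/8 * ((8 * (x i:ℝ)^2 + 2)/S^2) + 2200 * (81/S^2) + (178204 - 178200 - 15/4) * (1/S^2) := by
      field_simp; ring
    rw [e3, ← s1, ← s2]
    have : 0 ≤ (178204 - 178200 - 15/4) * (1/S^2) := by
      have : 0 < 1/S^2 := by positivity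
      nlinarith
    linarith
  unfold avg
  rw [div_le_iff₀ (by positivity), sum_stp]
  calc _ ≤ ∑ i, gg K x * (2 - 3 / S + (15 * (x i:ℝ)^2 + 178204) / S^2) :=
        Finset.sum_le_sum fun i _ => one i
    _ = gg K x * (2 * d - 3 * d / S + (15 * nsq x + 178204 * d)/S^2) := by
        rw [← Finset.mul_sum]; congr 1
        rw [Finset.sum_add_distrib, Finset.sum_const, ← Finset.sum_div, Finset.sum_add_distrib,
          ← Finset.mul_sum]
        simp [nsq]; ring
    _ ≤ gg K x * (1 - 1/S^2) * (2 * d) := by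
        rw [mul_assoc]
        refine mul_le_mul_of_nonneg_left ?_ hg.le
        have hn : nsq x = S - K := by rw [hSd]; unfold SS; ring
        rw [hn]
        have : (1 - 1/S^2) * (2 * (d:ℝ)) - (2 * d - 3 * d / S + (15 * (S-K) + 178204 * d)/S^2)
          = ((3 * d - 15) * S + (15 * K - 178206 * d))/S^2 := by field_simp; ring
        have h2 : 0 ≤ ((3 * (d:ℝ) - 15) * S + (15 * K - 178206 * d))/S^2 := by
          apply div_nonneg _ (by positivity)
          nlinarith
        linarith

lemma gg_super' {d : ℕ} (hd : 5 ≤ d) {K : ℝ} (hK : 15000 * (d:ℝ) ≤ K) (x : Pt d) :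
    avg (gg K) x ≤ gg K x := by
  have hd' : (5:ℝ) ≤ d := by exact_mod_cast hd
  refine (gg_super hd hK x).trans ?_
  have := gg_pos (show 0 < K by linarith) x
  have h2 : 0 ≤ 1 / (SS K x)^2 := by positivity
  nlinarith

lemma avg_sub {d : ℕ} (f : Pt d → ℝ) (w x : Pt d) : avg (fun z => f (z - w)) x = avg f (x - w) := by
  unfold avg
  congr 1
  refine Finset.sum_congr rfl fun k _ => ?_
  show f (x + stp k - w) = _
  rw [add_sub_right_comm]

lemma avg_sum {d : ℕ} (W : Finset (Pt d)) (f : Pt d → Pt d → ℝ) (x : Pt d) :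
    avg (fun z => ∑ w ∈ W, f w z) x = ∑ w ∈ W, avg (f w) x := by
  unfold avg
  rw [Finset.sum_comm, Finset.sum_div]

/-- H1: hitting upper bound -/
lemma Hit_le_gg {d : ℕ} (hd : 5 ≤ d) {K : ℝ} (hK : 15000 * (d:ℝ) ≤ K) (W : Finset (Pt d)) (x : Pt d) :
    Hit (↑W) (fun _ _ => 1) x ≤ ∑ w ∈ W, gg K (x - w) / gg K (0 : Pt d) := by
  have hd' : (5:ℝ) ≤ d := by exact_mod_cast hd
  have hp : ∀ z : Pt d, 0 < gg K z := gg_pos (show 0 < K by linarith)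
  have hsup : ∀ z, avg (fun z => ∑ w ∈ W, gg K (z - w) / gg K (0 : Pt d)) z ≤
      ∑ w ∈ W, gg K (z - w) / gg K (0 : Pt d) := by
    intro z
    rw [avg_sum]
    refine Finset.sum_le_sum fun w _ => ?_
    have := avg_sub (fun y => gg K y / gg K (0 : Pt d)) w z
    rw [this]
    unfold avg
    rw [← Finset.sum_div, div_right_comm]
    have := gg_super' hd hK (z - w)
    have h0 := (hp 0).le
    unfold avg at this
    gcongr
  refine (Hit_le (by omega) bw_one (fun z => Finset.sum_nonneg fun w _ =>
    (div_pos (hp _) (hp _)).le) (fun z _ => hsup z) ?_ x).trans (hsup x)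
  intro _ w hw
  have : gg K (w - w) / gg K (0 : Pt d) = 1 := by rw [sub_self, div_self (hp 0).ne']
  rw [← this]
  exact Finset.single_le_sum (f := fun w' => gg K (w - w') / gg K (0 : Pt d))
    (fun w _ => (div_pos (hp _) (hp _)).le) hw

/-- decay of `gg` : hitting bound in terms of distance. -/
lemma exists_hit_const {d : ℕ} (hd : 5 ≤ d) : ∃ C : ℝ, 0 < C ∧ ∀ (W : Finset (Pt d)) (x : Pt d) (ρ : ℝ),
    0 < ρ → (∀ w ∈ W, ρ^2 ≤ nsq (x - w)) → Hit (↑W) (fun _ _ => 1) x ≤ W.card * (C / ρ^3) := by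
  have hd' : (5:ℝ) ≤ d := by exact_mod_cast hd
  set K : ℝ := 15000 * d with hK
  have hK0 : 0 < K := by rw [hK]; positivity
  refine ⟨1 / gg K (0 : Pt d), by have := gg_pos hK0 (0 : Pt d); positivity, fun W x ρ hρ h => ?_⟩
  refine (Hit_le_gg hd hK.ge W x).trans ?_
  rw [← nsmul_eq_mul]
  refine Finset.sum_le_card_nsmul _ _ _ fun w hw => ?_
  rw [div_div, mul_comm, ← div_div]
  have := (gg_pos hK0 (0 : Pt d)).le
  gcongr
  unfold gg
  gcongr
  apply Real.le_sqrt_of_sq_le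
  unfold SS
  linarith [h w hw]

/-! ### paths -/

/-- a lattice path of length `l` whose points after the start are not in `W` -/
def PathA {d : ℕ} (W : Set (Pt d)) : ℕ → Pt d → Pt d → Prop
  | 0, x, y => x = y
  | l+1, x, y => ∃ k : Stp d, x + stp k ∉ W ∧ PathA W l (x + stp k) y

lemma PathA.trans {d : ℕ} {W : Set (Pt d)} {l m : ℕ} {x y z : Pt d} (h : PathA W l x y)
    (h' : PathA W m y z) : PathA W (l+m) x z := by
  induction l generalizing x with
  | zero => cases h; simpa using h'
  | succ l ih =>
    obtain ⟨k, hk, h⟩ := h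
    rw [show l + 1 + m = (l+m) + 1 by ring]
    exact ⟨k, hk, ih h⟩

lemma PathA_hit {d : ℕ} (hd : 0 < d) {W : Set (Pt d)} {q : Pt d → Pt d → ℝ} (hq : BW q) {l : ℕ}
    {x y : Pt d} (h : PathA W l x y) : (1 / (2 * d : ℝ))^l * Hit W q y ≤ Hit W q x := by
  classical
  induction l generalizing x with
  | zero => cases h; simp
  | succ l ih =>
    obtain ⟨k, hk, h⟩ := h
    rw [Hit_step hd hq x, pow_succ]
    calc _ = ((1 / (2 * d : ℝ))^l * Hit W q y) / (2 * d) := by ring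
      _ ≤ Hit W q (x + stp k) / (2 * d) := by gcongr; exact ih h
      _ ≤ _ := by
        gcongr
        have := Finset.single_le_sum (f := fun k => if x + stp k ∈ W then q x (x + stp k)
          else Hit W q (x + stp k)) (fun k _ => by
            split_ifs; exacts [(hq _ _).1, Hit_nonneg hq _]) (Finset.mem_univ k)
        simpa [hk] using this

lemma PathA_nohit {d : ℕ} (hd : 0 < d) {W : Set (Pt d)} {l : ℕ}
    {x y : Pt d} (h : PathA W l x y) :
    (1 / (2 * d : ℝ))^l * (1 - Hit W (fun _ _ => 1) y) ≤ 1 - Hit W (fun _ _ => 1) x := by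
  classical
  have hd' : (0:ℝ) < 2 * d := by positivity
  induction l generalizing x with
  | zero => cases h; simp
  | succ l ih =>
    obtain ⟨k, hk, h⟩ := h
    rw [Hit_step hd bw_one x, pow_succ]
    have e : 1 - (∑ k : Stp d, if x + stp k ∈ W then 1 else Hit W (fun _ _ => 1) (x + stp k)) / (2 * d : ℝ)
      = (∑ k : Stp d, (1 - if x + stp k ∈ W then 1 else Hit W (fun _ _ => 1) (x + stp k))) / (2 * d : ℝ) := by
      rw [Finset.sum_sub_distrib, sub_div]
      congr 1
      rw [eq_div_iff hd'.ne', ← card_stp]; simp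
    rw [e]
    calc _ = ((1 / (2 * d : ℝ))^l * (1 - Hit W (fun _ _ => 1) y)) / (2 * d) := by ring
      _ ≤ (1 - Hit W (fun _ _ => 1) (x + stp k)) / (2 * d) := by gcongr; exact ih h
      _ ≤ _ := by
        gcongr
        have := Finset.single_le_sum (f := fun k => 1 - if x + stp k ∈ W then 1
          else Hit W (fun _ _ => 1) (x + stp k)) (fun k _ => by
            split_ifs
            · simp
            · linarith [Hit_le_one hd (bw_one) (W := W) (x + stp k)]) (Finset.mem_univ k)
        simpa [hk] using this

/-- the inner product with a step -/
def sdot {d : ℕ} (x : Pt d) (k : Stp d) : ℤ := if k.2 then x k.1 else - x k.1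

lemma ray_path {d : ℕ} {W : Set (Pt d)} (x : Pt d) (k : Stp d) (l : ℕ)
    (h : ∀ j : ℕ, 1 ≤ j → j ≤ l → x + (j : ℤ) • stp k ∉ W) : PathA W l x (x + (l : ℤ) • stp k) := by
  induction l generalizing x with
  | zero => simp [PathA]
  | succ l ih =>
    refine ⟨k, by simpa using h 1 le_rfl (by omega), ?_⟩
    have : x + ((l+1 : ℕ) : ℤ) • stp k = x + stp k + (l : ℤ) • stp k := by
      push_cast; rw [add_smul, one_smul]; abel
    rw [this]
    refine ih _ fun j hj hj' => ?_
    have := h (j+1) (by omega) (by omega)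
    push_cast at this
    rw [add_smul, one_smul] at this
    rwa [add_assoc, add_comm (stp k)]

lemma sdot_stp {d : ℕ} (k : Stp d) (a : ℤ) : sdot (a • stp k) k = a := by
  unfold sdot stp; split_ifs <;> simp [*]

lemma sdot_add {d : ℕ} (x y : Pt d) (k : Stp d) : sdot (x + y) k = sdot x k + sdot y k := by
  unfold sdot; split_ifs <;> simp <;> ring

lemma sdot_sub {d : ℕ} (x y : Pt d) (k : Stp d) : sdot (x - y) k = sdot x k - sdot y k := by
  unfold sdot; split_ifs <;> simp <;> ring

lemma sdot_sq_le {d : ℕ} (x : Pt d) (k : Stp d) : (sdot x k : ℝ)^2 ≤ nsq x := by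
  refine le_trans (le_of_eq ?_) (coord_sq_le x k.1)
  unfold sdot; split_ifs <;> push_cast <;> ring

lemma nsq_smul_stp {d : ℕ} (k : Stp d) (a : ℤ) : nsq (a • stp k) = (a:ℝ)^2 := by
  unfold nsq
  rw [Finset.sum_eq_single k.1]
  · simp [stp]
  · intro b _ hb; simp [stp, hb]
  · simp

/-- Euclidean embedding -/
noncomputable def emb {d : ℕ} (x : Pt d) : EuclideanSpace ℝ (Fin d) :=
  WithLp.toLp 2 (fun i => (x i : ℝ))

@[simp] lemma emb_apply {d : ℕ} (x : Pt d) (i : Fin d) : emb x i = (x i : ℝ) := rfl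

lemma emb_sub {d : ℕ} (x y : Pt d) : emb (x - y) = emb x - emb y := by
  ext i; simp

lemma emb_add {d : ℕ} (x y : Pt d) : emb (x + y) = emb x + emb y := by
  ext i; simp

lemma nsq_eq {d : ℕ} (x : Pt d) : nsq x = ‖emb x‖^2 := by
  rw [EuclideanSpace.norm_eq, Real.sq_sqrt (Finset.sum_nonneg fun i _ => sq_nonneg _)]
  simp [nsq]

lemma dist0_eq {d : ℕ} (x y : Pt d) : dist0 d x y = ‖emb x - emb y‖ := by
  rw [EuclideanSpace.norm_eq, dist0]
  simp

/-- H2: escape along a ray -/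
lemma esc_ray {d : ℕ} (hd : 5 ≤ d) (n : ℕ) : ∃ (L : ℕ) (c : ℝ), 0 < c ∧ 1 ≤ L ∧
    ∀ (U : Finset (Pt d)) (x : Pt d) (k : Stp d), U.card ≤ n → x ∈ U →
      (∀ z ∈ U, sdot (z - x) k ≤ 0 ∨ 2 * (L:ℝ) ≤ dist0 d z x) → c ≤ esc d (↑U) x := by
  obtain ⟨C, hC, hhit⟩ := exists_hit_const hd
  obtain ⟨L, hL⟩ := exists_nat_gt (2 * (n+1) * C)
  have hL1 : 1 ≤ L := by
    by_contra h
    have : L = 0 := by omega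
    subst this
    have : 0 < 2 * ((n:ℝ)+1) * C := by positivity
    simp at hL; linarith
  have hL1' : (1:ℝ) ≤ L := by exact_mod_cast hL1
  have hd0 : 0 < d := by omega
  refine ⟨L, (1 / (2 * d : ℝ))^L * (1/2), by positivity, hL1, fun U x k hU hx h => ?_⟩
  rw [esc_eq hd0 _ (by exact_mod_cast hx)]
  have hp : PathA (↑U : Set (Pt d)) L x (x + (L:ℤ) • stp k) := by
    refine ray_path x k L fun j hj hj' hmem => ?_
    rcases h _ (Finset.mem_coe.1 hmem) with h1 | h1
    · rw [add_sub_cancel_left, sdot_stp] at h1; omega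
    · rw [dist0_eq, ← emb_sub, add_sub_cancel_left] at h1
      have h2 : ‖emb ((j:ℤ) • stp k)‖^2 = (j:ℝ)^2 := by rw [← nsq_eq, nsq_smul_stp]; simp
      have h3 : ‖emb ((j:ℤ) • stp k)‖ = j := by
        rwa [sq_eq_sq₀ (norm_nonneg _) (by positivity)] at h2
      rw [h3] at h1
      have : (j:ℝ) ≤ L := by exact_mod_cast hj'
      linarith
  refine le_trans ?_ (PathA_nohit hd0 hp)
  refine mul_le_mul_of_nonneg_left ?_ (by positivity)
  have hh := hhit U (x + (L:ℤ) • stp k) L (by linarith) ?_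
  · have : (U.card : ℝ) * (C / (L:ℝ)^3) ≤ 1/2 := by
      have h1 : (U.card:ℝ) ≤ n + 1 := by
        have : (U.card:ℝ) ≤ n := by exact_mod_cast hU
        linarith
      have h3 : (L:ℝ) ≤ (L:ℝ)^3 := le_self_pow₀ hL1' (by norm_num)
      calc (U.card : ℝ) * (C / (L:ℝ)^3) ≤ (n+1) * (C / (L:ℝ)^3) := by gcongr
        _ = ((n+1) * C) / (L:ℝ)^3 := by ring
        _ ≤ 1/2 := by
          rw [div_le_div_iff₀ (by positivity) (by norm_num)]; linarith
    linarith
  · intro w hw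
    rcases h w hw with h1 | h1
    · refine le_trans ?_ (sdot_sq_le _ k)
      have h2 : (L:ℤ) ≤ sdot (x + (L:ℤ) • stp k - w) k := by
        have : x + (L:ℤ) • stp k - w = (L:ℤ) • stp k - (w - x) := by abel
        rw [this, sdot_sub, sdot_stp]; linarith
      have h3 : (L:ℝ) ≤ (sdot (x + (L:ℤ) • stp k - w) k : ℝ) := by exact_mod_cast h2
      gcongr
    · rw [nsq_eq]
      gcongr
      rw [dist0_eq] at h1
      have e : emb (x + (L:ℤ) • stp k - w) = emb ((L:ℤ) • stp k) - (emb w - emb x) := by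
        rw [emb_sub, emb_add]; abel
      have h2 : ‖emb ((L:ℤ) • stp k)‖^2 = (L:ℝ)^2 := by rw [← nsq_eq, nsq_smul_stp]; simp
      have h3 : ‖emb ((L:ℤ) • stp k)‖ = L := by
        rwa [sq_eq_sq₀ (norm_nonneg _) (by positivity)] at h2
      rw [e, norm_sub_rev]
      have := norm_sub_norm_le (emb w - emb x) (emb ((L:ℤ) • stp k))
      rw [h3] at this
      linarith

/-! ### Lower bound for hitting a point -/

lemma pow_taylor (m : ℕ) : ∃ C : ℝ, 0 ≤ C ∧ ∀ z : ℝ, |z| ≤ 1 →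
    1 + m * z + (m * (m - 1) / 2) * z^2 - C * |z|^3 ≤ (1+z)^m := by
  induction m with
  | zero => exact ⟨0, le_rfl, fun z _ => by simp⟩
  | succ m ih =>
    obtain ⟨C, hC, h⟩ := ih
    have hm : (0:ℝ) ≤ m * (m-1) / 2 := by
      rcases Nat.eq_zero_or_pos m with rfl | hm
      · simp
      · have : (1:ℝ) ≤ m := by exact_mod_cast hm
        have : 0 ≤ (m:ℝ) * (m-1) := by apply mul_nonneg <;> linarith
        linarith
    refine ⟨2 * C + m * (m-1) / 2, by linarith, fun z hz => ?_⟩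
    have h1 := h z hz
    have hz' := abs_le.1 hz
    have h2 := mul_le_mul_of_nonneg_left h1 (show 0 ≤ 1 + z by linarith)
    have e : (1+z)^(m+1) = (1+z) * (1+z)^m := by ring
    rw [e]
    refine le_trans ?_ h2
    have h3 : (1 + z) * (C * |z|^3) ≤ 2 * (C * |z|^3) := by
      have : 0 ≤ C * |z|^3 := by positivity
      gcongr; linarith
    have h4 : -(m * (m-1) / 2 * |z|^3) ≤ m * (m-1) / 2 * z^3 := by
      have : -(|z|^3) ≤ z^3 := by rw [← abs_pow]; exact neg_abs_le _
      nlinarith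
    push_cast
    nlinarith

/-- second-order lower bound for `(1+η)^{-m}`. -/
lemma inv_pow_taylor (m : ℕ) (hm : 1 ≤ m) : ∃ C : ℝ, 0 ≤ C ∧ ∀ η : ℝ, |η| ≤ 1/2 →
    1 - m * η + (m * (m + 1) / 2) * η^2 - C * |η|^3 ≤ 1 / (1+η)^m := by
  obtain ⟨C, hC, h⟩ := pow_taylor m
  have hm' : (1:ℝ) ≤ m := by exact_mod_cast hm
  refine ⟨8 * C + 2 * m + m * (m-1), by nlinarith, fun η hη => ?_⟩
  have hη' := abs_le.1 hη
  have hp : 0 < 1 + η := by linarith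
  set z := -η / (1+η) with hz
  have hz1 : 1 + z = 1 / (1+η) := by rw [hz]; field_simp; ring
  have hzabs : |z| ≤ 2 * |η| := by
    rw [hz, abs_div, abs_neg, abs_of_pos hp, div_le_iff₀ hp]
    nlinarith [abs_nonneg η]
  have h1 := h z (by linarith)
  rw [hz1, one_div, inv_pow] at h1
  rw [one_div]
  refine le_trans ?_ h1
  have a3 : 0 ≤ |η|^3 := by positivity
  have hz3 : C * |z|^3 ≤ 8 * C * |η|^3 := by
    calc C * |z|^3 ≤ C * (2 * |η|)^3 := by gcongr
      _ = _ := by ring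
  have zlow : -η + η^2 - 2 * |η|^3 ≤ z := by
    have : z = -η + η^2 - η^3 / (1+η) := by rw [hz]; field_simp; ring
    rw [this]
    have : η^3/(1+η) ≤ 2 * |η|^3 := by
      rw [div_le_iff₀ hp]
      have : η^3 ≤ |η|^3 := by rw [← abs_pow]; exact le_abs_self _
      nlinarith
    linarith
  have z2low : η^2 - 2 * |η|^3 ≤ z^2 := by
    have : z^2 = η^2 - 2 * η^3 + η^4 * (3 + 2 * η) / (1+η)^2 := by rw [hz]; field_simp; ring
    rw [this]
    have h5 : 0 ≤ η^4 * (3 + 2 * η) / (1+η)^2 := by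
      have : 0 ≤ 3 + 2 * η := by linarith
      positivity
    have : η^3 ≤ |η|^3 := by rw [← abs_pow]; exact le_abs_self _
    linarith
  have k1 : (m:ℝ) * (-η + η^2 - 2 * |η|^3) ≤ m * z := by gcongr
  have hmm : 0 ≤ (m:ℝ) * (m-1)/2 := by
    have : 0 ≤ (m:ℝ) * (m-1) := by apply mul_nonneg <;> linarith
    linarith
  have k2 := mul_le_mul_of_nonneg_left z2low hmm
  nlinarith

/-- subharmonic function -/
noncomputable def vv {d : ℕ} (K : ℝ) (x : Pt d) : ℝ := 1 / (SS K x)^d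

lemma vv_sub {d : ℕ} (hd : 5 ≤ d) : ∃ K0 : ℝ, ∀ K, K0 ≤ K → ∀ x : Pt d, 3 * K ≤ nsq x →
    vv K x ≤ avg (vv K) x := by
  obtain ⟨C, hC, hT⟩ := inv_pow_taylor d (by omega)
  have hd' : (5:ℝ) ≤ d := by exact_mod_cast hd
  refine ⟨100 + (27 * 2 * d * C)^2, fun K hK x hx => ?_⟩
  have hS : 100 + (27 * 2 * d * C)^2 ≤ SS K x := by unfold SS; linarith [nsq_nonneg x]
  have hnS : 3/4 * SS K x ≤ nsq x := by unfold SS; linarith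
  set S := SS K x with hSd
  have hS0 : 0 < S := by nlinarith [sq_nonneg (27 * 2 * d * C)]
  have hS1 : 100 ≤ S := by nlinarith [sq_nonneg (27 * 2 * d * C)]
  have hr : 27 * 2 * d * C ≤ Real.sqrt S := by
    apply Real.le_sqrt_of_sq_le; linarith
  have hv : vv K x = 1 / S^d := rfl
  have hvp : 0 < vv K x := by rw [hv]; positivity
  have ratio : ∀ S' η : ℝ, S' - S = η * S → |η| ≤ 1/2 →
      (1 / S^d) * (1 - d * η + (d * (d + 1) / 2) * η^2 - C * |η|^3) ≤ 1 / S'^d := by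
    intro S' η h1 h2
    have : S' = S * (1 + η) := by linarith
    rw [this, mul_pow, ← one_div_mul_one_div]
    gcongr
    exact hT η h2
  have one : ∀ i, vv K x * (2 - 2 * d / S + (d * (d + 1) / 2) * (8 * (x i:ℝ)^2) / S^2 - 2 * C * (27 / (S * Real.sqrt S)))
      ≤ vv K (x + stp (i,true)) + vv K (x + stp (i,false)) := by
    intro i
    have hxi : (x i : ℝ)^2 ≤ S := (coord_sq_le x i).trans (by rw [hSd]; unfold SS; nlinarith [nsq_nonneg x, sq_nonneg (27 * 2 * d * C)])
    obtain ⟨a1, a2, a3⟩ := eta_bound hS1 hxi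
    obtain ⟨b1, b2, b3⟩ := eta_bound (a := -(x i:ℝ)) hS1 (by simpa using hxi)
    have e1 : SS K (x + stp (i,true)) - S = 2 * x i + 1 := by
      rw [hSd]; unfold SS; rw [nsq_stp]; simp; ring
    have e2 : SS K (x + stp (i,false)) - S = 2 * (-(x i:ℝ)) + 1 := by
      rw [hSd]; unfold SS; rw [nsq_stp]; simp; ring
    set p := (2 * (x i:ℝ) + 1)/S with hp
    set m := (2 * (-(x i:ℝ)) + 1)/S with hm
    have r1 := ratio (SS K (x + stp (i,true))) p (by rw [e1, hp]; field_simp) a3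
    have r2 := ratio (SS K (x + stp (i,false))) m (by rw [e2, hm]; field_simp) b3
    have hcube : (3 / Real.sqrt S)^3 = 27 / (S * Real.sqrt S) := by
      rw [div_pow, pow_succ (Real.sqrt S) 2, Real.sq_sqrt hS0.le]; norm_num
    have p3 : |p|^3 ≤ 27 / (S * Real.sqrt S) := by rw [← hcube]; gcongr
    have m3 : |m|^3 ≤ 27 / (S * Real.sqrt S) := by rw [← hcube]; gcongr
    unfold vv
    refine le_trans ?_ (add_le_add r1 r2)
    rw [← mul_add]
    refine mul_le_mul_of_nonneg_left ?_ (by positivity)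
    have s1 : p + m = 2 / S := by rw [hp, hm]; field_simp; ring
    have s2 : (8 * (x i:ℝ)^2)/S^2 ≤ p^2 + m^2 := by
      have : p^2 + m^2 = (8 * (x i:ℝ)^2 + 2)/S^2 := by rw [hp, hm]; field_simp; ring
      rw [this]; gcongr; linarith
    have e3 : 2 * (d:ℝ) / S = d * (p + m) := by rw [s1]; ring
    have k2 := mul_le_mul_of_nonneg_left s2 (show 0 ≤ (d:ℝ) * (d+1)/2 by positivity)
    have k3 := mul_le_mul_of_nonneg_left p3 hC
    have k4 := mul_le_mul_of_nonneg_left m3 hC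
    rw [e3, mul_div_assoc]
    linarith
  unfold avg
  rw [le_div_iff₀ (by positivity), sum_stp]
  refine le_trans ?_ (Finset.sum_le_sum fun i _ => one i)
  rw [← Finset.mul_sum]
  refine mul_le_mul_of_nonneg_left ?_ hvp.le
  rw [Finset.sum_sub_distrib, Finset.sum_add_distrib, Finset.sum_const, Finset.sum_const,
    ← Finset.sum_div, ← Finset.mul_sum, ← Finset.mul_sum]
  have hn : ∑ i, ((x i : ℝ))^2 = nsq x := rfl
  rw [hn]
  simp only [Finset.card_univ, Fintype.card_fin, nsmul_eq_mul]
  have k1 : (d:ℝ) * (d+1)/2 * (8 * (3/4 * S)) / S^2 ≤ d * (d+1)/2 * (8 * nsq x) / S^2 := by gcongr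
  have k2 : (d:ℝ) * (d+1)/2 * (8 * (3/4 * S)) / S^2 = 3 * d * (d+1) / S := by field_simp; ring
  have k3 : (d:ℝ) * (2 * C * (27 / (S * Real.sqrt S))) ≤ 1 / S := by
    have hsq : 0 < Real.sqrt S := Real.sqrt_pos.2 hS0
    have : (d:ℝ) * (2 * C * (27 / (S * Real.sqrt S))) = (27 * 2 * d * C) / Real.sqrt S / S := by
      field_simp
    rw [this]
    gcongr
    rw [div_le_one hsq]; exact hr
  have k4 : (d:ℝ) * (2 * d / S) + 1 / S ≤ 3 * d * (d+1) / S := by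
    rw [← mul_div_assoc, ← add_div]; gcongr; nlinarith
  linarith

/-- iterated averages -/
noncomputable def itavg {d : ℕ} (f : Pt d → ℝ) : ℕ → Pt d → ℝ
  | 0 => f
  | t+1 => avg (itavg f t)

lemma avg_mono {d : ℕ} {f g : Pt d → ℝ} (h : ∀ x, f x ≤ g x) (x : Pt d) : avg f x ≤ avg g x := by
  unfold avg; gcongr with k; exact h _

lemma avg_nonneg {d : ℕ} {f : Pt d → ℝ} (h : ∀ x, 0 ≤ f x) (x : Pt d) : 0 ≤ avg f x := by
  unfold avg; exact div_nonneg (Finset.sum_nonneg fun k _ => h _) (by positivity)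

lemma itavg_mono {d : ℕ} {f g : Pt d → ℝ} (h : ∀ x, f x ≤ g x) (t : ℕ) (x : Pt d) :
    itavg f t x ≤ itavg g t x := by
  induction t generalizing x with
  | zero => exact h x
  | succ t ih => exact avg_mono ih x

lemma avg_add {d : ℕ} (f g : Pt d → ℝ) (x : Pt d) : avg (fun z => f z + g z) x = avg f x + avg g x := by
  unfold avg; rw [Finset.sum_add_distrib, add_div]

lemma avg_sub' {d : ℕ} (f g : Pt d → ℝ) (x : Pt d) : avg (fun z => f z - g z) x = avg f x - avg g x := by
  unfold avg; rw [Finset.sum_sub_distrib, sub_div]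

/-- if `v ≤ g - avg g` with `g, v ≥ 0` then iterated averages of `v` tend to zero -/
lemma itavg_tendsto {d : ℕ} {v g : Pt d → ℝ} (hv : ∀ x, 0 ≤ v x) (hg : ∀ x, 0 ≤ g x)
    (h : ∀ x, v x ≤ g x - avg g x) (x : Pt d) :
    Filter.Tendsto (fun t => itavg v t x) Filter.atTop (nhds 0) := by
  have hit : ∀ f : Pt d → ℝ, (∀ x, 0 ≤ f x) → ∀ t x, 0 ≤ itavg f t x := by
    intro f hf t
    induction t with
    | zero => exact hf
    | succ t ih => exact avg_nonneg ih
  have hstep : ∀ t x, itavg v t x ≤ itavg g t x - itavg g (t+1) x := by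
    intro t
    induction t with
    | zero => exact h
    | succ t ih =>
      intro x
      have := avg_mono ih x
      rw [avg_sub'] at this
      exact this
  have hs : Summable (fun t => itavg v t x) := by
    refine summable_of_sum_range_le (c := g x) (fun t => hit v hv t x) fun T => ?_
    have : ∑ t ∈ Finset.range T, itavg v t x ≤ itavg g 0 x - itavg g T x := by
      rw [← Finset.sum_range_sub' (fun t => itavg g t x)]
      exact Finset.sum_le_sum fun t _ => hstep t x
    have h2 := hit g hg T x
    have : itavg g 0 x = g x := rfl
    linarith
  exact hs.tendsto_atTop_zero

lemma Hit_mono_set {d : ℕ} (hd : 0 < d) {W W' : Set (Pt d)} (h : W ⊆ W') (x : Pt d) :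
    Hit W (fun _ _ => 1) x ≤ Hit W' (fun _ _ => 1) x := by
  classical
  refine Hit_le_of_psum hd bw_one fun T => ?_
  have hx : ∀ T x, psum W (fun _ _ => 1) T x ≤ psum W' (fun _ _ => 1) T x := by
    intro T
    induction T with
    | zero => intro x; simp [psum]
    | succ T ih =>
      intro x
      rw [psum_succ, psum_succ]
      gcongr with k
      by_cases h1 : x + stp k ∈ W
      · rw [if_pos h1, if_pos (h h1)]
      · rw [if_neg h1]
        split_ifs
        · exact psum_le_one hd bw_one _ _
        · exact ih _
  refine (hx T x).trans ?_
  exact (fh_summable hd bw_one x).sum_le_tsum _ (fun t _ => fh_nonneg (fun _ _ => zero_le_one) t x)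

/-- A monotone lattice path between two points, through a set of allowed points. -/
lemma exists_path_l1 {d : ℕ} (m : ℕ) : ∀ x y : Pt d, (∑ i, (y i - x i).natAbs) = m →
    PathA (∅ : Set (Pt d)) m x y := by
  induction m with
  | zero =>
    intro x y h
    have : ∀ i, (y i - x i).natAbs = 0 := fun i => by
      have := Finset.sum_eq_zero_iff.1 h i (Finset.mem_univ i); exact this
    funext i
    have := this i
    omega
  | succ m ih =>
    intro x y h
    have : ∃ i, y i - x i ≠ 0 := by
      by_contra hc
      push Not at hc
      simp [hc] at h
    obtain ⟨i, hi⟩ := this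
    refine ⟨(i, decide (0 < y i - x i)), by simp, ih _ _ ?_⟩
    have hs : ∀ z : Pt d, ∑ j, (y j - z j).natAbs = (y i - z i).natAbs + ∑ j ∈ Finset.univ.erase i, (y j - z j).natAbs :=
      fun z => (Finset.add_sum_erase _ _ (Finset.mem_univ i)).symm
    rw [hs] at h ⊢
    have e : ∑ j ∈ Finset.univ.erase i, (y j - (x + stp (i, decide (0 < y i - x i))) j).natAbs
        = ∑ j ∈ Finset.univ.erase i, (y j - x j).natAbs := by
      refine Finset.sum_congr rfl fun j hj => ?_
      have : j ≠ i := (Finset.mem_erase.1 hj).1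
      simp [stp, this]
    rw [e]
    have : (x + stp (i, decide (0 < y i - x i))) i = x i + (if 0 < y i - x i then 1 else -1) := by
      simp [stp]
    rw [this]
    split_ifs with h0 <;> omega

/-- H3 : lower bound for hitting a given point -/
lemma Hit_lower {d : ℕ} (hd : 5 ≤ d) : ∃ c : ℝ, 0 < c ∧ ∀ (W : Set (Pt d)) (x w : Pt d), w ∈ W → x ≠ w →
    c / (nsq (x - w) + 1)^d ≤ Hit W (fun _ _ => 1) x := by
  classical
  obtain ⟨K0, hK0⟩ := vv_sub hd
  have hd' : (5:ℝ) ≤ d := by exact_mod_cast hd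
  have hd0 : 0 < d := by omega
  set K : ℝ := max K0 (15000 * d) with hKd
  have hK : 15000 * (d:ℝ) ≤ K := le_max_right _ _
  have hK1 : 1 ≤ K := by linarith
  have hsub := hK0 K (le_max_left _ _)
  -- finite number of points close to the origin
  obtain ⟨M, hM⟩ := exists_nat_gt (d * (3 * K))
  set c1 : ℝ := (1/(2*d:ℝ))^M with hc1
  have hc1p : 0 < c1 := by positivity
  refine ⟨c1 / K^d, by positivity, fun W x w hw hxw => ?_⟩
  refine le_trans ?_ (Hit_mono_set hd0 (Set.singleton_subset_iff.2 hw) x)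
  set h : Pt d → ℝ := fun z => if z = w then 1 else Hit {w} (fun _ _ => 1) z with hh
  have h0 : ∀ z, 0 ≤ h z := fun z => by
    simp only [hh]; split_ifs; exacts [zero_le_one, Hit_nonneg bw_one _]
  have h1 : ∀ z, h z ≤ 1 := fun z => by
    simp only [hh]; split_ifs; exacts [le_rfl, Hit_le_one hd0 bw_one _]
  have hstep : ∀ z, z ≠ w → h z = avg h z := by
    intro z hz
    simp only [hh, if_neg hz]
    rw [Hit_step hd0 bw_one]
    unfold avg
    simp
  have hge : ∀ z, avg h z ≤ h z := fun z => by
    by_cases hz : z = w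
    · have : h z = 1 := by simp [hh, hz]
      rw [this]
      unfold avg
      rw [div_le_one (by positivity), ← card_stp]
      calc _ ≤ ∑ k : Stp d, (1:ℝ) := Finset.sum_le_sum fun k _ => h1 _
        _ = _ := by simp
    · exact (hstep z hz).ge
  have hpath : ∀ l z, PathA (∅ : Set (Pt d)) l z w → (1/(2*d:ℝ))^l ≤ h z := by
    intro l
    induction l with
    | zero => intro z hz; cases hz; simp [hh]
    | succ l ih =>
      rintro z ⟨k, _, hz⟩
      refine le_trans ?_ (hge z)
      have := ih _ hz
      unfold avg
      rw [pow_succ, mul_one_div]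
      gcongr
      exact this.trans (Finset.single_le_sum (f := fun k => h (z + stp k)) (fun k _ => h0 _) (Finset.mem_univ k))
  have hnear : ∀ z, nsq (z - w) < 3 * K → c1 ≤ h z := by
    intro z hz
    refine le_trans ?_ (hpath _ z (exists_path_l1 _ z w rfl))
    rw [hc1]
    apply pow_le_pow_of_le_one (by positivity)
    · rw [div_le_one (by positivity)]; linarith
    · have hi : ∀ i, (((w i - z i).natAbs : ℕ) : ℝ) ≤ 3 * K := by
        intro i
        have e1 : (((w i - z i).natAbs : ℕ) : ℝ) ≤ (((w i - z i).natAbs : ℕ) : ℝ)^2 := by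
          exact_mod_cast Nat.le_self_pow (by norm_num) _
        have e2 : (((w i - z i).natAbs : ℕ) : ℝ)^2 = ((z - w) i : ℝ)^2 := by
          rw [Nat.cast_natAbs, Int.cast_abs, sq_abs]; simp; ring
        have := coord_sq_le (z - w) i
        linarith
      have : ((∑ i, (w i - z i).natAbs : ℕ) : ℝ) ≤ d * (3 * K) := by
        push_cast
        calc _ ≤ ∑ i : Fin d, 3 * K := Finset.sum_le_sum fun i _ => hi i
          _ = _ := by simp
      have := this.trans hM.le
      exact_mod_cast this
  -- u⁺
  set v : Pt d → ℝ := fun z => vv K (z - w) with hvd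
  have hSpos : ∀ z : Pt d, 1 ≤ SS K z := fun z => by unfold SS; linarith [nsq_nonneg z]
  have hv0 : ∀ z, 0 ≤ v z := fun z => by
    have := hSpos (z - w)
    simp only [hvd, vv]; positivity
  have hv1 : ∀ z, v z ≤ 1 / K^d := fun z => by
    simp only [hvd, vv, SS]; gcongr; linarith [nsq_nonneg (z - w)]
  set C0 : ℝ := 1 / K^d / c1 with hC0
  have hC0p : 0 < C0 := by positivity
  set u : Pt d → ℝ := fun z => max (v z - C0 * h z) 0 with hud
  have huv : ∀ z, u z ≤ v z := fun z => max_le (by nlinarith [h0 z]) (hv0 z)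
  have hu : ∀ z, u z ≤ avg u z := by
    intro z
    by_cases hz : nsq (z - w) < 3 * K
    · have : u z = 0 := by
        apply max_eq_right
        have a := hnear z hz
        have b := hv1 z
        have : C0 * c1 = 1 / K^d := by rw [hC0]; field_simp
        nlinarith
      rw [this]
      exact avg_nonneg (fun z => le_max_right _ _) z
    · apply max_le _ (avg_nonneg (fun z => le_max_right _ _) z)
      have hzw : z ≠ w := by rintro rfl; simp [nsq] at hz; linarith
      have a : v z ≤ avg v z := by
        simp only [hvd]; rw [avg_sub]; exact hsub _ (by linarith)
      have b := hstep z hzw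
      have : avg (fun z => v z - C0 * h z) z = avg v z - C0 * avg h z := by
        rw [avg_sub']; congr 1; unfold avg; rw [← Finset.mul_sum, mul_div_assoc]
      have e : avg (fun z => v z - C0 * h z) z ≤ avg u z := avg_mono (fun z => le_max_left _ _) z
      rw [this, ← b] at e
      linarith
  have hut : ∀ t z, u z ≤ itavg v t z := by
    intro t
    induction t with
    | zero => exact huv
    | succ t ih => exact fun z => (hu z).trans (avg_mono ih z)
  have hlim := itavg_tendsto (v := v) (g := fun z => gg K (z - w)) hv0
    (fun z => (gg_pos (by linarith) _).le) (fun z => by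
      rw [avg_sub]
      have a := gg_super hd hK (z - w)
      have hS := hSpos (z - w)
      have : v z ≤ gg K (z - w) * (1 / (SS K (z - w))^2) := by
        simp only [hvd, vv, gg]
        set S := SS K (z - w)
        rw [one_div_mul_one_div]
        apply one_div_le_one_div_of_le
        · have : 0 < Real.sqrt S := Real.sqrt_pos.2 (by linarith)
          positivity
        · have : Real.sqrt S ≤ S := by
            rw [Real.sqrt_le_left (by linarith)]; nlinarith
          calc Real.sqrt S ^3 * S^2 ≤ S^3 * S^2 := by gcongr
            _ = S^5 := by ring
            _ ≤ S^d := pow_le_pow_right₀ hS hd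
      linarith) x
  have hux : u x ≤ 0 := ge_of_tendsto' hlim fun t => hut t x
  have hfin : v x ≤ C0 * h x := by
    have := (le_max_left (v x - C0 * h x) 0).trans hux
    linarith
  have hhx : h x = Hit {w} (fun _ _ => 1) x := by simp [hh, hxw]
  rw [← hhx]
  have hvx : 1 / (K * (nsq (x - w) + 1))^d ≤ v x := by
    simp only [hvd, vv, SS]
    have := nsq_nonneg (x - w)
    gcongr
    nlinarith
  rw [mul_pow] at hvx
  have e : C0 * h x = h x / (c1 * K^d) := by rw [hC0]; field_simp
  rw [e] at hfin
  have h3 := hvx.trans hfin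
  have hn : 0 < nsq (x - w) + 1 := by linarith [nsq_nonneg (x - w)]
  have hKd0 : 0 < K^d := by positivity
  rw [le_div_iff₀ (by positivity)] at h3
  calc c1 / K^d / (nsq (x - w) + 1)^d = 1 / (K^d * (nsq (x - w) + 1)^d) * c1 := by field_simp
    _ ≤ 1 / (K^d * (nsq (x - w) + 1)^d) * (c1 * K^d) := by
      gcongr; exact le_mul_of_one_le_right hc1p.le (one_le_pow₀ hK1)
    _ ≤ h x := h3

/-! ### Basic properties of `pHAT` -/

lemma fh_congr {d : ℕ} {W : Set (Pt d)} {q q' : Pt d → Pt d → ℝ}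
    (h : ∀ a k, a + stp k ∈ W → q a (a + stp k) = q' a (a + stp k)) (t : ℕ) (x : Pt d) :
    fh W q t x = fh W q' t x := by
  induction t generalizing x with
  | zero => rw [fh, fh]; congr 1; refine Finset.sum_congr rfl fun k _ => ?_
            split_ifs with h1
            · exact h _ _ h1
            · rfl
  | succ t ih => rw [fh, fh]; congr 1; refine Finset.sum_congr rfl fun k _ => ?_
                 rw [ih]

lemma fh_sum {d : ℕ} {W : Set (Pt d)} {ι : Type*} (s : Finset ι) (q : ι → Pt d → Pt d → ℝ) (t : ℕ)
    (x : Pt d) : fh W (fun a b => ∑ i ∈ s, q i a b) t x = ∑ i ∈ s, fh W (q i) t x := by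
  induction t generalizing x with
  | zero =>
    simp only [fh]; rw [← Finset.sum_div, Finset.sum_comm]; congr 1
    refine Finset.sum_congr rfl fun k _ => ?_
    split_ifs <;> simp
  | succ t ih =>
    simp only [fh]; rw [← Finset.sum_div, Finset.sum_comm]; congr 1
    refine Finset.sum_congr rfl fun k _ => ?_
    split_ifs
    · simp
    · exact ih _

lemma Hit_sum {d : ℕ} (hd : 0 < d) {W : Set (Pt d)} {ι : Type*} (s : Finset ι)
    (q : ι → Pt d → Pt d → ℝ) (hq : ∀ i, BW (q i)) (x : Pt d) :
    Hit W (fun a b => ∑ i ∈ s, q i a b) x = ∑ i ∈ s, Hit W (q i) x := by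
  unfold Hit
  simp_rw [fh_sum]
  exact Summable.tsum_finsetSum fun i _ => fh_summable hd (hq i) x

/-- the neighbours of a finite set -/
def nbF {d : ℕ} (W : Finset (Pt d)) : Finset (Pt d) :=
  W.biUnion fun w => Finset.univ.image fun k : Stp d => w + stp k

/-- opposite step -/
def opp {d : ℕ} (k : Stp d) : Stp d := (k.1, !k.2)

lemma stp_opp {d : ℕ} (k : Stp d) : stp (opp k) = - stp k := by
  rcases k with ⟨i, b⟩
  cases b <;> simp [stp, opp, Pi.single_neg]

lemma mem_nbF {d : ℕ} {W : Finset (Pt d)} {y : Pt d} : y ∈ nbF W ↔ ∃ k, y + stp k ∈ W := by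
  unfold nbF
  simp only [Finset.mem_biUnion, Finset.mem_image, Finset.mem_univ, true_and]
  constructor
  · rintro ⟨w, hw, k, rfl⟩
    exact ⟨opp k, by simpa [stp_opp] using hw⟩
  · rintro ⟨k, hk⟩
    exact ⟨_, hk, opp k, by simp [stp_opp]⟩

lemma nbF_mono {d : ℕ} {W W' : Finset (Pt d)} (h : W ⊆ W') : nbF W ⊆ nbF W' := by
  intro y hy
  rw [mem_nbF] at *
  obtain ⟨k, hk⟩ := hy
  exact ⟨k, h hk⟩

lemma nbF_card {d : ℕ} (W : Finset (Pt d)) : (nbF W).card ≤ 2 * d * W.card := by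
  unfold nbF
  refine Finset.card_biUnion_le.trans ?_
  rw [mul_comm, ← smul_eq_mul]
  refine Finset.sum_le_card_nsmul _ _ _ fun w _ => Finset.card_image_le.trans ?_
  simp [Stp, mul_comm]

lemma sum_hitFrom {d : ℕ} (hd : 0 < d) (W : Finset (Pt d)) (x : Pt d) (s : Finset (Pt d))
    (hs : nbF W ⊆ s) : ∑ y ∈ s, hitFrom d (↑W) x y = retProb d (↑W) x := by
  classical
  simp_rw [hitFrom_eq hd]
  rw [← Hit_sum hd _ _ (fun y => bw_qAt _), retProb_eq hd]
  unfold Hit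
  refine tsum_congr fun t => fh_congr (fun a k hk => ?_) t x
  have : a ∈ s := hs (mem_nbF.2 ⟨k, by exact_mod_cast hk⟩)
  simp only [qAt]
  rw [Finset.sum_eq_single a]
  · simp
  · intro b _ hb; rw [if_neg]; exact fun h => hb h.symm
  · intro h; exact absurd this h

lemma hitFrom_nonneg {d : ℕ} (hd : 0 < d) (W : Set (Pt d)) (x y : Pt d) : 0 ≤ hitFrom d W x y := by
  rw [hitFrom_eq hd]; exact Hit_nonneg (bw_qAt _) x

lemma hitFrom_zero {d : ℕ} (hd : 0 < d) (W : Finset (Pt d)) (x y : Pt d) (h : y ∉ nbF W) :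
    hitFrom d (↑W) x y = 0 := by
  classical
  rw [hitFrom_eq hd]
  have : Hit (↑W) (qAt (· = y)) x = Hit (↑W : Set (Pt d)) (fun _ _ => 0) x := by
    unfold Hit
    refine tsum_congr fun t => fh_congr (fun a k hk => ?_) t x
    simp only [qAt]
    rw [if_neg]
    rintro rfl
    exact h (mem_nbF.2 ⟨k, by exact_mod_cast hk⟩)
  rw [this]
  unfold Hit
  have h0 : ∀ t (x : Pt d), fh (↑W : Set (Pt d)) (fun _ _ => 0) t x = 0 := by
    intro t
    induction t with
    | zero => intro x; simp [fh]
    | succ t ih => intro x; simp [fh, ih]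
  simp [h0]

lemma hitFrom_zero_mem {d : ℕ} (hd : 0 < d) (W : Set (Pt d)) (x y : Pt d) (hx : x ∉ W) (h : y ∈ W) :
    hitFrom d W x y = 0 := by
  classical
  rw [hitFrom_eq hd]
  unfold Hit
  have h0 : ∀ t (x : Pt d), x ∉ W → fh W (qAt (· = y)) t x = 0 := by
    intro t
    induction t with
    | zero =>
      intro x hx
      have : x ≠ y := by rintro rfl; exact hx h
      simp [fh, qAt, this]
    | succ t ih =>
      intro x hx
      simp only [fh]
      rw [Finset.sum_eq_zero, zero_div]
      intro k _
      split_ifs with hk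
      · rfl
      · exact ih _ hk
  simp [h0 _ x hx]

lemma ret_pos {d : ℕ} (hd : 5 ≤ d) {W : Set (Pt d)} {x w : Pt d} (hw : w ∈ W) (hx : x ∉ W) :
    0 < retProb d W x := by
  obtain ⟨c, hc, h⟩ := Hit_lower hd
  rw [retProb_eq (by omega)]
  refine lt_of_lt_of_le ?_ (h W x w hw (by rintro rfl; exact hx hw))
  have := nsq_nonneg (x - w)
  positivity

lemma ret_le_one {d : ℕ} (hd : 0 < d) (W : Set (Pt d)) (x : Pt d) : retProb d W x ≤ 1 := by
  rw [retProb_eq hd]; exact Hit_le_one hd bw_one x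

lemma ret_nonneg {d : ℕ} (hd : 0 < d) (W : Set (Pt d)) (x : Pt d) : 0 ≤ retProb d W x := by
  rw [retProb_eq hd]; exact Hit_nonneg bw_one x

lemma capa_eq {d : ℕ} (U : Finset (Pt d)) : capa d (↑U) = ∑ x ∈ U, esc d (↑U) x := by
  unfold capa
  exact Finset.tsum_subtype' U (fun x => esc d (↑U) x)

/-- a constant below the escape probabilities from extreme points -/
lemma exists_extreme {d : ℕ} (U : Finset (Pt d)) (hU : U.Nonempty) (k : Stp d) :
    ∃ x ∈ U, ∀ z ∈ U, sdot (z - x) k ≤ 0 := by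
  obtain ⟨x, hx, h⟩ := U.exists_max_image (fun z => sdot z k) hU
  exact ⟨x, hx, fun z hz => by rw [sdot_sub]; linarith [h z hz]⟩

lemma capa_lower {d : ℕ} (hd : 5 ≤ d) (n : ℕ) : ∃ c : ℝ, 0 < c ∧ ∀ U : Finset (Pt d), U.card ≤ n →
    U.Nonempty → c ≤ capa d (↑U) := by
  obtain ⟨L, c, hc, _, h⟩ := esc_ray hd n
  refine ⟨c, hc, fun U hU hne => ?_⟩
  obtain ⟨x, hx, hz⟩ := exists_extreme U hne (⟨0, by omega⟩, true)
  rw [capa_eq]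
  exact (h U x _ hU hx fun z hzU => Or.inl (hz z hzU)).trans
    (Finset.single_le_sum (f := fun x => esc d (↑U) x) (fun x _ => esc_nonneg (by omega) _ _) hx)

lemma capa_pos {d : ℕ} (hd : 5 ≤ d) {U : Finset (Pt d)} (hU : U.Nonempty) : 0 < capa d (↑U) := by
  obtain ⟨c, hc, h⟩ := capa_lower hd U.card
  exact lt_of_lt_of_le hc (h U le_rfl hU)

lemma capa_le {d : ℕ} (hd : 0 < d) (U : Finset (Pt d)) : capa d (↑U) ≤ U.card := by
  rw [capa_eq]
  calc _ ≤ ∑ x ∈ U, (1:ℝ) := Finset.sum_le_sum fun x _ => esc_le_one hd _ _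
    _ = _ := by simp

lemma coe_erase' {d : ℕ} (U : Finset (Pt d)) (x : Pt d) :
    ((↑U : Set (Pt d)) \ {x}) = ↑(U.erase x) := by simp

lemma pHAT_eq {d : ℕ} (U : Finset (Pt d)) (x y : Pt d) : pHAT d U x y =
    esc d (↑U) x / capa d (↑U) * (hitFrom d (↑(U.erase x)) x y / retProb d (↑(U.erase x)) x) := by
  unfold pHAT harm transP; rw [coe_erase']

lemma pHAT_nonneg {d : ℕ} (hd : 0 < d) (U : Finset (Pt d)) (x y : Pt d) : 0 ≤ pHAT d U x y := by
  rw [pHAT_eq]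
  have h1 := esc_nonneg hd (↑U) x
  have h2 : 0 ≤ capa d (↑U) := by rw [capa_eq]; exact Finset.sum_nonneg fun x _ => esc_nonneg hd _ _
  have h3 := hitFrom_nonneg hd (↑(U.erase x)) x y
  have h4 := ret_nonneg hd (↑(U.erase x)) x
  positivity

lemma pHAT_ne_zero {d : ℕ} (hd : 0 < d) {U : Finset (Pt d)} {x y : Pt d} (h : pHAT d U x y ≠ 0) :
    x ∈ U ∧ y ∈ nbF (U.erase x) ∧ y ∉ U.erase x := by
  rw [pHAT_eq] at h
  refine ⟨?_, ?_, ?_⟩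
  · by_contra hx
    apply h
    have : esc d (↑U) x = 0 := by unfold esc; rw [if_neg (by exact_mod_cast hx)]
    simp [this]
  · by_contra hy
    apply h
    rw [hitFrom_zero hd _ _ _ hy, zero_div, mul_zero]
  · intro hy
    apply h
    have := hitFrom_zero_mem hd (↑(U.erase x)) x y (by simp) (Finset.mem_coe.2 hy)
    rw [this, zero_div, mul_zero]

/-- replace `x` by `y` -/
def mv {d : ℕ} (U : Finset (Pt d)) (x y : Pt d) : Finset (Pt d) := insert y (U.erase x)

lemma mv_card {d : ℕ} {U : Finset (Pt d)} {x y : Pt d} (hx : x ∈ U) (hy : y ∉ U.erase x) :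
    (mv U x y).card = U.card := by
  unfold mv
  rw [Finset.card_insert_of_notMem hy, Finset.card_erase_of_mem hx]
  have := Finset.card_pos.2 ⟨x, hx⟩
  omega

/-- expectation of one step -/
noncomputable def EU {d : ℕ} (U : Finset (Pt d)) (f : Pt d → Pt d → ℝ) : ℝ :=
  ∑ x ∈ U, ∑ y ∈ nbF U, pHAT d U x y * f x y

lemma sum_pHAT_y {d : ℕ} (hd : 5 ≤ d) {U : Finset (Pt d)} (hU : 2 ≤ U.card) {x : Pt d} (hx : x ∈ U)
    {s : Finset (Pt d)} (hs : nbF (U.erase x) ⊆ s) :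
    ∑ y ∈ s, pHAT d U x y = esc d (↑U) x / capa d (↑U) := by
  simp_rw [pHAT_eq]
  rw [← Finset.mul_sum, ← Finset.sum_div, sum_hitFrom (by omega) _ _ _ hs, div_self, mul_one]
  have : (U.erase x).Nonempty := by
    rw [← Finset.card_pos, Finset.card_erase_of_mem hx]; omega
  obtain ⟨w, hw⟩ := this
  exact (ret_pos hd (Finset.mem_coe.2 hw) (by simp)).ne'

lemma EU_const {d : ℕ} (hd : 5 ≤ d) {U : Finset (Pt d)} (hU : 2 ≤ U.card) (c : ℝ) :
    EU U (fun _ _ => c) = c := by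
  unfold EU
  have : ∀ x ∈ U, ∑ y ∈ nbF U, pHAT d U x y * c = esc d (↑U) x / capa d (↑U) * c := by
    intro x hx
    rw [← Finset.sum_mul, sum_pHAT_y hd hU hx (nbF_mono (Finset.erase_subset _ _))]
  rw [Finset.sum_congr rfl this, ← Finset.sum_mul, ← Finset.sum_div, ← capa_eq, div_self, one_mul]
  exact (capa_pos hd (Finset.card_pos.1 (by omega))).ne'

lemma EU_mono {d : ℕ} (hd : 0 < d) {U : Finset (Pt d)} {f g : Pt d → Pt d → ℝ}
    (h : ∀ x y, x ∈ U → y ∈ nbF (U.erase x) → y ∉ U.erase x → f x y ≤ g x y) : EU U f ≤ EU U g := by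
  unfold EU
  refine Finset.sum_le_sum fun x _ => Finset.sum_le_sum fun y _ => ?_
  by_cases h0 : pHAT d U x y = 0
  · simp [h0]
  · obtain ⟨a, b, c⟩ := pHAT_ne_zero hd h0
    exact mul_le_mul_of_nonneg_left (h x y a b c) (pHAT_nonneg hd _ _ _)

lemma EU_congr {d : ℕ} (hd : 0 < d) {U : Finset (Pt d)} {f g : Pt d → Pt d → ℝ}
    (h : ∀ x y, x ∈ U → y ∈ nbF (U.erase x) → y ∉ U.erase x → f x y = g x y) : EU U f = EU U g :=
  le_antisymm (EU_mono hd fun x y a b c => (h x y a b c).le)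
    (EU_mono hd fun x y a b c => (h x y a b c).ge)

lemma EU_add {d : ℕ} (U : Finset (Pt d)) (f g : Pt d → Pt d → ℝ) :
    EU U (fun x y => f x y + g x y) = EU U f + EU U g := by
  unfold EU; simp_rw [mul_add, Finset.sum_add_distrib]

lemma EU_sub {d : ℕ} (U : Finset (Pt d)) (f g : Pt d → Pt d → ℝ) :
    EU U (fun x y => f x y - g x y) = EU U f - EU U g := by
  unfold EU; simp_rw [mul_sub, Finset.sum_sub_distrib]

lemma EU_mul {d : ℕ} (U : Finset (Pt d)) (c : ℝ) (f : Pt d → Pt d → ℝ) :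
    EU U (fun x y => c * f x y) = c * EU U f := by
  unfold EU; simp_rw [Finset.mul_sum]
  refine Finset.sum_congr rfl fun x _ => Finset.sum_congr rfl fun y _ => by ring

lemma EU_nonneg {d : ℕ} (hd : 0 < d) {U : Finset (Pt d)} {f : Pt d → Pt d → ℝ}
    (h : ∀ x y, x ∈ U → y ∈ nbF (U.erase x) → y ∉ U.erase x → 0 ≤ f x y) : 0 ≤ EU U f := by
  have := EU_mono hd (U := U) (f := fun _ _ => 0) h
  simpa [EU] using this

/-- one term of the expectation -/
lemma EU_single {d : ℕ} (hd : 0 < d) {U : Finset (Pt d)} {f : Pt d → Pt d → ℝ}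
    (h : ∀ x y, x ∈ U → y ∈ nbF (U.erase x) → y ∉ U.erase x → 0 ≤ f x y) {x y : Pt d}
    (hf : 0 ≤ f x y) :
    pHAT d U x y * f x y ≤ EU U f := by
  by_cases h0 : pHAT d U x y = 0
  · rw [h0, zero_mul]; exact EU_nonneg hd h
  · obtain ⟨a, b, c⟩ := pHAT_ne_zero hd h0
    have hnn : ∀ x y, 0 ≤ pHAT d U x y * f x y := fun x y => by
      by_cases h0 : pHAT d U x y = 0
      · simp [h0]
      · obtain ⟨a, b, c⟩ := pHAT_ne_zero hd h0
        exact mul_nonneg (pHAT_nonneg hd _ _ _) (h _ _ a b c)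
    unfold EU
    refine le_trans ?_ (Finset.single_le_sum (f := fun x => ∑ y ∈ nbF U, pHAT d U x y * f x y)
      (fun x _ => Finset.sum_nonneg fun y _ => hnn x y) a)
    exact Finset.single_le_sum (f := fun y => pHAT d U x y * f x y) (fun y _ => hnn x y)
      (nbF_mono (Finset.erase_subset _ _) b)

/-- the transition probabilities as a finite sum -/
lemma hatProb_eq {d : ℕ} (hd : 0 < d) (U V : Finset (Pt d)) :
    hatProb d U V = EU U (fun x y => if V = mv U x y then 1 else 0) := by
  classical
  unfold hatProb EU
  beta_reduce
  have hz : ∀ x, x ∉ U → ∀ y, pHAT d U x y = 0 := fun x hx y => by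
    by_contra h; exact hx (pHAT_ne_zero hd h).1
  have hz2 : ∀ x y, y ∉ nbF U → pHAT d U x y = 0 := fun x y hy => by
    by_contra h; exact hy (nbF_mono (Finset.erase_subset _ _) (pHAT_ne_zero hd h).2.1)
  split_ifs with hV
  · subst hV
    rw [tsum_eq_sum (s := V) (fun x hx => hz x hx x)]
    refine Finset.sum_congr rfl fun x hx => ?_
    by_cases hxn : x ∈ nbF V
    · rw [Finset.sum_eq_single x]
      · rw [if_pos (by unfold mv; rw [Finset.insert_erase hx]), mul_one]
      · intro y _ hyx
        rw [if_neg, mul_zero]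
        intro h
        have : x ∈ mv V x y := h ▸ hx
        unfold mv at this
        simp at this
        exact hyx this.symm
      · intro h; exact absurd hxn h
    · rw [hz2 x x hxn, Finset.sum_eq_zero]
      intro y hy
      rw [if_neg, mul_zero]
      intro h
      have : x ∈ mv V x y := h ▸ hx
      unfold mv at this
      simp at this
      exact hxn (this ▸ hy)
  · rw [tsum_eq_sum (s := U)]
    · refine Finset.sum_congr rfl fun x hx => ?_
      rw [tsum_eq_sum (s := nbF U)]
      · refine Finset.sum_congr rfl fun y hy => ?_
        by_cases hm : V = mv U x y
        · have hxy : x ≠ y := by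
            rintro rfl
            apply hV; rw [hm]; unfold mv; rw [Finset.insert_erase hx]
          rw [if_pos ⟨hx, hxy, hm⟩, if_pos hm, mul_one]
        · rw [if_neg (fun h => hm h.2.2), if_neg hm, mul_zero]
      · intro y hy
        rw [hz2 x y hy]; simp
    · intro x hx
      rw [← tsum_zero (β := Pt d)]
      congr 1; funext y
      simp [hx]

/-- move lemma -/
lemma move_lower {d : ℕ} (hd : 0 < d) {U : Finset (Pt d)} {x y : Pt d} {c : ℝ} {n l : ℕ} (hc : 0 ≤ c)
    (hn : U.card ≤ n) (hx : x ∈ U) (hesc : c ≤ esc d (↑U) x) (hp : PathA (↑(U.erase x)) l x y)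
    (hy : y ∈ nbF (U.erase x)) : c / n * (1 / (2 * d : ℝ))^(l+1) ≤ pHAT d U x y := by
  classical
  by_cases hc0 : c = 0
  · rw [hc0]; simpa using pHAT_nonneg hd U x y
  have hcpos : 0 < c := lt_of_le_of_ne hc (Ne.symm hc0)
  have hcap : 0 < capa d (↑U) := by
    rw [capa_eq]
    exact lt_of_lt_of_le hcpos (hesc.trans (Finset.single_le_sum (f := fun x => esc d (↑U) x)
      (fun x _ => esc_nonneg hd _ _) hx))
  have hcap2 : capa d (↑U) ≤ n := (capa_le hd U).trans (by exact_mod_cast hn)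
  obtain ⟨k, hk⟩ := mem_nbF.1 hy
  have hhit : (1 / (2 * d : ℝ)) ≤ Hit (↑(U.erase x)) (qAt (· = y)) y := by
    rw [Hit_step hd (bw_qAt _)]
    gcongr
    refine le_trans ?_ (Finset.single_le_sum
      (fun k _ => ?_) (Finset.mem_univ k))
    · rw [if_pos (Finset.mem_coe.2 hk)]; simp [qAt]
    · split_ifs
      · exact (bw_qAt _ _ _).1
      · exact Hit_nonneg (bw_qAt _) _
  have hh : (1 / (2 * d : ℝ))^(l+1) ≤ hitFrom d (↑(U.erase x)) x y := by
    rw [hitFrom_eq hd, pow_succ]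
    refine le_trans ?_ (PathA_hit hd (bw_qAt _) hp)
    gcongr
  have hret := ret_le_one hd (↑(U.erase x)) x
  have hret0 : 0 < retProb d (↑(U.erase x)) x := by
    have := sum_hitFrom hd (U.erase x) x _ (Finset.Subset.refl _)
    rw [← this]
    have hpos : 0 < (1 / (2 * d : ℝ))^(l+1) := by positivity
    exact lt_of_lt_of_le hpos (hh.trans (Finset.single_le_sum (f := fun y => hitFrom d (↑(U.erase x)) x y)
      (fun y _ => hitFrom_nonneg hd _ _ _) hy))
  rw [pHAT_eq]
  have h1 : c / n ≤ esc d (↑U) x / capa d (↑U) := by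
    have := esc_nonneg hd (↑U) x
    gcongr
  have h2 : (1 / (2 * d : ℝ))^(l+1) ≤ hitFrom d (↑(U.erase x)) x y / retProb d (↑(U.erase x)) x := by
    rw [le_div_iff₀ hret0]
    have : 0 < (1 / (2 * d : ℝ))^(l+1) := by positivity
    nlinarith
  exact mul_le_mul h1 h2 (by positivity) (div_nonneg (esc_nonneg hd _ _) hcap.le)

/-! ### Symmetries -/

/-- lattice symmetry -/
structure LS (d : ℕ) where
  perm : Equiv.Perm (Fin d)
  sg : Fin d → ℤ
  hsg : ∀ i, sg i = 1 ∨ sg i = -1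
  tr : Pt d

/-- the action -/
def LS.ap {d : ℕ} (g : LS d) (x : Pt d) : Pt d := fun i => g.tr i + g.sg i * x (g.perm i)

lemma LS.inj {d : ℕ} (g : LS d) : Function.Injective g.ap := by
  intro x y h
  funext j
  have := congrFun h (g.perm.symm j)
  simp only [LS.ap, Equiv.apply_symm_apply, add_right_inj] at this
  rcases g.hsg (g.perm.symm j) with h1 | h1 <;> rw [h1] at this <;> linarith

lemma LS.ap_add {d : ℕ} (g : LS d) (x s : Pt d) (i : Fin d) : g.ap (x + s) i = g.ap x i + g.sg i * s (g.perm i) := by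
  simp only [LS.ap, Pi.add_apply]; ring

lemma LS.exists_stp {d : ℕ} (g : LS d) (k : Stp d) : ∃ k' : Stp d, ∀ x, g.ap (x + stp k) = g.ap x + stp k' := by
  rcases k with ⟨j, b⟩
  refine ⟨(g.perm.symm j, if g.sg (g.perm.symm j) = 1 then b else !b), fun x => ?_⟩
  funext i
  rw [LS.ap_add, Pi.add_apply, add_right_inj]
  by_cases hi : g.perm i = j
  · have hi' : i = g.perm.symm j := by rw [← hi]; simp
    subst hi'
    simp only [stp, Equiv.apply_symm_apply, Pi.single_eq_same]
    rcases g.hsg (g.perm.symm j) with h1 | h1 <;> rw [h1] <;> cases b <;> simp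
  · have hi' : i ≠ g.perm.symm j := by rintro rfl; simp at hi
    simp [stp, Pi.single_eq_of_ne hi, Pi.single_eq_of_ne hi']

lemma LS.exists_perm {d : ℕ} (g : LS d) : ∃ p : Equiv.Perm (Stp d), ∀ x k, g.ap (x + stp k) = g.ap x + stp (p k) := by
  choose f hf using g.exists_stp
  have hinj : Function.Injective f := by
    intro a b hab
    have h1 := hf a 0
    have h2 := hf b 0
    rw [hab] at h1
    have := g.inj (h1.trans h2.symm)
    exact stp_inj (by simpa using this)
  exact ⟨Equiv.ofBijective f (Finite.injective_iff_bijective.1 hinj), fun x k => hf k x⟩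

lemma fh_sym {d : ℕ} (g : LS d) (W : Set (Pt d)) (q : Pt d → Pt d → ℝ) (t : ℕ) (x : Pt d) :
    fh (g.ap '' W) q t (g.ap x) = fh W (fun a b => q (g.ap a) (g.ap b)) t x := by
  obtain ⟨p, hp⟩ := g.exists_perm
  induction t generalizing x with
  | zero =>
    rw [fh, fh, ← Equiv.sum_comp p]
    congr 1
    refine Finset.sum_congr rfl fun k _ => ?_
    rw [← hp, g.inj.mem_set_image]
  | succ t ih =>
    rw [fh, fh, ← Equiv.sum_comp p]
    congr 1
    refine Finset.sum_congr rfl fun k _ => ?_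
    rw [← hp, g.inj.mem_set_image, ih]

lemma Hit_sym {d : ℕ} (g : LS d) (W : Set (Pt d)) (q : Pt d → Pt d → ℝ) (x : Pt d) :
    Hit (g.ap '' W) q (g.ap x) = Hit W (fun a b => q (g.ap a) (g.ap b)) x :=
  tsum_congr fun t => fh_sym g W q t x

lemma ret_sym {d : ℕ} (hd : 0 < d) (g : LS d) (W : Set (Pt d)) (x : Pt d) :
    retProb d (g.ap '' W) (g.ap x) = retProb d W x := by
  rw [retProb_eq hd, retProb_eq hd, Hit_sym]

lemma hitFrom_sym {d : ℕ} (hd : 0 < d) (g : LS d) (W : Set (Pt d)) (x y : Pt d) :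
    hitFrom d (g.ap '' W) (g.ap x) (g.ap y) = hitFrom d W x y := by
  rw [hitFrom_eq hd, hitFrom_eq hd, Hit_sym]
  congr 1
  funext a b
  by_cases h : a = y <;> simp [qAt, g.inj.eq_iff, h]

lemma esc_sym {d : ℕ} (hd : 0 < d) (g : LS d) (W : Set (Pt d)) (x : Pt d) :
    esc d (g.ap '' W) (g.ap x) = esc d W x := by
  by_cases hx : x ∈ W
  · rw [esc_eq hd _ hx, esc_eq hd _ (Set.mem_image_of_mem _ hx), Hit_sym]
  · unfold esc
    rw [if_neg hx, if_neg (by rwa [g.inj.mem_set_image])]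

/-- action on finite sets -/
def LS.im {d : ℕ} (g : LS d) (U : Finset (Pt d)) : Finset (Pt d) := U.image g.ap

lemma LS.im_coe {d : ℕ} (g : LS d) (U : Finset (Pt d)) : (↑(g.im U) : Set (Pt d)) = g.ap '' ↑U := by
  simp [LS.im]

lemma capa_sym {d : ℕ} (hd : 0 < d) (g : LS d) (U : Finset (Pt d)) :
    capa d (↑(g.im U)) = capa d (↑U) := by
  rw [capa_eq, capa_eq]
  conv_lhs => arg 1; unfold LS.im
  rw [Finset.sum_image (fun a _ b _ h => g.inj h)]
  refine Finset.sum_congr rfl fun x _ => ?_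
  rw [g.im_coe, esc_sym hd]

lemma LS.im_erase {d : ℕ} (g : LS d) (U : Finset (Pt d)) (x : Pt d) :
    (g.im U).erase (g.ap x) = g.im (U.erase x) := by
  unfold LS.im; rw [Finset.image_erase g.inj]

lemma LS.im_mv {d : ℕ} (g : LS d) (U : Finset (Pt d)) (x y : Pt d) :
    mv (g.im U) (g.ap x) (g.ap y) = g.im (mv U x y) := by
  unfold mv; rw [LS.im_erase]; unfold LS.im; rw [Finset.image_insert]

lemma LS.im_nbF {d : ℕ} (g : LS d) (U : Finset (Pt d)) : nbF (g.im U) = g.im (nbF U) := by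
  obtain ⟨p, hp⟩ := g.exists_perm
  ext y
  rw [mem_nbF]
  simp only [LS.im, Finset.mem_image]
  constructor
  · rintro ⟨k, z, hz, h⟩
    refine ⟨z + stp (p.symm (opp k)), ?_, ?_⟩
    · exact mem_nbF.2 ⟨opp (p.symm (opp k)), by simpa [stp_opp] using hz⟩
    · rw [hp, h]; simp [stp_opp]
  · rintro ⟨z, hz, rfl⟩
    obtain ⟨k, hk⟩ := mem_nbF.1 hz
    exact ⟨p k, _, hk, hp z k⟩

lemma pHAT_sym {d : ℕ} (hd : 0 < d) (g : LS d) (U : Finset (Pt d)) (x y : Pt d) :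
    pHAT d (g.im U) (g.ap x) (g.ap y) = pHAT d U x y := by
  rw [pHAT_eq, pHAT_eq, capa_sym hd, LS.im_erase, g.im_coe, g.im_coe, esc_sym hd, hitFrom_sym hd, ret_sym hd]

lemma EU_sym {d : ℕ} (hd : 0 < d) (g : LS d) (U : Finset (Pt d)) (f : Pt d → Pt d → ℝ) :
    EU (g.im U) f = EU U (fun x y => f (g.ap x) (g.ap y)) := by
  unfold EU
  rw [LS.im_nbF]
  conv_lhs => arg 1; unfold LS.im
  rw [Finset.sum_image (fun a _ b _ h => g.inj h)]
  refine Finset.sum_congr rfl fun x _ => ?_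
  conv_lhs => arg 1; unfold LS.im
  rw [Finset.sum_image (fun a _ b _ h => g.inj h)]
  refine Finset.sum_congr rfl fun y _ => ?_
  rw [pHAT_sym hd]

lemma LS.im_inj {d : ℕ} (g : LS d) : Function.Injective g.im := Finset.image_injective g.inj

/-- inverse -/
def LS.inv {d : ℕ} (g : LS d) : LS d where
  perm := g.perm.symm
  sg := fun j => g.sg (g.perm.symm j)
  hsg := fun j => g.hsg _
  tr := fun j => - g.sg (g.perm.symm j) * g.tr (g.perm.symm j)

lemma LS.inv_ap {d : ℕ} (g : LS d) (x : Pt d) : g.inv.ap (g.ap x) = x := by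
  funext j
  simp only [LS.ap, LS.inv, Equiv.apply_symm_apply]
  rcases g.hsg (g.perm.symm j) with h | h <;> rw [h] <;> ring

lemma LS.inv_im {d : ℕ} (g : LS d) (U : Finset (Pt d)) : g.inv.im (g.im U) = U := by
  unfold LS.im; rw [Finset.image_image]
  have : g.inv.ap ∘ g.ap = id := funext fun x => g.inv_ap x
  rw [this, Finset.image_id]

/-! ### Shapes -/

/-- a dimer or trimer with an adjacent pair -/
def Shp {d : ℕ} (A : Finset (Pt d)) : Prop := (A.card = 2 ∨ A.card = 3) ∧ ∃ u ∈ A, ∃ k, u + stp k ∈ A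

/-- straight dimers and trimers -/
def Line {d : ℕ} (A : Finset (Pt d)) : Prop :=
  (∃ o k, A = {o, o + stp k}) ∨ ∃ o k, A = {o - stp k, o, o + stp k}

lemma stp_ne_zero {d : ℕ} (k : Stp d) : stp k ≠ 0 := by
  intro h
  have := congrFun h k.1
  simp only [stp, Pi.single_eq_same, Pi.zero_apply] at this
  split_ifs at this <;> omega

lemma stp_ne_neg {d : ℕ} (k : Stp d) : stp k ≠ - stp k := by
  intro h
  have := congrFun h k.1
  simp only [stp, Pi.single_eq_same, Pi.neg_apply] at this
  split_ifs at this <;> omega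

lemma card_dimer {d : ℕ} (o : Pt d) (k : Stp d) : ({o, o + stp k} : Finset (Pt d)).card = 2 := by
  rw [Finset.card_pair]; simp [stp_ne_zero]

lemma card_trimer {d : ℕ} (o : Pt d) (k : Stp d) : ({o - stp k, o, o + stp k} : Finset (Pt d)).card = 3 := by
  rw [Finset.card_eq_three]
  refine ⟨_, _, _, ?_, ?_, ?_, rfl⟩
  · simp [stp_ne_zero]
  · intro h
    apply stp_ne_neg k
    have : o - stp k - o = o + stp k - o := by rw [h]
    simpa using this.symm
  · simp [stp_ne_zero]

lemma Line.shp {d : ℕ} {A : Finset (Pt d)} (h : Line A) : Shp A := by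
  rcases h with ⟨o, k, rfl⟩ | ⟨o, k, rfl⟩
  · exact ⟨Or.inl (card_dimer o k), o, by simp, k, by simp⟩
  · exact ⟨Or.inr (card_trimer o k), o, by simp, k, by simp⟩

lemma Shp.card_le {d : ℕ} {A : Finset (Pt d)} (h : Shp A) : A.card ≤ 3 := by
  rcases h.1 with h | h <;> omega

lemma Shp.two_le {d : ℕ} {A : Finset (Pt d)} (h : Shp A) : 2 ≤ A.card := by
  rcases h.1 with h | h <;> omega

lemma Shp.mv {d : ℕ} {A : Finset (Pt d)} (h : Shp A) {x y : Pt d} (hx : x ∈ A)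
    (hy : y ∈ nbF (A.erase x)) (hy' : y ∉ A.erase x) : Shp (mv A x y) := by
  refine ⟨by rw [mv_card hx hy']; exact h.1, y, by simp [HATFormal.mv], ?_⟩
  obtain ⟨k, hk⟩ := mem_nbF.1 hy
  exact ⟨k, by unfold HATFormal.mv; exact Finset.mem_insert_of_mem hk⟩

lemma LS.im_card {d : ℕ} (g : LS d) (A : Finset (Pt d)) : (g.im A).card = A.card :=
  Finset.card_image_of_injective _ g.inj

lemma Shp.im {d : ℕ} {A : Finset (Pt d)} (h : Shp A) (g : LS d) : Shp (g.im A) := by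
  obtain ⟨h1, u, hu, k, hk⟩ := h
  obtain ⟨p, hp⟩ := g.exists_perm
  refine ⟨by rwa [g.im_card], g.ap u, Finset.mem_image_of_mem _ hu, p k, ?_⟩
  rw [← hp]; exact Finset.mem_image_of_mem _ hk

lemma Line.im {d : ℕ} {A : Finset (Pt d)} (h : Line A) (g : LS d) : Line (g.im A) := by
  obtain ⟨p, hp⟩ := g.exists_perm
  rcases h with ⟨o, k, rfl⟩ | ⟨o, k, rfl⟩
  · refine Or.inl ⟨g.ap o, p k, ?_⟩
    simp [LS.im, hp, Finset.image_insert]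
  · refine Or.inr ⟨g.ap o, p k, ?_⟩
    have : g.ap (o - stp k) = g.ap o - stp (p k) := by
      have := hp (o - stp k) k
      rw [sub_add_cancel] at this
      rw [this]; simp
    simp [LS.im, hp, Finset.image_insert, this]

lemma Line.im_iff {d : ℕ} {A : Finset (Pt d)} (g : LS d) : Line (g.im A) ↔ Line A := by
  refine ⟨fun h => ?_, fun h => h.im g⟩
  have := h.im g.inv
  rwa [g.inv_im] at this

/-- the points of a `Shp` are exposed -/
lemma shp_esc {d : ℕ} (hd : 5 ≤ d) : ∃ c : ℝ, 0 < c ∧ c ≤ 1 ∧ ∀ A : Finset (Pt d), Shp A → ∀ x ∈ A, c ≤ esc d (↑A) x := by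
  obtain ⟨L, c, hc, _, h⟩ := esc_ray hd 3
  refine ⟨min c 1, lt_min hc one_pos, min_le_right _ _, fun A hA x hx => (min_le_left _ _).trans ?_⟩
  obtain ⟨h1, u, hu, k, hk⟩ := id hA
  obtain ⟨i, hi⟩ : ∃ i : Fin d, i ≠ k.1 := by
    by_contra! hcon
    have h0 := hcon ⟨0, by omega⟩
    have h1 := hcon ⟨1, by omega⟩
    rw [← h1] at h0
    simp at h0
  have huv : (u + stp k) i = u i := by simp [stp, Pi.single_eq_of_ne hi]
  -- the third point
  obtain ⟨z, hz⟩ : ∃ z, ∀ w ∈ A, w = u ∨ w = u + stp k ∨ w = z := by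
    have hsub : ({u, u + stp k} : Finset (Pt d)) ⊆ A := by
      intro w hw; simp at hw; rcases hw with rfl | rfl <;> assumption
    have hc : (A \ {u, u + stp k}).card ≤ 1 := by
      rw [Finset.card_sdiff_of_subset hsub, card_dimer]
      have := hA.card_le; omega
    rw [Finset.card_le_one_iff_subset_singleton] at hc
    obtain ⟨z, hz⟩ := hc
    refine ⟨z, fun w hw => ?_⟩
    by_cases hw' : w ∈ ({u, u + stp k} : Finset (Pt d))
    · simp at hw'; tauto
    · right; right; simpa using hz (Finset.mem_sdiff.2 ⟨hw, hw'⟩)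
  have key : (∀ w ∈ A, w i ≤ x i) ∨ (∀ w ∈ A, x i ≤ w i) := by
    have hx' : x i = u i ∨ x i = z i := by
      rcases hz x hx with rfl | rfl | rfl
      · left; rfl
      · left; exact huv
      · right; rfl
    have hw' : ∀ w ∈ A, w i = u i ∨ w i = z i := by
      intro w hw
      rcases hz w hw with rfl | rfl | rfl
      · left; rfl
      · left; exact huv
      · right; rfl
    rcases le_total (u i) (z i) with h1 | h1 <;> rcases hx' with h2 | h2
    · right; intro w hw; rcases hw' w hw with h | h <;> omega
    · left; intro w hw; rcases hw' w hw with h | h <;> omega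
    · left; intro w hw; rcases hw' w hw with h | h <;> omega
    · right; intro w hw; rcases hw' w hw with h | h <;> omega
  rcases key with hkey | hkey
  · refine h A x (i, true) hA.card_le hx fun w hw => Or.inl ?_
    simp [sdot]; exact hkey w hw
  · refine h A x (i, false) hA.card_le hx fun w hw => Or.inl ?_
    simp [sdot]; exact hkey w hw

/-! ### The chain of a single cluster -/

lemma EU_act {d : ℕ} (hd : 5 ≤ d) {U : Finset (Pt d)} (hU : 2 ≤ U.card) {f : Pt d → Pt d → ℝ} {m : ℝ}
    (h : ∀ x y, x ∈ U → y ∈ nbF (U.erase x) → y ∉ U.erase x → 0 ≤ f x y) {x : Pt d} (hx : x ∈ U)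
    (hm : ∀ y, y ∈ nbF (U.erase x) → y ∉ U.erase x → m ≤ f x y) :
    m * (esc d (↑U) x / capa d (↑U)) ≤ EU U f := by
  have hd0 : 0 < d := by omega
  have hnn : ∀ x y, 0 ≤ pHAT d U x y * f x y := fun x y => by
    by_cases h0 : pHAT d U x y = 0
    · simp [h0]
    · obtain ⟨a, b, c⟩ := pHAT_ne_zero hd0 h0
      exact mul_nonneg (pHAT_nonneg hd0 _ _ _) (h _ _ a b c)
  unfold EU
  refine le_trans ?_ (Finset.single_le_sum (f := fun x => ∑ y ∈ nbF U, pHAT d U x y * f x y)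
    (fun x _ => Finset.sum_nonneg fun y _ => hnn x y) hx)
  rw [← sum_pHAT_y hd hU hx (nbF_mono (Finset.erase_subset x _)), Finset.mul_sum]
  refine Finset.sum_le_sum fun y _ => ?_
  by_cases h0 : pHAT d U x y = 0
  · simp [h0]
  · obtain ⟨a, b, c⟩ := pHAT_ne_zero hd0 h0
    rw [mul_comm]
    exact mul_le_mul_of_nonneg_left (hm y b c) (pHAT_nonneg hd0 _ _ _)

/-- connected shapes -/
def Con {d : ℕ} (A : Finset (Pt d)) : Prop := ∃ o k l, k ≠ l ∧ A = {o, o + stp k, o + stp l}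

/-- a nonline shape is a pair plus a point -/
lemma Shp.nonline {d : ℕ} {A : Finset (Pt d)} (h : Shp A) (hl : ¬ Line A) :
    ∃ u k z, A = {u, u + stp k, z} ∧ z ≠ u ∧ z ≠ u + stp k := by
  obtain ⟨h1, u, hu, k, hk⟩ := h
  have hsub : ({u, u + stp k} : Finset (Pt d)) ⊆ A := by
    intro w hw; simp at hw; rcases hw with rfl | rfl <;> assumption
  rcases h1 with h1 | h1
  · exfalso; apply hl
    exact Or.inl ⟨u, k, (Finset.eq_of_subset_of_card_le hsub (by rw [h1, card_dimer])).symm⟩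
  · have : (A \ {u, u + stp k}).card = 1 := by
      rw [Finset.card_sdiff_of_subset hsub, card_dimer, h1]
    rw [Finset.card_eq_one] at this
    obtain ⟨z, hz⟩ := this
    have hzA : z ∈ A \ {u, u + stp k} := by rw [hz]; simp
    rw [Finset.mem_sdiff] at hzA
    simp at hzA
    refine ⟨u, k, z, ?_, hzA.2.1, hzA.2.2⟩
    rw [← Finset.sdiff_union_of_subset hsub, hz]
    ext w; simp; tauto

/-- an attached point is connected -/
lemma con_attach {d : ℕ} {u y : Pt d} {k : Stp d} (hy : y ∈ nbF ({u, u + stp k} : Finset (Pt d)))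
    (hy' : y ∉ ({u, u + stp k} : Finset (Pt d))) : Con (insert y ({u, u + stp k} : Finset (Pt d))) := by
  obtain ⟨l, hl⟩ := mem_nbF.1 hy
  simp at hl hy'
  rcases hl with hl | hl
  · refine ⟨u, k, opp l, ?_, ?_⟩
    · rintro rfl
      apply hy'.2
      rw [stp_opp, ← hl]; simp
    · rw [stp_opp, ← hl]
      ext w; simp; tauto
  · have hyl : y = u + stp k + stp (opp l) := by rw [stp_opp, ← hl]; simp
    refine ⟨u + stp k, opp k, opp l, ?_, ?_⟩
    · intro h
      apply hy'.1
      rw [hyl, ← h, stp_opp]; simp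
    · rw [← hyl, stp_opp]
      ext w; simp; tauto

lemma erase_third {d : ℕ} {a b z : Pt d} (h1 : z ≠ a) (h2 : z ≠ b) :
    ({a, b, z} : Finset (Pt d)).erase z = {a, b} := by
  ext w; simp; constructor
  · tauto
  · rintro (rfl | rfl)
    · exact ⟨h1.symm, Or.inl rfl⟩
    · exact ⟨h2.symm, Or.inr (Or.inl rfl)⟩

open Classical in
/-- corrector -/
noncomputable def Gc {d : ℕ} (c : ℝ) (A : Finset (Pt d)) : ℝ :=
  if Line A then 1 else if Con A then 2 - c / 2 else 2

lemma stp_sum_ne {d : ℕ} (k l : Stp d) (h : l ≠ opp k) : stp k + stp l ≠ 0 := by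
  intro h0
  apply h
  apply stp_inj
  rw [stp_opp]
  exact (neg_eq_of_add_eq_zero_right h0).symm

lemma stp_ne_two {d : ℕ} (l k : Stp d) : stp l ≠ stp k + stp k := by
  intro h
  have h1 := congrFun h k.1
  simp only [stp, Pi.add_apply, Pi.single_eq_same, Pi.single_apply] at h1
  split_ifs at h1 <;> omega

lemma Gc_drift {d : ℕ} (hd : 5 ≤ d) : ∃ c : ℝ, 0 < c ∧ c ≤ 1 ∧ ∀ A : Finset (Pt d), Shp A → ¬ Line A →
    EU A (fun x y => Gc c (mv A x y)) ≤ Gc c A - c^2/2 := by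
  have hd0 : 0 < d := by omega
  obtain ⟨c0, hc0, hc01, hesc⟩ := shp_esc hd
  have hdpos : (0:ℝ) < d := by exact_mod_cast hd0
  refine ⟨c0 / 3 * (1 / (2 * d : ℝ))^3, by positivity, ?_, ?_⟩
  · have h1 : (1 / (2 * d : ℝ)) ≤ 1 := by
      rw [div_le_one (by positivity)]
      have : (5:ℝ) ≤ d := by exact_mod_cast hd
      linarith
    have := pow_le_one₀ (n := 3) (by positivity : (0:ℝ) ≤ 1 / (2 * d : ℝ)) h1
    have h0 : 0 ≤ (1 / (2 * d : ℝ))^3 := by positivity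
    nlinarith
  set c := c0 / 3 * (1 / (2 * d : ℝ))^3 with hc
  have hcpos : 0 < c := by positivity
  have hq1 : (1 / (2 * d : ℝ))^3 ≤ 1 := by
    have h1 : (1 / (2 * d : ℝ)) ≤ 1 := by
      rw [div_le_one (by positivity)]
      have : (5:ℝ) ≤ d := by exact_mod_cast hd
      linarith
    exact pow_le_one₀ (by positivity) h1
  have hc3 : c ≤ c0 / 3 := by
    rw [hc]
    nlinarith
  have hc1 : c ≤ 1 := by linarith
  have hG2 : ∀ A : Finset (Pt d), Gc c A ≤ 2 := by
    intro A; unfold Gc; split_ifs <;> linarith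
  intro A hA hl
  obtain ⟨u, k, z, hAe, hz1, hz2⟩ := hA.nonline hl
  have h2 : EU A (fun x y => 2 - Gc c (mv A x y)) = 2 - EU A (fun x y => Gc c (mv A x y)) := by
    rw [EU_sub, EU_const hd hA.two_le]
  by_cases hcon : Con A
  · obtain ⟨o, k, l, hkl, hA2⟩ := id hcon
    have hlk : l ≠ opp k := by
      rintro rfl
      apply hl
      refine Or.inr ⟨o, k, ?_⟩
      rw [hA2, stp_opp]; ext w; simp; tauto
    have e1 : o + stp l ≠ o := by simp [stp_ne_zero]
    have e2 : o + stp l ≠ o + stp k := by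
      intro h; exact hkl (stp_inj (add_left_cancel h)).symm
    have herase : A.erase (o + stp l) = {o, o + stp k} := by rw [hA2, erase_third e1 e2]
    have hmem : o + stp l ∈ A := by rw [hA2]; simp
    have hmv : mv A (o + stp l) (o - stp k) = {o - stp k, o, o + stp k} := by
      unfold mv; rw [herase]
    have hp := move_lower hd0 (n := 3) (l := 2) hc0.le hA.card_le hmem (hesc A hA _ hmem)
      (y := o - stp k) ?_ ?_
    · have := EU_single hd0 (U := A) (f := fun x y => 2 - Gc c (mv A x y))
        (fun x y _ _ _ => by linarith [hG2 (mv A x y)]) (x := o + stp l) (y := o - stp k)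
        (by linarith [hG2 (mv A (o + stp l) (o - stp k))])
      rw [h2, hmv] at this
      have hG1 : Gc c ({o - stp k, o, o + stp k} : Finset (Pt d)) = 1 := by
        unfold Gc; rw [if_pos (show Line _ from Or.inr ⟨o, k, rfl⟩)]
      rw [hG1] at this
      have hGA : Gc c A = 2 - c / 2 := by unfold Gc; rw [if_neg hl, if_pos hcon]
      rw [hGA]
      have : c ≤ pHAT d A (o + stp l) (o - stp k) := by rw [hc]; exact_mod_cast hp
      nlinarith
    · rw [herase]
      refine ⟨opp k, ?_, opp l, ?_, ?_⟩
      · rw [stp_opp]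
        simp only [Finset.coe_insert, Finset.coe_singleton, Set.mem_insert_iff, Set.mem_singleton_iff, not_or]
        constructor
        · intro h
          apply hkl
          apply stp_inj
          have : stp l - stp k = 0 := by
            have h' : o + stp l + -stp k - o = 0 := by rw [h]; simp
            rw [← h']; abel
          exact (sub_eq_zero.1 this).symm
        · intro h
          apply stp_ne_two l k
          have h' : o + stp l + -stp k - o = stp k := by rw [h]; simp
          calc stp l = (o + stp l + -stp k - o) + stp k := by abel
            _ = _ := by rw [h']
      · rw [stp_opp, stp_opp]
        have he : o + stp l + -stp k + -stp l = o - stp k := by abel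
        rw [he]
        simp only [Finset.coe_insert, Finset.coe_singleton, Set.mem_insert_iff, Set.mem_singleton_iff, not_or]
        constructor
        · simp [stp_ne_zero]
        · intro h
          apply stp_ne_neg k
          have : o - stp k - o = o + stp k - o := by rw [h]
          simpa using this.symm
      · show _ = _
        rw [stp_opp, stp_opp]; abel
    · rw [herase]; exact mem_nbF.2 ⟨k, by simp⟩
  · have := EU_act hd hA.two_le (f := fun x y => 2 - Gc c (mv A x y)) (m := c / 2)
      (fun x y _ _ _ => by linarith [hG2 (mv A x y)]) (x := z) (by rw [hAe]; simp) ?_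
    · rw [h2] at this
      have hGA : Gc c A = 2 := by unfold Gc; rw [if_neg hl, if_neg hcon]
      have h3 : c ≤ esc d (↑A) z / capa d (↑A) := by
        have hcap := capa_pos hd (U := A) (Finset.card_pos.1 (by have := hA.two_le; omega))
        rw [le_div_iff₀ hcap]
        have h4 := capa_le hd0 A
        have h5 : (A.card : ℝ) ≤ 3 := by exact_mod_cast hA.card_le
        have h6 := hesc A hA z (by rw [hAe]; simp)
        nlinarith
      rw [hGA]
      nlinarith
    · intro y hy hy'
      rw [hAe, erase_third hz1 hz2] at hy hy'
      have hcm := con_attach hy hy'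
      have : mv A z y = insert y {u, u + stp k} := by unfold mv; rw [hAe, erase_third hz1 hz2]
      simp only [this]
      unfold Gc
      split_ifs <;> linarith

lemma Gc_bd {d : ℕ} {c : ℝ} (h0 : 0 ≤ c) (h1 : c ≤ 1) (A : Finset (Pt d)) : 1 ≤ Gc c A ∧ Gc c A ≤ 2 := by
  unfold Gc; split_ifs <;> constructor <;> linarith

open Classical in
/-- first hit of a line at time `t` -/
noncomputable def op {d : ℕ} : ℕ → (Finset (Pt d) → ℝ) → Finset (Pt d) → ℝ
  | 0, f, A => if Line A then f A else 0
  | t+1, f, A => if Line A then 0 else EU A (fun x y => op t f (mv A x y))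

open Classical in
/-- not yet hit -/
noncomputable def orem {d : ℕ} : ℕ → Finset (Pt d) → ℝ
  | 0, A => 1
  | t+1, A => if Line A then 0 else EU A (fun x y => orem t (mv A x y))

/-- reachability -/
def Rch {d : ℕ} : ℕ → Finset (Pt d) → Finset (Pt d) → Prop
  | 0, A, L => A = L
  | t+1, A, L => ∃ x y, x ∈ A ∧ y ∈ nbF (A.erase x) ∧ y ∉ A.erase x ∧ Rch t (mv A x y) L

lemma Rch.shp {d : ℕ} {t : ℕ} {A L : Finset (Pt d)} (h : Rch t A L) (hA : Shp A) : Shp L := by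
  induction t generalizing A with
  | zero => rw [Rch] at h; exact h ▸ hA
  | succ t ih => obtain ⟨x, y, a, b, c, h⟩ := h; exact ih h (hA.mv a b c)

lemma Rch.card {d : ℕ} {t : ℕ} {A L : Finset (Pt d)} (h : Rch t A L) : L.card = A.card := by
  induction t generalizing A with
  | zero => rw [Rch] at h; rw [h]
  | succ t ih => obtain ⟨x, y, a, b, c, h⟩ := h; rw [ih h, mv_card a c]

lemma norm_stp {d : ℕ} (k : Stp d) : ‖emb (stp k)‖ = 1 := by
  have := nsq_smul_stp k 1
  rw [one_smul, nsq_eq] at this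
  have h0 := norm_nonneg (emb (stp k))
  push_cast at this
  nlinarith

lemma Rch.near {d : ℕ} {t : ℕ} {A L : Finset (Pt d)} (h : Rch t A L) : ∀ x ∈ L, ∃ y ∈ A, ‖emb x - emb y‖ ≤ t := by
  induction t generalizing A with
  | zero => rw [Rch] at h; subst h; intro x hx; exact ⟨x, hx, by simp⟩
  | succ t ih =>
    obtain ⟨x, y, a, b, c, h⟩ := h
    intro w hw
    obtain ⟨z, hz, hwz⟩ := ih h w hw
    unfold mv at hz
    rw [Finset.mem_insert] at hz
    push_cast
    rcases hz with rfl | hz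
    · obtain ⟨k, hk⟩ := mem_nbF.1 b
      refine ⟨_, Finset.mem_of_mem_erase hk, ?_⟩
      calc ‖emb w - emb (z + stp k)‖ = ‖(emb w - emb z) - emb (stp k)‖ := by rw [emb_add]; congr 1; abel
        _ ≤ ‖emb w - emb z‖ + ‖emb (stp k)‖ := norm_sub_le _ _
        _ ≤ _ := by rw [norm_stp]; linarith
    · exact ⟨z, Finset.mem_of_mem_erase hz, by linarith⟩

lemma op_mono {d : ℕ} (hd : 0 < d) {f g : Finset (Pt d) → ℝ} {t : ℕ} {A : Finset (Pt d)}
    (h : ∀ L, Line L → Rch t A L → f L ≤ g L) : op t f A ≤ op t g A := by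
  induction t generalizing A with
  | zero => rw [op, op]; split_ifs with hl
            · exact h A hl rfl
            · rfl
  | succ t ih => rw [op, op]; split_ifs with hl
                 · rfl
                 · refine EU_mono hd fun x y a b c => ih fun L hL hr => h L hL ⟨x, y, a, b, c, hr⟩

lemma op_congr {d : ℕ} (hd : 0 < d) {f g : Finset (Pt d) → ℝ} {t : ℕ} {A : Finset (Pt d)}
    (h : ∀ L, Line L → Rch t A L → f L = g L) : op t f A = op t g A :=
  le_antisymm (op_mono hd fun L a b => (h L a b).le) (op_mono hd fun L a b => (h L a b).ge)

lemma op_add {d : ℕ} (f g : Finset (Pt d) → ℝ) (t : ℕ) (A : Finset (Pt d)) :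
    op t (fun L => f L + g L) A = op t f A + op t g A := by
  induction t generalizing A with
  | zero => simp only [op]; split_ifs <;> simp
  | succ t ih => simp only [op]; split_ifs
                 · simp
                 · simp_rw [ih]; rw [EU_add]

lemma op_mul {d : ℕ} (c : ℝ) (f : Finset (Pt d) → ℝ) (t : ℕ) (A : Finset (Pt d)) :
    op t (fun L => c * f L) A = c * op t f A := by
  induction t generalizing A with
  | zero => simp only [op]; split_ifs <;> simp
  | succ t ih => simp only [op]; split_ifs
                 · simp
                 · simp_rw [ih]; rw [EU_mul]

lemma op_zero {d : ℕ} (t : ℕ) (A : Finset (Pt d)) : op t (fun _ => 0) A = 0 := by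
  have := op_mul 0 (fun _ => 0) t A
  simpa using this

lemma op_sum {d : ℕ} {ι : Type*} (s : Finset ι) (f : ι → Finset (Pt d) → ℝ) (t : ℕ) (A : Finset (Pt d)) :
    op t (fun L => ∑ i ∈ s, f i L) A = ∑ i ∈ s, op t (f i) A := by
  classical
  induction s using Finset.induction_on with
  | empty => simp [op_zero]
  | insert a s ha ih => simp_rw [Finset.sum_insert ha]; rw [op_add, ih]

lemma op_EU {d : ℕ} (U : Finset (Pt d)) (f : Pt d → Pt d → Finset (Pt d) → ℝ) (t : ℕ) (A : Finset (Pt d)) :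
    op t (fun L => EU U (fun x y => f x y L)) A = EU U (fun x y => op t (f x y) A) := by
  unfold EU
  rw [op_sum]
  refine Finset.sum_congr rfl fun x _ => ?_
  rw [op_sum]
  refine Finset.sum_congr rfl fun y _ => ?_
  rw [op_mul]

lemma op_comm {d : ℕ} (f : Finset (Pt d) → Finset (Pt d) → ℝ) (t s : ℕ) (A B : Finset (Pt d)) :
    op t (fun L => op s (f L) B) A = op s (fun L' => op t (fun L => f L L') A) B := by
  induction t generalizing A with
  | zero =>
    simp only [op]
    split_ifs
    · rfl
    · rw [op_zero]
  | succ t ih =>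
    simp only [op]
    split_ifs
    · rw [op_zero]
    · simp_rw [ih]; rw [op_EU]

lemma op_nonneg {d : ℕ} (hd : 0 < d) {f : Finset (Pt d) → ℝ} {t : ℕ} {A : Finset (Pt d)}
    (h : ∀ L, Line L → Rch t A L → 0 ≤ f L) : 0 ≤ op t f A := by
  have := op_mono hd (f := fun _ => 0) h
  rwa [op_zero] at this

lemma op_sym {d : ℕ} (hd : 0 < d) (g : LS d) (f : Finset (Pt d) → ℝ) (t : ℕ) (A : Finset (Pt d)) :
    op t f (g.im A) = op t (fun L => f (g.im L)) A := by
  induction t generalizing A with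
  | zero =>
    simp only [op]
    by_cases hl : Line A
    · rw [if_pos hl, if_pos (hl.im g)]
    · rw [if_neg hl, if_neg (fun h => hl ((Line.im_iff g).1 h))]
  | succ t ih =>
    simp only [op]
    by_cases hl : Line A
    · rw [if_pos hl, if_pos (hl.im g)]
    · rw [if_neg hl, if_neg (fun h => hl ((Line.im_iff g).1 h)), EU_sym hd]
      simp_rw [LS.im_mv, ih]

lemma op_orem {d : ℕ} (hd : 5 ≤ d) (T : ℕ) {A : Finset (Pt d)} (hA : Shp A) :
    ∑ t ∈ Finset.range T, op t (fun _ => 1) A + orem T A = 1 := by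
  induction T generalizing A with
  | zero => simp [orem]
  | succ T ih =>
    rw [Finset.sum_range_succ']
    simp only [op, orem]
    split_ifs with hl
    · simp
    · have : ∑ t ∈ Finset.range T, EU A (fun x y => op t (fun _ => 1) (mv A x y)) =
          EU A (fun x y => ∑ t ∈ Finset.range T, op t (fun _ => 1) (mv A x y)) := by
        unfold EU
        rw [Finset.sum_comm]
        refine Finset.sum_congr rfl fun x _ => ?_
        rw [Finset.sum_comm]
        refine Finset.sum_congr rfl fun y _ => ?_
        rw [Finset.mul_sum]
      rw [this, add_zero, ← EU_add]
      refine Eq.trans ?_ (EU_const hd hA.two_le 1)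
      exact EU_congr (by omega) fun x y a b c => ih (hA.mv a b c)

lemma chain_decay {d : ℕ} (hd : 5 ≤ d) : ∃ γ : ℝ, 0 < γ ∧ γ < 1 ∧ ∀ A : Finset (Pt d), Shp A → ∀ t,
    op t (fun _ => 1) A ≤ 2 * γ^t ∧ orem t A ≤ 2 * γ^t := by
  have hd0 : 0 < d := by omega
  obtain ⟨c, hc0, hc1, h⟩ := Gc_drift hd
  have hG := Gc_bd (d := d) hc0.le hc1
  have hg0 : 0 < 1 - c^2/4 := by nlinarith
  refine ⟨1 - c^2/4, hg0, by nlinarith, ?_⟩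
  have key : ∀ t (A : Finset (Pt d)), Shp A → op t (fun _ => 1) A ≤ (1 - c^2/4)^t * Gc c A ∧
      orem t A ≤ (1 - c^2/4)^t * Gc c A := by
    intro t
    induction t with
    | zero =>
      intro A hA
      have := (hG A).1
      simp only [op, orem, pow_zero, one_mul]
      constructor
      · split_ifs <;> linarith
      · exact this
    | succ t ih =>
      intro A hA
      simp only [op, orem]
      have hp : 0 ≤ (1 - c^2/4)^(t+1) * Gc c A := mul_nonneg (by positivity) (by linarith [(hG A).1])
      by_cases hl : Line A
      · simp only [if_pos hl]; exact ⟨hp, hp⟩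
      · simp only [if_neg hl]
        have h1 : EU A (fun x y => (1 - c^2/4)^t * Gc c (mv A x y)) ≤ (1 - c^2/4)^(t+1) * Gc c A := by
          rw [EU_mul, pow_succ (1 - c^2/4) t, mul_assoc]
          refine mul_le_mul_of_nonneg_left ((h A hA hl).trans ?_) (by positivity)
          nlinarith [(hG A).2]
        exact ⟨(EU_mono hd0 fun x y a b e => (ih _ (hA.mv a b e)).1).trans h1,
          (EU_mono hd0 fun x y a b e => (ih _ (hA.mv a b e)).2).trans h1⟩
  intro A hA t
  have h0 : 0 ≤ (1 - c^2/4)^t := by positivity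
  have := (hG A).2
  exact ⟨(key t A hA).1.trans (by nlinarith), (key t A hA).2.trans (by nlinarith)⟩

/-! ### Expectations at the first line -/

/-- expectation at the first line -/
noncomputable def R {d : ℕ} (f : Finset (Pt d) → ℝ) (A : Finset (Pt d)) : ℝ := ∑' t, op t f A

/-- polynomially bounded along the chain -/
def BB {d : ℕ} (A : Finset (Pt d)) (f : Finset (Pt d) → ℝ) : Prop :=
  ∃ (K : ℝ) (q : ℕ), 0 ≤ K ∧ ∀ t L, Line L → Rch t A L → |f L| ≤ K * ((1:ℝ) + t)^q

lemma op_abs {d : ℕ} (hd : 0 < d) {f : Finset (Pt d) → ℝ} {t : ℕ} {A : Finset (Pt d)} {K : ℝ}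
    (h : ∀ L, Line L → Rch t A L → |f L| ≤ K) : |op t f A| ≤ K * op t (fun _ => 1) A := by
  rw [abs_le, ← op_mul, ← neg_one_mul, ← op_mul]
  constructor
  · refine op_mono hd fun L a b => ?_
    have := (abs_le.1 (h L a b)).1; linarith
  · refine op_mono hd fun L a b => ?_
    have := (abs_le.1 (h L a b)).2; linarith

lemma summable_poly_geom {γ : ℝ} (h0 : 0 < γ) (h1 : γ < 1) (q : ℕ) :
    Summable (fun t : ℕ => ((1:ℝ) + t)^q * γ^t) := by
  have h := summable_pow_mul_geometric_of_norm_lt_one (R := ℝ) q (r := γ) (by rw [Real.norm_eq_abs, abs_of_pos h0]; exact h1)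
  have h2 := ((summable_nat_add_iff 1).2 h).mul_left γ⁻¹
  refine h2.congr fun t => ?_
  push_cast
  rw [pow_succ]
  field_simp
  ring

lemma R_bound {d : ℕ} (hd : 5 ≤ d) (q : ℕ) : ∃ C : ℝ, 1 ≤ C ∧ ∀ (A : Finset (Pt d)) (f : Finset (Pt d) → ℝ) (K : ℝ),
    Shp A → 0 ≤ K → (∀ t L, Line L → Rch t A L → |f L| ≤ K * ((1:ℝ) + t)^q) →
    Summable (fun t => op t f A) ∧ |R f A| ≤ K * C := by
  obtain ⟨γ, h0, h1, h⟩ := chain_decay hd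
  have hs := summable_poly_geom h0 h1 q
  have hnn : ∀ t : ℕ, 0 ≤ ((1:ℝ) + t)^q * γ^t := fun t => by positivity
  refine ⟨2 * (∑' t : ℕ, ((1:ℝ) + t)^q * γ^t) + 1, by
    have : 0 ≤ ∑' t : ℕ, ((1:ℝ) + t)^q * γ^t := tsum_nonneg hnn
    linarith, ?_⟩
  intro A f K hA hK hf
  have hb : ∀ t, ‖op t f A‖ ≤ (K * 2) * (((1:ℝ) + t)^q * γ^t) := by
    intro t
    rw [Real.norm_eq_abs]
    refine (op_abs (by omega) (hf t)).trans ?_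
    have := (h A hA t).1
    calc _ ≤ K * ((1:ℝ) + t)^q * (2 * γ^t) := by gcongr
      _ = _ := by ring
  have hs2 := hs.mul_left (K * 2)
  refine ⟨Summable.of_norm_bounded hs2 hb, ?_⟩
  have := tsum_of_norm_bounded hs2.hasSum hb
  rw [Real.norm_eq_abs] at this
  rw [tsum_mul_left] at this
  unfold R
  nlinarith

lemma BB.summable {d : ℕ} (hd : 5 ≤ d) {A : Finset (Pt d)} (hA : Shp A) {f : Finset (Pt d) → ℝ} (h : BB A f) :
    Summable (fun t => op t f A) := by
  obtain ⟨K, q, hK, h⟩ := h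
  obtain ⟨C, _, hC⟩ := R_bound hd q
  exact (hC A f K hA hK h).1

lemma BB.mv {d : ℕ} {A : Finset (Pt d)} {f : Finset (Pt d) → ℝ} (h : BB A f) {x y : Pt d} (hx : x ∈ A)
    (hy : y ∈ nbF (A.erase x)) (hy' : y ∉ A.erase x) : BB (mv A x y) f := by
  obtain ⟨K, q, hK, h⟩ := h
  refine ⟨K * 2^q, q, by positivity, fun t L hL hr => (h (t+1) L hL ⟨x, y, hx, hy, hy', hr⟩).trans ?_⟩
  rw [mul_assoc, ← mul_pow]
  have : (0:ℝ) ≤ t := by positivity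
  gcongr
  push_cast; linarith

lemma BB.of_bdd {d : ℕ} {A : Finset (Pt d)} {f : Finset (Pt d) → ℝ} {K : ℝ} (h : ∀ L, Line L → |f L| ≤ K) : BB A f := by
  refine ⟨|K|, 0, abs_nonneg _, fun t L hL _ => ?_⟩
  rw [pow_zero, mul_one]
  exact (h L hL).trans (le_abs_self K)

lemma BB.add {d : ℕ} {A : Finset (Pt d)} {f g : Finset (Pt d) → ℝ} (hf : BB A f) (hg : BB A g) :
    BB A (fun L => f L + g L) := by
  obtain ⟨K, q, hK, h⟩ := hf
  obtain ⟨K', q', hK', h'⟩ := hg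
  refine ⟨K + K', max q q', by positivity, fun t L hL hr => ?_⟩
  have e : (1:ℝ) ≤ 1 + t := by simp
  have h1 : ((1:ℝ)+t)^q ≤ (1+t)^(max q q') := pow_le_pow_right₀ e (le_max_left _ _)
  have h2 : ((1:ℝ)+t)^q' ≤ (1+t)^(max q q') := pow_le_pow_right₀ e (le_max_right _ _)
  calc |f L + g L| ≤ |f L| + |g L| := abs_add_le _ _
    _ ≤ K * (1+t)^q + K' * (1+t)^q' := add_le_add (h t L hL hr) (h' t L hL hr)
    _ ≤ K * (1+t)^(max q q') + K' * (1+t)^(max q q') := by gcongr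
    _ = _ := by ring

lemma BB.mul {d : ℕ} {A : Finset (Pt d)} {f g : Finset (Pt d) → ℝ} (hf : BB A f) (hg : BB A g) :
    BB A (fun L => f L * g L) := by
  obtain ⟨K, q, hK, h⟩ := hf
  obtain ⟨K', q', hK', h'⟩ := hg
  refine ⟨K * K', q + q', by positivity, fun t L hL hr => ?_⟩
  rw [abs_mul, pow_add]
  calc |f L| * |g L| ≤ (K * (1+t)^q) * (K' * (1+t)^q') := by
        gcongr
        · exact h t L hL hr
        · exact h' t L hL hr
    _ = _ := by ring

lemma BB.const {d : ℕ} {A : Finset (Pt d)} (c : ℝ) : BB A (fun _ => c) := BB.of_bdd (K := |c|) fun _ _ => le_rfl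

lemma BB.neg {d : ℕ} {A : Finset (Pt d)} {f : Finset (Pt d) → ℝ} (hf : BB A f) : BB A (fun L => - f L) := by
  obtain ⟨K, q, hK, h⟩ := hf
  exact ⟨K, q, hK, fun t L a b => by rw [abs_neg]; exact h t L a b⟩

lemma BB.sub {d : ℕ} {A : Finset (Pt d)} {f g : Finset (Pt d) → ℝ} (hf : BB A f) (hg : BB A g) :
    BB A (fun L => f L - g L) := by
  simp_rw [sub_eq_add_neg]; exact hf.add hg.neg

lemma BB.sum {d : ℕ} {A : Finset (Pt d)} {ι : Type*} (s : Finset ι) (f : ι → Finset (Pt d) → ℝ)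
    (hf : ∀ i, BB A (f i)) : BB A (fun L => ∑ i ∈ s, f i L) := by
  classical
  induction s using Finset.induction_on with
  | empty => simpa using BB.const 0
  | insert a s ha ih => simp_rw [Finset.sum_insert ha]; exact (hf a).add ih

lemma R_line {d : ℕ} {A : Finset (Pt d)} (hA : Line A) (f : Finset (Pt d) → ℝ) : R f A = f A := by
  unfold R
  rw [tsum_eq_single 0]
  · rw [op, if_pos hA]
  · intro t ht
    obtain ⟨s, rfl⟩ := Nat.exists_eq_succ_of_ne_zero ht
    rw [op, if_pos hA]

lemma tsum_EU {d : ℕ} (hd : 0 < d) (A : Finset (Pt d)) (f : ℕ → Pt d → Pt d → ℝ)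
    (h : ∀ x y, x ∈ A → y ∈ nbF (A.erase x) → y ∉ A.erase x → Summable (fun t => f t x y)) :
    ∑' t, EU A (f t) = EU A (fun x y => ∑' t, f t x y) := by
  have hs : ∀ x y, Summable (fun t => pHAT d A x y * f t x y) := by
    intro x y
    by_cases h0 : pHAT d A x y = 0
    · simp [h0, summable_zero]
    · obtain ⟨a, b, c⟩ := pHAT_ne_zero hd h0
      exact (h x y a b c).mul_left _
  unfold EU
  rw [Summable.tsum_finsetSum fun x _ => summable_sum fun y _ => hs x y]
  refine Finset.sum_congr rfl fun x _ => ?_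
  rw [Summable.tsum_finsetSum fun y _ => hs x y]
  refine Finset.sum_congr rfl fun y _ => ?_
  rw [tsum_mul_left]

lemma R_step {d : ℕ} (hd : 5 ≤ d) {A : Finset (Pt d)} (hA : Shp A) (hl : ¬ Line A) {f : Finset (Pt d) → ℝ}
    (hf : BB A f) : R f A = EU A (fun x y => R f (mv A x y)) := by
  unfold R
  rw [(hf.summable hd hA).tsum_eq_zero_add]
  simp only [op, if_neg hl, zero_add]
  rw [tsum_EU (by omega)]
  intro x y a b c
  exact (hf.mv a b c).summable hd (hA.mv a b c)

lemma R_mono {d : ℕ} (hd : 5 ≤ d) {A : Finset (Pt d)} (hA : Shp A) {f g : Finset (Pt d) → ℝ}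
    (hf : BB A f) (hg : BB A g) (h : ∀ t L, Line L → Rch t A L → f L ≤ g L) : R f A ≤ R g A :=
  (hf.summable hd hA).tsum_le_tsum (fun t => op_mono (by omega) fun L a b => h t L a b) (hg.summable hd hA)

lemma R_congr {d : ℕ} (hd : 0 < d) {A : Finset (Pt d)} {f g : Finset (Pt d) → ℝ}
    (h : ∀ t L, Line L → Rch t A L → f L = g L) : R f A = R g A :=
  tsum_congr fun t => op_congr hd fun L a b => h t L a b

lemma R_add {d : ℕ} (hd : 5 ≤ d) {A : Finset (Pt d)} (hA : Shp A) {f g : Finset (Pt d) → ℝ}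
    (hf : BB A f) (hg : BB A g) : R (fun L => f L + g L) A = R f A + R g A := by
  unfold R
  simp_rw [op_add]
  exact (hf.summable hd hA).tsum_add (hg.summable hd hA)

lemma R_mul {d : ℕ} (c : ℝ) (A : Finset (Pt d)) (f : Finset (Pt d) → ℝ) :
    R (fun L => c * f L) A = c * R f A := by
  unfold R
  simp_rw [op_mul]
  exact tsum_mul_left

lemma R_sum {d : ℕ} (hd : 5 ≤ d) {A : Finset (Pt d)} (hA : Shp A) {ι : Type*} (s : Finset ι)
    (f : ι → Finset (Pt d) → ℝ) (hf : ∀ i, BB A (f i)) :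
    R (fun L => ∑ i ∈ s, f i L) A = ∑ i ∈ s, R (f i) A := by
  unfold R
  simp_rw [op_sum]
  exact Summable.tsum_finsetSum fun i _ => (hf i).summable hd hA

lemma R_one {d : ℕ} (hd : 5 ≤ d) {A : Finset (Pt d)} (hA : Shp A) : R (fun _ => 1) A = 1 := by
  obtain ⟨γ, h0, h1, h⟩ := chain_decay hd
  have hs := ((BB.const (A := A) 1).summable hd hA).hasSum.tendsto_sum_nat
  have hz : Filter.Tendsto (fun T => orem T A) Filter.atTop (nhds 0) := by
    have hnn : ∀ T (A : Finset (Pt d)), 0 ≤ orem T A := by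
      intro T
      induction T with
      | zero => intro A; simp [orem]
      | succ T ih =>
        intro A
        rw [orem]
        split_ifs
        · rfl
        · exact EU_nonneg (by omega) fun x y _ _ _ => ih _
    refine squeeze_zero (fun T => hnn T A) (fun T => (h A hA T).2) ?_
    have := (tendsto_pow_atTop_nhds_zero_of_lt_one h0.le h1).const_mul 2
    simpa using this
  have h2 := hs.add hz
  have h3 : (fun T => ∑ t ∈ Finset.range T, op t (fun _ => (1:ℝ)) A + orem T A) = fun _ => 1 :=
    funext fun T => op_orem hd T hA
  rw [h3, add_zero] at h2
  exact tendsto_nhds_unique h2 tendsto_const_nhds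

lemma R_const {d : ℕ} (hd : 5 ≤ d) {A : Finset (Pt d)} (hA : Shp A) (c : ℝ) : R (fun _ => c) A = c := by
  have := R_mul c A (fun _ => 1)
  rw [R_one hd hA, mul_one] at this
  simpa using this

lemma R_sym {d : ℕ} (hd : 0 < d) (g : LS d) (f : Finset (Pt d) → ℝ) (A : Finset (Pt d)) :
    R f (g.im A) = R (fun L => f (g.im L)) A := by
  unfold R; simp_rw [op_sym hd]

lemma R_nonneg {d : ℕ} (hd : 0 < d) {A : Finset (Pt d)} {f : Finset (Pt d) → ℝ}
    (h : ∀ t L, Line L → Rch t A L → 0 ≤ f L) : 0 ≤ R f A :=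
  tsum_nonneg fun t => op_nonneg hd fun L a b => h t L a b

lemma R_comm {d : ℕ} (hd : 5 ≤ d) {A B : Finset (Pt d)} (hA : Shp A) (hB : Shp B)
    {f : Finset (Pt d) → Finset (Pt d) → ℝ} (hf : ∀ L L', 0 ≤ f L L' ∧ f L L' ≤ 1) :
    R (fun L => R (f L) B) A = R (fun L' => R (fun L => f L L') A) B := by
  have hd0 : 0 < d := by omega
  obtain ⟨γ, h0, h1, h⟩ := chain_decay hd
  have hab : ∀ L L', |f L L'| ≤ 1 := fun L L' => abs_le.2 ⟨by linarith [(hf L L').1], (hf L L').2⟩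
  have key : ∀ (A B : Finset (Pt d)) (hA : Shp A) (hB : Shp B) (f : Finset (Pt d) → Finset (Pt d) → ℝ)
      (hab : ∀ L L', |f L L'| ≤ 1) (t : ℕ),
      op t (fun L => R (f L) B) A = ∑' s, op t (fun L => op s (f L) B) A := by
    intro A B hA hB f hab t
    induction t generalizing A with
    | zero =>
      simp only [op]
      split_ifs
      · rfl
      · simp
    | succ t ih =>
      simp only [op]
      split_ifs
      · simp
      · rw [tsum_EU hd0]
        · exact EU_congr hd0 fun x y a b c => ih _ (hA.mv a b c)
        · intro x y a b c
          refine Summable.of_norm_bounded ((summable_poly_geom h0 h1 0).mul_left 4) fun s => ?_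
          rw [Real.norm_eq_abs]
          have h2 : ∀ L, Line L → Rch t (mv A x y) L → |op s (f L) B| ≤ 2 * γ^s := fun L _ _ =>
            (op_abs hd0 (fun L' _ _ => hab L L')).trans (by rw [one_mul]; exact (h B hB s).1)
          refine (op_abs hd0 h2).trans ?_
          have h3 := (h _ (hA.mv a b c) t).1
          have h4 : γ^t ≤ 1 := pow_le_one₀ h0.le h1.le
          have h5 : 0 < γ^s := by positivity
          rw [pow_zero, one_mul]
          nlinarith
  have e1 : R (fun L => R (f L) B) A = ∑' t, ∑' s, op t (fun L => op s (f L) B) A :=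
    tsum_congr fun t => key A B hA hB f hab t
  have e2 : R (fun L' => R (fun L => f L L') A) B = ∑' s, ∑' t, op s (fun L' => op t (fun L => f L L') A) B :=
    tsum_congr fun t => key B A hB hA (fun L' L => f L L') (fun L L' => hab L' L) t
  rw [e1, e2]
  simp_rw [op_comm f]
  refine Summable.tsum_comm ?_
  have hg : Summable (fun t : ℕ => 2 * γ^t) := (summable_geometric_of_lt_one h0.le h1).mul_left 2
  have hprod := hg.mul_of_nonneg hg (fun t => by positivity) (fun t => by positivity)
  refine Summable.of_norm_bounded hprod fun p => ?_
  rcases p with ⟨t, s⟩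
  simp only [Function.uncurry]
  rw [Real.norm_eq_abs]
  have h2 : ∀ L', Line L' → Rch t B L' → |op s (fun L => f L L') A| ≤ 2 * γ^s := fun L' _ _ =>
    (op_abs hd0 (fun L _ _ => hab L L')).trans (by rw [one_mul]; exact (h A hA s).1)
  refine (op_abs hd0 h2).trans ?_
  have h3 := (h B hB t).1
  have h5 : 0 < γ^s := by positivity
  nlinarith

/-- expectation at the first line after one step -/
noncomputable def Rp {d : ℕ} (f : Finset (Pt d) → ℝ) (A : Finset (Pt d)) : ℝ := EU A (fun x y => R f (mv A x y))

lemma Rp_sym {d : ℕ} (hd : 0 < d) (g : LS d) (f : Finset (Pt d) → ℝ) (A : Finset (Pt d)) :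
    Rp f (g.im A) = Rp (fun L => f (g.im L)) A := by
  unfold Rp; rw [EU_sym hd]; simp_rw [LS.im_mv, R_sym hd]

lemma Rp_mono {d : ℕ} (hd : 5 ≤ d) {A : Finset (Pt d)} (hA : Shp A) {f g : Finset (Pt d) → ℝ}
    (hf : BB A f) (hg : BB A g) (h : ∀ t L, Line L → Rch (t+1) A L → f L ≤ g L) : Rp f A ≤ Rp g A :=
  EU_mono (by omega) fun x y a b c => R_mono hd (hA.mv a b c) (hf.mv a b c) (hg.mv a b c)
    fun t L hL hr => h t L hL ⟨x, y, a, b, c, hr⟩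

lemma Rp_congr {d : ℕ} (hd : 0 < d) {A : Finset (Pt d)} {f g : Finset (Pt d) → ℝ}
    (h : ∀ t L, Line L → Rch (t+1) A L → f L = g L) : Rp f A = Rp g A :=
  EU_congr hd fun x y a b c => R_congr hd fun t L hL hr => h t L hL ⟨x, y, a, b, c, hr⟩

lemma Rp_add {d : ℕ} (hd : 5 ≤ d) {A : Finset (Pt d)} (hA : Shp A) {f g : Finset (Pt d) → ℝ}
    (hf : BB A f) (hg : BB A g) : Rp (fun L => f L + g L) A = Rp f A + Rp g A := by
  unfold Rp
  rw [← EU_add]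
  exact EU_congr (by omega) fun x y a b c => R_add hd (hA.mv a b c) (hf.mv a b c) (hg.mv a b c)

lemma Rp_mul {d : ℕ} (c : ℝ) (A : Finset (Pt d)) (f : Finset (Pt d) → ℝ) :
    Rp (fun L => c * f L) A = c * Rp f A := by
  unfold Rp; simp_rw [R_mul]; rw [EU_mul]

lemma Rp_sum {d : ℕ} (hd : 5 ≤ d) {A : Finset (Pt d)} (hA : Shp A) {ι : Type*} (s : Finset ι)
    (f : ι → Finset (Pt d) → ℝ) (hf : ∀ i, BB A (f i)) :
    Rp (fun L => ∑ i ∈ s, f i L) A = ∑ i ∈ s, Rp (f i) A := by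
  classical
  induction s using Finset.induction_on with
  | empty => simp only [Finset.sum_empty]; have := Rp_mul 0 A (fun _ => 0); simpa using this
  | insert a s ha ih =>
    simp_rw [Finset.sum_insert ha]
    rw [Rp_add hd hA (hf a) (BB.sum s f hf), ih]

lemma Rp_const {d : ℕ} (hd : 5 ≤ d) {A : Finset (Pt d)} (hA : Shp A) (c : ℝ) : Rp (fun _ => c) A = c := by
  unfold Rp
  rw [← EU_const hd hA.two_le c]
  refine EU_congr (by omega) fun x y a b e => ?_
  rw [EU_const hd hA.two_le c, R_const hd (hA.mv a b e)]

lemma Rp_bound {d : ℕ} (hd : 5 ≤ d) (q : ℕ) : ∃ C : ℝ, 1 ≤ C ∧ ∀ (A : Finset (Pt d)) (f : Finset (Pt d) → ℝ) (K : ℝ),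
    Shp A → 0 ≤ K → (∀ t L, Line L → Rch (t+1) A L → |f L| ≤ K * ((1:ℝ) + t)^q) → |Rp f A| ≤ K * C := by
  obtain ⟨C, h1, h⟩ := R_bound hd q
  refine ⟨C, h1, fun A f K hA hK hf => ?_⟩
  have key : ∀ x y, x ∈ A → y ∈ nbF (A.erase x) → y ∉ A.erase x → |R f (mv A x y)| ≤ K * C :=
    fun x y a b c => (h _ f K (hA.mv a b c) hK fun t L hL hr => hf t L hL ⟨x, y, a, b, c, hr⟩).2
  unfold Rp
  rw [abs_le]
  constructor
  · refine (EU_const hd hA.two_le (-(K*C))).symm.le.trans (EU_mono (by omega) fun x y a b c => (abs_le.1 (key x y a b c)).1)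
  · refine (EU_mono (by omega) fun x y a b c => (abs_le.1 (key x y a b c)).2).trans (EU_const hd hA.two_le (K*C)).le

/-- the real space -/
abbrev Eu (d : ℕ) := EuclideanSpace ℝ (Fin d)

/-- the basic potential -/
noncomputable def FF {d : ℕ} (x : Eu d) : ℝ := 1 / Real.sqrt (1 + ‖x‖^2)

lemma FF_pos {d : ℕ} (x : Eu d) : 0 < FF x := by
  unfold FF; positivity

lemma FF_le_one {d : ℕ} (x : Eu d) : FF x ≤ 1 := by
  unfold FF
  rw [div_le_one (by positivity)]
  rw [Real.one_le_sqrt]; nlinarith [sq_nonneg ‖x‖]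

lemma FF_sq {d : ℕ} (x : Eu d) : (FF x)^2 * (1 + ‖x‖^2) = 1 := by
  unfold FF
  rw [div_pow, Real.sq_sqrt (by positivity)]
  field_simp

lemma FF_neg {d : ℕ} (x : Eu d) : FF (-x) = FF x := by unfold FF; rw [norm_neg]

lemma FF_norm_le {d : ℕ} (x : Eu d) : ‖x‖ * FF x ≤ 1 := by
  have h := FF_sq x
  have h0 := FF_pos x
  have h1 := norm_nonneg x
  have : (‖x‖ * FF x)^2 ≤ 1 := by nlinarith [sq_nonneg (FF x)]
  nlinarith [mul_nonneg h1 h0.le]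

lemma FF_le_inv {d : ℕ} (x : Eu d) {r : ℝ} (hr : 0 < r) (h : r ≤ ‖x‖) : FF x ≤ 1 / r := by
  rw [le_div_iff₀ hr]
  have := FF_norm_le x
  have := FF_pos x
  nlinarith

lemma FF_ge_inv {d : ℕ} (x : Eu d) : 1 / (1 + ‖x‖) ≤ FF x := by
  unfold FF
  apply one_div_le_one_div_of_le (by positivity)
  rw [Real.sqrt_le_left (by positivity)]
  nlinarith [norm_nonneg x]

lemma FF_eq_of_norm {d : ℕ} {x y : Eu d} (h : ‖x‖ = ‖y‖) : FF x = FF y := by unfold FF; rw [h]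

lemma taylor_aux (u : ℝ) (hu : 0 < u) :
    |1/u - (1 - (u^2-1)/2 + 3*(u^2-1)^2/8)| ≤ |u^2-1|^3 / u := by
  have h : 1/u - (1 - (u^2-1)/2 + 3*(u^2-1)^2/8) = -((u^2-1)^3 / u * ((3*u^2+9*u+8) / (8*(u+1)^3))) := by
    field_simp
    ring
  rw [h, abs_neg, abs_mul, abs_div, abs_pow, abs_of_pos hu]
  have h2 : |(3*u^2+9*u+8) / (8*(u+1)^3)| ≤ 1 := by
    rw [abs_of_pos (by positivity), div_le_one (by positivity)]
    nlinarith [pow_pos hu 2, pow_pos hu 3]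
  have h3 : 0 ≤ |u^2-1|^3 / u := by positivity
  nlinarith

/-- basic ratio data -/
lemma ratio_data {d : ℕ} (x D : Eu d) : ∃ u : ℝ, 0 < u ∧ FF (x + D) = FF x / u ∧
    u^2 - 1 = (FF x)^2 * (2 * inner ℝ x D + ‖D‖^2) ∧ 1/u ≤ 2 * (1 + ‖D‖) ∧ |u^2-1| ≤ FF x * (1+‖D‖)^2 := by
  have hF := FF_pos x
  have hF1 := FF_le_one x
  have hF' := FF_pos (x+D)
  have hs := FF_sq x
  have hs' := FF_sq (x+D)
  have hn := norm_add_sq_real x D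
  have hD := norm_nonneg D
  have hu : (FF x / FF (x+D))^2 = FF x^2 * (1 + ‖x+D‖^2) := by
    rw [div_pow, div_eq_iff (by positivity), mul_assoc, mul_comm (1 + ‖x+D‖^2), hs', mul_one]
  have hu2 : (FF x / FF (x+D))^2 - 1 = (FF x)^2 * (2 * inner ℝ x D + ‖D‖^2) := by
    rw [hu, hn]; linarith
  refine ⟨FF x / FF (x+D), by positivity, by field_simp, hu2, ?_, ?_⟩
  · rw [one_div_div, div_le_iff₀ hF]
    have hx : ‖x‖ ≤ ‖x + D‖ + ‖D‖ := by
      have := norm_sub_le (x+D) D; simpa using this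
    have h1 : FF (x+D)^2 ≤ (2*(1+‖D‖)*FF x)^2 := by
      have h2 : 1 + ‖x‖^2 ≤ 4*(1+‖D‖)^2*(1+‖x+D‖^2) := by
        nlinarith [norm_nonneg x, norm_nonneg (x+D), sq_nonneg (‖x+D‖ - ‖D‖), mul_nonneg hD (sq_nonneg ‖x+D‖), mul_nonneg (sq_nonneg ‖D‖) (sq_nonneg ‖x+D‖)]
      have h3 : FF (x+D)^2 * FF x^2 * (1+‖x‖^2) ≤ FF (x+D)^2 * FF x^2 * (4*(1+‖D‖)^2*(1+‖x+D‖^2)) :=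
        mul_le_mul_of_nonneg_left h2 (by positivity)
      nlinarith
    exact abs_le_of_sq_le_sq' h1 (by positivity) |>.2
  · rw [hu2]
    have hi := abs_real_inner_le_norm x D
    have hxF := FF_norm_le x
    rw [abs_mul, abs_of_pos (by positivity : 0 < FF x^2)]
    have h4 : |2 * inner ℝ x D + ‖D‖^2| ≤ 2 * (‖x‖ * ‖D‖) + ‖D‖^2 := by
      refine (abs_add_le _ _).trans ?_
      rw [abs_mul, abs_of_pos (by norm_num : (0:ℝ) < 2), abs_of_nonneg (sq_nonneg ‖D‖)]
      linarith
    have h5 : FF x * (2 * (‖x‖ * ‖D‖) + ‖D‖^2) ≤ (1+‖D‖)^2 := by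
      nlinarith [mul_le_mul_of_nonneg_right hxF hD, mul_le_mul_of_nonneg_right hF1 (sq_nonneg ‖D‖)]
    calc FF x^2 * |2 * inner ℝ x D + ‖D‖^2| ≤ FF x * (FF x * (2 * (‖x‖ * ‖D‖) + ‖D‖^2)) := by
          rw [sq, mul_assoc]; gcongr
      _ ≤ _ := by gcongr

lemma FF_peetre {d : ℕ} (x D : Eu d) : FF (x + D) ≤ 2 * (1+‖D‖) * FF x := by
  obtain ⟨u, hu, h1, h2, h3, h4⟩ := ratio_data x D
  rw [h1, div_eq_mul_one_div, mul_comm]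
  exact mul_le_mul_of_nonneg_right h3 (FF_pos x).le

lemma FF_peetre' {d : ℕ} (x y : Eu d) : FF x ≤ 2 * (1+‖x - y‖) * FF y := by
  have := FF_peetre y (x - y)
  rwa [add_sub_cancel] at this

lemma FF_diff {d : ℕ} (x D : Eu d) : |FF (x + D) - FF x| ≤ 2 * (1+‖D‖)^3 * FF x^2 := by
  obtain ⟨u, hu, h1, h2, h3, h4⟩ := ratio_data x D
  have hF := FF_pos x
  have h5 : FF (x+D) - FF x = FF x * (1 - u) * (1/u) := by rw [h1]; field_simp
  have h6 : |1 - u| ≤ |u^2-1| := by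
    have : |u^2-1| = |1-u| * (1+u) := by
      rw [← abs_of_pos (by linarith : 0 < 1 + u), ← abs_mul, abs_sub_comm]; congr 1; ring
    rw [this]; nlinarith [abs_nonneg (1-u)]
  rw [h5, abs_mul, abs_mul, abs_of_pos hF, abs_of_pos (by positivity : 0 < 1/u)]
  calc FF x * |1-u| * (1/u) ≤ FF x * (FF x * (1+‖D‖)^2) * (2*(1+‖D‖)) := by
        gcongr; exact h6.trans h4
    _ = _ := by ring

lemma FF_diff3 {d : ℕ} (x D : Eu d) : |FF (x + D)^3 - FF x^3| ≤ 24 * (1+‖D‖)^5 * FF x^4 := by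
  have h1 := FF_diff x D
  have h2 := FF_peetre x D
  have hF := FF_pos x
  have hF' := FF_pos (x+D)
  have hD := norm_nonneg D
  have h3 : FF (x + D)^3 - FF x^3 = (FF (x+D) - FF x) * (FF (x+D)^2 + FF (x+D) * FF x + FF x^2) := by ring
  rw [h3, abs_mul, abs_of_pos (by positivity : 0 < FF (x+D)^2 + FF (x+D) * FF x + FF x^2)]
  have h4 : FF x ≤ 2 * (1+‖D‖) * FF x := by nlinarith
  have h5 : FF (x+D)^2 + FF (x+D) * FF x + FF x^2 ≤ 3 * (2 * (1+‖D‖) * FF x)^2 := by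
    nlinarith [mul_le_mul h2 h2 hF'.le (by positivity), mul_le_mul h2 h4 hF.le (by positivity), mul_le_mul h4 h4 hF.le (by positivity)]
  calc |FF (x+D) - FF x| * (FF (x+D)^2 + FF (x+D) * FF x + FF x^2)
      ≤ (2 * (1+‖D‖)^3 * FF x^2) * (3 * (2 * (1+‖D‖) * FF x)^2) := by gcongr
    _ = _ := by ring

lemma FF_taylor {d : ℕ} (x D : Eu d) :
    |FF (x + D) - (FF x - FF x^3 * inner ℝ x D - FF x^3 * ‖D‖^2 / 2 + 3/2 * FF x^5 * (inner ℝ x D)^2)|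
      ≤ 4 * (1+‖D‖)^7 * FF x^4 := by
  obtain ⟨u, hu, h1, h2, h3, h4⟩ := ratio_data x D
  have hF := FF_pos x
  have hF1 := FF_le_one x
  have hD := norm_nonneg D
  have ht := taylor_aux u hu
  set p := inner ℝ x D with hp
  have hi : |p| ≤ ‖x‖ * ‖D‖ := abs_real_inner_le_norm x D
  have hxF := FF_norm_le x
  have e : FF (x + D) - (FF x - FF x^3 * p - FF x^3 * ‖D‖^2 / 2 + 3/2 * FF x^5 * p^2)
      = FF x * (1/u - (1 - (u^2-1)/2 + 3*(u^2-1)^2/8)) + 3/8 * FF x^5 * (4 * p * ‖D‖^2 + ‖D‖^4) := by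
    rw [h2, h1]; ring
  rw [e]
  refine (abs_add_le _ _).trans ?_
  have a1 : |FF x * (1/u - (1 - (u^2-1)/2 + 3*(u^2-1)^2/8))| ≤ 2 * (1+‖D‖)^7 * FF x^4 := by
    rw [abs_mul, abs_of_pos hF]
    calc FF x * |1/u - (1 - (u^2-1)/2 + 3*(u^2-1)^2/8)| ≤ FF x * ((FF x * (1+‖D‖)^2)^3 * (2*(1+‖D‖))) := by
          gcongr
          refine ht.trans ?_
          rw [div_eq_mul_one_div]
          gcongr
      _ = _ := by ring
  have a2 : |3/8 * FF x^5 * (4 * p * ‖D‖^2 + ‖D‖^4)| ≤ 2 * (1+‖D‖)^7 * FF x^4 := by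
    rw [abs_mul, abs_of_pos (by positivity : 0 < 3/8 * FF x^5)]
    have b1 : |4 * p * ‖D‖^2 + ‖D‖^4| ≤ 4 * (‖x‖ * ‖D‖) * ‖D‖^2 + ‖D‖^4 := by
      refine (abs_add_le _ _).trans ?_
      rw [abs_mul, abs_mul, abs_of_pos (by norm_num : (0:ℝ) < 4), abs_of_nonneg (by positivity : 0 ≤ ‖D‖^2), abs_of_nonneg (by positivity : 0 ≤ ‖D‖^4)]
      gcongr
    have b2 : FF x * (4 * (‖x‖ * ‖D‖) * ‖D‖^2 + ‖D‖^4) ≤ 4 * (1+‖D‖)^7 := by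
      have c1 : FF x * (4 * (‖x‖ * ‖D‖) * ‖D‖^2 + ‖D‖^4) ≤ 4 * ‖D‖^3 + ‖D‖^4 := by
        have := mul_le_mul_of_nonneg_right hxF (by positivity : 0 ≤ 4 * ‖D‖^3)
        have := mul_le_mul_of_nonneg_right hF1 (by positivity : 0 ≤ ‖D‖^4)
        nlinarith
      have c2 : 4 * ‖D‖^3 + ‖D‖^4 ≤ 4 * (1+‖D‖)^4 := by nlinarith [pow_nonneg hD 2, pow_nonneg hD 3, pow_nonneg hD 4]
      have c3 : (1+‖D‖)^4 ≤ (1+‖D‖)^7 := pow_le_pow_right₀ (by linarith) (by norm_num)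
      linarith
    calc 3/8 * FF x^5 * |4 * p * ‖D‖^2 + ‖D‖^4| ≤ 3/8 * FF x^5 * (4 * (‖x‖ * ‖D‖) * ‖D‖^2 + ‖D‖^4) := by gcongr
      _ = 3/8 * FF x^4 * (FF x * (4 * (‖x‖ * ‖D‖) * ‖D‖^2 + ‖D‖^4)) := by ring
      _ ≤ 3/8 * FF x^4 * (4 * (1+‖D‖)^7) := by gcongr
      _ ≤ _ := by nlinarith [show 0 ≤ FF x^4 * (1+‖D‖)^7 by positivity]
  linarith

/-- center of a finite set -/
noncomputable def ctr {d : ℕ} (L : Finset (Pt d)) : Eu d := (1 / (L.card : ℝ)) • ∑ x ∈ L, emb x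

/-- average over a finite set -/
noncomputable def mean {d : ℕ} (L : Finset (Pt d)) (f : Pt d → ℝ) : ℝ := (1 / (L.card : ℝ)) * ∑ x ∈ L, f x

lemma mean_add {d : ℕ} (L : Finset (Pt d)) (f g : Pt d → ℝ) : mean L (fun x => f x + g x) = mean L f + mean L g := by
  unfold mean; rw [Finset.sum_add_distrib, mul_add]

lemma mean_mul {d : ℕ} (L : Finset (Pt d)) (c : ℝ) (f : Pt d → ℝ) : mean L (fun x => c * f x) = c * mean L f := by
  unfold mean; rw [← Finset.mul_sum]; ring

lemma mean_const {d : ℕ} {L : Finset (Pt d)} (hL : L.Nonempty) (c : ℝ) : mean L (fun _ => c) = c := by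
  unfold mean
  have : (L.card : ℝ) ≠ 0 := by exact_mod_cast (Finset.card_pos.2 hL).ne'
  rw [Finset.sum_const, nsmul_eq_mul]; field_simp

lemma mean_sum {d : ℕ} {ι : Type*} (s : Finset ι) (L : Finset (Pt d)) (f : ι → Pt d → ℝ) :
    mean L (fun x => ∑ i ∈ s, f i x) = ∑ i ∈ s, mean L (f i) := by
  unfold mean; rw [Finset.sum_comm, Finset.mul_sum]

lemma mean_mono {d : ℕ} {L : Finset (Pt d)} {f g : Pt d → ℝ} (h : ∀ x ∈ L, f x ≤ g x) : mean L f ≤ mean L g := by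
  unfold mean; exact mul_le_mul_of_nonneg_left (Finset.sum_le_sum h) (by positivity)

lemma mean_congr {d : ℕ} {L : Finset (Pt d)} {f g : Pt d → ℝ} (h : ∀ x ∈ L, f x = g x) : mean L f = mean L g := by
  unfold mean; rw [Finset.sum_congr rfl h]

lemma mean_comm {d : ℕ} (L L' : Finset (Pt d)) (f : Pt d → Pt d → ℝ) :
    mean L (fun x => mean L' (f x)) = mean L' (fun y => mean L (fun x => f x y)) := by
  unfold mean
  simp_rw [← Finset.mul_sum]
  rw [Finset.sum_comm]; ring

lemma mean_abs {d : ℕ} {L : Finset (Pt d)} (hL : L.Nonempty) {f g : Pt d → ℝ} {K : ℝ} (h : ∀ x ∈ L, |f x - g x| ≤ K) :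
    |mean L f - mean L g| ≤ K := by
  rw [abs_le]
  have h1 := mean_mono (L := L) (f := f) (g := fun x => g x + K) fun x hx => by linarith [(abs_le.1 (h x hx)).2]
  have h2 := mean_mono (L := L) (f := g) (g := fun x => f x + K) fun x hx => by linarith [(abs_le.1 (h x hx)).1]
  rw [mean_add, mean_const hL] at h1 h2
  constructor <;> linarith

lemma ctr_apply {d : ℕ} (L : Finset (Pt d)) (i : Fin d) : ctr L i = mean L (fun x => (x i : ℝ)) := by
  unfold ctr mean
  simp

lemma ctr_near {d : ℕ} {L : Finset (Pt d)} (hL : L.Nonempty) {p : Eu d} {r : ℝ} (h : ∀ x ∈ L, ‖emb x - p‖ ≤ r) :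
    ‖ctr L - p‖ ≤ r := by
  have hc : (L.card : ℝ) ≠ 0 := by exact_mod_cast (Finset.card_pos.2 hL).ne'
  have e : ctr L - p = (1 / (L.card : ℝ)) • ∑ x ∈ L, (emb x - p) := by
    unfold ctr
    rw [Finset.sum_sub_distrib, smul_sub, Finset.sum_const, ← Nat.cast_smul_eq_nsmul ℝ, smul_smul, one_div, inv_mul_cancel₀ hc, one_smul]
  rw [e, norm_smul]
  have h1 : ‖∑ x ∈ L, (emb x - p)‖ ≤ L.card * r := by
    refine (norm_sum_le _ _).trans ?_
    refine (Finset.sum_le_sum h).trans ?_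
    rw [Finset.sum_const, nsmul_eq_mul]
  rw [Real.norm_of_nonneg (by positivity)]
  calc 1 / (L.card:ℝ) * ‖∑ x ∈ L, (emb x - p)‖ ≤ 1 / (L.card:ℝ) * (L.card * r) := by gcongr
    _ = r := by field_simp

/-- stretched points -/
noncomputable def pt {d : ℕ} (τ : ℝ) (L : Finset (Pt d)) (x : Pt d) : Eu d := ctr L + τ • (emb x - ctr L)

lemma pt_near {d : ℕ} {L : Finset (Pt d)} (hL : L.Nonempty) {p : Eu d} {r τ : ℝ} (hτ : 0 ≤ τ) (h : ∀ x ∈ L, ‖emb x - p‖ ≤ r)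
    {x : Pt d} (hx : x ∈ L) : ‖pt τ L x - p‖ ≤ (1 + 2*τ) * r := by
  have h1 := ctr_near hL h
  have h2 := h x hx
  have e : pt τ L x - p = (ctr L - p) + τ • ((emb x - p) - (ctr L - p)) := by unfold pt; simp [sub_sub_sub_cancel_right]; abel
  rw [e]
  refine (norm_add_le _ _).trans ?_
  rw [norm_smul, Real.norm_of_nonneg hτ]
  have := norm_sub_le (emb x - p) (ctr L - p)
  nlinarith

/-- shape tensor -/
noncomputable def qq {d : ℕ} (i j : Fin d) (L : Finset (Pt d)) : ℝ :=
  mean L (fun x => ((x i : ℝ) - ctr L i) * ((x j : ℝ) - ctr L j))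

lemma mean_im {d : ℕ} (g : LS d) (L : Finset (Pt d)) (f : Pt d → ℝ) : mean (g.im L) f = mean L (fun x => f (g.ap x)) := by
  unfold mean LS.im
  rw [Finset.card_image_of_injective _ g.inj, Finset.sum_image (fun a _ b _ h => g.inj h)]

lemma ctr_im {d : ℕ} (g : LS d) {L : Finset (Pt d)} (hL : L.Nonempty) (i : Fin d) :
    ctr (g.im L) i = g.tr i + g.sg i * ctr L (g.perm i) := by
  rw [ctr_apply, ctr_apply, mean_im]
  simp only [LS.ap, Int.cast_add, Int.cast_mul]
  rw [mean_add, mean_const hL, mean_mul]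

lemma qq_im {d : ℕ} (g : LS d) {L : Finset (Pt d)} (hL : L.Nonempty) (i j : Fin d) :
    qq i j (g.im L) = g.sg i * g.sg j * qq (g.perm i) (g.perm j) L := by
  unfold qq
  rw [mean_im, ← mean_mul]
  refine mean_congr fun x _ => ?_
  rw [ctr_im g hL, ctr_im g hL]
  simp only [LS.ap, Int.cast_add, Int.cast_mul]
  ring

/-- second moment tensor -/
noncomputable def MM {d : ℕ} (τ : ℝ) (A : Finset (Pt d)) (i j : Fin d) (L : Finset (Pt d)) : ℝ :=
  (ctr L i - ctr A i) * (ctr L j - ctr A j) + τ^2 * qq i j L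

lemma MM_im {d : ℕ} (g : LS d) {A L : Finset (Pt d)} (hA : A.Nonempty) (hL : L.Nonempty) (τ : ℝ) (i j : Fin d) :
    MM τ (g.im A) i j (g.im L) = g.sg i * g.sg j * MM τ A (g.perm i) (g.perm j) L := by
  unfold MM
  rw [qq_im g hL, ctr_im g hL, ctr_im g hL, ctr_im g hA, ctr_im g hA]
  ring

lemma mean_pt {d : ℕ} {L : Finset (Pt d)} (hL : L.Nonempty) (τ : ℝ) (A : Finset (Pt d)) (i : Fin d) :
    mean L (fun x => (pt τ L x - ctr A) i) = ctr L i - ctr A i := by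
  have : ∀ x, (pt τ L x - ctr A) i = (ctr L i - ctr A i - τ * ctr L i) + τ * (x i : ℝ) := by
    intro x; simp [pt]; ring
  simp_rw [this]
  rw [mean_add, mean_const hL, mean_mul, ← ctr_apply]; ring

lemma mean_pt2 {d : ℕ} {L : Finset (Pt d)} (hL : L.Nonempty) (τ : ℝ) (A : Finset (Pt d)) (i j : Fin d) :
    mean L (fun x => (pt τ L x - ctr A) i * (pt τ L x - ctr A) j) = MM τ A i j L := by
  have h0 : ∀ i, mean L (fun x => (x i : ℝ) - ctr L i) = 0 := by
    intro i
    have : ∀ x : Pt d, (x i : ℝ) - ctr L i = (x i : ℝ) + (-ctr L i) := fun x => by ring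
    simp_rw [this]
    rw [mean_add, mean_const hL, ← ctr_apply]; ring
  have : ∀ x, (pt τ L x - ctr A) i * (pt τ L x - ctr A) j =
      ((ctr L i - ctr A i) * (ctr L j - ctr A j) + τ^2 * (((x i : ℝ) - ctr L i) * ((x j : ℝ) - ctr L j)))
      + (((ctr L i - ctr A i) * τ) * ((x j : ℝ) - ctr L j) + ((ctr L j - ctr A j) * τ) * ((x i : ℝ) - ctr L i)) := by
    intro x; simp [pt]; ring
  simp_rw [this]
  rw [mean_add, mean_add, mean_add, mean_const hL, mean_mul, mean_mul, mean_mul, h0, h0]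
  unfold MM qq; ring

/-- one-sided averaged potential -/
noncomputable def FL {d : ℕ} (τ : ℝ) (L : Finset (Pt d)) (v : Eu d) : ℝ := mean L (fun x => FF (pt τ L x - v))

/-- Taylor polynomial of `FL` around `ctr A` -/
noncomputable def TL {d : ℕ} (τ : ℝ) (A : Finset (Pt d)) (X : Eu d) (L : Finset (Pt d)) : ℝ :=
  FF X + (∑ i, (-(FF X^3 * X i)) * (ctr L i - ctr A i)) + (∑ i, (-(FF X^3/2)) * MM τ A i i L)
    + ∑ i, ∑ j, (3/2 * FF X^5 * X i * X j) * MM τ A i j L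

lemma TL_mean {d : ℕ} {L : Finset (Pt d)} (hL : L.Nonempty) (τ : ℝ) (A : Finset (Pt d)) (X : Eu d) :
    TL τ A X L = mean L (fun x => FF X - FF X^3 * inner ℝ X (pt τ L x - ctr A) - FF X^3 * ‖pt τ L x - ctr A‖^2 / 2
      + 3/2 * FF X^5 * (inner ℝ X (pt τ L x - ctr A))^2) := by
  have e : ∀ D : Eu d, FF X - FF X^3 * inner ℝ X D - FF X^3 * ‖D‖^2 / 2 + 3/2 * FF X^5 * (inner ℝ X D)^2 =
     FF X + (∑ i, (-(FF X^3 * X i)) * D i) + (∑ i, (-(FF X^3/2)) * (D i * D i))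
    + ∑ i, ∑ j, (3/2 * FF X^5 * X i * X j) * (D i * D j) := by
    intro D
    have h1 : inner ℝ X D = ∑ i, X i * D i := by
      rw [PiLp.inner_apply]
      exact Finset.sum_congr rfl fun i _ => by simp [mul_comm]
    have h2 : ‖D‖^2 = ∑ i, D i * D i := by
      rw [EuclideanSpace.norm_sq_eq]
      exact Finset.sum_congr rfl fun i _ => by rw [Real.norm_eq_abs, sq_abs, sq]
    rw [h1, h2, sq, Finset.sum_mul_sum]
    simp_rw [Finset.mul_sum]
    rw [Finset.sum_div, ← sub_eq_zero]
    have e1 : (∑ i, (-(FF X^3 * X i)) * D i) = - ∑ i, FF X^3 * (X i * D i) := by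
      rw [← Finset.sum_neg_distrib]; exact Finset.sum_congr rfl fun i _ => by ring
    have e2 : (∑ i, (-(FF X^3/2)) * (D i * D i)) = - ∑ i, FF X ^ 3 * (D i * D i) / 2 := by
      rw [← Finset.sum_neg_distrib]; exact Finset.sum_congr rfl fun i _ => by ring
    have e3 : ∑ i, ∑ j, (3/2 * FF X^5 * X i * X j) * (D i * D j) = ∑ i, ∑ j, 3/2 * FF X^5 * (X i * D i * (X j * D j)) :=
      Finset.sum_congr rfl fun i _ => Finset.sum_congr rfl fun j _ => by ring
    rw [e1, e2, e3]; ring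
  simp_rw [e]
  rw [mean_add, mean_add, mean_add, mean_const hL, mean_sum, mean_sum, mean_sum]
  simp_rw [mean_sum, mean_mul, mean_pt2 hL, mean_pt hL]
  rfl

lemma FL_approx {d : ℕ} {A L : Finset (Pt d)} (hL : L.Nonempty) {τ K : ℝ} (v : Eu d)
    (h : ∀ x ∈ L, ‖pt τ L x - ctr A‖ ≤ K) : |FL τ L v - TL τ A (ctr A - v) L| ≤ 4 * (1+K)^7 * FF (ctr A - v)^4 := by
  rw [TL_mean hL]
  refine mean_abs hL fun x hx => ?_
  have := FF_taylor (ctr A - v) (pt τ L x - ctr A)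
  rw [show ctr A - v + (pt τ L x - ctr A) = pt τ L x - v by abel] at this
  refine this.trans ?_
  have hF := FF_pos (ctr A - v)
  have := h x hx
  gcongr

lemma Shp.nonempty {d : ℕ} {A : Finset (Pt d)} (h : Shp A) : A.Nonempty := by
  obtain ⟨_, u, hu, _⟩ := h; exact ⟨u, hu⟩

lemma le_diam {d : ℕ} {A : Finset (Pt d)} {x y : Pt d} (hx : x ∈ A) (hy : y ∈ A) : ‖emb x - emb y‖ ≤ diam0 d A := by
  classical
  rw [← dist0_eq]
  unfold diam0
  refine le_csSup ?_ ⟨x, hx, y, hy, rfl⟩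
  have : {r : ℝ | ∃ x ∈ A, ∃ y ∈ A, r = dist0 d x y} = ↑((A ×ˢ A).image (fun p => dist0 d p.1 p.2)) := by
    ext r; simp only [Set.mem_setOf_eq, Finset.coe_image, Set.mem_image, Finset.mem_coe, Finset.mem_product, Prod.exists]
    constructor
    · rintro ⟨x, hx, y, hy, rfl⟩; exact ⟨x, y, ⟨hx, hy⟩, rfl⟩
    · rintro ⟨x, y, ⟨hx, hy⟩, rfl⟩; exact ⟨x, hx, y, hy, rfl⟩
  rw [this]; exact Finset.bddAbove _

lemma diam_le {d : ℕ} {A : Finset (Pt d)} (hA : A.Nonempty) {r : ℝ} (h : ∀ x ∈ A, ∀ y ∈ A, ‖emb x - emb y‖ ≤ r) : diam0 d A ≤ r := by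
  unfold diam0
  obtain ⟨x, hx⟩ := hA
  refine csSup_le ⟨_, x, hx, x, hx, rfl⟩ ?_
  rintro r ⟨x, hx, y, hy, rfl⟩
  rw [dist0_eq]; exact h x hx y hy

lemma diam_nonneg {d : ℕ} {A : Finset (Pt d)} (hA : A.Nonempty) : 0 ≤ diam0 d A := by
  obtain ⟨x, hx⟩ := hA
  exact (norm_nonneg _).trans (le_diam hx hx)

lemma near_self {d : ℕ} {A : Finset (Pt d)} {x : Pt d} (hx : x ∈ A) : ‖emb x - ctr A‖ ≤ diam0 d A := by
  rw [norm_sub_rev]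
  exact ctr_near ⟨x, hx⟩ fun y hy => le_diam hy hx

lemma Rch.near_ctr {d : ℕ} {t : ℕ} {A L : Finset (Pt d)} (h : Rch t A L) {x : Pt d} (hx : x ∈ L) :
    ‖emb x - ctr A‖ ≤ t + diam0 d A := by
  obtain ⟨y, hy, h1⟩ := h.near x hx
  have h2 := near_self hy
  have := norm_add_le (emb x - emb y) (emb y - ctr A)
  rw [sub_add_sub_cancel] at this
  linarith

lemma Rch.nonempty {d : ℕ} {t : ℕ} {A L : Finset (Pt d)} (h : Rch t A L) (hA : A.Nonempty) : L.Nonempty := by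
  rw [← Finset.card_pos] at *; rw [h.card]; exact hA

lemma coord_le {d : ℕ} (x : Eu d) (i : Fin d) : |x i| ≤ ‖x‖ := by
  have := EuclideanSpace.norm_sq_eq x
  have h2 : ‖x i‖^2 ≤ ‖x‖^2 := by
    rw [this]; exact Finset.single_le_sum (f := fun i => ‖x i‖^2) (fun i _ => sq_nonneg _) (Finset.mem_univ i)
  rw [← Real.norm_eq_abs]
  exact abs_le_of_sq_le_sq h2 (norm_nonneg _) |>.trans' (le_abs_self _)

lemma BB_ctr {d : ℕ} {A : Finset (Pt d)} (hA : A.Nonempty) (i : Fin d) : BB A (fun L => ctr L i - ctr A i) := by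
  have hd := diam_nonneg hA
  refine ⟨1 + diam0 d A, 1, by linarith, fun t L hL hr => ?_⟩
  have h1 : ‖ctr L - ctr A‖ ≤ t + diam0 d A := ctr_near (hr.nonempty hA) fun x hx => hr.near_ctr hx
  have h2 := coord_le (ctr L - ctr A) i
  have h3 : (ctr L - ctr A) i = ctr L i - ctr A i := rfl
  rw [h3] at h2
  have : (0:ℝ) ≤ t := by positivity
  nlinarith

lemma BB_qq {d : ℕ} {A : Finset (Pt d)} (hA : A.Nonempty) (i j : Fin d) : BB A (qq i j) := by
  have hd := diam_nonneg hA
  refine ⟨4 * (1 + diam0 d A)^2, 2, by positivity, fun t L hL hr => ?_⟩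
  have h1 : ‖ctr L - ctr A‖ ≤ t + diam0 d A := ctr_near (hr.nonempty hA) fun x hx => hr.near_ctr hx
  have ht : (0:ℝ) ≤ t := by positivity
  have hc : ∀ x ∈ L, ∀ i, |(x i : ℝ) - ctr L i| ≤ 2 * (1 + diam0 d A) * (1 + t) := by
    intro x hx i
    have h2 := coord_le (emb x - ctr L) i
    have h3 : (emb x - ctr L) i = (x i : ℝ) - ctr L i := rfl
    rw [h3] at h2
    have h4 := hr.near_ctr hx
    have h5 : ‖emb x - ctr L‖ ≤ ‖emb x - ctr A‖ + ‖ctr L - ctr A‖ := by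
      have := norm_sub_le (emb x - ctr A) (ctr L - ctr A)
      rwa [sub_sub_sub_cancel_right] at this
    nlinarith
  have := mean_abs (hr.nonempty hA) (f := fun x => ((x i : ℝ) - ctr L i) * ((x j : ℝ) - ctr L j)) (g := fun _ => 0) (K := 4 * (1 + diam0 d A) ^ 2 * (1 + ↑t) ^ 2) (by
    intro x hx
    rw [sub_zero, abs_mul]
    calc _ ≤ (2 * (1 + diam0 d A) * (1 + t)) * (2 * (1 + diam0 d A) * (1 + t)) := by
          gcongr
          · exact hc x hx i
          · exact hc x hx j
      _ = _ := by ring)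
  rw [mean_const (hr.nonempty hA), sub_zero] at this
  exact this

lemma BB_MM {d : ℕ} {A : Finset (Pt d)} (hA : A.Nonempty) (τ : ℝ) (i j : Fin d) : BB A (MM τ A i j) :=
  ((BB_ctr hA i).mul (BB_ctr hA j)).add ((BB.const (τ^2)).mul (BB_qq hA i j))

/-- increment of second moments -/
noncomputable def mu {d : ℕ} (τ : ℝ) (A : Finset (Pt d)) (i j : Fin d) : ℝ := Rp (MM τ A i j) A - MM τ A i j A

/-- first moment -/
noncomputable def m1 {d : ℕ} (A : Finset (Pt d)) (i : Fin d) : ℝ := Rp (fun L => ctr L i - ctr A i) A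

lemma m1_im {d : ℕ} (hd : 0 < d) (g : LS d) {A : Finset (Pt d)} (hA : A.Nonempty) (i : Fin d) :
    m1 (g.im A) i = g.sg i * m1 A (g.perm i) := by
  unfold m1
  rw [Rp_sym hd, ← Rp_mul]
  refine Rp_congr hd fun t L _ hr => ?_
  rw [ctr_im g hA, ctr_im g (hr.nonempty hA)]; ring

lemma mu_im {d : ℕ} (hd : 0 < d) (g : LS d) {A : Finset (Pt d)} (hA : A.Nonempty) (τ : ℝ) (i j : Fin d) :
    mu τ (g.im A) i j = g.sg i * g.sg j * mu τ A (g.perm i) (g.perm j) := by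
  unfold mu
  rw [Rp_sym hd, MM_im g hA hA, mul_sub, ← Rp_mul]
  congr 1
  exact Rp_congr hd fun t L _ hr => MM_im g hA (hr.nonempty hA) τ i j

lemma mu_eq {d : ℕ} (hd : 5 ≤ d) {A : Finset (Pt d)} (hA : Shp A) (τ : ℝ) (i : Fin d) :
    mu τ A i i = Rp (fun L => (ctr L i - ctr A i)^2) A + τ^2 * (Rp (qq i i) A - qq i i A) := by
  unfold mu
  have : Rp (MM τ A i i) A = Rp (fun L => (ctr L i - ctr A i) * (ctr L i - ctr A i) + τ^2 * qq i i L) A := rfl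
  rw [this, Rp_add hd hA ((BB_ctr hA.nonempty i).mul (BB_ctr hA.nonempty i)) ((BB.const (τ^2)).mul (BB_qq hA.nonempty i i)), Rp_mul]
  simp_rw [← sq]
  unfold MM; ring

/-- moment of inertia constants -/
noncomputable def kap (m : ℕ) : ℝ := if m = 2 then 1/4 else 2/3

lemma line_qq {d : ℕ} {L : Finset (Pt d)} (hL : Line L) : ∃ k : Stp d, ∀ i j, qq i j L = kap L.card * (stp k i) * (stp k j) := by
  rcases hL with ⟨o, k, rfl⟩ | ⟨o, k, rfl⟩
  · refine ⟨k, fun i j => ?_⟩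
    have hm : ∀ f : Pt d → ℝ, mean {o, o + stp k} f = (f o + f (o + stp k)) / 2 := by
      intro f; unfold mean; rw [card_dimer, Finset.sum_pair (by simp [stp_ne_zero])]; push_cast; ring
    unfold qq kap
    rw [card_dimer, if_pos rfl]
    simp only [hm, ctr_apply, Pi.add_apply, Int.cast_add]
    ring
  · refine ⟨k, fun i j => ?_⟩
    have hc := card_trimer o k
    have h1 : o - stp k ∉ ({o, o + stp k} : Finset (Pt d)) := by
      intro h
      rw [Finset.card_insert_of_mem h, card_dimer] at hc
      omega
    have hm : ∀ f : Pt d → ℝ, mean {o - stp k, o, o + stp k} f = (f (o - stp k) + (f o + f (o + stp k))) / 3 := by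
      intro f; unfold mean; rw [card_trimer, Finset.sum_insert h1, Finset.sum_pair (by simp [stp_ne_zero])]; push_cast; ring
    unfold qq kap
    rw [card_trimer, if_neg (by norm_num)]
    simp only [hm, ctr_apply, Pi.add_apply, Pi.sub_apply, Int.cast_add, Int.cast_sub]
    ring

lemma stp_sq_sum {d : ℕ} (k : Stp d) : ∑ i, ((stp k i : ℤ) : ℝ) * (stp k i : ℝ) = 1 := by
  have h := norm_stp k
  have h2 := EuclideanSpace.norm_sq_eq (emb (stp k))
  rw [h] at h2
  simp only [emb_apply, Real.norm_eq_abs, sq_abs] at h2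
  rw [one_pow] at h2
  rw [h2]; exact Finset.sum_congr rfl fun i _ => by ring

lemma line_trace {d : ℕ} {L : Finset (Pt d)} (hL : Line L) : ∑ i, qq i i L = kap L.card := by
  obtain ⟨k, hk⟩ := line_qq hL
  simp_rw [hk, mul_assoc]
  rw [← Finset.mul_sum, stp_sq_sum, mul_one]

/-- positive move -/
lemma pHAT_pos {d : ℕ} (hd : 5 ≤ d) {A : Finset (Pt d)} (hA : Shp A) {x y : Pt d} (hx : x ∈ A) {l : ℕ}
    (hp : PathA (↑(A.erase x)) l x y) (hy : y ∈ nbF (A.erase x)) : 0 < pHAT d A x y := by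
  obtain ⟨c, hc, _, h⟩ := shp_esc hd
  refine lt_of_lt_of_le ?_ (move_lower (by omega) hc.le le_rfl hx (h A hA x hx) hp hy)
  have : (0:ℝ) < A.card := by exact_mod_cast Finset.card_pos.2 ⟨x, hx⟩
  have : (0:ℝ) < d := by exact_mod_cast (by omega : 0 < d)
  positivity

lemma EU_pos {d : ℕ} (hd : 5 ≤ d) {A : Finset (Pt d)} {f : Finset (Pt d) → ℝ} (h0 : ∀ B, 0 ≤ f B) {x y : Pt d}
    (hp : 0 < pHAT d A x y) (hf : 0 < f (mv A x y)) : 0 < EU A (fun x y => f (mv A x y)) :=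
  lt_of_lt_of_le (mul_pos hp hf) (EU_single (f := fun x y => f (mv A x y)) (by omega) (fun _ _ _ _ _ => h0 _) hf.le)

lemma stp_same {d : ℕ} (k : Stp d) : stp k k.1 = 1 ∨ stp k k.1 = -1 := by
  unfold stp; simp

lemma stp_other {d : ℕ} (k : Stp d) {i : Fin d} (h : i ≠ k.1) : stp k i = 0 := by
  unfold stp; simp [h]

lemma R_nonneg' {d : ℕ} (hd : 5 ≤ d) {f : Finset (Pt d) → ℝ} (h0 : ∀ B, 0 ≤ f B) (A : Finset (Pt d)) : 0 ≤ R f A :=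
  R_nonneg (by omega) fun _ _ _ _ => h0 _

lemma dimer_reach {d : ℕ} (hd : 5 ≤ d) (o : Pt d) (k l : Stp d) (hkl : l.1 ≠ k.1) {f : Finset (Pt d) → ℝ} (h0 : ∀ B, 0 ≤ f B)
    (hf : 0 < f {o + stp k, o + stp k + stp l}) : 0 < Rp f {o, o + stp k} := by
  have hA : Line ({o, o + stp k} : Finset (Pt d)) := Or.inl ⟨o, k, rfl⟩
  have he : ({o, o + stp k} : Finset (Pt d)).erase o = {o + stp k} := by
    rw [Finset.erase_insert]; simp [stp_ne_zero]
  have hm : mv {o, o + stp k} o (o + stp k + stp l) = {o + stp k, o + stp k + stp l} := by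
    unfold mv; rw [he, Finset.pair_comm]
  have hl := stp_same l
  have hl' := stp_other k hkl
  refine EU_pos hd (fun B => R_nonneg' hd h0 B) (x := o) (y := o + stp k + stp l)
    (pHAT_pos hd hA.shp (by simp) (l := 2) ?_ ?_) ?_
  · rw [he]
    refine ⟨l, ?_, k, ?_, ?_⟩
    · intro h
      have := congrFun (by simpa using h : stp l = stp k) l.1
      omega
    · intro h
      have := congrFun (by simpa using h : o + stp l + stp k = o + stp k) l.1
      simp only [Pi.add_apply] at this
      omega
    · show o + stp l + stp k = _
      abel
  · rw [he, mem_nbF]; exact ⟨opp l, by simp [stp_opp]⟩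
  · rw [hm, R_line (Or.inl ⟨o + stp k, l, rfl⟩)]; exact hf

lemma not_line_corner {d : ℕ} (o : Pt d) (k l : Stp d) (hkl : l.1 ≠ k.1) :
    ¬ Line ({o + stp l, o - stp k, o} : Finset (Pt d)) := by
  intro h
  have hl := stp_same l
  have hk := stp_same k
  have hl' := stp_other k hkl
  have hk' := stp_other l (Ne.symm hkl)
  have hc : ({o + stp l, o - stp k, o} : Finset (Pt d)).card = 3 := by
    rw [Finset.card_eq_three]
    refine ⟨_, _, _, ?_, ?_, ?_, rfl⟩
    · intro h; have := congrFun h l.1; simp only [Pi.add_apply, Pi.sub_apply] at this; omega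
    · simp [stp_ne_zero]
    · simp [stp_ne_zero]
  rcases h with ⟨p, s, h⟩ | ⟨p, s, h⟩
  · rw [h, card_dimer] at hc; omega
  · have h1 : p - stp s ∈ ({o + stp l, o - stp k, o} : Finset (Pt d)) := by rw [h]; simp
    have h2 : p + stp s ∈ ({o + stp l, o - stp k, o} : Finset (Pt d)) := by rw [h]; simp
    have hs := stp_same s
    simp only [Finset.mem_insert, Finset.mem_singleton] at h1 h2
    have a1 : ∀ {x y : Pt d}, p - stp s = x → p + stp s = y → ∀ i, 2 * stp s i = y i - x i := by
      rintro _ _ rfl rfl i; simp only [Pi.add_apply, Pi.sub_apply]; ring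
    rcases h1 with h1 | h1 | h1 <;> rcases h2 with h2 | h2 | h2 <;>
    · have b1 := a1 h1 h2 l.1
      have b2 := a1 h1 h2 k.1
      have b3 := a1 h1 h2 s.1
      try simp only [Pi.add_apply, Pi.sub_apply] at b1 b2 b3
      omega

lemma rev3 {d : ℕ} (a b c : Pt d) : ({a, b, c} : Finset (Pt d)) = {c, b, a} := by
  ext z; simp only [Finset.mem_insert, Finset.mem_singleton]
  constructor <;> rintro (h | h | h) <;> simp [h]

set_option maxHeartbeats 1000000 in
lemma trimer_reach {d : ℕ} (hd : 5 ≤ d) (o : Pt d) (k l : Stp d) (hkl : l.1 ≠ k.1) {f : Finset (Pt d) → ℝ} (h0 : ∀ B, 0 ≤ f B)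
    (hb : BB {o - stp k, o, o + stp k} f)
    (hf : 0 < f {o + stp l - stp l, o + stp l, o + stp l + stp l}) : 0 < Rp f {o - stp k, o, o + stp k} := by
  have hA : Line ({o - stp k, o, o + stp k} : Finset (Pt d)) := Or.inr ⟨o, k, rfl⟩
  have hl := stp_same l
  have hk := stp_same k
  have hl' := stp_other k hkl
  have hk' := stp_other l (Ne.symm hkl)
  have he : ({o - stp k, o, o + stp k} : Finset (Pt d)).erase (o + stp k) = {o - stp k, o} := by
    apply erase_third
    · intro h; have := congrFun h k.1; simp only [Pi.add_apply, Pi.sub_apply] at this; omega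
    · simp [stp_ne_zero]
  have hm : mv {o - stp k, o, o + stp k} (o + stp k) (o + stp l) = {o + stp l, o - stp k, o} := by
    unfold mv; rw [he]
  have hp1 : PathA (↑(({o - stp k, o, o + stp k} : Finset (Pt d)).erase (o + stp k))) 2 (o + stp k) (o + stp l) := by
    rw [he]
    refine ⟨l, ?_, opp k, ?_, ?_⟩
    · intro h
      simp only [Finset.coe_insert, Finset.coe_singleton, Set.mem_insert_iff, Set.mem_singleton_iff] at h
      rcases h with h | h <;> have := congrFun h l.1 <;> simp only [Pi.add_apply, Pi.sub_apply] at this <;> omega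
    · intro h
      simp only [Finset.coe_insert, Finset.coe_singleton, Set.mem_insert_iff, Set.mem_singleton_iff] at h
      rcases h with h | h <;> have := congrFun h l.1 <;> simp only [Pi.add_apply, Pi.sub_apply, stp_opp, Pi.neg_apply] at this <;> omega
    · show o + stp k + stp l + stp (opp k) = _
      rw [stp_opp]; abel
  have hy1 : o + stp l ∈ nbF (({o - stp k, o, o + stp k} : Finset (Pt d)).erase (o + stp k)) := by
    rw [he, mem_nbF]; exact ⟨opp l, by simp [stp_opp]⟩
  have hP := pHAT_pos hd hA.shp (by simp) hp1 hy1
  have hv := pHAT_ne_zero (by omega) hP.ne'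
  refine EU_pos hd (fun B => R_nonneg' hd h0 B) hP ?_
  have hS := hA.shp.mv hv.1 hv.2.1 hv.2.2
  have hB := hb.mv hv.1 hv.2.1 hv.2.2
  rw [hm] at hS hB ⊢
  rw [R_step hd hS (not_line_corner o k l hkl) hB]
  have he2 : ({o + stp l, o - stp k, o} : Finset (Pt d)).erase (o - stp k) = {o + stp l, o} := by
    rw [Finset.pair_comm (o - stp k) o]
    apply erase_third
    · intro h; have := congrFun h k.1; simp only [Pi.add_apply, Pi.sub_apply] at this; omega
    · simp [stp_ne_zero]
  have hm2 : mv {o + stp l, o - stp k, o} (o - stp k) (o + stp l + stp l) = {o + stp l - stp l, o + stp l, o + stp l + stp l} := by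
    unfold mv; rw [he2, add_sub_cancel_right]
    exact rev3 _ _ _
  refine EU_pos hd (fun B => R_nonneg' hd h0 B) (x := o - stp k) (y := o + stp l + stp l) (pHAT_pos hd hS (by simp) (l := 3) ?_ ?_) ?_
  · rw [he2]
    refine ⟨l, ?_, l, ?_, k, ?_, ?_⟩
    · intro h
      simp only [Finset.coe_insert, Finset.coe_singleton, Set.mem_insert_iff, Set.mem_singleton_iff] at h
      rcases h with h | h <;> have := congrFun h k.1 <;> simp only [Pi.add_apply, Pi.sub_apply] at this <;> omega
    · intro h
      simp only [Finset.coe_insert, Finset.coe_singleton, Set.mem_insert_iff, Set.mem_singleton_iff] at h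
      rcases h with h | h <;> have := congrFun h k.1 <;> simp only [Pi.add_apply, Pi.sub_apply] at this <;> omega
    · intro h
      simp only [Finset.coe_insert, Finset.coe_singleton, Set.mem_insert_iff, Set.mem_singleton_iff] at h
      rcases h with h | h <;> have := congrFun h l.1 <;> simp only [Pi.add_apply, Pi.sub_apply] at this <;> omega
    · show o - stp k + stp l + stp l + stp k = _
      abel
  · rw [he2, mem_nbF]; exact ⟨opp l, by simp [stp_opp]⟩
  · rw [hm2, R_line (Or.inr ⟨o + stp l, l, rfl⟩)]; exact hf

/-- symmetric reference-type line with axis `a` -/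
structure RefL {d : ℕ} (A : Finset (Pt d)) (a : Fin d) : Prop where
  line : Line A
  refl : ∀ i, ∃ g : LS d, g.im A = A ∧ g.perm = 1 ∧ g.sg i = -1 ∧ ∀ j, j ≠ i → g.sg j = 1
  swap : ∀ i j, i ≠ a → j ≠ a → ∃ g : LS d, g.im A = A ∧ g.perm = Equiv.swap i j ∧ ∀ j, g.sg j = 1
  qz : ∀ i, i ≠ a → qq i i A = 0
  pos : ∃ i, i ≠ a ∧ 0 < Rp (qq i i) A ∧ 0 < Rp (fun L => (ctr L i - ctr A i)^2) A

lemma qq_nonneg {d : ℕ} (i : Fin d) (L : Finset (Pt d)) : 0 ≤ qq i i L := by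
  unfold qq mean
  exact mul_nonneg (by positivity) (Finset.sum_nonneg fun x _ => mul_self_nonneg _)

lemma RefL.claim {d : ℕ} (hd : 5 ≤ d) {A : Finset (Pt d)} {a : Fin d} (h : RefL A a) :
    ∃ τ c1 : ℝ, 0 ≤ τ ∧ 0 < c1 ∧ (∀ i, m1 A i = 0) ∧ (∀ i j, i ≠ j → mu τ A i j = 0) ∧
      (∀ i, c1 ≤ (∑ j, mu τ A j j) / 2 - 3/2 * mu τ A i i) := by
  have hd0 : 0 < d := by omega
  have hS := h.line.shp
  have hN := hS.nonempty
  have hm : ∀ i, m1 A i = 0 := by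
    intro i
    obtain ⟨g, h1, h2, h3, h4⟩ := h.refl i
    have := m1_im hd0 g hN i
    rw [h1, h2, h3, Equiv.Perm.one_apply] at this
    push_cast at this; linarith
  have ho : ∀ τ i j, i ≠ j → mu τ A i j = 0 := by
    intro τ i j hij
    obtain ⟨g, h1, h2, h3, h4⟩ := h.refl i
    have := mu_im hd0 g hN τ i j
    rw [h1, h2, h3, h4 j hij.symm, Equiv.Perm.one_apply, Equiv.Perm.one_apply] at this
    push_cast at this; linarith
  obtain ⟨b, hb, hO, hP⟩ := h.pos
  set P : Fin d → ℝ := fun i => Rp (fun L => (ctr L i - ctr A i)^2) A with hPdef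
  set O : Fin d → ℝ := fun i => Rp (qq i i) A with hOdef
  have hmu : ∀ τ i, mu τ A i i = P i + τ^2 * (O i - qq i i A) := fun τ i => mu_eq hd hS τ i
  have hPs : ∀ i, i ≠ a → P i = P b := by
    intro i hi
    obtain ⟨g, h1, h2, h3⟩ := h.swap i b hi hb
    have := mu_im hd0 g hN 0 i i
    rw [h1, h2, h3, Equiv.swap_apply_left, hmu, hmu] at this
    push_cast at this; linarith
  have hOs : ∀ i, i ≠ a → O i = O b := by
    intro i hi
    obtain ⟨g, h1, h2, h3⟩ := h.swap i b hi hb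
    have := mu_im hd0 g hN 1 i i
    rw [h1, h2, h3, Equiv.swap_apply_left, hmu, hmu, h.qz i hi, h.qz b hb, hPs i hi] at this
    push_cast at this; linarith
  have hsum : ∀ f : Fin d → ℝ, (∀ i, i ≠ a → f i = f b) → ∑ i, f i = f a + (d - 1) * f b := by
    intro f hf
    rw [← Finset.add_sum_erase _ _ (Finset.mem_univ a)]
    congr 1
    rw [Finset.sum_congr rfl (fun i hi => hf i (Finset.ne_of_mem_erase hi)), Finset.sum_const, Finset.card_erase_of_mem (Finset.mem_univ a),
      Finset.card_univ, Fintype.card_fin, nsmul_eq_mul, Nat.cast_sub (by omega)]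
    push_cast; ring
  have htr : ∑ i, O i = ∑ i, qq i i A := by
    rw [line_trace h.line, hOdef]
    simp only
    rw [← Rp_sum hd hS Finset.univ (fun i => qq i i) (fun i => BB_qq hN i i)]
    rw [← Rp_const hd hS (kap A.card)]
    refine Rp_congr hd0 fun t L hL hr => ?_
    rw [line_trace hL, hr.card]
  rw [hsum O hOs, hsum (fun i => qq i i A) (fun i hi => by rw [h.qz i hi, h.qz b hb])] at htr
  simp only [h.qz b hb, mul_zero, add_zero] at htr
  have hdR : (5:ℝ) ≤ d := by exact_mod_cast hd
  have hPa : 0 ≤ P a := by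
    have := Rp_mono hd hS (BB.const 0) (f := fun _ => 0) (g := fun L => (ctr L a - ctr A a)^2)
      (by simp_rw [sq]; exact (BB_ctr hN a).mul (BB_ctr hN a)) (fun _ _ _ _ => sq_nonneg _)
    rwa [Rp_const hd hS] at this
  have hPb : 0 < P b := hP
  have hOb : 0 < O b := hO
  -- expression of N
  have hNa : ∀ τ, mu τ A a a = P a - τ^2 * ((d-1) * O b) := by
    intro τ; rw [hmu]; have : O a - qq a a A = -((d-1) * O b) := by linarith
    rw [this]; ring
  have hNb : ∀ τ i, i ≠ a → mu τ A i i = P b + τ^2 * O b := by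
    intro τ i hi; rw [hmu, h.qz i hi, hPs i hi, hOs i hi]; ring
  have htrN : ∀ τ, ∑ i, mu τ A i i = P a + (d-1) * P b := by
    intro τ
    rw [hsum (fun i => mu τ A i i) (fun i hi => by simp only [hNb τ i hi, hNb τ b hb]), hNa, hNb τ b hb]; ring
  by_cases hc : P a ≤ P b
  · refine ⟨0, P b / 2, le_rfl, by linarith, hm, fun i j => ho 0 i j, fun i => ?_⟩
    rw [htrN]
    by_cases hi : i = a
    · subst hi; rw [hNa]; nlinarith
    · rw [hNb 0 i hi]; nlinarith
  · push Not at hc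
    have ht : 0 ≤ (P a - P b) / (d * O b) := div_nonneg (by linarith) (by positivity)
    refine ⟨Real.sqrt ((P a - P b) / (d * O b)), (P a + (d-1) * P b) / d / 2, Real.sqrt_nonneg _, ?_, hm, fun i j => ho _ i j, fun i => ?_⟩
    · have : 0 < (d-1) * P b := mul_pos (by linarith) hPb
      positivity
    have hT : 0 < P a + (d-1) * P b := by nlinarith
    have hNi : mu (Real.sqrt ((P a - P b) / (d * O b))) A i i = (P a + (d-1) * P b) / d := by
      by_cases hi : i = a
      · subst hi; rw [hNa, Real.sq_sqrt ht]; field_simp; ring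
      · rw [hNb _ i hi, Real.sq_sqrt ht]; field_simp; ring
    rw [htrN, hNi]
    rw [div_div, div_le_iff₀ (by positivity)]
    have : ((P a + (d-1) * P b) / 2 - 3/2 * ((P a + (d-1) * P b) / d)) * (d * 2) = (P a + (d-1) * P b) * (d - 3) := by
      field_simp
    rw [this]; nlinarith

lemma mean_dimer {d : ℕ} (o : Pt d) (k : Stp d) (f : Pt d → ℝ) : mean {o, o + stp k} f = (f o + f (o + stp k)) / 2 := by
  unfold mean; rw [card_dimer, Finset.sum_pair (by simp [stp_ne_zero])]; push_cast; ring

lemma mean_trimer {d : ℕ} (o : Pt d) (k : Stp d) (f : Pt d → ℝ) :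
    mean {o - stp k, o, o + stp k} f = (f (o - stp k) + (f o + f (o + stp k))) / 3 := by
  have hc := card_trimer o k
  have h1 : o - stp k ∉ ({o, o + stp k} : Finset (Pt d)) := by
    intro h
    rw [Finset.card_insert_of_mem h, card_dimer] at hc
    omega
  unfold mean; rw [card_trimer, Finset.sum_insert h1, Finset.sum_pair (by simp [stp_ne_zero])]; push_cast; ring

/-- reflection -/
def rfl2 {d : ℕ} (i : Fin d) (c : ℤ) : LS d where
  perm := 1
  sg := fun j => if j = i then -1 else 1
  hsg := by intro j; by_cases h : j = i <;> simp [h]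
  tr := fun j => if j = i then c else 0

/-- swap -/
def swp {d : ℕ} (i j : Fin d) (o : Pt d) : LS d where
  perm := Equiv.swap i j
  sg := fun _ => 1
  hsg := by intro j; simp
  tr := fun l => o l - o (Equiv.swap i j l)

lemma rfl2_ap {d : ℕ} (i : Fin d) (c : ℤ) (x : Pt d) (j : Fin d) : (rfl2 i c).ap x j = if j = i then c - x i else x j := by
  by_cases h : j = i
  · subst h; simp [rfl2, LS.ap]; ring
  · simp [rfl2, LS.ap, h]

lemma swp_fix {d : ℕ} {i j : Fin d} (o : Pt d) (k : Stp d) (hi : i ≠ k.1) (hj : j ≠ k.1) :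
    (swp i j o).ap o = o ∧ (swp i j o).ap (o + stp k) = o + stp k ∧ (swp i j o).ap (o - stp k) = o - stp k := by
  have h : ∀ l, stp k (Equiv.swap i j l) = stp k l := by
    intro l
    by_cases h1 : l = i
    · subst h1; simp [stp_other k hi, stp_other k hj]
    by_cases h2 : l = j
    · subst h2; simp [stp_other k hi, stp_other k hj]
    rw [Equiv.swap_apply_of_ne_of_ne h1 h2]
  refine ⟨?_, ?_, ?_⟩ <;> funext l <;> simp [swp, LS.ap, h] <;> ring

lemma refL_dimer {d : ℕ} (hd : 5 ≤ d) (o : Pt d) (k : Stp d) : RefL {o, o + stp k} k.1 where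
  line := Or.inl ⟨o, k, rfl⟩
  refl := by
    intro i
    refine ⟨rfl2 i (2 * o i + stp k i), ?_, rfl, by simp [rfl2], fun j hj => by simp [rfl2, hj]⟩
    unfold LS.im
    rw [Finset.image_insert, Finset.image_singleton]
    by_cases h : i = k.1
    · have h1 : (rfl2 i (2 * o i + stp k i)).ap o = o + stp k := by
        funext j; rw [rfl2_ap]; split_ifs with hj
        · subst hj; simp; ring
        · simp [stp_other k (h ▸ hj)]
      have h2 : (rfl2 i (2 * o i + stp k i)).ap (o + stp k) = o := by
        funext j; rw [rfl2_ap]; split_ifs with hj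
        · subst hj; simp; ring
        · simp [stp_other k (h ▸ hj)]
      rw [h1, h2, Finset.pair_comm]
    · have h1 : (rfl2 i (2 * o i + stp k i)).ap o = o := by
        funext j; rw [rfl2_ap]; split_ifs with hj
        · subst hj; simp [stp_other k h]; ring
        · rfl
      have h2 : (rfl2 i (2 * o i + stp k i)).ap (o + stp k) = o + stp k := by
        funext j; rw [rfl2_ap]; split_ifs with hj
        · subst hj; simp [stp_other k h]; ring
        · rfl
      rw [h1, h2]
  swap := by
    intro i j hi hj
    refine ⟨swp i j o, ?_, rfl, fun _ => rfl⟩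
    obtain ⟨h1, h2, h3⟩ := swp_fix o k hi hj
    unfold LS.im
    rw [Finset.image_insert, Finset.image_singleton, h1, h2]
  qz := by
    intro i hi
    unfold qq
    simp only [mean_dimer, ctr_apply, Pi.add_apply, stp_other k hi]; push_cast; ring
  pos := by
    haveI : Nontrivial (Fin d) := Fin.nontrivial_iff_two_le.2 (by omega)
    obtain ⟨b, hb⟩ := exists_ne k.1
    refine ⟨b, hb, ?_, ?_⟩
    · refine dimer_reach hd o k (b, true) hb (fun B => qq_nonneg _ _) ?_
      unfold qq
      simp only [mean_dimer, ctr_apply, Pi.add_apply, stp_other k hb]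
      simp [stp]; ring_nf; norm_num
    · refine dimer_reach hd o k (b, true) hb (fun B => sq_nonneg _) ?_
      simp only [mean_dimer, ctr_apply, Pi.add_apply, stp_other k hb]
      simp [stp]; ring_nf; norm_num

lemma refL_trimer {d : ℕ} (hd : 5 ≤ d) (o : Pt d) (k : Stp d) : RefL {o - stp k, o, o + stp k} k.1 where
  line := Or.inr ⟨o, k, rfl⟩
  refl := by
    intro i
    refine ⟨rfl2 i (2 * o i), ?_, rfl, by simp [rfl2], fun j hj => by simp [rfl2, hj]⟩
    unfold LS.im
    rw [Finset.image_insert, Finset.image_insert, Finset.image_singleton]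
    have h0 : (rfl2 i (2 * o i)).ap o = o := by
      funext j; rw [rfl2_ap]; split_ifs with hj
      · subst hj; ring
      · rfl
    by_cases h : i = k.1
    · have h1 : (rfl2 i (2 * o i)).ap (o - stp k) = o + stp k := by
        funext j; rw [rfl2_ap]; split_ifs with hj
        · subst hj; simp; ring
        · simp [stp_other k (h ▸ hj)]
      have h2 : (rfl2 i (2 * o i)).ap (o + stp k) = o - stp k := by
        funext j; rw [rfl2_ap]; split_ifs with hj
        · subst hj; simp; ring
        · simp [stp_other k (h ▸ hj)]
      rw [h0, h1, h2, rev3]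
    · have h1 : (rfl2 i (2 * o i)).ap (o - stp k) = o - stp k := by
        funext j; rw [rfl2_ap]; split_ifs with hj
        · subst hj; simp [stp_other k h]; ring
        · rfl
      have h2 : (rfl2 i (2 * o i)).ap (o + stp k) = o + stp k := by
        funext j; rw [rfl2_ap]; split_ifs with hj
        · subst hj; simp [stp_other k h]; ring
        · rfl
      rw [h0, h1, h2]
  swap := by
    intro i j hi hj
    refine ⟨swp i j o, ?_, rfl, fun _ => rfl⟩
    obtain ⟨h1, h2, h3⟩ := swp_fix o k hi hj
    unfold LS.im
    rw [Finset.image_insert, Finset.image_insert, Finset.image_singleton, h1, h2, h3]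
  qz := by
    intro i hi
    unfold qq
    simp only [mean_trimer, ctr_apply, Pi.add_apply, Pi.sub_apply, stp_other k hi]; push_cast; ring
  pos := by
    haveI : Nontrivial (Fin d) := Fin.nontrivial_iff_two_le.2 (by omega)
    obtain ⟨b, hb⟩ := exists_ne k.1
    have hN : ({o - stp k, o, o + stp k} : Finset (Pt d)).Nonempty := ⟨o, by simp⟩
    refine ⟨b, hb, ?_, ?_⟩
    · refine trimer_reach hd o k (b, true) hb (fun B => qq_nonneg _ _) (BB_qq hN _ _) ?_
      unfold qq
      simp only [mean_trimer, ctr_apply, Pi.add_apply, Pi.sub_apply, stp_other k hb]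
      simp [stp]; ring_nf; norm_num
    · refine trimer_reach hd o k (b, true) hb (fun B => sq_nonneg _) (by simp_rw [sq]; exact (BB_ctr hN b).mul (BB_ctr hN b)) ?_
      simp only [mean_trimer, ctr_apply, Pi.add_apply, Pi.sub_apply, stp_other k hb]
      simp [stp]; ring_nf; norm_num

/-- symmetry taking the direction `k0` to `k` -/
def toK {d : ℕ} (k0 k : Stp d) (o : Pt d) : LS d where
  perm := Equiv.swap k0.1 k.1
  sg := fun i => if i = k.1 then stp k k.1 * stp k0 k0.1 else 1
  hsg := by
    intro j; by_cases h : j = k.1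
    · rcases stp_same k with a | a <;> rcases stp_same k0 with b | b <;> simp [h, a, b]
    · simp [h]
  tr := o

lemma toK_ap {d : ℕ} (k0 k : Stp d) (o : Pt d) : (toK k0 k o).ap 0 = o ∧ (toK k0 k o).ap (0 + stp k0) = o + stp k ∧
    (toK k0 k o).ap (0 - stp k0) = o - stp k := by
  have h : ∀ i, (if i = k.1 then stp k k.1 * stp k0 k0.1 else 1) * stp k0 (Equiv.swap k0.1 k.1 i) = stp k i := by
    intro i
    split_ifs with h
    · subst h; rw [Equiv.swap_apply_right]; rcases stp_same k0 with b | b <;> simp [b]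
    · rw [stp_other k h, stp_other k0, mul_zero]
      intro h2
      apply h
      have := congrArg (Equiv.swap k0.1 k.1) h2
      rwa [Equiv.swap_apply_self, Equiv.swap_apply_left] at this
  refine ⟨?_, ?_, ?_⟩ <;> funext i
  · simp [toK, LS.ap]
  · rw [zero_add]; simp only [toK, LS.ap, Pi.add_apply, h]
  · rw [zero_sub]; simp only [toK, LS.ap, Pi.neg_apply, Pi.sub_apply, mul_neg, h]; ring

/-- uniform second-moment claim for lines -/
lemma line_claim {d : ℕ} (hd : 5 ≤ d) : ∃ (tau : ℕ → ℝ) (c1 : ℝ), (∀ m, 0 ≤ tau m) ∧ 0 < c1 ∧ ∀ A : Finset (Pt d), Line A →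
    (∀ i, m1 A i = 0) ∧ (∀ i j, i ≠ j → mu (tau A.card) A i j = 0) ∧
      (∀ i, c1 ≤ (∑ j, mu (tau A.card) A j j) / 2 - 3/2 * mu (tau A.card) A i i) := by
  set k0 : Stp d := (⟨0, by omega⟩, true)
  obtain ⟨t2, c2, ht2, hc2, a1, a2, a3⟩ := (refL_dimer hd 0 k0).claim hd
  obtain ⟨t3, c3, ht3, hc3, b1, b2, b3⟩ := (refL_trimer hd 0 k0).claim hd
  have key : ∀ (g : LS d) (B : Finset (Pt d)) (τ c : ℝ), B.Nonempty → (∀ i, m1 B i = 0) → (∀ i j, i ≠ j → mu τ B i j = 0) →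
      (∀ i, c ≤ (∑ j, mu τ B j j) / 2 - 3/2 * mu τ B i i) → (∀ i, m1 (g.im B) i = 0) ∧ (∀ i j, i ≠ j → mu τ (g.im B) i j = 0) ∧
      (∀ i, c ≤ (∑ j, mu τ (g.im B) j j) / 2 - 3/2 * mu τ (g.im B) i i) := by
    intro g B τ c hB h1 h2 h3
    have hs : ∀ i, (g.sg i : ℝ) * g.sg i = 1 := by
      intro i; rcases g.hsg i with h | h <;> rw [h] <;> norm_num
    refine ⟨fun i => by rw [m1_im (by omega) g hB, h1, mul_zero], fun i j hij => ?_, fun i => ?_⟩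
    · rw [mu_im (by omega) g hB, h2 _ _ (fun h => hij (g.perm.injective h)), mul_zero]
    · simp_rw [mu_im (by omega) g hB, hs, one_mul]
      rw [Equiv.sum_comp g.perm (fun j => mu τ B j j)]; exact h3 _
  refine ⟨fun m => if m = 2 then t2 else t3, min c2 c3, fun m => by dsimp only; split_ifs <;> assumption, lt_min hc2 hc3, ?_⟩
  rintro A (⟨o, k, rfl⟩ | ⟨o, k, rfl⟩)
  · have e : (toK k0 k o).im {0, 0 + stp k0} = {o, o + stp k} := by
      obtain ⟨h1, h2, h3⟩ := toK_ap k0 k o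
      unfold LS.im; rw [Finset.image_insert, Finset.image_singleton, h1, h2]
    rw [card_dimer]; simp only [if_true]
    have := key (toK k0 k o) _ _ _ ⟨0, by simp⟩ a1 a2 a3
    rw [e] at this
    exact ⟨this.1, this.2.1, fun i => (min_le_left _ _).trans (this.2.2 i)⟩
  · have e : (toK k0 k o).im {0 - stp k0, 0, 0 + stp k0} = {o - stp k, o, o + stp k} := by
      obtain ⟨h1, h2, h3⟩ := toK_ap k0 k o
      unfold LS.im; rw [Finset.image_insert, Finset.image_insert, Finset.image_singleton, h1, h2, h3]
    rw [card_trimer]; simp only [if_neg (by norm_num : ¬ (3:ℕ) = 2)]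
    have := key (toK k0 k o) _ _ _ ⟨0, by simp⟩ b1 b2 b3
    rw [e] at this
    exact ⟨this.1, this.2.1, fun i => (min_le_right _ _).trans (this.2.2 i)⟩

lemma FL_bd {d : ℕ} {L : Finset (Pt d)} (hL : L.Nonempty) (τ : ℝ) (v : Eu d) : 0 ≤ FL τ L v ∧ FL τ L v ≤ 1 := by
  unfold FL
  constructor
  · have := mean_mono (L := L) (f := fun _ => 0) (g := fun x => FF (pt τ L x - v)) fun x _ => (FF_pos _).le
    rwa [mean_const hL] at this
  · have := mean_mono (L := L) (g := fun _ => 1) (f := fun x => FF (pt τ L x - v)) fun x _ => FF_le_one _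
    rwa [mean_const hL] at this

lemma BB_TL {d : ℕ} {A : Finset (Pt d)} (hA : A.Nonempty) (τ : ℝ) (X : Eu d) : BB A (TL τ A X) := by
  unfold TL
  refine ((((BB.const _).add (BB.sum _ _ fun i => ?_)).add (BB.sum _ _ fun i => ?_)).add (BB.sum _ _ fun i => BB.sum _ _ fun j => ?_))
  · exact (BB.const _).mul (BB_ctr hA i)
  · exact (BB.const _).mul (BB_MM hA τ i i)
  · exact (BB.const _).mul (BB_MM hA τ i j)

lemma Rp_TL {d : ℕ} (hd : 5 ≤ d) {A : Finset (Pt d)} (hA : Shp A) (τ : ℝ) (X : Eu d) :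
    Rp (TL τ A X) A = FF X + (∑ i, (-(FF X^3 * X i)) * m1 A i) + (∑ i, (-(FF X^3/2)) * Rp (MM τ A i i) A)
    + ∑ i, ∑ j, (3/2 * FF X^5 * X i * X j) * Rp (MM τ A i j) A := by
  have hN := hA.nonempty
  have b1 : ∀ i : Fin d, BB A (fun L => (-(FF X^3 * X i)) * (ctr L i - ctr A i)) := fun i => (BB.const _).mul (BB_ctr hN i)
  have b2 : ∀ i : Fin d, BB A (fun L => (-(FF X^3/2)) * MM τ A i i L) := fun i => (BB.const _).mul (BB_MM hN τ i i)
  have b3 : ∀ i j : Fin d, BB A (fun L => (3/2 * FF X^5 * X i * X j) * MM τ A i j L) := fun i j => (BB.const _).mul (BB_MM hN τ i j)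
  have b3' : ∀ i : Fin d, BB A (fun L => ∑ j, (3/2 * FF X^5 * X i * X j) * MM τ A i j L) := fun i => BB.sum _ _ fun j => b3 i j
  unfold TL
  rw [Rp_add hd hA (((BB.const _).add (BB.sum _ _ b1)).add (BB.sum _ _ b2)) (BB.sum _ _ b3'),
    Rp_add hd hA ((BB.const _).add (BB.sum _ _ b1)) (BB.sum _ _ b2), Rp_add hd hA (BB.const _) (BB.sum _ _ b1),
    Rp_const hd hA, Rp_sum hd hA _ _ b1, Rp_sum hd hA _ _ b2, Rp_sum hd hA _ _ b3']
  congr 1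
  · congr 1
    · congr 1
      exact Finset.sum_congr rfl fun i _ => Rp_mul _ _ _
    · exact Finset.sum_congr rfl fun i _ => Rp_mul _ _ _
  · refine Finset.sum_congr rfl fun i _ => ?_
    rw [Rp_sum hd hA _ _ (b3 i)]
    exact Finset.sum_congr rfl fun i _ => Rp_mul _ _ _

lemma TL_drift {d : ℕ} (hd : 5 ≤ d) {A : Finset (Pt d)} (hA : Shp A) {τ c1 : ℝ} (X : Eu d) (hc : 0 < c1)
    (h1 : ∀ i, m1 A i = 0) (h2 : ∀ i j, i ≠ j → mu τ A i j = 0)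
    (h3 : ∀ i, c1 ≤ (∑ j, mu τ A j j) / 2 - 3/2 * mu τ A i i) :
    Rp (TL τ A X) A ≤ TL τ A X A - c1 * FF X^3 := by
  have hF := FF_pos X
  set S := ∑ j, mu τ A j j with hS
  have hS2 : c1 ≤ S / 2 := by
    have := Finset.sum_le_sum (s := Finset.univ) fun i (_ : i ∈ Finset.univ) => h3 i
    rw [Finset.sum_sub_distrib, ← Finset.mul_sum, ← hS] at this
    simp only [Finset.sum_const, Finset.card_univ, Fintype.card_fin, nsmul_eq_mul] at this
    have hdR : (5:ℝ) ≤ d := by exact_mod_cast hd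
    nlinarith
  have e : Rp (TL τ A X) A - TL τ A X A = -(FF X^3/2) * S + ∑ i, (3/2 * FF X^5 * (X i)^2) * mu τ A i i := by
    rw [Rp_TL hd hA, hS, Finset.mul_sum]
    unfold TL
    have e1 : ∑ i, (-(FF X^3 * X i)) * m1 A i = 0 := Finset.sum_eq_zero fun i _ => by rw [h1, mul_zero]
    have e2 : ∑ i, (-(FF X^3 * X i)) * (ctr A i - ctr A i) = 0 := Finset.sum_eq_zero fun i _ => by rw [sub_self, mul_zero]
    have e3 : ∀ i, ∑ j, (3/2 * FF X^5 * X i * X j) * Rp (MM τ A i j) A =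
        ∑ j, (3/2 * FF X^5 * X i * X j) * MM τ A i j A + (3/2 * FF X^5 * (X i)^2) * mu τ A i i := by
      intro i
      rw [← sub_eq_iff_eq_add', ← Finset.sum_sub_distrib, Finset.sum_eq_single i]
      · unfold mu; ring
      · intro j _ hj
        have := h2 i j hj.symm
        unfold mu at this
        rw [← mul_sub, this, mul_zero]
      · simp
    rw [e1, e2]
    simp_rw [e3]
    rw [Finset.sum_add_distrib]
    have e4 : ∑ i, (-(FF X^3/2)) * Rp (MM τ A i i) A = ∑ i, (-(FF X^3/2)) * MM τ A i i A + ∑ i, (-(FF X^3/2)) * mu τ A i i := by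
      rw [← Finset.sum_add_distrib]; exact Finset.sum_congr rfl fun i _ => by unfold mu; ring
    rw [e4]; ring
  have hb : ∑ i, (3/2 * FF X^5 * (X i)^2) * mu τ A i i ≤ ∑ i, FF X^5 * (X i)^2 * (S/2 - c1) := by
    refine Finset.sum_le_sum fun i _ => ?_
    have := h3 i
    have h0 : 0 ≤ FF X^5 * (X i)^2 := by positivity
    nlinarith
  have hs : ∑ i, FF X^5 * (X i)^2 * (S/2 - c1) = FF X^5 * ‖X‖^2 * (S/2 - c1) := by
    rw [← Finset.sum_mul, ← Finset.mul_sum, EuclideanSpace.norm_sq_eq]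
    simp only [Real.norm_eq_abs, sq_abs]
  have hsq := FF_sq X
  have : FF X^5 * ‖X‖^2 ≤ FF X^3 := by
    have : FF X^5 * ‖X‖^2 = FF X^3 * (1 - FF X^2) := by rw [← hsq]; ring
    rw [this]; nlinarith [pow_pos hF 3, pow_pos hF 2]
  nlinarith [mul_le_mul_of_nonneg_right this (by linarith : 0 ≤ S/2 - c1)]

lemma line_diam {d : ℕ} {A : Finset (Pt d)} (hA : Line A) : diam0 d A ≤ 2 := by
  refine diam_le hA.shp.nonempty ?_
  have hz : ∀ k : Stp d, ‖emb (stp k)‖ = 1 := norm_stp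
  rcases hA with ⟨o, k, rfl⟩ | ⟨o, k, rfl⟩
  · intro x hx y hy
    simp only [Finset.mem_insert, Finset.mem_singleton] at hx hy
    rcases hx with rfl | rfl <;> rcases hy with rfl | rfl <;> simp [emb_add, hz]
  · have h2 : ‖(2:ℝ) • emb (stp k)‖ ≤ 2 := by rw [norm_smul, hz]; norm_num
    have e1 : emb (o - stp k) - emb (o + stp k) = - ((2:ℝ) • emb (stp k)) := by rw [emb_add, emb_sub, two_smul]; abel
    have e2 : emb (o + stp k) - emb (o - stp k) = (2:ℝ) • emb (stp k) := by rw [emb_add, emb_sub, two_smul]; abel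
    intro x hx y hy
    simp only [Finset.mem_insert, Finset.mem_singleton] at hx hy
    rcases hx with rfl | rfl | rfl <;> rcases hy with rfl | rfl | rfl <;>
      first
      | (rw [e1, norm_neg]; exact h2)
      | (rw [e2]; exact h2)
      | simp [emb_add, emb_sub, hz]

/-- drift of the line functional -/
lemma line_drift {d : ℕ} (hd : 5 ≤ d) : ∃ (tau : ℕ → ℝ) (c1 C : ℝ), (∀ m, 0 ≤ tau m) ∧ 0 < c1 ∧ 0 ≤ C ∧
    ∀ (A : Finset (Pt d)) (v : Eu d), Line A →
      Rp (fun L => FL (tau L.card) L v) A ≤ FL (tau A.card) A v - c1 * FF (ctr A - v)^3 + C * FF (ctr A - v)^4 := by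
  obtain ⟨tau, c1, ht, hc1, hcl⟩ := line_claim hd
  obtain ⟨CR, hCR, hR⟩ := Rp_bound hd 7
  set T := tau 2 + tau 3 with hT
  have hT0 : 0 ≤ T := add_nonneg (ht 2) (ht 3)
  set K0 := 1 + (1 + 2*T) * 3 with hK0
  have hK00 : 0 ≤ K0 := by positivity
  refine ⟨tau, c1, 4 * K0^7 * CR + 4 * K0^7, ht, hc1, by positivity, fun A v hA => ?_⟩
  have hS := hA.shp
  have hN := hS.nonempty
  obtain ⟨h1, h2, h3⟩ := hcl A hA
  set τ := tau A.card with hτ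
  have hτ0 : 0 ≤ τ := ht _
  have hτT : τ ≤ T := by
    rcases hS.1 with h | h <;> rw [hτ, h, hT]
    · linarith [ht 3]
    · linarith [ht 2]
  have hF := FF_pos (ctr A - v)
  have hnear : ∀ t L, Rch t A L → ∀ x ∈ L, ‖pt τ L x - ctr A‖ ≤ (1 + 2*T) * (t + 2) := by
    intro t L hr x hx
    refine (pt_near (hr.nonempty hN) hτ0 (fun x hx => hr.near_ctr hx) hx).trans ?_
    have := line_diam hA
    have h0 := diam_nonneg hN
    have : (t:ℝ) + diam0 d A ≤ t + 2 := by linarith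
    have h4 : (0:ℝ) ≤ t := Nat.cast_nonneg t
    gcongr
  have hD := TL_drift hd hS (ctr A - v) hc1 h1 h2 h3
  have happ : ∀ t L, Line L → Rch (t+1) A L → |FL (tau L.card) L v - TL τ A (ctr A - v) L| ≤
      (4 * K0^7 * FF (ctr A - v)^4) * ((1:ℝ) + t)^7 := by
    intro t L hL hr
    rw [hr.card, ← hτ]
    refine (FL_approx (hr.nonempty hN) v (hnear _ L hr)).trans ?_
    have h4 : (0:ℝ) ≤ t := Nat.cast_nonneg t
    have : 1 + (1 + 2*T) * (((t+1:ℕ):ℝ) + 2) ≤ K0 * (1 + t) := by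
      push_cast; rw [hK0]; nlinarith [mul_nonneg hT0 h4]
    have h5 : (1 + (1 + 2*T) * (((t+1:ℕ):ℝ) + 2))^7 ≤ (K0 * (1 + t))^7 := pow_le_pow_left₀ (by positivity) this 7
    rw [mul_pow] at h5
    calc _ ≤ 4 * (K0^7 * (1+t)^7) * FF (ctr A - v)^4 := by gcongr
      _ = _ := by ring
  have hbF : BB A (fun L => FL (tau L.card) L v) := BB.of_bdd (K := 1) fun L hL => by
    obtain ⟨a, b⟩ := FL_bd hL.shp.nonempty (tau L.card) v
    rw [abs_of_nonneg a]; exact b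
  have hbT := BB_TL hN τ (ctr A - v)
  have hE := hR A (fun L => FL (tau L.card) L v + (-1) * TL τ A (ctr A - v) L) (4 * K0^7 * FF (ctr A - v)^4) hS (by positivity)
    (fun t L a b => by
      have := happ t L a b
      rwa [show FL (tau L.card) L v + (-1) * TL τ A (ctr A - v) L = FL (tau L.card) L v - TL τ A (ctr A - v) L by ring])
  rw [Rp_add hd hS hbF ((BB.const _).mul hbT), Rp_mul] at hE
  have hself : |FL τ A v - TL τ A (ctr A - v) A| ≤ 4 * K0^7 * FF (ctr A - v)^4 := by
    have := FL_approx hN v (hnear 0 A rfl)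
    refine this.trans ?_
    have : 1 + (1 + 2*T) * (((0:ℕ):ℝ) + 2) ≤ K0 := by push_cast; rw [hK0]; linarith
    gcongr
  have a1 := (abs_le.1 hE).2
  have a2 := (abs_le.1 hself).1
  linarith

lemma mean_bd {d : ℕ} (L : Finset (Pt d)) {f : Pt d → ℝ} (h : ∀ x ∈ L, 0 ≤ f x ∧ f x ≤ 1) : 0 ≤ mean L f ∧ mean L f ≤ 1 := by
  rcases L.eq_empty_or_nonempty with rfl | hL
  · simp [mean]
  · constructor
    · have := mean_mono (L := L) (f := fun _ => 0) fun x hx => (h x hx).1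
      rwa [mean_const hL] at this
    · have := mean_mono (L := L) (g := fun _ => 1) fun x hx => (h x hx).2
      rwa [mean_const hL] at this

/-- pair functional on lines -/
noncomputable def F2 {d : ℕ} (tau : ℕ → ℝ) (L L' : Finset (Pt d)) : ℝ :=
  mean L' (fun y => FL (tau L.card) L (pt (tau L'.card) L' y))

lemma F2_bd {d : ℕ} (tau : ℕ → ℝ) (L L' : Finset (Pt d)) : 0 ≤ F2 tau L L' ∧ F2 tau L L' ≤ 1 :=
  mean_bd _ fun y _ => mean_bd _ fun x _ => ⟨(FF_pos _).le, FF_le_one _⟩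

lemma F2_comm {d : ℕ} (tau : ℕ → ℝ) (L L' : Finset (Pt d)) : F2 tau L L' = F2 tau L' L := by
  unfold F2 FL
  rw [mean_comm]
  refine mean_congr fun x _ => mean_congr fun y _ => ?_
  rw [← FF_neg, neg_sub]

/-- pair functional -/
noncomputable def W0 {d : ℕ} (tau : ℕ → ℝ) (A B : Finset (Pt d)) : ℝ := R (fun L' => R (fun L => F2 tau L L') A) B

lemma BB_F2 {d : ℕ} (tau : ℕ → ℝ) {A : Finset (Pt d)} (L' : Finset (Pt d)) : BB A (fun L => F2 tau L L') :=
  BB.of_bdd (K := 1) fun L _ => by rw [abs_of_nonneg (F2_bd _ _ _).1]; exact (F2_bd _ _ _).2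

lemma RF2_bd {d : ℕ} (hd : 5 ≤ d) (tau : ℕ → ℝ) {A : Finset (Pt d)} (hA : Shp A) (L' : Finset (Pt d)) :
    0 ≤ R (fun L => F2 tau L L') A ∧ R (fun L => F2 tau L L') A ≤ 1 := by
  refine ⟨R_nonneg (by omega) fun _ _ _ _ => (F2_bd _ _ _).1, ?_⟩
  rw [← R_const hd hA 1]
  exact R_mono hd hA (BB_F2 _ _) (BB.const _) fun _ _ _ _ => (F2_bd _ _ _).2

lemma BB_RF2 {d : ℕ} (hd : 5 ≤ d) (tau : ℕ → ℝ) {A B : Finset (Pt d)} (hA : Shp A) : BB B (fun L' => R (fun L => F2 tau L L') A) :=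
  BB.of_bdd (K := 1) fun L _ => by rw [abs_of_nonneg (RF2_bd hd _ hA _).1]; exact (RF2_bd hd _ hA _).2

lemma W0_comm {d : ℕ} (hd : 5 ≤ d) (tau : ℕ → ℝ) {A B : Finset (Pt d)} (hA : Shp A) (hB : Shp B) : W0 tau A B = W0 tau B A := by
  unfold W0
  rw [← R_comm hd hA hB (f := fun L L' => F2 tau L L') (fun L L' => F2_bd _ _ _)]
  exact congrArg (fun f => R f A) (funext fun L => congrArg (fun f => R f B) (funext fun L' => F2_comm tau L L'))

lemma W0_bd {d : ℕ} (hd : 5 ≤ d) (tau : ℕ → ℝ) {A B : Finset (Pt d)} (hA : Shp A) (hB : Shp B) : 0 ≤ W0 tau A B ∧ W0 tau A B ≤ 1 := by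
  refine ⟨R_nonneg (by omega) fun _ _ _ _ => (RF2_bd hd _ hA _).1, ?_⟩
  rw [← R_const hd hB 1]
  exact R_mono hd hB (BB_RF2 hd _ hA) (BB.const _) fun _ _ _ _ => (RF2_bd hd _ hA _).2

lemma pt_Rch {d : ℕ} {tau : ℕ → ℝ} (ht : ∀ m, 0 ≤ tau m) {A L : Finset (Pt d)} (hA : Shp A) {t : ℕ} (hr : Rch t A L) {x : Pt d} (hx : x ∈ L) :
    ‖pt (tau L.card) L x - ctr A‖ ≤ (1 + 2*(tau 2 + tau 3)) * (t + diam0 d A) := by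
  refine (pt_near (hr.nonempty hA.nonempty) (ht _) (fun x hx => hr.near_ctr hx) hx).trans ?_
  have h0 := diam_nonneg hA.nonempty
  have h4 : (0:ℝ) ≤ t := Nat.cast_nonneg t
  have : tau L.card ≤ tau 2 + tau 3 := by
    rw [hr.card]; rcases hA.1 with h | h <;> rw [h]
    · linarith [ht 3]
    · linarith [ht 2]
  gcongr

/-- moving `A` when it is not a line does not change the mean of `W0` -/
lemma W0_nonline {d : ℕ} (hd : 5 ≤ d) (tau : ℕ → ℝ) {A B : Finset (Pt d)} (hA : Shp A) (hB : Shp B) (hl : ¬ Line A) :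
    EU A (fun x y => W0 tau (mv A x y) B) = W0 tau A B := by
  have e : ∀ A', Shp A' → W0 tau A' B = R (fun L => R (fun L' => F2 tau L L') B) A' := fun A' h =>
    (R_comm hd h hB (f := fun L L' => F2 tau L L') (fun L L' => F2_bd _ _ _)).symm
  rw [e A hA, R_step hd hA hl]
  · exact EU_congr (by omega) fun x y a b c => e _ (hA.mv a b c)
  · rw [show (fun L => R (fun L' => F2 tau L L') B) = fun L => R (fun L' => F2 tau L' L) B from
      funext fun L => congrArg (fun f => R f B) (funext fun L' => F2_comm tau L L')]
    exact BB_RF2 hd tau hB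

lemma EU_R {d : ℕ} (hd : 5 ≤ d) {A B : Finset (Pt d)} (hB : Shp B) (f : Pt d → Pt d → Finset (Pt d) → ℝ)
    (hf : ∀ x y, x ∈ A → y ∈ nbF (A.erase x) → y ∉ A.erase x → BB B (f x y)) :
    EU A (fun x y => R (f x y) B) = R (fun L => EU A (fun x y => f x y L)) B := by
  classical
  unfold EU
  have hb : ∀ x y, BB B (fun L => pHAT d A x y * f x y L) := by
    intro x y
    by_cases h : pHAT d A x y = 0
    · simp_rw [h, zero_mul]; exact BB.const 0
    · obtain ⟨a, b, c⟩ := pHAT_ne_zero (by omega) h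
      exact (BB.const _).mul (hf x y a b c)
  rw [R_sum hd hB _ _ (fun x => BB.sum _ _ fun y => hb x y)]
  refine Finset.sum_congr rfl fun x _ => ?_
  rw [R_sum hd hB _ _ (fun y => hb x y)]
  exact Finset.sum_congr rfl fun y _ => (R_mul _ _ _).symm

lemma drift_aux {c1 C M F δ t z P : ℝ} (hc : 0 ≤ c1) (hC : 0 ≤ C) (hF : 0 ≤ F) (hz : 1 ≤ z) (hzM : z ≤ M * ((1 + δ) * (1 + t)))
    (h3 : -(24 * z^5 * F^4) ≤ P^3 - F^3) (hP : 0 ≤ P) (hp : P ≤ 2 * z * F) :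
    -(c1 * P^3) + C * P^4 ≤ -(c1 * F^3) + ((24 * c1 + 16 * C) * M^5 * (1 + δ)^5 * F^4) * (1 + t)^5 := by
  have h5 : z^5 ≤ M^5 * ((1 + δ)^5 * (1 + t)^5) := by
    have := pow_le_pow_left₀ (by linarith) hzM 5
    rwa [mul_pow, mul_pow] at this
  have h45 : z^4 ≤ z^5 := pow_le_pow_right₀ hz (by norm_num)
  have hF4 : 0 ≤ F^4 := by positivity
  have hp4 : P^4 ≤ 16 * z^5 * F^4 := by
    have h1 := pow_le_pow_left₀ hP hp 4
    have h2 : (2 * z * F)^4 = 16 * z^4 * F^4 := by ring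
    rw [h2] at h1
    nlinarith [mul_le_mul_of_nonneg_right h45 hF4]
  have h6 := mul_le_mul_of_nonneg_left hp4 hC
  have h7 := mul_le_mul_of_nonneg_left h3 hc
  have h8 := mul_le_mul_of_nonneg_left (mul_le_mul_of_nonneg_right h5 hF4) (by positivity : 0 ≤ 24 * c1 + 16 * C)
  nlinarith

set_option maxHeartbeats 1000000 in
lemma W0_line {d : ℕ} (hd : 5 ≤ d) {tau : ℕ → ℝ} {c1 C : ℝ} (ht : ∀ m, 0 ≤ tau m) (hc : 0 < c1) (hC : 0 ≤ C)
    (hdr : ∀ (A : Finset (Pt d)) (v : Eu d), Line A →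
      Rp (fun L => FL (tau L.card) L v) A ≤ FL (tau A.card) A v - c1 * FF (ctr A - v)^3 + C * FF (ctr A - v)^4) :
    ∃ C' : ℝ, 0 ≤ C' ∧ ∀ A B : Finset (Pt d), Line A → Shp B →
      EU A (fun x y => W0 tau (mv A x y) B) ≤ W0 tau A B - c1 * FF (ctr A - ctr B)^3 + C' * (1 + diam0 d B)^5 * FF (ctr A - ctr B)^4 := by
  obtain ⟨CR, hCR, hR⟩ := R_bound hd 5
  obtain ⟨M, hM⟩ : ∃ M, M = 1 + 2*(tau 2 + tau 3) := ⟨_, rfl⟩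
  have hM1 : 1 ≤ M := by have := ht 2; have := ht 3; linarith
  obtain ⟨K, hK⟩ : ∃ K, K = (24 * c1 + 16 * C) * M^5 := ⟨_, rfl⟩
  have hK0 : 0 ≤ K := by rw [hK]; positivity
  refine ⟨K * CR, by positivity, fun A B hA hB => ?_⟩
  have hS := hA.shp
  have hdB := diam_nonneg hB.nonempty
  have hFp := FF_pos (ctr A - ctr B)
  generalize hF : FF (ctr A - ctr B) = F at *
  -- pointwise estimate
  have key : ∀ t L', Line L' → Rch t B L' → EU A (fun x y => R (fun L => F2 tau L L') (mv A x y)) - F2 tau A L' + c1 * F^3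
      ≤ (K * (1 + diam0 d B)^5 * F^4) * ((1:ℝ) + t)^5 := by
    intro t L' hL' hr
    have h4 : (0:ℝ) ≤ t := Nat.cast_nonneg t
    have e1 : EU A (fun x y => R (fun L => F2 tau L L') (mv A x y)) =
        mean L' (fun y' => Rp (fun L => FL (tau L.card) L (pt (tau L'.card) L' y')) A) := by
      change Rp (fun L => F2 tau L L') A = _
      unfold F2 mean
      rw [Rp_mul, Rp_sum hd hS]
      intro y'
      exact BB.of_bdd (K := 1) fun L hL => by
        obtain ⟨a, b⟩ := FL_bd hL.shp.nonempty (tau L.card) (pt (tau L'.card) L' y')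
        rw [abs_of_nonneg a]; exact b
    have e2 : mean L' (fun y' => Rp (fun L => FL (tau L.card) L (pt (tau L'.card) L' y')) A) ≤
        mean L' (fun y' => FL (tau A.card) A (pt (tau L'.card) L' y') + (-c1 * F^3 + (K * (1 + diam0 d B)^5 * F^4) * ((1:ℝ) + t)^5)) := by
      refine mean_mono fun y' hy' => ?_
      refine (hdr A _ hA).trans ?_
      have hn := pt_Rch ht hB hr hy'
      generalize pt (tau L'.card) L' y' = v at *
      have ev : ctr A - v = (ctr A - ctr B) + (ctr B - v) := by abel
      have hD : ‖ctr B - v‖ ≤ M * (t + diam0 d B) := by rw [norm_sub_rev, hM]; exact hn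
      have hD1 : 1 + ‖ctr B - v‖ ≤ M * ((1 + diam0 d B) * (1 + t)) := by nlinarith [mul_nonneg h4 hdB]
      have h3 := FF_diff3 (ctr A - ctr B) (ctr B - v)
      have hp := FF_peetre (ctr A - ctr B) (ctr B - v)
      rw [← ev, hF] at h3 hp
      have := drift_aux hc.le hC hFp.le (by linarith [norm_nonneg (ctr B - v)]) hD1 (abs_le.1 h3).1 (FF_pos _).le hp
      rw [← hK] at this
      linarith
    rw [mean_add, mean_const (hr.nonempty hB.nonempty)] at e2
    rw [e1]
    unfold F2
    linarith
  have hbb : ∀ x y, x ∈ A → y ∈ nbF (A.erase x) → y ∉ A.erase x → BB B (fun L' => R (fun L => F2 tau L L') (mv A x y)) :=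
    fun x y a b c => BB_RF2 hd tau (hS.mv a b c)
  have e3 : EU A (fun x y => W0 tau (mv A x y) B) = R (fun L' => EU A (fun x y => R (fun L => F2 tau L L') (mv A x y))) B :=
    EU_R hd hB _ hbb
  have e4 : W0 tau A B = R (fun L' => F2 tau A L') B := by
    unfold W0; simp_rw [R_line hA]
  have hb1 : BB B (fun L' => EU A (fun x y => R (fun L => F2 tau L L') (mv A x y))) := by
    refine BB.of_bdd (K := 1) fun L' _ => ?_
    rw [abs_of_nonneg (EU_nonneg (by omega) fun x y a b c => (RF2_bd hd tau (hS.mv a b c) _).1), ← EU_const hd hS.two_le 1]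
    exact EU_mono (by omega) fun x y a b c => (RF2_bd hd tau (hS.mv a b c) _).2
  have hb2 : BB B (fun L' => F2 tau A L') := by
    rw [show (fun L' => F2 tau A L') = fun L' => F2 tau L' A from funext fun L' => F2_comm tau A L']; exact BB_F2 tau A
  have hb3 : BB B (fun L' => EU A (fun x y => R (fun L => F2 tau L L') (mv A x y)) + (-1) * F2 tau A L') :=
    hb1.add ((BB.const _).mul hb2)
  -- positive part
  have hpp : BB B (fun L' => max (EU A (fun x y => R (fun L => F2 tau L L') (mv A x y)) + (-1) * F2 tau A L' + c1 * F^3) 0) := by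
    obtain ⟨K', q, hK', h⟩ := hb3.add (BB.const (c1 * F^3))
    refine ⟨K', q, hK', fun t L a b => le_trans ?_ (h t L a b)⟩
    rw [abs_of_nonneg (le_max_right _ _)]
    exact max_le (le_abs_self _) (abs_nonneg _)
  have h1 := R_mono hd hB (hb3.add (BB.const (c1 * F^3))) hpp fun t L _ _ => le_max_left _ _
  have h2 := (hR B _ (K * (1 + diam0 d B)^5 * F^4) hB (by positivity) (fun t L a b => by
    have := key t L a b
    rw [abs_of_nonneg (le_max_right _ _)]
    refine max_le ?_ (by positivity)
    linarith : ∀ t L, Line L → Rch t B L → |max (EU A (fun x y => R (fun L' => F2 tau L' L) (mv A x y)) + (-1) * F2 tau A L + c1 * F^3) 0| ≤ _)).2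
  rw [R_add hd hB hb3 (BB.const _), R_add hd hB hb1 ((BB.const _).mul hb2), R_mul, R_const hd hB, ← e3, ← e4] at h1
  have h3 := le_abs_self (R (fun L' => max (EU A (fun x y => R (fun L => F2 tau L L') (mv A x y)) + (-1) * F2 tau A L' + c1 * F^3) 0) B)
  have : K * (1 + diam0 d B)^5 * F^4 * CR = K * CR * (1 + diam0 d B)^5 * F^4 := by ring
  linarith

/-- mean displacement on pairs of lines -/
noncomputable def NN {d : ℕ} (tau : ℕ → ℝ) (X : Eu d) (L L' : Finset (Pt d)) : ℝ :=
  mean L' (fun y => mean L (fun x => 1 + ‖pt (tau L.card) L x - pt (tau L'.card) L' y - X‖))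

lemma disp_le {d : ℕ} {tau : ℕ → ℝ} (ht : ∀ m, 0 ≤ tau m) {A B L L' : Finset (Pt d)} (hA : Shp A) (hB : Shp B) {t t' : ℕ}
    (hr : Rch t A L) (hr' : Rch t' B L') {x y : Pt d} (hx : x ∈ L) (hy : y ∈ L') :
    1 + ‖pt (tau L.card) L x - pt (tau L'.card) L' y - (ctr A - ctr B)‖ ≤
      (1 + 2*(tau 2 + tau 3)) * (1 + (diam0 d A + diam0 d B)) * (1 + t') * (1 + t) := by
  have h1 := pt_Rch ht hA hr hx
  have h2 := pt_Rch ht hB hr' hy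
  have e : pt (tau L.card) L x - pt (tau L'.card) L' y - (ctr A - ctr B) =
    (pt (tau L.card) L x - ctr A) - (pt (tau L'.card) L' y - ctr B) := by abel
  rw [e]
  have h3 := norm_sub_le (pt (tau L.card) L x - ctr A) (pt (tau L'.card) L' y - ctr B)
  have h0 := diam_nonneg hA.nonempty
  have h0' := diam_nonneg hB.nonempty
  have h4 : (0:ℝ) ≤ t := Nat.cast_nonneg t
  have h4' : (0:ℝ) ≤ t' := Nat.cast_nonneg t'
  have hM : 1 ≤ 1 + 2*(tau 2 + tau 3) := by have := ht 2; have := ht 3; linarith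
  generalize 1 + 2*(tau 2 + tau 3) = M at *
  generalize diam0 d A = a at *
  generalize diam0 d B = b at *
  have e2 : 1 + (t + a) + (t' + b) ≤ (1 + (a+b)) * (1 + t') * (1 + t) := by nlinarith [mul_nonneg h4 h4', mul_nonneg (add_nonneg h0 h0') h4, mul_nonneg (add_nonneg h0 h0') h4', mul_nonneg (mul_nonneg (add_nonneg h0 h0') h4') h4]
  nlinarith [mul_le_mul_of_nonneg_left e2 (by linarith : 0 ≤ M)]

lemma NN_bd {d : ℕ} {tau : ℕ → ℝ} (ht : ∀ m, 0 ≤ tau m) {A B L L' : Finset (Pt d)} (hA : Shp A) (hB : Shp B) {t t' : ℕ}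
    (hr : Rch t A L) (hr' : Rch t' B L') :
    |NN tau (ctr A - ctr B) L L'| ≤ (1 + 2*(tau 2 + tau 3)) * (1 + (diam0 d A + diam0 d B)) * (1 + t') * (1 + t) := by
  have h0 : 0 ≤ NN tau (ctr A - ctr B) L L' := by
    unfold NN mean; positivity
  rw [abs_of_nonneg h0]
  refine (mean_mono (g := fun _ => (1 + 2*(tau 2 + tau 3)) * (1 + (diam0 d A + diam0 d B)) * (1 + t') * (1 + t)) fun y hy => ?_).trans
    (mean_const (hr'.nonempty hB.nonempty) _).le
  exact (mean_mono fun x hx => disp_le ht hA hB hr hr' hx hy).trans (mean_const (hr.nonempty hA.nonempty) _).le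

lemma F2_lower {d : ℕ} (tau : ℕ → ℝ) (X : Eu d) {L L' : Finset (Pt d)} (hL : L.Nonempty) (hL' : L'.Nonempty) {m : ℝ} (hm : 0 < m) :
    FF X / m + (-(FF X / (2*m^2))) * NN tau X L L' ≤ F2 tau L L' := by
  unfold NN F2 FL
  rw [← mean_mul]
  rw [← mean_const hL' (FF X / m), ← mean_add]
  refine mean_mono fun y hy => ?_
  rw [← mean_mul, ← mean_const hL (FF X / m), ← mean_add]
  refine mean_mono fun x hx => ?_
  have h := FF_peetre' X (pt (tau L.card) L x - pt (tau L'.card) L' y)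
  rw [norm_sub_rev] at h
  have hF := FF_pos X
  have hn := norm_nonneg (pt (tau L.card) L x - pt (tau L'.card) L' y - X)
  generalize FF (pt (tau L.card) L x - pt (tau L'.card) L' y) = P at *
  generalize ‖pt (tau L.card) L x - pt (tau L'.card) L' y - X‖ = z at *
  have h2 : FF X / (2 * (1+z)) ≤ P := by rw [div_le_iff₀ (by positivity)]; linarith
  refine le_trans ?_ h2
  have : FF X / (2 * (1+z)) - (FF X / m + (-(FF X / (2*m^2))) * (1 + z)) = FF X * ((1+z) - m)^2 / (2 * m^2 * (1+z)) := by
    field_simp; ring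
  have h3 : 0 ≤ FF X * ((1+z) - m)^2 / (2 * m^2 * (1+z)) := by positivity
  linarith

lemma W0_lower {d : ℕ} (hd : 5 ≤ d) {tau : ℕ → ℝ} (ht : ∀ m, 0 ≤ tau m) : ∃ C : ℝ, 1 ≤ C ∧ ∀ A B : Finset (Pt d), Shp A → Shp B →
    FF (ctr A - ctr B) ≤ C * (1 + (diam0 d A + diam0 d B)) * W0 tau A B := by
  obtain ⟨CR, hCR, hR⟩ := R_bound hd 1
  have hM : 1 ≤ 1 + 2*(tau 2 + tau 3) := by have := ht 2; have := ht 3; linarith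
  refine ⟨2 * ((1 + 2*(tau 2 + tau 3)) * CR * CR), by nlinarith [mul_le_mul hCR hCR (by norm_num) (by linarith)], fun A B hA hB => ?_⟩
  have hF := FF_pos (ctr A - ctr B)
  have h0 := diam_nonneg hA.nonempty
  have h0' := diam_nonneg hB.nonempty
  obtain ⟨m, hm⟩ : ∃ m, m = (1 + 2*(tau 2 + tau 3)) * CR * CR * (1 + (diam0 d A + diam0 d B)) := ⟨_, rfl⟩
  have hm0 : 0 < m := by rw [hm]; positivity
  have b1 : ∀ t' L', Line L' → Rch t' B L' → BB A (fun L => NN tau (ctr A - ctr B) L L') := fun t' L' _ hr' =>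
    ⟨(1 + 2*(tau 2 + tau 3)) * (1 + (diam0 d A + diam0 d B)) * (1 + t'), 1, by positivity, fun t L _ hr => by
      rw [pow_one]; exact NN_bd ht hA hB hr hr'⟩
  have i1 : ∀ t' L', Line L' → Rch t' B L' → |R (fun L => NN tau (ctr A - ctr B) L L') A| ≤
      ((1 + 2*(tau 2 + tau 3)) * (1 + (diam0 d A + diam0 d B)) * CR) * ((1:ℝ) + t')^1 := by
    intro t' L' _ hr'
    refine ((hR A _ ((1 + 2*(tau 2 + tau 3)) * (1 + (diam0 d A + diam0 d B)) * (1 + t')) hA (by positivity) fun t L _ hr => by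
      rw [pow_one]; exact NN_bd ht hA hB hr hr').2).trans (le_of_eq (by ring))
  have b2 : BB B (fun L' => R (fun L => NN tau (ctr A - ctr B) L L') A) :=
    ⟨_, 1, by positivity, i1⟩
  have i2 := (hR B _ _ hB (by positivity) i1).2
  have j1 : ∀ t' L', Line L' → Rch t' B L' → FF (ctr A - ctr B) / m + (-(FF (ctr A - ctr B) / (2*m^2))) * R (fun L => NN tau (ctr A - ctr B) L L') A
      ≤ R (fun L => F2 tau L L') A := by
    intro t' L' hL' hr'
    rw [← R_mul, ← R_const hd hA (FF (ctr A - ctr B) / m), ← R_add hd hA (BB.const _) ((BB.const _).mul (b1 t' L' hL' hr'))]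
    refine R_mono hd hA ((BB.const _).add ((BB.const _).mul (b1 t' L' hL' hr'))) (BB_F2 _ _) fun t L hL hr => ?_
    exact F2_lower tau _ hL.shp.nonempty hL'.shp.nonempty hm0
  have j2 := R_mono hd hB ((BB.const _).add ((BB.const _).mul b2)) (BB_RF2 hd tau hA) j1
  rw [R_add hd hB (BB.const _) ((BB.const _).mul b2), R_mul, R_const hd hB] at j2
  change _ ≤ W0 tau A B at j2
  have i3 : R (fun L' => R (fun L => NN tau (ctr A - ctr B) L L') A) B ≤ m := by
    refine ((le_abs_self _).trans i2).trans (le_of_eq ?_); rw [hm]; ring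
  have e : FF (ctr A - ctr B) / m - FF (ctr A - ctr B) / (2*m^2) * m = FF (ctr A - ctr B) / (2*m) := by field_simp; ring
  have h5 : FF (ctr A - ctr B) / (2*m) ≤ W0 tau A B := by
    have : FF (ctr A - ctr B) / (2*m^2) * R (fun L' => R (fun L => NN tau (ctr A - ctr B) L L') A) B ≤ FF (ctr A - ctr B) / (2*m^2) * m :=
      mul_le_mul_of_nonneg_left i3 (by positivity)
    linarith
  rw [div_le_iff₀ (by positivity)] at h5
  refine h5.trans (le_of_eq ?_); rw [hm]; ring

lemma W0_upper {d : ℕ} (hd : 5 ≤ d) {tau : ℕ → ℝ} (ht : ∀ m, 0 ≤ tau m) : ∃ C : ℝ, 1 ≤ C ∧ ∀ A B : Finset (Pt d), Shp A → Shp B →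
    W0 tau A B ≤ C * (1 + (diam0 d A + diam0 d B)) * FF (ctr A - ctr B) := by
  obtain ⟨CR, hCR, hR⟩ := R_bound hd 1
  have hM : 1 ≤ 1 + 2*(tau 2 + tau 3) := by have := ht 2; have := ht 3; linarith
  refine ⟨2 * ((1 + 2*(tau 2 + tau 3)) * CR * CR), by nlinarith [mul_le_mul hCR hCR (by norm_num) (by linarith)], fun A B hA hB => ?_⟩
  have hF := FF_pos (ctr A - ctr B)
  have h0 := diam_nonneg hA.nonempty
  have h0' := diam_nonneg hB.nonempty
  have i0 : ∀ t' L', Line L' → Rch t' B L' → ∀ t L, Line L → Rch t A L → |F2 tau L L'| ≤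
      (2 * FF (ctr A - ctr B) * (1 + 2*(tau 2 + tau 3)) * (1 + (diam0 d A + diam0 d B)) * (1 + t')) * ((1:ℝ) + t)^1 := by
    intro t' L' hL' hr' t L hL hr
    rw [abs_of_nonneg (F2_bd _ _ _).1]
    unfold F2 FL
    refine (mean_mono fun y hy => (mean_mono fun x hx => ?_).trans (mean_const hL.shp.nonempty _).le).trans (mean_const hL'.shp.nonempty _).le
    refine (FF_peetre' _ (ctr A - ctr B)).trans ?_
    have := disp_le ht hA hB hr hr' hx hy
    nlinarith
  have i1 : ∀ t' L', Line L' → Rch t' B L' → |R (fun L => F2 tau L L') A| ≤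
      (2 * FF (ctr A - ctr B) * (1 + 2*(tau 2 + tau 3)) * (1 + (diam0 d A + diam0 d B)) * CR) * ((1:ℝ) + t')^1 := by
    intro t' L' hL' hr'
    exact ((hR A _ _ hA (by positivity) (i0 t' L' hL' hr')).2).trans (le_of_eq (by ring))
  have i2 := (hR B _ _ hB (by positivity) i1).2
  refine ((le_abs_self _).trans i2).trans (le_of_eq (by ring))

lemma ctr_mv {d : ℕ} {A : Finset (Pt d)} (hA : Shp A) {x y : Pt d} (a : x ∈ A) (b : y ∈ nbF (A.erase x)) (c : y ∉ A.erase x) :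
    ‖ctr (mv A x y) - ctr A‖ ≤ 1 + diam0 d A := by
  have hr : Rch 1 A (mv A x y) := ⟨x, y, a, b, c, rfl⟩
  refine ctr_near (hA.mv a b c).nonempty fun z hz => (hr.near_ctr hz).trans (by simp)

set_option maxHeartbeats 2000000 in
/-- the pair Lyapunov function -/
lemma pair_fn {d : ℕ} (hd : 5 ≤ d) : ∃ (W : Finset (Pt d) → Finset (Pt d) → ℝ) (c C : ℝ), 0 < c ∧ 1 ≤ C ∧
    ∀ A B : Finset (Pt d), Shp A → Shp B →
      W A B = W B A ∧ 0 ≤ W A B ∧ W A B ≤ C ∧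
      FF (ctr A - ctr B) ≤ C * (1 + (diam0 d A + diam0 d B)) * W A B ∧
      W A B ≤ C * (1 + (diam0 d A + diam0 d B)) * FF (ctr A - ctr B) ∧
      EU A (fun x y => W (mv A x y) B) ≤ W A B - c * FF (ctr A - ctr B)^3 +
        C * (1 + (diam0 d A + diam0 d B))^5 * FF (ctr A - ctr B)^4 := by
  obtain ⟨tau, c1, C1, ht, hc1, hC1, hdr⟩ := line_drift hd
  obtain ⟨C2, hC2, hl⟩ := W0_line hd ht hc1 hC1 hdr
  obtain ⟨C3, hC3, hlow⟩ := W0_lower hd ht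
  obtain ⟨C4, hC4, hup⟩ := W0_upper hd ht
  obtain ⟨g, hg0, hg1, hG⟩ := Gc_drift hd
  have hGb := fun A => Gc_bd (d := d) hg0.le hg1 A
  refine ⟨fun A B => W0 tau A B + (c1/4) * (Gc g A + Gc g B) * FF (ctr A - ctr B)^3, min (3*c1/4) (c1*g^2/8),
    C2 + C3 + C4 + 1 + c1 + 24 * 32 * c1, by positivity, by nlinarith, fun A B hA hB => ?_⟩
  have hF := FF_pos (ctr A - ctr B)
  have hF1 := FF_le_one (ctr A - ctr B)
  have h0 := diam_nonneg hA.nonempty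
  have h0' := diam_nonneg hB.nonempty
  obtain ⟨gA1, gA2⟩ := hGb A
  obtain ⟨gB1, gB2⟩ := hGb B
  have hFs : FF (ctr B - ctr A) = FF (ctr A - ctr B) := by rw [← FF_neg, neg_sub]
  obtain ⟨w1, w2⟩ := W0_bd hd tau hA hB
  have hlw := hlow A B hA hB
  have hupp := hup A B hA hB
  have hF31 : FF (ctr A - ctr B)^3 ≤ FF (ctr A - ctr B) := by
    have := pow_le_pow_of_le_one hF.le hF1 (show 1 ≤ 3 by norm_num); simpa using this
  have hF3 : 0 < FF (ctr A - ctr B)^3 := by positivity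
  have hF4 : 0 < FF (ctr A - ctr B)^4 := by positivity
  have hkj : (c1/4) * (Gc g A + Gc g B) * FF (ctr A - ctr B)^3 ≤ c1 * FF (ctr A - ctr B) := by
    have : (c1/4) * (Gc g A + Gc g B) ≤ c1 := by nlinarith
    exact mul_le_mul this hF31 hF3.le hc1.le
  have hkj0 : 0 ≤ (c1/4) * (Gc g A + Gc g B) * FF (ctr A - ctr B)^3 := by positivity
  -- the drift
  have hJ : EU A (fun x y => (c1/4) * (Gc g (mv A x y) + Gc g B) * FF (ctr (mv A x y) - ctr B)^3) ≤
      (c1/4) * (EU A (fun x y => Gc g (mv A x y)) + Gc g B) * FF (ctr A - ctr B)^3 +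
        c1 * (24 * (32 * (1 + diam0 d A)^5) * FF (ctr A - ctr B)^4) := by
    have e : (c1/4) * (EU A (fun x y => Gc g (mv A x y)) + Gc g B) * FF (ctr A - ctr B)^3 + c1 * (24 * (32 * (1 + diam0 d A)^5) * FF (ctr A - ctr B)^4)
        = EU A (fun x y => ((c1/4) * FF (ctr A - ctr B)^3) * Gc g (mv A x y) + ((c1/4) * Gc g B * FF (ctr A - ctr B)^3 + c1 * (24 * (32 * (1 + diam0 d A)^5) * FF (ctr A - ctr B)^4))) := by
      rw [EU_add, EU_mul, EU_const hd hA.two_le]; ring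
    rw [e]
    refine EU_mono (by omega) fun x y a b c => ?_
    have hs := ctr_mv hA a b c
    have h3 := FF_diff3 (ctr A - ctr B) (ctr (mv A x y) - ctr A)
    rw [show ctr A - ctr B + (ctr (mv A x y) - ctr A) = ctr (mv A x y) - ctr B by abel] at h3
    have h5 : (1 + ‖ctr (mv A x y) - ctr A‖)^5 ≤ 32 * (1 + diam0 d A)^5 := by
      refine (pow_le_pow_left₀ (by positivity) (by linarith : _ ≤ 2 * (1 + diam0 d A)) 5).trans (le_of_eq ?_)
      rw [mul_pow]; norm_num
    obtain ⟨gm1, gm2⟩ := hGb (mv A x y)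
    have h6 := (abs_le.1 h3).2
    have h7 : FF (ctr (mv A x y) - ctr B)^3 ≤ FF (ctr A - ctr B)^3 + 24 * (32 * (1 + diam0 d A)^5) * FF (ctr A - ctr B)^4 := by
      have := mul_le_mul_of_nonneg_right h5 hF4.le
      nlinarith
    have h8 : (c1/4) * (Gc g (mv A x y) + Gc g B) ≤ c1 := by nlinarith
    have h9 : 0 ≤ (c1/4) * (Gc g (mv A x y) + Gc g B) := by positivity
    have h10 := mul_le_mul_of_nonneg_left h7 h9
    have h11 : 0 ≤ 24 * (32 * (1 + diam0 d A)^5) * FF (ctr A - ctr B)^4 := by positivity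
    have h12 := mul_le_mul_of_nonneg_right h8 h11
    linarith
  have hpA : (1 + diam0 d A)^5 ≤ (1 + (diam0 d A + diam0 d B))^5 := pow_le_pow_left₀ (by positivity) (by linarith) 5
  have hpB : (1 + diam0 d B)^5 ≤ (1 + (diam0 d A + diam0 d B))^5 := pow_le_pow_left₀ (by positivity) (by linarith) 5
  have hq0 : 0 ≤ (1 + (diam0 d A + diam0 d B))^5 := by positivity
  have m1 := mul_le_mul_of_nonneg_left (mul_le_mul_of_nonneg_right hpB hF4.le) hC2
  have m2 := mul_le_mul_of_nonneg_left (mul_le_mul_of_nonneg_right hpA hF4.le) hc1.le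
  have m3 : 0 ≤ (1 + (diam0 d A + diam0 d B))^5 * FF (ctr A - ctr B)^4 := by positivity
  have m4 : 0 ≤ (C3 + C4 + 1 + c1) * ((1 + (diam0 d A + diam0 d B))^5 * FF (ctr A - ctr B)^4) := by positivity
  refine ⟨?_, ?_, ?_, ?_, ?_, ?_⟩
  · simp only [hFs, W0_comm hd tau hA hB]; ring
  · exact add_nonneg w1 hkj0
  · show W0 tau A B + _ ≤ _
    have h1 : c1 * FF (ctr A - ctr B) ≤ c1 := mul_le_of_le_one_right hc1.le hF1
    linarith
  · refine hlw.trans ?_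
    show _ ≤ _ * _ * (W0 tau A B + _)
    have : C3 ≤ C2 + C3 + C4 + 1 + c1 + 24 * 32 * c1 := by nlinarith
    gcongr
    linarith
  · show W0 tau A B + _ ≤ _
    have h1 : c1 * FF (ctr A - ctr B) ≤ c1 * (1 + (diam0 d A + diam0 d B)) * FF (ctr A - ctr B) := by
      have : c1 ≤ c1 * (1 + (diam0 d A + diam0 d B)) := by nlinarith
      gcongr
    have h2 : 0 ≤ (C2 + C3 + 1 + 24*32*c1) * ((1 + (diam0 d A + diam0 d B)) * FF (ctr A - ctr B)) := by positivity
    linarith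
  · show EU A (fun x y => W0 tau (mv A x y) B + _) ≤ W0 tau A B + _ - _ + _
    rw [EU_add]
    by_cases hL : Line A
    · have h1 := hl A B hL hB
      have h2 : EU A (fun x y => Gc g (mv A x y)) ≤ Gc g A + 1 := by
        have := EU_mono (U := A) (f := fun x y => Gc g (mv A x y)) (g := fun _ _ => 2) (by omega) fun x y _ _ _ => (hGb _).2
        rw [EU_const hd hA.two_le] at this
        linarith
      have h3 := mul_le_mul_of_nonneg_left (mul_le_mul_of_nonneg_right h2 hF3.le) (by positivity : 0 ≤ c1/4)
      have h4 := mul_le_mul_of_nonneg_right (min_le_left (3*c1/4) (c1*g^2/8)) hF3.le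
      linarith
    · have h1 := (W0_nonline hd tau hA hB hL).le
      have h2 := hG A hA hL
      have h3 := mul_le_mul_of_nonneg_left (mul_le_mul_of_nonneg_right h2 hF3.le) (by positivity : 0 ≤ c1/4)
      have h4 := mul_le_mul_of_nonneg_right (min_le_right (3*c1/4) (c1*g^2/8)) hF3.le
      have h5 : 0 ≤ C2 * ((1 + (diam0 d A + diam0 d B))^5 * FF (ctr A - ctr B)^4) := by positivity
      linarith

/-! ### Comparison of HAT with intracluster HAT -/

lemma Hit_le_psum' {d : ℕ} (hd : 0 < d) {W : Set (Pt d)} {q : Pt d → Pt d → ℝ} (hq : BW q) {G : Pt d → ℝ}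
    (h0 : ∀ x, 0 ≤ G x) (h : ∀ F : Pt d → ℝ, (∀ x, F x ≤ 1) → (∀ x, F x ≤ G x) → ∀ x, (open Classical in
      (∑ k : Stp d, if x + stp k ∈ W then q x (x + stp k) else F (x + stp k)) / (2 * d : ℝ)) ≤ G x) (x : Pt d) :
    Hit W q x ≤ G x := by
  classical
  refine Hit_le_of_psum hd hq fun T => ?_
  have : ∀ x, psum W q T x ≤ G x := by
    induction T with
    | zero => intro x; simpa [psum] using h0 x
    | succ T ih =>
      intro x
      rw [psum_succ]
      convert h _ (fun x => psum_le_one hd hq T x) ih x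
  exact this x

lemma Hit_diff {d : ℕ} (hd : 0 < d) {A B : Set (Pt d)} {q : Pt d → Pt d → ℝ} (hq : BW q) (x : Pt d) :
    Hit A q x ≤ Hit (A ∪ B) q x + Hit B (fun _ _ => 1) x := by
  classical
  refine Hit_le_psum' hd hq (G := fun x => Hit (A ∪ B) q x + Hit B (fun _ _ => 1) x)
    (fun x => add_nonneg (Hit_nonneg hq x) (Hit_nonneg bw_one x)) (fun F h1 h2 x => ?_) x
  rw [Hit_step hd hq x, Hit_step hd bw_one x, ← add_div, ← Finset.sum_add_distrib]
  refine div_le_div_of_nonneg_right (Finset.sum_le_sum fun k _ => ?_) (by positivity)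
  have hqk := hq x (x + stp k)
  by_cases hA : x + stp k ∈ A
  · rw [if_pos hA, if_pos (show x + stp k ∈ A ∪ B from Or.inl hA)]
    have : (0:ℝ) ≤ if x + stp k ∈ B then 1 else Hit B (fun _ _ => 1) (x + stp k) := by
      split_ifs
      · norm_num
      · exact Hit_nonneg bw_one _
    linarith
  · rw [if_neg hA]
    by_cases hB : x + stp k ∈ B
    · rw [if_pos (show x + stp k ∈ A ∪ B from Or.inr hB), if_pos hB]; have := h1 (x + stp k); linarith
    · rw [if_neg (show x + stp k ∉ A ∪ B by rintro (h | h) <;> contradiction), if_neg hB]; exact h2 _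

lemma Hit_union {d : ℕ} (hd : 0 < d) (A B : Set (Pt d)) (x : Pt d) :
    Hit (A ∪ B) (fun _ _ => 1) x ≤ Hit A (fun _ _ => 1) x + Hit B (fun _ _ => 1) x := by
  classical
  refine Hit_le_psum' hd bw_one (G := fun x => Hit A (fun _ _ => 1) x + Hit B (fun _ _ => 1) x)
    (fun x => add_nonneg (Hit_nonneg bw_one x) (Hit_nonneg bw_one x)) (fun F h1 h2 x => ?_) x
  rw [Hit_step hd bw_one x, Hit_step hd bw_one x, ← add_div, ← Finset.sum_add_distrib]
  refine div_le_div_of_nonneg_right (Finset.sum_le_sum fun k _ => ?_) (by positivity)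
  have i1 := Hit_nonneg (W := A) bw_one (x + stp k)
  have i2 := Hit_nonneg (W := B) bw_one (x + stp k)
  by_cases hA : x + stp k ∈ A <;> by_cases hB : x + stp k ∈ B
  · simp [hA, hB]
  · simp [hA, hB]; exact i2
  · simp [hA, hB]; exact i1
  · simp [hA, hB]; exact h2 _

lemma cmp_arith {e e' h h' r r' ε K K' : ℝ} (he' : e - ε ≤ e') (he0 : 0 ≤ e') (he1 : e' ≤ 1) (hε : 0 ≤ ε) (hh : h - ε ≤ h')
    (hh0 : 0 ≤ h') (h0 : 0 ≤ h) (hr : h ≤ r) (hr0 : 0 < r) (hr1 : r ≤ 1) (hr' : r' ≤ r + ε) (hr0' : 0 < r') (hK' : 0 < K')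
    (hK : K' ≤ K) : e / K * (h / r) - e' / K' * (h' / r') ≤ 3 * ε / (K * r) := by
  have hK0 : 0 < K := by linarith
  have a1 : e' / K * (h' / (r + ε)) ≤ e' / K' * (h' / r') := by gcongr
  have a2 : h / r - 2 * ε / r ≤ h' / (r + ε) := by
    have : h / r - 2 * ε / r ≤ (h - ε) / (r + ε) := by
      rw [← sub_div, div_le_div_iff₀ hr0 (by linarith)]
      nlinarith
    exact this.trans (by gcongr)
  have a3 : h / r ≤ 1 := (div_le_one hr0).2 hr
  have a4 : e * (h / r) - e' * (h' / (r + ε)) ≤ 3 * ε / r := by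
    have b1 := mul_le_mul_of_nonneg_left a2 he0
    have b2 : (e - e') * (h / r) ≤ ε * 1 := by
      calc (e - e') * (h / r) ≤ ε * (h / r) := by gcongr; linarith
        _ ≤ ε * 1 := by gcongr
    have b3 : e' * (2 * ε / r) ≤ 1 * (2 * ε / r) := by gcongr
    have b4 : ε ≤ ε / r := by rw [le_div_iff₀ hr0]; nlinarith
    have b5 : 3 * ε / r = ε / r + 2 * ε / r := by ring
    rw [mul_sub] at b1
    linarith
  calc e / K * (h / r) - e' / K' * (h' / r') ≤ e / K * (h / r) - e' / K * (h' / (r + ε)) := by linarith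
    _ = (e * (h / r) - e' * (h' / (r + ε))) / K := by ring
    _ ≤ (3 * ε / r) / K := by gcongr
    _ = 3 * ε / (K * r) := by field_simp

lemma cmp_pt {d : ℕ} (hd : 5 ≤ d) {U A : Finset (Pt d)} (hAU : A ⊆ U) {x : Pt d} (hx : x ∈ A) (hA : 2 ≤ A.card) {K ε : ℝ}
    (hK : capa d (↑U) ≤ K) (hε : Hit (↑(U \ A)) (fun _ _ => 1) x ≤ ε) (y : Pt d) :
    esc d (↑A) x / K * (hitFrom d (↑(A.erase x)) x y / retProb d (↑(A.erase x)) x) - pHAT d U x y ≤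
      3 * ε / (K * retProb d (↑(A.erase x)) x) := by
  have hd0 : 0 < d := by omega
  have e1 : (↑U : Set (Pt d)) = ↑A ∪ ↑(U \ A) := by
    rw [← Finset.coe_union, Finset.union_sdiff_of_subset hAU]
  have e2 : (↑(U.erase x) : Set (Pt d)) = ↑(A.erase x) ∪ ↑(U \ A) := by
    rw [← Finset.coe_union, Finset.coe_inj]
    ext z; simp only [Finset.mem_erase, Finset.mem_union, Finset.mem_sdiff]; constructor
    · rintro ⟨h, h'⟩; by_cases hz : z ∈ A
      · exact Or.inl ⟨h, hz⟩
      · exact Or.inr ⟨h', hz⟩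
    · rintro (h | h)
      · exact ⟨h.1, hAU h.2⟩
      · exact ⟨fun e => h.2 (e ▸ hx), h.1⟩
  rw [pHAT_eq]
  obtain ⟨w, hw⟩ : (A.erase x).Nonempty := by
    rw [← Finset.card_pos, Finset.card_erase_of_mem hx]; omega
  refine cmp_arith ?_ (esc_nonneg hd0 _ _) (esc_le_one hd0 _ _) ((Hit_nonneg bw_one x).trans hε) ?_ (hitFrom_nonneg hd0 _ _ _)
    (hitFrom_nonneg hd0 _ _ _) ?_ (ret_pos hd (Finset.mem_coe.2 hw) (by simp)) (ret_le_one hd0 _ _) ?_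
    (ret_pos hd (w := w) ?_ (by simp)) (capa_pos hd ⟨x, hAU hx⟩) hK
  · rw [esc_eq hd0 _ (Finset.mem_coe.2 hx), esc_eq hd0 _ (Finset.mem_coe.2 (hAU hx)), e1]
    have := Hit_union hd0 (↑A) (↑(U \ A)) x
    linarith
  · rw [hitFrom_eq hd0, hitFrom_eq hd0, e2]
    have := Hit_diff hd0 (A := ↑(A.erase x)) (B := ↑(U \ A)) (bw_qAt (· = y)) x
    linarith
  · rw [hitFrom_eq hd0, retProb_eq hd0]
    exact Hit_mono hd0 (bw_qAt _) bw_one (fun a b _ => (bw_qAt _ a b).2) x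
  · rw [retProb_eq hd0, retProb_eq hd0, e2]
    have := Hit_union hd0 (↑(A.erase x)) (↑(U \ A)) x
    linarith
  · rw [e2]; exact Or.inl (Finset.mem_coe.2 hw)

lemma mix_arith {p q g δ : ℝ} (h : q - p ≤ δ) (h0 : 0 ≤ g) (h1 : g ≤ 1) (hδ : 0 ≤ δ) : p * g ≤ q * g + (p - q) + δ := by
  nlinarith [mul_le_mul_of_nonneg_right h (by linarith : 0 ≤ 1 - g), mul_nonneg hδ h0]

lemma esc_anti {d : ℕ} (hd : 0 < d) {A U : Finset (Pt d)} (h : A ⊆ U) {x : Pt d} (hx : x ∈ A) : esc d (↑U) x ≤ esc d (↑A) x := by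
  rw [esc_eq hd _ (Finset.mem_coe.2 hx), esc_eq hd _ (Finset.mem_coe.2 (h hx))]
  have := Hit_mono_set hd (W := ↑A) (W' := ↑U) (by exact_mod_cast h) x
  linarith

lemma compare {d : ℕ} (hd : 5 ≤ d) (k : ℕ) (hk : 0 < k) : ∃ K1 : ℝ, 0 < K1 ∧ ∀ C : Fin k → Finset (Pt d), (∀ i, Shp (C i)) →
    ∀ ρ D : ℝ, 0 < ρ → (∀ i j, i ≠ j → ∀ x ∈ C i, ∀ y ∈ C j, ρ ≤ ‖emb x - emb y‖) → (∀ i, diam0 d (C i) ≤ D) →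
    ∀ g : Pt d → Pt d → ℝ, (∀ x y, 0 ≤ g x y) → (∀ x y, g x y ≤ 1) →
    EU (Finset.univ.biUnion C) g ≤ ∑ i, (capa d (↑(C i)) / ∑ j, capa d (↑(C j))) * EU (C i) g + K1 * (D^2+1)^d / ρ^3 := by
  classical
  have hd0 : 0 < d := by omega
  obtain ⟨c, hc, _, hesc⟩ := shp_esc hd
  obtain ⟨Ch, hCh, hhit⟩ := exists_hit_const hd
  obtain ⟨c2, hc2, hlow⟩ := Hit_lower hd
  refine ⟨(3 * k) * (6 * d) * (3 * (3 * k * Ch) / (c * c2)), by positivity, fun C hC ρ D hρ hsep hD g hg0 hg1 => ?_⟩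
  obtain ⟨U, hU⟩ : ∃ U, U = Finset.univ.biUnion C := ⟨_, rfl⟩
  obtain ⟨K, hK⟩ : ∃ K, K = ∑ j, capa d (↑(C j)) := ⟨_, rfl⟩
  rw [← hU, ← hK]
  have hsub : ∀ i, C i ⊆ U := fun i => by rw [hU]; exact Finset.subset_biUnion_of_mem C (Finset.mem_univ i)
  have hdis : (↑(Finset.univ : Finset (Fin k)) : Set (Fin k)).PairwiseDisjoint C := by
    intro i _ j _ hij
    rw [Function.onFun, Finset.disjoint_left]
    intro x hx hx'
    have := hsep i j hij x hx x hx'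
    simp at this; linarith
  have hsum : ∀ f : Pt d → ℝ, ∑ x ∈ U, f x = ∑ i, ∑ x ∈ C i, f x := fun f => by rw [hU, Finset.sum_biUnion hdis]
  have hcapU : capa d (↑U) ≤ K := by
    rw [capa_eq, hsum, hK]
    refine Finset.sum_le_sum fun i _ => ?_
    rw [capa_eq]
    exact Finset.sum_le_sum fun x hx => esc_anti hd0 (hsub i) hx
  have hcapc : ∀ i, c ≤ capa d (↑(C i)) := fun i => by
    obtain ⟨x, hx⟩ := (hC i).nonempty
    rw [capa_eq]
    exact (hesc _ (hC i) x hx).trans (Finset.single_le_sum (f := fun x => esc d (↑(C i)) x) (fun x _ => esc_nonneg hd0 _ x) hx)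
  have hKc : c ≤ K := by
    rw [hK]
    exact (hcapc ⟨0, hk⟩).trans (Finset.single_le_sum (f := fun j => capa d (↑(C j))) (fun j _ => hc.le.trans (hcapc j)) (Finset.mem_univ _))
  have hK0 : 0 < K := by linarith
  obtain ⟨δ, hδ⟩ : ∃ δ, δ = 3 * (3 * k * Ch) / (c * c2) * ((D^2+1)^d / ρ^3) := ⟨_, rfl⟩
  have hδ0 : 0 ≤ δ := by rw [hδ]; positivity
  have hUcard : U.card ≤ 3 * k := by
    rw [hU]
    refine Finset.card_biUnion_le.trans ((Finset.sum_le_card_nsmul _ _ 3 fun i _ => (hC i).card_le).trans ?_)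
    simp; omega
  have hpt : ∀ i, ∀ x ∈ C i, ∀ y, capa d (↑(C i)) / K * pHAT d (C i) x y - pHAT d U x y ≤ δ := by
    intro i x hx y
    have hε : Hit (↑(U \ C i)) (fun _ _ => 1) x ≤ 3 * k * (Ch / ρ^3) := by
      refine (hhit (U \ C i) x ρ hρ fun w hw => ?_).trans ?_
      · rw [nsq_eq, emb_sub]
        obtain ⟨hw1, hw2⟩ := Finset.mem_sdiff.1 hw
        rw [hU, Finset.mem_biUnion] at hw1
        obtain ⟨j, _, hj⟩ := hw1
        exact pow_le_pow_left₀ hρ.le (hsep i j (fun e => hw2 (e ▸ hj)) x hx w hj) 2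
      · have : ((U \ C i).card : ℝ) ≤ 3 * k := by exact_mod_cast (Finset.card_le_card Finset.sdiff_subset).trans hUcard
        gcongr
    have h1 := cmp_pt hd (hsub i) hx (hC i).two_le hcapU hε y
    have e1 : capa d (↑(C i)) / K * pHAT d (C i) x y = esc d (↑(C i)) x / K * (hitFrom d (↑((C i).erase x)) x y / retProb d (↑((C i).erase x)) x) := by
      rw [pHAT_eq]
      have := (hc.trans_le (hcapc i)).ne'
      field_simp
    rw [e1]
    refine h1.trans ?_
    obtain ⟨w, hw⟩ : ((C i).erase x).Nonempty := by
      have := (hC i).two_le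
      rw [← Finset.card_pos, Finset.card_erase_of_mem hx]; omega
    have hr : c2 / (D^2+1)^d ≤ retProb d (↑((C i).erase x)) x := by
      rw [retProb_eq hd0]
      refine le_trans ?_ (hlow _ x w (Finset.mem_coe.2 hw) (Finset.mem_erase.1 hw).1.symm)
      have hh := (le_diam hx (Finset.mem_erase.1 hw).2).trans (hD i)
      have : nsq (x - w) ≤ D^2 := by
        rw [nsq_eq, emb_sub]; exact pow_le_pow_left₀ (norm_nonneg _) hh 2
      have := nsq_nonneg (x - w)
      gcongr
    have hr0 : 0 < c2 / (D^2+1)^d := by positivity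
    calc 3 * (3 * k * (Ch / ρ^3)) / (K * retProb d (↑((C i).erase x)) x) ≤ 3 * (3 * k * (Ch / ρ^3)) / (c * (c2 / (D^2+1)^d)) := by gcongr
      _ = δ := by rw [hδ]; field_simp
  -- pointwise bound
  have hrow : ∀ i, ∀ x ∈ C i, ∑ y ∈ nbF U, pHAT d U x y * g x y ≤
      capa d (↑(C i)) / K * ∑ y ∈ nbF (C i), pHAT d (C i) x y * g x y +
       (∑ y ∈ nbF U, pHAT d U x y - capa d (↑(C i)) / K * ∑ y ∈ nbF (C i), pHAT d (C i) x y) + 6 * d * δ := by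
    intro i x hx
    have hs : nbF (C i) ⊆ nbF U := nbF_mono (hsub i)
    rw [← Finset.sum_sdiff hs, ← Finset.sum_sdiff hs (f := fun y => pHAT d U x y), Finset.mul_sum, Finset.mul_sum]
    have a1 : ∑ y ∈ nbF U \ nbF (C i), pHAT d U x y * g x y ≤ ∑ y ∈ nbF U \ nbF (C i), pHAT d U x y :=
      Finset.sum_le_sum fun y _ => mul_le_of_le_one_right (pHAT_nonneg hd0 _ _ _) (hg1 x y)
    have a2 : ∑ y ∈ nbF (C i), pHAT d U x y * g x y ≤ ∑ y ∈ nbF (C i), (capa d (↑(C i)) / K * (pHAT d (C i) x y * g x y) +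
        (pHAT d U x y - capa d (↑(C i)) / K * pHAT d (C i) x y) + δ) := by
      refine Finset.sum_le_sum fun y _ => ?_
      rw [← mul_assoc]
      exact mix_arith (hpt i x hx y) (hg0 x y) (hg1 x y) hδ0
    rw [Finset.sum_add_distrib, Finset.sum_add_distrib, Finset.sum_sub_distrib, Finset.sum_const, nsmul_eq_mul] at a2
    have a3 : ((nbF (C i)).card : ℝ) * δ ≤ 6 * d * δ := by
      have h3 := nbF_card (C i)
      have h4 := (hC i).card_le
      have : ((nbF (C i)).card : ℝ) ≤ 6 * d := by
        have : (nbF (C i)).card ≤ 6 * d := by nlinarith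
        exact_mod_cast this
      gcongr
    linarith
  have hU2 : 2 ≤ U.card := (hC ⟨0, hk⟩).two_le.trans (Finset.card_le_card (hsub _))
  have t1 := EU_const hd hU2 1
  have t2 : ∀ i, EU (C i) (fun _ _ => 1) = 1 := fun i => EU_const hd (hC i).two_le 1
  unfold EU at t1 t2 ⊢
  simp only [mul_one] at t1 t2
  rw [hsum] at t1 ⊢
  have main : ∑ i, ∑ x ∈ C i, ∑ y ∈ nbF U, pHAT d U x y * g x y ≤ ∑ i, ∑ x ∈ C i, (capa d (↑(C i)) / K * ∑ y ∈ nbF (C i), pHAT d (C i) x y * g x y +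
       (∑ y ∈ nbF U, pHAT d U x y - capa d (↑(C i)) / K * ∑ y ∈ nbF (C i), pHAT d (C i) x y) + 6 * d * δ) :=
    Finset.sum_le_sum fun i _ => Finset.sum_le_sum fun x hx => hrow i x hx
  refine main.trans ?_
  simp_rw [Finset.sum_add_distrib, Finset.sum_sub_distrib]
  rw [t1]
  have t3 : ∑ i, ∑ x ∈ C i, capa d (↑(C i)) / K * ∑ y ∈ nbF (C i), pHAT d (C i) x y = 1 := by
    simp_rw [← Finset.mul_sum, t2, mul_one]
    rw [← Finset.sum_div, ← hK, div_self hK0.ne']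
  rw [t3]
  simp_rw [← Finset.mul_sum]
  have t4 : ∑ i, ∑ x ∈ C i, (6 * d * δ : ℝ) ≤ (3 * k) * (6 * d * δ) := by
    rw [← hsum]
    rw [Finset.sum_const, nsmul_eq_mul]
    have : (U.card : ℝ) ≤ 3 * k := by exact_mod_cast hUcard
    gcongr
  have t5 : (3 * k) * (6 * d * δ) = 3 * ↑k * (6 * ↑d) * (3 * (3 * ↑k * Ch) / (c * c2)) * (D ^ 2 + 1) ^ d / ρ ^ 3 := by
    rw [hδ]; field_simp
  simp_rw [← Finset.mul_sum] at t4
  linarith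

/-! ### Diameter drift -/

lemma diam_ins {d : ℕ} {B : Finset (Pt d)} {y : Pt d} (hy : y ∈ nbF B) : diam0 d (insert y B) ≤ diam0 d B + 1 := by
  obtain ⟨k, hk⟩ := mem_nbF.1 hy
  have h0 := diam_nonneg ⟨_, hk⟩
  have key : ∀ z ∈ B, ‖emb y - emb z‖ ≤ diam0 d B + 1 := by
    intro z hz
    have h1 := le_diam hk hz
    have h2 : emb y - emb z = (emb (y + stp k) - emb z) - emb (stp k) := by rw [emb_add]; abel
    rw [h2]
    refine (norm_sub_le _ _).trans ?_
    rw [norm_stp]; linarith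
  refine diam_le ⟨y, by simp⟩ fun a ha b hb => ?_
  rcases Finset.mem_insert.1 ha with ha | ha <;> rcases Finset.mem_insert.1 hb with hb | hb
  · rw [ha, hb]; simp; linarith
  · rw [ha]; exact key b hb
  · rw [hb, norm_sub_rev]; exact key a ha
  · exact (le_diam ha hb).trans (by linarith)

lemma diam_mv {d : ℕ} {A : Finset (Pt d)} {x y : Pt d} (hx : x ∈ A) (hy : y ∈ nbF (A.erase x)) :
    diam0 d (mv A x y) ≤ diam0 d A + 1 := by
  obtain ⟨k, hk⟩ := mem_nbF.1 hy
  refine (diam_ins hy).trans ?_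
  have : diam0 d (A.erase x) ≤ diam0 d A := diam_le ⟨_, hk⟩ fun a ha b hb =>
    le_diam (Finset.mem_erase.1 ha).2 (Finset.mem_erase.1 hb).2
  linarith

lemma diam_pair {d : ℕ} (u : Pt d) (k : Stp d) : diam0 d ({u, u + stp k} : Finset (Pt d)) ≤ 2 :=
  line_diam (Or.inl ⟨u, k, rfl⟩)

lemma diam_drift {d : ℕ} (hd : 5 ≤ d) : ∃ l C : ℝ, 0 < l ∧ 1 ≤ C ∧ ∀ A : Finset (Pt d), Shp A →
    EU A (fun x y => Real.exp (l * diam0 d (mv A x y))) ≤ Real.exp (l * diam0 d A) + C := by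
  have hd0 : 0 < d := by omega
  obtain ⟨c, hc, hc1, hesc⟩ := shp_esc hd
  refine ⟨c/3, Real.exp (c/3*3), by positivity, Real.one_le_exp (by positivity), fun A hA => ?_⟩
  have h0 := diam_nonneg hA.nonempty
  have hl : 0 < c/3 := by positivity
  by_cases hL : Line A
  · have h2 := line_diam hL
    have := EU_mono hd0 (U := A) (f := fun x y => Real.exp (c/3 * diam0 d (mv A x y))) (g := fun _ _ => Real.exp (c/3*3)) fun x y a b _ => by
      have := diam_mv a b
      exact Real.exp_le_exp.2 (mul_le_mul_of_nonneg_left (by linarith) hl.le)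
    rw [EU_const hd hA.two_le] at this
    have := Real.exp_pos (c/3 * diam0 d A)
    linarith
  · obtain ⟨u, k, z, hAe, hz1, hz2⟩ := hA.nonline hL
    have hzA : z ∈ A := by rw [hAe]; simp
    have her : A.erase z = {u, u + stp k} := by rw [hAe]; exact erase_third hz1 hz2
    have h1 := EU_act hd hA.two_le (f := fun x y => Real.exp (c/3*(diam0 d A + 1)) - Real.exp (c/3 * diam0 d (mv A x y)))
      (m := Real.exp (c/3*(diam0 d A + 1)) - Real.exp (c/3*3))
      (fun x y a b _ => by
        have := diam_mv a b
        exact sub_nonneg.2 (Real.exp_le_exp.2 (mul_le_mul_of_nonneg_left this hl.le))) hzA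
      (fun y hy _ => by
        have : diam0 d (mv A z y) ≤ 3 := by
          have h4 : diam0 d (mv A z y) ≤ diam0 d ({u, u+stp k} : Finset (Pt d)) + 1 := by
            rw [her] at hy; unfold mv; rw [her]; exact diam_ins hy
          have := diam_pair u k
          linarith
        have := Real.exp_le_exp.2 (mul_le_mul_of_nonneg_left this hl.le)
        linarith)
    rw [EU_sub, EU_const hd hA.two_le] at h1
    have h2 : 0 ≤ EU A (fun x y => Real.exp (c/3*(diam0 d A + 1)) - Real.exp (c/3 * diam0 d (mv A x y))) :=
      EU_nonneg hd0 fun x y a b _ => by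
        have := diam_mv a b
        exact sub_nonneg.2 (Real.exp_le_exp.2 (mul_le_mul_of_nonneg_left this hl.le))
    rw [EU_sub, EU_const hd hA.two_le] at h2
    have hfrac : c/3 ≤ esc d (↑A) z / capa d (↑A) := by
      have h3 : capa d (↑A) ≤ 3 := (capa_le hd0 A).trans (by exact_mod_cast hA.card_le)
      have h4 := capa_pos hd hA.nonempty
      have := hesc A hA z hzA
      have h6 : 0 ≤ esc d (↑A) z := hc.le.trans this
      gcongr
    have hX : 0 ≤ Real.exp (c/3*3) := (Real.exp_pos _).le
    have e1 : Real.exp (c/3*(diam0 d A + 1)) = Real.exp (c/3) * Real.exp (c/3 * diam0 d A) := by rw [← Real.exp_add]; ring_nf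
    have e2 : (1 - c/3) * Real.exp (c/3) ≤ 1 := by
      have := Real.one_sub_le_exp_neg (c/3)
      calc (1 - c/3) * Real.exp (c/3) ≤ Real.exp (-(c/3)) * Real.exp (c/3) := by gcongr
        _ = 1 := by rw [← Real.exp_add]; simp
    have e3 : (1 - c/3) * Real.exp (c/3*(diam0 d A + 1)) ≤ Real.exp (c/3 * diam0 d A) := by
      rw [e1, ← mul_assoc]; exact mul_le_of_le_one_left (Real.exp_pos _).le e2
    have h5 : (Real.exp (c/3*(diam0 d A + 1)) - Real.exp (c/3*3)) * (c/3) ≤ Real.exp (c/3*(diam0 d A + 1)) - EU A (fun x y => Real.exp (c/3 * diam0 d (mv A x y))) := by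
      rcases le_total 0 (Real.exp (c/3*(diam0 d A + 1)) - Real.exp (c/3*3)) with h | h
      · exact (mul_le_mul_of_nonneg_left hfrac h).trans h1
      · exact (mul_nonpos_of_nonpos_of_nonneg h hl.le).trans h2
    have h6 : c/3 * Real.exp (c/3*3) ≤ Real.exp (c/3*3) := mul_le_of_le_one_left hX (by linarith)
    generalize EU A (fun x y => Real.exp (c/3 * diam0 d (mv A x y))) = E1 at *
    generalize Real.exp (c/3*(diam0 d A + 1)) = E2 at *
    generalize Real.exp (c/3*3) = E3 at *
    linarith

/-! ### Arithmetic -/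

lemma pair_arith {s w w' σ c0 C F P V : ℝ} (hs : 1 ≤ s) (hw : s^8 ≤ w) (hσ : σ = (s^6*w)^2) (hw' : w ≤ w') (hw2 : w' ≤ w + w/σ)
    (hc0 : 0 < c0) (hC : 1 ≤ C) (h1 : 4*C ≤ c0*s) (h2 : C ≤ s) (hF : 0 < F) (hP : 1 ≤ P) (hPs : P ≤ s) (hV : 0 ≤ V)
    (hFV : F ≤ C*P*V) (hVF : V ≤ C*P*F) (hwV : w*V ≤ 1) :
    w' * (V + (-c0*F^3 + 2*C*P^5*F^4)) ≤ w*V + 1/(s^2*σ) := by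
  have hw0 : 0 < w := lt_of_lt_of_le (by positivity) hw
  have hσ0 : 0 < σ := by rw [hσ]; positivity
  have a1 : F ≤ s^2/w := by
    rw [le_div_iff₀ hw0]
    calc F*w ≤ C*P*V*w := by gcongr
      _ = C*P*(w*V) := by ring
      _ ≤ s*s*1 := by gcongr
      _ = s^2 := by ring
  have a2 : 2*C*P^5*F^4 ≤ c0/2*F^3 := by
    have b1 : 2*C*P^5*F ≤ c0/2 := by
      calc 2*C*P^5*F ≤ 2*C*s^5*(s^2/w) := by gcongr
        _ ≤ c0/2 := by
          rw [← mul_div_assoc, div_le_iff₀ hw0]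
          calc 2*C*s^5*s^2 = (4*C)*(s^7)/2 := by ring
            _ ≤ c0*s*s^7/2 := by gcongr
            _ = c0/2*s^8 := by ring
            _ ≤ c0/2*w := by gcongr
    calc 2*C*P^5*F^4 = 2*C*P^5*F*F^3 := by ring
      _ ≤ c0/2*F^3 := by gcongr
  have hF3 : 0 < F^3 := by positivity
  have a3 : w' * (V + (-c0*F^3 + 2*C*P^5*F^4)) ≤ w'*V - w*(c0/2*F^3) := by
    have : w' * (V + (-c0*F^3 + 2*C*P^5*F^4)) ≤ w'*(V - c0/2*F^3) :=
      mul_le_mul_of_nonneg_left (by linarith) (by linarith)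
    have h3 : w*(c0/2*F^3) ≤ w'*(c0/2*F^3) := by gcongr
    linarith
  have a4 : w'*V ≤ w*V + w/σ*V := by
    calc w'*V ≤ (w+w/σ)*V := by gcongr
      _ = _ := by ring
  have a5 : w/σ*V ≤ w/σ*(s*s*F) := by
    have : V ≤ s*s*F := hVF.trans (by gcongr)
    gcongr
  have a5' : w/σ*V ≤ w/σ*(C*s*F) := by
    have : V ≤ C*s*F := hVF.trans (by gcongr)
    gcongr
  suffices h : w/σ*(C*s*F) - w*(c0/2*F^3) ≤ 1/(s^2*σ) by linarith
  by_cases hcs : C*s/σ ≤ c0/2*F^2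
  · have : w/σ*(C*s*F) - w*(c0/2*F^3) = w*F*(C*s/σ - c0/2*F^2) := by ring
    rw [this]
    have h3 : w*F*(C*s/σ - c0/2*F^2) ≤ 0 := mul_nonpos_of_nonneg_of_nonpos (by positivity) (by linarith)
    have : 0 < 1/(s^2*σ) := by positivity
    linarith
  · push Not at hcs
    have b1 : F^2 ≤ (s/(s^6*w))^2 := by
      have b2 : c0*F^2 ≤ c0*(s^2/σ) := by
        calc c0*F^2 ≤ 2*C*s/σ := by rw [mul_assoc, mul_div_assoc]; linarith
          _ ≤ c0*s*s/σ := by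
            have : 2*C*s ≤ c0*s*s := mul_le_mul_of_nonneg_right (by linarith) (by linarith)
            gcongr
          _ = _ := by ring
      have b3 := le_of_mul_le_mul_left b2 hc0
      rw [div_pow, ← hσ]; exact b3
    have b4 : F ≤ s/(s^6*w) := le_of_sq_le_sq b1 (by positivity)
    have hp : 0 ≤ w*(c0/2*F^3) := by positivity
    calc w/σ*(C*s*F) - w*(c0/2*F^3) ≤ w/σ*(s*s*(s/(s^6*w))) := by
          have : w/σ*(C*s*F) ≤ w/σ*(s*s*(s/(s^6*w))) := by gcongr
          linarith
      _ = 1/(s^3*σ) := by field_simp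
      _ ≤ 1/(s^2*σ) := by
          have : s^2 ≤ s^3 := pow_le_pow_right₀ hs (by norm_num)
          gcongr

lemma pow_sub_pow_le_of {s s' : ℝ} {M : ℕ} (h0 : 0 ≤ s) (h : s ≤ s') : s'^M - s^M ≤ M * s'^(M-1) * (s' - s) := by
  induction M with
  | zero => simp
  | succ M ih =>
    have e : s'^(M+1) - s^(M+1) = s' * (s'^M - s^M) + s^M*(s'-s) := by ring
    have h1 : s' * (s'^M - s^M) ≤ s' * (M * s'^(M-1) * (s' - s)) := mul_le_mul_of_nonneg_left ih (by linarith)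
    have h2 : s^M*(s'-s) ≤ s'^M*(s'-s) := mul_le_mul_of_nonneg_right (pow_le_pow_left₀ h0 h M) (by linarith)
    have h3 : s' * (M * s'^(M-1) * (s' - s)) = M * s'^M * (s' - s) := by
      cases M with
      | zero => simp
      | succ m => simp only [Nat.add_sub_cancel]; ring
    rw [e, Nat.add_sub_cancel]; push_cast
    linarith

lemma r_arith {s s' : ℝ} {M : ℕ} (hM : 1 ≤ M) (hs : 1 ≤ s) (hs' : 0 ≤ s') (h : s'^M = s^M + 1) :
    s ≤ s' ∧ s' ≤ 2*s ∧ 1/s' + 1/(M*2^M*(s*s^M)) ≤ 1/s := by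
  have hM0 : M ≠ 0 := by omega
  have h1 : s ≤ s' := le_of_pow_le_pow_left₀ hM0 hs' (by linarith)
  have h2 : s' ≤ 2*s := by
    refine le_of_pow_le_pow_left₀ hM0 (by linarith) ?_
    rw [h, mul_pow]
    have a : (2:ℝ) ≤ 2^M := le_self_pow₀ (by norm_num) hM0
    have b : 1 ≤ s^M := one_le_pow₀ hs
    nlinarith
  refine ⟨h1, h2, ?_⟩
  have hs0 : 0 < s' := by linarith
  have h3 : 1 ≤ M * s'^(M-1) * (s' - s) := by
    have : s'^M - s^M ≤ M * s'^(M-1) * (s' - s) := by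
      exact pow_sub_pow_le_of (by linarith) h1
    linarith
  have h4 : M * s'^(M-1) * (s*s') ≤ M*2^M*(s*s^M) := by
    calc M * s'^(M-1) * (s*s') = M * s * (s'^(M-1)*s') := by ring
      _ = M*s*s'^M := by rw [← pow_succ, Nat.sub_add_cancel hM]
      _ ≤ M*s*(2*s)^M := by gcongr
      _ = _ := by rw [mul_pow]; ring
  have h5 : 1/s - 1/s' = (s'-s)/(s*s') := by field_simp
  have hMp : (0:ℝ) < M := by exact_mod_cast hM
  have h6 : 1/(M*2^M*(s*s^M)) ≤ (s'-s)/(s*s') := by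
    calc 1/(M*2^M*(s*s^M)) ≤ 1/(M * s'^(M-1) * (s*s')) := by gcongr
      _ ≤ (s'-s)/(s*s') := by
        rw [div_le_div_iff₀ (by positivity) (by positivity)]
        have : 0 < s*s' := by positivity
        nlinarith
  linarith

/-! ### One step of the potential -/

noncomputable def VV {d k : ℕ} (W : Finset (Pt d) → Finset (Pt d) → ℝ) (C : Fin k → Finset (Pt d)) : ℝ :=
  ∑ p ∈ (Finset.univ.filter fun p : Fin k × Fin k => p.1 ≠ p.2), W (C p.1) (C p.2)

noncomputable def EE {d k : ℕ} (l : ℝ) (C : Fin k → Finset (Pt d)) : ℝ := ∑ i, Real.exp (l * diam0 d (C i))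

noncomputable def Phi {d k : ℕ} (W : Finset (Pt d) → Finset (Pt d) → ℝ) (l : ℝ) (m : ℕ) (s : ℝ) (C : Fin k → Finset (Pt d)) : ℝ :=
  s^m * VV W C + EE l C / (s^(2*(m+6)))^2 + 1/s

def gd {d k : ℕ} (W : Finset (Pt d) → Finset (Pt d) → ℝ) (l : ℝ) (m : ℕ) (s : ℝ) (C : Fin k → Finset (Pt d)) : Prop :=
  (∀ i, Shp (C i)) ∧ s^m * VV W C < 1 ∧ ∀ i, Real.exp (l * diam0 d (C i)) < (s^(2*(m+6)))^2

/-- The defining properties of the pair function. -/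
def PF {d : ℕ} (W : Finset (Pt d) → Finset (Pt d) → ℝ) (c C : ℝ) : Prop :=
  ∀ A B, Shp A → Shp B → W A B = W B A ∧ 0 ≤ W A B ∧ W A B ≤ C ∧ FF (ctr A - ctr B) ≤ C*(1+(diam0 d A+diam0 d B))*W A B ∧
    W A B ≤ C*(1+(diam0 d A+diam0 d B))*FF (ctr A-ctr B) ∧ EU A (fun x y => W (mv A x y) B) ≤
      W A B - c*FF (ctr A-ctr B)^3 + C*(1+(diam0 d A+diam0 d B))^5*FF (ctr A-ctr B)^4

lemma EU_sum {d : ℕ} {ι : Type*} (s : Finset ι) (U : Finset (Pt d)) (f : ι → Pt d → Pt d → ℝ) :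
    EU U (fun x y => ∑ i ∈ s, f i x y) = ∑ i ∈ s, EU U (f i) := by
  unfold EU
  simp_rw [Finset.mul_sum]
  rw [Finset.sum_comm]
  rw [Finset.sum_congr rfl (fun x _ => Finset.sum_comm)]
  rw [Finset.sum_comm, Finset.sum_congr rfl (fun x _ => Finset.sum_comm)]

lemma VV_nonneg {d k : ℕ} {W : Finset (Pt d) → Finset (Pt d) → ℝ} {c C : ℝ} (hW : PF W c C) {D : Fin k → Finset (Pt d)} (hD : ∀ i, Shp (D i)) : 0 ≤ VV W D :=
  Finset.sum_nonneg fun p _ => (hW _ _ (hD _) (hD _)).2.1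

lemma le_VV {d k : ℕ} {W : Finset (Pt d) → Finset (Pt d) → ℝ} {c C : ℝ} (hW : PF W c C) {D : Fin k → Finset (Pt d)} (hD : ∀ i, Shp (D i))
    {a b : Fin k} (h : a ≠ b) : W (D a) (D b) ≤ VV W D :=
  Finset.single_le_sum (f := fun p : Fin k × Fin k => W (D p.1) (D p.2)) (fun p _ => (hW _ _ (hD _) (hD _)).2.1) (Finset.mem_filter.2 ⟨Finset.mem_univ (a,b), h⟩)

lemma EU_pair {d k : ℕ} (hd : 5 ≤ d) {W : Finset (Pt d) → Finset (Pt d) → ℝ} {c C : ℝ} (hW : PF W c C) {D : Fin k → Finset (Pt d)} (hD : ∀ i, Shp (D i))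
    (i a b : Fin k) (h : a ≠ b) :
    EU (D i) (fun x y => W (Function.update D i (mv (D i) x y) a) (Function.update D i (mv (D i) x y) b)) ≤ W (D a) (D b) +
      ((if i = a then 1 else 0) + (if i = b then 1 else 0)) * (- c*FF (ctr (D a)-ctr (D b))^3 + C*(1+(diam0 d (D a)+diam0 d (D b)))^5*FF (ctr (D a)-ctr (D b))^4) := by
  by_cases ha : i = a
  · subst ha
    have hb : ¬ i = b := h
    simp only [Function.update_self, if_true, if_neg hb, Function.update_of_ne (Ne.symm h)]
    have := (hW _ _ (hD i) (hD b)).2.2.2.2.2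
    linarith
  · by_cases hb : i = b
    · subst hb
      simp only [Function.update_self, if_true, if_neg ha, Function.update_of_ne h]
      have := (hW _ _ (hD i) (hD a)).2.2.2.2.2
      have h1 : EU (D i) (fun x y => W (D a) (mv (D i) x y)) = EU (D i) (fun x y => W (mv (D i) x y) (D a)) :=
        EU_congr (by omega) fun x y hx hy hy' => (hW _ _ (hD a) ((hD i).mv hx hy hy')).1
      rw [h1, (hW _ _ (hD a) (hD i)).1, ← FF_neg (ctr (D a) - ctr (D i)), neg_sub, add_comm (diam0 d (D a))]
      linarith
    · simp only [if_neg ha, if_neg hb, Function.update_of_ne (Ne.symm ha), Function.update_of_ne (Ne.symm hb)]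
      rw [EU_const hd (hD i).two_le]
      linarith

lemma VV_step {d k : ℕ} (hd : 5 ≤ d) {W : Finset (Pt d) → Finset (Pt d) → ℝ} {c C : ℝ} (hW : PF W c C) (hc : 0 < c) (hC : 1 ≤ C) {D : Fin k → Finset (Pt d)} (hD : ∀ i, Shp (D i))
    {th : Fin k → ℝ} {t0 : ℝ} (h0 : ∀ i, t0 ≤ th i) (ht0 : 0 < t0) (h1 : ∑ i, th i = 1) :
    ∑ i, th i * EU (D i) (fun x y => VV W (Function.update D i (mv (D i) x y))) ≤
      ∑ p ∈ (Finset.univ.filter fun p : Fin k × Fin k => p.1 ≠ p.2), (W (D p.1) (D p.2) + (-(2*c*t0)*FF (ctr (D p.1)-ctr (D p.2))^3 +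
        2*C*(1+(diam0 d (D p.1)+diam0 d (D p.2)))^5*FF (ctr (D p.1)-ctr (D p.2))^4)) := by
  have hth : ∀ i, th i ≤ 1 := fun i => by
    rw [← h1]; exact Finset.single_le_sum (f := th) (fun j _ => ht0.le.trans (h0 j)) (Finset.mem_univ i)
  unfold VV
  simp_rw [EU_sum, Finset.mul_sum]
  rw [Finset.sum_comm]
  refine Finset.sum_le_sum fun p hp => ?_
  have hp' := (Finset.mem_filter.1 hp).2
  have hF := FF_pos (ctr (D p.1)-ctr (D p.2))
  have hA := diam_nonneg (hD p.1).nonempty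
  have hB := diam_nonneg (hD p.2).nonempty
  have e1 := Finset.sum_le_sum (s := Finset.univ) fun i _ => mul_le_mul_of_nonneg_left (EU_pair hd hW hD i p.1 p.2 hp') (ht0.le.trans (h0 i))
  refine e1.trans ?_
  generalize FF (ctr (D p.1)-ctr (D p.2)) = F at *
  obtain ⟨P, hP⟩ : ∃ P, P = 1+(diam0 d (D p.1)+diam0 d (D p.2)) := ⟨_, rfl⟩
  rw [← hP]
  obtain ⟨X, hX⟩ : ∃ X, X = - c*F^3 + C*P^5*F^4 := ⟨_, rfl⟩
  rw [← hX]
  have e2 : ∑ i, th i * (W (D p.1) (D p.2) + ((if i = p.1 then 1 else 0) + (if i = p.2 then 1 else 0)) * X) = W (D p.1) (D p.2) + (th p.1 + th p.2) * X := by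
    simp_rw [mul_add, add_mul, mul_add, Finset.sum_add_distrib]
    rw [← Finset.sum_mul, h1]
    simp
  rw [e2, hX]
  have hP1 : 0 ≤ C*P^5*F^4 := by rw [hP]; positivity
  have := mul_nonneg hc.le (pow_pos hF 3).le
  nlinarith [h0 p.1, h0 p.2, hth p.1, hth p.2, mul_nonneg (sub_nonneg.2 (h0 p.1)) this, mul_nonneg (sub_nonneg.2 (h0 p.2)) this,
    mul_nonneg (sub_nonneg.2 (hth p.1)) hP1, mul_nonneg (sub_nonneg.2 (hth p.2)) hP1]

lemma EE_step {d k : ℕ} (hd : 5 ≤ d) {l Cl : ℝ} (hl : ∀ A : Finset (Pt d), Shp A →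
    EU A (fun x y => Real.exp (l * diam0 d (mv A x y))) ≤ Real.exp (l * diam0 d A) + Cl) {D : Fin k → Finset (Pt d)} (hD : ∀ i, Shp (D i)) (i : Fin k) :
    EU (D i) (fun x y => EE l (Function.update D i (mv (D i) x y))) ≤ EE l D + Cl := by
  unfold EE
  rw [EU_sum]
  have : ∑ j, (Real.exp (l * diam0 d (D j)) + if j = i then Cl else 0) = ∑ j, Real.exp (l * diam0 d (D j)) + Cl := by
    rw [Finset.sum_add_distrib]; simp
  rw [← this]
  refine Finset.sum_le_sum fun j _ => ?_
  by_cases h : j = i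
  · subst h
    simp only [Function.update_self, if_true]
    exact hl _ (hD j)
  · simp only [Function.update_of_ne h, if_neg h]
    rw [EU_const hd (hD i).two_le]; linarith

lemma ge_arith {s w F V C P : ℝ} (hs : 2 ≤ s) (hw : s^8 ≤ w) (hF : 0 < F) (hC : C ≤ s) (hC1 : 1 ≤ C) (hP1 : 1 ≤ P) (hP : P ≤ s) (hV : 0 ≤ V) (h : w * V < 1)
    (hFV : F ≤ C*P*V) {x D : ℝ} (hx : 1/(1+x) ≤ F) (hx0 : 0 ≤ x) (hD : 1 + D ≤ s) : w/s^4 ≤ x - D := by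
  have hw0 : 0 < w := lt_of_lt_of_le (by positivity) hw
  have h1 : F ≤ s*s*V := hFV.trans (mul_le_mul_of_nonneg_right (mul_le_mul hC hP (by linarith) (by linarith)) hV)
  have h2 : w * F ≤ s^2 := by nlinarith
  have h3 : w ≤ s^2*(1+x) := by
    rw [div_le_iff₀ (by positivity)] at hx
    nlinarith
  rw [div_le_iff₀ (by positivity)]
  have h4 : s^8 = s^6*s^2 := by ring
  have h5 : w*s^2 ≤ s^4*(1+x) := by nlinarith [sq_nonneg s]
  have h6 : s^5 + w ≤ w * s^2 := by
    have : (1:ℝ) ≤ s^3 := one_le_pow₀ (by linarith)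
    have h7 : s^5*1 ≤ s^5*s^3 := mul_le_mul_of_nonneg_left this (by positivity)
    have h8 : s^5*s^3 = s^8 := by ring
    have h9 : (4:ℝ) ≤ s^2 := by nlinarith
    have := mul_le_mul_of_nonneg_left h9 hw0.le
    linarith
  nlinarith [mul_le_mul_of_nonneg_left hD (by positivity : (0:ℝ) ≤ s^4)]

lemma gd_geom {d k : ℕ} {W : Finset (Pt d) → Finset (Pt d) → ℝ} {c C l : ℝ} (hW : PF W c C) (hC : 1 ≤ C) (hl : 0 < l) {m : ℕ} (hm : 8 ≤ m) {s : ℝ} (hs : 2 ≤ s) (hCs : C ≤ s)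
    (hlog : 1 + 2*((4*(m+6)/l) * Real.log s) ≤ s) {D : Fin k → Finset (Pt d)} (hg : gd W l m s D) :
    (∀ i, diam0 d (D i) ≤ (4*(m+6)/l) * Real.log s) ∧ ∀ i j, i ≠ j → ∀ x ∈ D i, ∀ y ∈ D j, s^m/s^4 ≤ ‖emb x - emb y‖ := by
  obtain ⟨hD, hV, hE⟩ := hg
  have h1 : ∀ i, diam0 d (D i) ≤ (4*(m+6)/l) * Real.log s := by
    intro i
    have := Real.log_lt_log (Real.exp_pos _) (hE i)
    rw [Real.log_exp, Real.log_pow, Real.log_pow] at this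
    push_cast at this
    rw [div_mul_eq_mul_div, le_div_iff₀ hl]
    linarith
  refine ⟨h1, fun i j hij x hx y hy => ?_⟩
  have hp := hW _ _ (hD i) (hD j)
  have d1 := h1 i
  have d2 := h1 j
  have d3 := diam_nonneg (hD i).nonempty
  have d4 := diam_nonneg (hD j).nonempty
  have hwV : s^m * W (D i) (D j) < 1 := lt_of_le_of_lt (mul_le_mul_of_nonneg_left (le_VV hW hD hij) (by positivity)) hV
  have := ge_arith hs (pow_le_pow_right₀ (by linarith) hm) (FF_pos _) hCs hC (by linarith) (by linarith) hp.2.1 hwV hp.2.2.2.1 (FF_ge_inv (ctr (D i) - ctr (D j))) (norm_nonneg _)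
    (D := diam0 d (D i)+diam0 d (D j)) (by linarith)
  have n1 := near_self hx
  have n2 := near_self hy
  have n3 : ‖ctr (D i) - ctr (D j)‖ ≤ ‖emb x - ctr (D i)‖ + ‖emb x - emb y‖ + ‖emb y - ctr (D j)‖ := by
    have : ctr (D i) - ctr (D j) = -(emb x - ctr (D i)) + (emb x - emb y) + (emb y - ctr (D j)) := by abel
    rw [this]
    refine (norm_add_le _ _).trans ?_
    have := norm_add_le (-(emb x - ctr (D i))) (emb x - emb y)
    rw [norm_neg] at this
    linarith
  linarith

lemma err_arith {K D s : ℝ} {m d : ℕ} (hs : 2 ≤ s) (hK : 0 < K) (hKs : K ≤ s) (hD0 : 0 ≤ D) (hD : 1 + 2*D ≤ s) (hm : 2*d+27 ≤ m) :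
    K * (D^2+1)^d/(s^m/s^4)^3 ≤ 1/(s^2 * s^(2*(m+6))) := by
  have hs0 : 0 < s := by linarith
  have h1 : D^2+1 ≤ s^2 := by nlinarith
  have h2 : (D^2+1)^d ≤ s^(2*d) := by rw [pow_mul]; exact pow_le_pow_left₀ (by positivity) h1 d
  have h3 : K * (D^2+1)^d ≤ s^(2*d+1) := by
    have := mul_le_mul hKs h2 (by positivity) hs0.le
    rw [pow_succ s (2*d), mul_comm (s^(2*d))]; exact this
  rw [div_pow, div_div_eq_mul_div, div_le_div_iff₀ (by positivity) (by positivity), one_mul]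
  calc K * (D^2+1)^d * (s^4)^3 * (s^2 * s^(2*(m+6))) ≤ s^(2*d+1) * (s^4)^3 * (s^2 * s^(2*(m+6))) := by gcongr
    _ = s^(2*d+27 + 2*m) := by ring
    _ ≤ s^(m + 2*m) := pow_le_pow_right₀ (by linarith) (by omega)
    _ = (s^m)^3 := by ring

lemma w_arith {s s' : ℝ} {m M : ℕ} (hs : 1 ≤ s) (hs' : s ≤ s') (h : s'^M = s^M + 1) (hm : m ≤ M) : s'^m ≤ s^m + s^m/s^M := by
  have hs0 : 0 < s := by linarith
  have h1 : (1:ℝ) ≤ s'/s := by rw [le_div_iff₀ hs0]; linarith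
  have h2 := pow_le_pow_right₀ h1 hm
  rw [div_pow, div_pow, h, div_le_div_iff₀ (by positivity) (by positivity)] at h2
  have e : s^m + s^m/s^M = ((s^M+1)*s^m)/s^M := by field_simp
  rw [e, le_div_iff₀ (by positivity)]
  exact h2

lemma r_tot {s s' R : ℝ} {M : ℕ} (hM : 1 ≤ M) (hs : 1 ≤ s) (h : 1/s' + 1/(M*2^M*(s*s^M)) ≤ 1/s) (hR : R*(M*2^M) ≤ s) : 1/s' + R * (1/(s^2*s^M)) ≤ 1/s := by
  have hs0 : 0 < s := by linarith
  have hM0 : (0:ℝ) < M := by exact_mod_cast hM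
  have : R * (1/(s^2*s^M)) ≤ 1/(M*2^M*(s*s^M)) := by
    rw [mul_one_div, div_le_div_iff₀ (by positivity) (by positivity)]
    calc R * (M*2^M*(s*s^M)) = (R*(M*2^M))*(s*s^M) := by ring
      _ ≤ s * (s*s^M) := by gcongr
      _ = _ := by ring
  linarith

lemma fin_arith {w w' σ V V' E Cl σ' R r r' q G er : ℝ} (h1 : w' * V' ≤ w*V + R*q) (hE : 0 ≤ E) (hσ : 0 < σ) (hσ' : σ ≤ σ') (hCl : Cl/σ^2 ≤ q) (hCl0 : 0 ≤ Cl)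
    (her : er ≤ q) (hr : r' + (R+2)*q ≤ r) (hG : G ≤ w'*V' + (E+Cl)/σ'^2 + r' + er) : G ≤ w*V + E/σ^2 + r := by
  have : (E+Cl)/σ'^2 ≤ (E+Cl)/σ^2 := by gcongr
  have e : (E+Cl)/σ^2 = E/σ^2 + Cl/σ^2 := add_div _ _ _
  rw [e] at this
  linarith

lemma step_thm {d k : ℕ} (hd : 5 ≤ d) (hk : 0 < k) {W : Finset (Pt d) → Finset (Pt d) → ℝ} {c C l Cl : ℝ} (hW : PF W c C) (hc : 0 < c) (hC : 1 ≤ C) (hl : 0 < l) (hCl : 1 ≤ Cl)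
    (hlE : ∀ A : Finset (Pt d), Shp A → EU A (fun x y => Real.exp (l * diam0 d (mv A x y))) ≤ Real.exp (l * diam0 d A) + Cl) {m : ℕ} (hm : 2*d+27 ≤ m) :
    ∃ s1 : ℝ, 2 ≤ s1 ∧ C ≤ s1 ∧ ∀ s s' : ℝ, s1 ≤ s → s ≤ s' → s'^(2*(m+6)) = s^(2*(m+6)) + 1 → 1 + 2*((4*(m+6)/l) * Real.log s) ≤ s →
      ∀ D : Fin k → Finset (Pt d), gd W l m s D → ∀ g : Pt d → Pt d → ℝ, (∀ x y, 0 ≤ g x y) → (∀ x y, g x y ≤ 1) →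
        (∀ i x y, x ∈ D i → y ∈ nbF ((D i).erase x) → y ∉ (D i).erase x → g x y ≤ Phi W l m s' (Function.update D i (mv (D i) x y))) →
        EU (Finset.univ.biUnion D) g ≤ Phi W l m s D := by
  obtain ⟨K, hK, hcmp⟩ := compare hd k hk
  obtain ⟨cc, hcc, hcap⟩ := capa_lower hd 3
  have hk0 : (0:ℝ) < k := by exact_mod_cast hk
  obtain ⟨t0, ht0⟩ : ∃ t0, t0 = cc/(3*k) := ⟨_, rfl⟩
  have ht0p : 0 < t0 := by rw [ht0]; positivity
  refine ⟨2 + C + K + Cl + 4*C/(2*c*t0) + ((k:ℝ)^2+2)*((2*(m+6) : ℕ)*2^(2*(m+6))), ?_, ?_, ?_⟩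
  · have : 0 ≤ 4*C/(2*c*t0) := by positivity
    have : 0 ≤ ((k:ℝ)^2+2)*((2*(m+6) : ℕ)*2^(2*(m+6))) := by positivity
    linarith
  · have : 0 ≤ 4*C/(2*c*t0) := by positivity
    have : 0 ≤ ((k:ℝ)^2+2)*((2*(m+6) : ℕ)*2^(2*(m+6))) := by positivity
    linarith
  intro s s' hs hss hM hlog D hg g hg0 hg1 hgP
  have q1 : 0 ≤ 4*C/(2*c*t0) := by positivity
  have q2 : 0 ≤ ((k:ℝ)^2+2)*((2*(m+6) : ℕ)*2^(2*(m+6))) := by positivity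
  have hs2 : 2 ≤ s := by linarith
  have hs0 : 0 < s := by linarith
  have hs1 : 1 ≤ s := by linarith
  have hCs : C ≤ s := by linarith
  have hKs : K ≤ s := by linarith
  have hcs : 4*C ≤ 2*c*t0*s := by
    have : 4*C/(2*c*t0) ≤ s := by linarith
    rw [div_le_iff₀ (by positivity)] at this
    linarith
  have hRs : ((k:ℝ)^2+2)*((2*(m+6) : ℕ)*2^(2*(m+6))) ≤ s := by linarith
  have hClS : Cl ≤ s := by linarith
  clear hs q1 q2
  obtain ⟨hdi, hsep⟩ := gd_geom hW hC hl (by omega) hs2 hCs hlog hg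
  obtain ⟨hD, hV, hE⟩ := hg
  have hlog0 : 0 ≤ (4*(m+6)/l) * Real.log s := mul_nonneg (by positivity) (Real.log_nonneg hs1)
  have hcm := hcmp D hD (s^m/s^4) _ (by positivity) hsep hdi g hg0 hg1
  have her := err_arith hs2 hK hKs hlog0 hlog hm
  -- weights
  have hca : ∀ i, cc ≤ capa d (↑(D i)) := fun i => hcap _ (hD i).card_le (hD i).nonempty
  have hcb : ∀ i, capa d (↑(D i)) ≤ 3 := fun i => (capa_le (by omega) _).trans (by exact_mod_cast (hD i).card_le)
  have hsum : ∑ j, capa d (↑(D j)) ≤ 3*k := by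
    refine (Finset.sum_le_sum fun i _ => hcb i).trans ?_
    simp [mul_comm]
  have hsum0 : 0 < ∑ j, capa d (↑(D j)) := Finset.sum_pos (fun i _ => hcc.trans_le (hca i)) ⟨⟨0, hk⟩, Finset.mem_univ _⟩
  obtain ⟨th, hth⟩ : ∃ th : Fin k → ℝ, th = fun i => capa d (↑(D i)) / ∑ j, capa d (↑(D j)) := ⟨_, rfl⟩
  have hth1 : ∑ i, th i = 1 := by rw [hth]; rw [← Finset.sum_div, div_self hsum0.ne']
  have hth0 : ∀ i, t0 ≤ th i := by
    intro i; rw [hth, ht0]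
    exact div_le_div₀ (hcc.le.trans (hca i)) (hca i) hsum0 hsum
  have hcm' : EU (Finset.univ.biUnion D) g ≤ ∑ i, th i * EU (D i) g + K * (((4*(m+6)/l) * Real.log s)^2+1)^d/(s^m/s^4)^3 := by rw [hth]; exact hcm
  have hs'0 : 0 < s' := by linarith
  -- single cluster bound
  have hEi : ∀ i, EU (D i) g ≤ s'^m * EU (D i) (fun x y => VV W (Function.update D i (mv (D i) x y))) + ((EE l D + Cl)/(s'^(2*(m+6)))^2 + 1/s') := by
    intro i
    have a1 : EU (D i) g ≤ EU (D i) (fun x y => Phi W l m s' (Function.update D i (mv (D i) x y))) :=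
      EU_mono (by omega) fun x y hx hy hy' => hgP i x y hx hy hy'
    have a2 : EU (D i) (fun x y => Phi W l m s' (Function.update D i (mv (D i) x y))) = s'^m * EU (D i) (fun x y => VV W (Function.update D i (mv (D i) x y))) +
        (1/(s'^(2*(m+6)))^2) * EU (D i) (fun x y => EE l (Function.update D i (mv (D i) x y))) + 1/s' := by
      rw [← EU_mul, ← EU_mul, ← EU_const hd (hD i).two_le (1/s'), ← EU_add, ← EU_add]
      refine EU_congr (by omega) fun x y _ _ _ => ?_
      unfold Phi; ring
    have a3 := EE_step hd hlE hD i
    rw [a2] at a1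
    have a4 := mul_le_mul_of_nonneg_left a3 (by positivity : 0 ≤ 1/(s'^(2*(m+6)))^2)
    have a5 : 1/(s'^(2*(m+6)))^2 * (EE l D + Cl) = (EE l D + Cl)/(s'^(2*(m+6)))^2 := by ring
    linarith
  have hEs : ∑ i, th i * EU (D i) g ≤ s'^m * (∑ i, th i * EU (D i) (fun x y => VV W (Function.update D i (mv (D i) x y)))) + ((EE l D + Cl)/(s'^(2*(m+6)))^2 + 1/s') := by
    refine (Finset.sum_le_sum fun i _ => mul_le_mul_of_nonneg_left (hEi i) (ht0p.le.trans (hth0 i))).trans ?_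
    generalize (EE l D + Cl)/(s'^(2*(m+6)))^2 + 1/s' = Z
    simp_rw [mul_add (th _)]
    rw [Finset.sum_add_distrib, ← Finset.sum_mul, hth1, one_mul, Finset.mul_sum]
    refine le_of_eq ?_
    congr 1
    exact Finset.sum_congr rfl fun i _ => by ring
  have hVs := VV_step hd hW hc hC hD hth0 ht0p hth1
  have hM1 : 1 ≤ 2*(m+6) := by omega
  obtain ⟨hr1, hr2, hr3⟩ := r_arith hM1 hs1 hs'0.le hM
  have hw2 := w_arith hs1 hss hM (by omega : m ≤ 2*(m+6))
  have hrt := r_tot hM1 hs1 hr3 hRs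
  have hmain : s'^m * (∑ i, th i * EU (D i) (fun x y => VV W (Function.update D i (mv (D i) x y)))) ≤ s^m * VV W D + (k:ℝ)^2 * (1/(s^2*s^(2*(m+6)))) := by
    refine (mul_le_mul_of_nonneg_left hVs (by positivity)).trans ?_
    rw [Finset.mul_sum]
    have : s^m * VV W D + (k:ℝ)^2 * (1/(s^2*s^(2*(m+6)))) ≥ ∑ p ∈ (Finset.univ.filter fun p : Fin k × Fin k => p.1 ≠ p.2), (s^m * W (D p.1) (D p.2) + 1/(s^2*s^(2*(m+6)))) := by
      rw [Finset.sum_add_distrib, ← Finset.mul_sum, Finset.sum_const, nsmul_eq_mul]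
      have hcard : ((Finset.univ.filter fun p : Fin k × Fin k => p.1 ≠ p.2).card : ℝ) ≤ (k:ℝ)^2 := by
        have := Finset.card_le_univ (Finset.univ.filter fun p : Fin k × Fin k => p.1 ≠ p.2)
        rw [Fintype.card_prod, Fintype.card_fin] at this
        rw [sq]; exact_mod_cast this
      have : (0:ℝ) ≤ 1/(s^2*s^(2*(m+6))) := by positivity
      have := mul_le_mul_of_nonneg_right hcard this
      unfold VV
      linarith
    refine le_trans (Finset.sum_le_sum fun p hp => ?_) this
    have hp' := (Finset.mem_filter.1 hp).2
    have hpf := hW _ _ (hD p.1) (hD p.2)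
    have hA := diam_nonneg (hD p.1).nonempty
    have hB := diam_nonneg (hD p.2).nonempty
    have hA' := hdi p.1
    have hB' := hdi p.2
    exact pair_arith hs1 (pow_le_pow_right₀ hs1 (by omega)) (by ring) (pow_le_pow_left₀ hs0.le hss m) hw2 (by positivity) hC hcs hCs (FF_pos _) (by linarith) (by linarith) hpf.2.1
      hpf.2.2.2.1 hpf.2.2.2.2.1 ((mul_le_mul_of_nonneg_left (le_VV hW hD hp') (by positivity)).trans hV.le)
  refine fin_arith (Cl := Cl) (σ' := s'^(2*(m+6))) hmain (Finset.sum_nonneg fun i _ => (Real.exp_pos _).le) (by positivity) (pow_le_pow_left₀ hs0.le hss _) ?_ (by linarith) her hrt (by linarith)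
  rw [div_le_div_iff₀ (by positivity) (by positivity), one_mul]
  calc Cl * (s^2*s^(2*(m+6))) ≤ s * (s^2*s^(2*(m+6))) := by gcongr
    _ = s^3 * s^(2*(m+6)) := by ring
    _ ≤ s^(2*(m+6)) * s^(2*(m+6)) := by gcongr <;> first | exact hs1 | omega
    _ = _ := by ring

/-! ### Staying good forever with probability at least one half -/

def updx {d k : ℕ} (C : Fin k → Finset (Pt d)) (x y : Pt d) : Fin k → Finset (Pt d) :=
  fun i => if x ∈ C i then mv (C i) x y else C i

noncomputable def rt (M t : ℕ) : ℝ := (t:ℝ)^((1:ℝ)/M)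

lemma rt_pow {M : ℕ} (hM : 1 ≤ M) (t : ℕ) : rt M t ^ M = t := by
  unfold rt
  rw [← Real.rpow_natCast, ← Real.rpow_mul (by positivity)]
  have : (M:ℝ) ≠ 0 := by positivity
  rw [one_div_mul_cancel this, Real.rpow_one]

lemma rt_nonneg (M t : ℕ) : 0 ≤ rt M t := by unfold rt; positivity

lemma rt_mono {M t t' : ℕ} (h : t ≤ t') : rt M t ≤ rt M t' := by
  unfold rt
  exact Real.rpow_le_rpow (by positivity) (by exact_mod_cast h) (by positivity)

lemma rt_of_pow {M : ℕ} (hM : 1 ≤ M) (a : ℕ) : rt M (a^M) = a :=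
  (pow_left_inj₀ (rt_nonneg _ _) (by positivity) (by omega : M ≠ 0)).1 (by rw [rt_pow hM]; push_cast; rfl)

open Classical in
noncomputable def Bd {d k : ℕ} (W : Finset (Pt d) → Finset (Pt d) → ℝ) (l : ℝ) (m : ℕ) : ℕ → ℕ → (Fin k → Finset (Pt d)) → ℝ
  | 0, σ, C => if gd W l m (rt (2*(m+6)) σ) C then 0 else 1
  | T+1, σ, C => if gd W l m (rt (2*(m+6)) σ) C then EU (Finset.univ.biUnion C) (fun x y => Bd W l m T (σ+1) (updx C x y)) else 1

lemma Bd_nonneg {d k : ℕ} (hd : 0 < d) {W : Finset (Pt d) → Finset (Pt d) → ℝ} {l : ℝ} {m : ℕ} (T : ℕ) : ∀ σ (C : Fin k → Finset (Pt d)), 0 ≤ Bd W l m T σ C := by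
  induction T with
  | zero => intro σ C; unfold Bd; split_ifs <;> norm_num
  | succ T ih =>
    intro σ C; unfold Bd; split_ifs
    · exact EU_nonneg hd fun x y _ _ _ => ih _ _
    · norm_num

lemma union_two {d k : ℕ} (hk : 0 < k) {C : Fin k → Finset (Pt d)} (hC : ∀ i, Shp (C i)) : 2 ≤ (Finset.univ.biUnion C).card :=
  (hC ⟨0, hk⟩).two_le.trans (Finset.card_le_card (Finset.subset_biUnion_of_mem C (Finset.mem_univ _)))

lemma Bd_le_one {d k : ℕ} (hd : 5 ≤ d) (hk : 0 < k) {W : Finset (Pt d) → Finset (Pt d) → ℝ} {l : ℝ} {m : ℕ} (T : ℕ) : ∀ σ (C : Fin k → Finset (Pt d)), Bd W l m T σ C ≤ 1 := by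
  induction T with
  | zero => intro σ C; unfold Bd; split_ifs <;> norm_num
  | succ T ih =>
    intro σ C; unfold Bd; split_ifs with h
    · rw [← EU_const hd (union_two hk h.1) 1]
      exact EU_mono (by omega) fun x y _ _ _ => ih _ _
    · norm_num

lemma Bd_not {d k : ℕ} {W : Finset (Pt d) → Finset (Pt d) → ℝ} {l : ℝ} {m : ℕ} (T : ℕ) {σ} {C : Fin k → Finset (Pt d)} (h : ¬ gd W l m (rt (2*(m+6)) σ) C) :
    Bd W l m T σ C = 1 := by
  cases T <;> (unfold Bd; exact if_neg h)

lemma Phi_nonneg {d k : ℕ} {W : Finset (Pt d) → Finset (Pt d) → ℝ} {c C l : ℝ} (hW : PF W c C) {m : ℕ} {s : ℝ} (hs : 0 < s) {D : Fin k → Finset (Pt d)} (hD : ∀ i, Shp (D i)) :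
    0 ≤ Phi W l m s D := by
  unfold Phi
  have := VV_nonneg hW hD
  have : 0 ≤ EE l D := Finset.sum_nonneg fun i _ => (Real.exp_pos _).le
  positivity

lemma Phi_not {d k : ℕ} {W : Finset (Pt d) → Finset (Pt d) → ℝ} {c C l : ℝ} (hW : PF W c C) {m : ℕ} {s : ℝ} (hs : 0 < s) {D : Fin k → Finset (Pt d)} (hD : ∀ i, Shp (D i))
    (h : ¬ gd W l m s D) : 1 ≤ Phi W l m s D := by
  have h1 := VV_nonneg hW hD
  have h2 : 0 ≤ EE l D := Finset.sum_nonneg fun i _ => (Real.exp_pos _).le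
  have h3 : 0 ≤ s^m * VV W D := by positivity
  have h4 : 0 ≤ EE l D / (s^(2*(m+6)))^2 := by positivity
  have h5 : 0 ≤ 1/s := by positivity
  unfold Phi
  by_contra hlt
  apply h
  refine ⟨hD, by linarith, fun i => ?_⟩
  have h6 : Real.exp (l * diam0 d (D i)) ≤ EE l D := Finset.single_le_sum (f := fun i => Real.exp (l * diam0 d (D i))) (fun i _ => (Real.exp_pos _).le) (Finset.mem_univ i)
  have h7 : EE l D / (s^(2*(m+6)))^2 < 1 := by linarith
  rw [div_lt_one (by positivity)] at h7
  linarith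

lemma gd_disj {d k : ℕ} {W : Finset (Pt d) → Finset (Pt d) → ℝ} {c C l : ℝ} (hW : PF W c C) (hC : 1 ≤ C) (hl : 0 < l) {m : ℕ} (hm : 8 ≤ m) {s : ℝ} (hs : 2 ≤ s) (hCs : C ≤ s)
    (hlog : 1 + 2*((4*(m+6)/l) * Real.log s) ≤ s) {D : Fin k → Finset (Pt d)} (hg : gd W l m s D) {i j : Fin k} (hij : i ≠ j) {x : Pt d} (hx : x ∈ D i) : x ∉ D j := by
  intro hy
  have := (gd_geom hW hC hl hm hs hCs hlog hg).2 i j hij x hx x hy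
  rw [sub_self, norm_zero] at this
  have : 0 < s^m/s^4 := by positivity
  linarith

lemma updx_eq {d k : ℕ} {D : Fin k → Finset (Pt d)} (h : ∀ i j, i ≠ j → ∀ x ∈ D i, x ∉ D j) {i : Fin k} {x : Pt d} (hx : x ∈ D i) (y : Pt d) :
    updx D x y = Function.update D i (mv (D i) x y) := by
  funext j
  unfold updx
  by_cases hj : j = i
  · subst hj; simp [hx]
  · rw [Function.update_of_ne hj, if_neg (h i j (Ne.symm hj) x hx)]

lemma aSep_le {n m t σ0 : ℕ} (hn : 4 ≤ n) (hm : 6*n^100 ≤ m) (hσ : 1 ≤ σ0) (hs : (100*n + 1 : ℝ) ≤ rt (2*(m+6)) (t+σ0)) :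
    aSep n t ≤ rt (2*(m+6)) (t+σ0) ^ (m-4) := by
  have hn1 : (1:ℝ) ≤ n := by exact_mod_cast (by omega : 1 ≤ n)
  have hm' : (6*(n:ℝ)^100) ≤ m := by exact_mod_cast hm
  have hpow : (1:ℝ) ≤ (n:ℝ)^100 := one_le_pow₀ hn1
  have hm5 : 5 ≤ m := by
    have : 1 ≤ n^100 := Nat.one_le_pow _ _ (by omega)
    omega
  obtain ⟨s, hsd⟩ : ∃ s, s = rt (2*(m+6)) (t+σ0) := ⟨_, rfl⟩
  have hs1 : 1 ≤ s := by rw [hsd]; linarith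
  have hneg : (n:ℝ)^(-(100:ℝ)) = 1/(n:ℝ)^100 := by
    rw [Real.rpow_neg (by positivity)]
    rw [one_div]; congr 1
    exact_mod_cast Real.rpow_natCast (n:ℝ) 100
  have hp2 : (2:ℝ) ≤ (n:ℝ)^100 := by
    have h4 : (4:ℝ) ≤ n := by exact_mod_cast hn
    calc (2:ℝ) ≤ n := by linarith
      _ = (n:ℝ)^1 := (pow_one _).symm
      _ ≤ _ := pow_le_pow_right₀ hn1 (by norm_num)
  have e0 : (0:ℝ) ≤ 1/2 - (n:ℝ)^(-(100:ℝ)) := by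
    rw [hneg, sub_nonneg]
    exact one_div_le_one_div_of_le (by norm_num) hp2
  have e1 : (1:ℝ)/2 - (n:ℝ)^(-(100:ℝ)) ≤ (1:ℝ)/(2*(m+6) : ℕ) * ((m-5 : ℕ):ℝ) := by
    rw [hneg, Nat.cast_sub hm5]
    push_cast
    generalize (n:ℝ)^100 = q at *
    have : 11/(2*((m:ℝ)+6)) ≤ 1/q := by
      rw [div_le_div_iff₀ (by positivity) (by linarith)]; linarith
    have e : 1/(2*((m:ℝ)+6)) * (m-5) = 1/2 - 11/(2*((m:ℝ)+6)) := by field_simp; ring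
    rw [e]; linarith
  have h1 : (t:ℝ)^((1:ℝ)/2 - (n:ℝ)^(-(100:ℝ))) ≤ s^(m-5) := by
    calc (t:ℝ)^((1:ℝ)/2 - (n:ℝ)^(-(100:ℝ))) ≤ ((t+σ0 : ℕ):ℝ)^((1:ℝ)/2 - (n:ℝ)^(-(100:ℝ))) :=
          Real.rpow_le_rpow (by positivity) (by push_cast; linarith [(by positivity : (0:ℝ) ≤ σ0)]) e0
      _ ≤ ((t+σ0 : ℕ):ℝ)^((1:ℝ)/(2*(m+6) : ℕ) * ((m-5 : ℕ):ℝ)) := Real.rpow_le_rpow_of_exponent_le (by exact_mod_cast (by omega : 1 ≤ t+σ0)) e1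
      _ = s^(m-5) := by rw [Real.rpow_mul (by positivity), Real.rpow_natCast, hsd]; rfl
  have h2 : s^(m-4) = s^(m-5)*s := by rw [← pow_succ]; congr 1; omega
  have h3 : 1 ≤ s^(m-5) := one_le_pow₀ hs1
  unfold aSep
  rw [← hsd, h2]
  rw [← hsd] at hs
  nlinarith

lemma log_cond (A : ℝ) : ∃ s2 : ℝ, ∀ s, s2 ≤ s → 1 + 2*(A * Real.log s) ≤ s := by
  have h1 : Filter.Tendsto (fun s : ℝ => Real.log s / s) Filter.atTop (nhds 0) := by
    have := Real.isLittleO_log_id_atTop.tendsto_div_nhds_zero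
    simpa using this
  have h2 := h1.eventually (Metric.ball_mem_nhds (0:ℝ) (by positivity : (0:ℝ) < 1/(4*(|A|+1))))
  obtain ⟨s2, hs2⟩ := Filter.eventually_atTop.1 h2
  refine ⟨max s2 2, fun s hs => ?_⟩
  have hs' : 2 ≤ s := (le_max_right _ _).trans hs
  have h3 := hs2 s ((le_max_left _ _).trans hs)
  rw [Real.dist_eq, sub_zero, abs_div, abs_of_pos (by linarith : 0 < s), div_lt_div_iff₀ (by linarith) (by positivity)] at h3
  have h4 : |A| * |Real.log s| ≤ s/4 := by nlinarith [abs_nonneg A, abs_nonneg (Real.log s)]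
  have h5 : A * Real.log s ≤ |A| * |Real.log s| := by rw [← abs_mul]; exact le_abs_self _
  linarith

lemma init_arith {s w V E σ : ℝ} (hs : 8 ≤ s) (hV : w*V ≤ 1/8) (hE : E ≤ s) (hσ : s ≤ σ) : w*V + E/σ^2 + 1/s ≤ 1/2 := by
  have hσ0 : 0 < σ := by linarith
  have h1 : E/σ^2 ≤ 1/8 := by rw [div_le_div_iff₀ (by positivity) (by norm_num)]; nlinarith
  have h2 : 1/s ≤ 1/8 := one_div_le_one_div_of_le (by norm_num) hs
  linarith

lemma start_phi {d k : ℕ} {W : Finset (Pt d) → Finset (Pt d) → ℝ} {c C l : ℝ} (hW : PF W c C) (hC : 1 ≤ C) (hl : 0 < l) (m : ℕ) {s : ℝ} (hs : 8 ≤ s) (hsk : k * Real.exp (l*2) ≤ s) :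
    ∃ R : ℝ, 0 < R ∧ ∀ D : Fin k → Finset (Pt d), (∀ i, Line (D i)) → (∀ i j, i ≠ j → ∀ x ∈ D i, ∀ y ∈ D j, R ≤ ‖emb x - emb y‖) → Phi W l m s D ≤ 1/2 := by
  have hs0 : 0 < s := by linarith
  refine ⟨4 + 8*(s^m*((k:ℝ)^2+1)*(C*5)), by positivity, fun D hD hR => ?_⟩
  unfold Phi
  refine init_arith hs ?_ ?_ (le_self_pow₀ (by linarith) (by omega))
  · have hb : VV W D ≤ (k:ℝ)^2 * (1/(8*(s^m*((k:ℝ)^2+1)))) := by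
      have hcard : ((Finset.univ.filter fun p : Fin k × Fin k => p.1 ≠ p.2).card : ℝ) ≤ (k:ℝ)^2 := by
        have := Finset.card_le_univ (Finset.univ.filter fun p : Fin k × Fin k => p.1 ≠ p.2)
        rw [Fintype.card_prod, Fintype.card_fin] at this
        rw [sq]; exact_mod_cast this
      refine le_trans ?_ (mul_le_mul_of_nonneg_right hcard (by positivity))
      rw [← nsmul_eq_mul]
      refine Finset.sum_le_card_nsmul _ _ _ fun p hp => ?_
      have hp' := (Finset.mem_filter.1 hp).2
      have hA := (hD p.1).shp
      have hB := (hD p.2).shp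
      have h := (hW _ _ hA hB).2.2.2.2.1
      have dA := line_diam (hD p.1)
      have dB := line_diam (hD p.2)
      have dA0 := diam_nonneg hA.nonempty
      have dB0 := diam_nonneg hB.nonempty
      obtain ⟨x, hx⟩ := hA.nonempty
      obtain ⟨y, hy⟩ := hB.nonempty
      have n1 := near_self hx
      have n2 := near_self hy
      have n4 := hR _ _ hp' x hx y hy
      have n3 : ‖emb x - emb y‖ ≤ ‖emb x - ctr (D p.1)‖ + ‖ctr (D p.1) - ctr (D p.2)‖ + ‖emb y - ctr (D p.2)‖ := by
        have : emb x - emb y = (emb x - ctr (D p.1)) + (ctr (D p.1) - ctr (D p.2)) - (emb y - ctr (D p.2)) := by abel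
        rw [this]
        exact (norm_sub_le _ _).trans (add_le_add_left (norm_add_le _ _) _)
      have hF := FF_le_inv (ctr (D p.1) - ctr (D p.2)) (r := 8*(s^m*((k:ℝ)^2+1)*(C*5))) (by positivity) (by linarith)
      refine h.trans ?_
      have e : 1/(8*(s^m*((k:ℝ)^2+1))) = C*5*(1/(8*(s^m*((k:ℝ)^2+1)*(C*5)))) := by field_simp
      rw [e]
      exact mul_le_mul (mul_le_mul_of_nonneg_left (by linarith) (by linarith)) hF (FF_pos _).le (by positivity)
    refine (mul_le_mul_of_nonneg_left hb (by positivity)).trans ?_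
    have e : s^m * ((k:ℝ)^2 * (1/(8*(s^m*((k:ℝ)^2+1))))) = (k:ℝ)^2/((k:ℝ)^2+1)*(1/8) := by field_simp
    rw [e]
    have : (k:ℝ)^2/((k:ℝ)^2+1) ≤ 1 := by rw [div_le_one (by positivity)]; linarith
    linarith
  · refine le_trans ?_ hsk
    have : EE l D ≤ ∑ i : Fin k, Real.exp (l*2) := Finset.sum_le_sum fun i _ => Real.exp_le_exp.2 (mul_le_mul_of_nonneg_left (line_diam (hD i)) hl.le)
    simpa using this

theorem stay {d : ℕ} (hd : 5 ≤ d) {n : ℕ} (hn : 4 ≤ n) : ∃ b : ℝ, 0 < b ∧ ∀ k, 0 < k → ∃ (R : ℝ) (G : ℕ → (Fin k → Finset (Pt d)) → Prop) (B : ℕ → ℕ → (Fin k → Finset (Pt d)) → ℝ),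
    0 < R ∧ (∀ T t C, 0 ≤ B T t C) ∧ (∀ T t C, ¬ G t C → 1 ≤ B T t C) ∧
    (∀ T t C, G t C → EU (Finset.univ.biUnion C) (fun x y => B T (t+1) (updx C x y)) ≤ B (T+1) t C) ∧
    (∀ C, (∀ i, Line (C i)) → (∀ i j, i ≠ j → ∀ x ∈ C i, ∀ y ∈ C j, R ≤ ‖emb x - emb y‖) → ∀ T, B T 0 C ≤ 1/2) ∧
    (∀ t C, G t C → (∀ i, Shp (C i)) ∧ ∀ i j, i ≠ j → ∀ x ∈ C i, ∀ y ∈ C j, aSep n t ≤ ‖emb x - emb y‖ ∧ diam0 d (C i) ≤ b * Real.log ‖emb x - emb y‖ ∧ 1 ≤ ‖emb x - emb y‖) := by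
  obtain ⟨W, c, C, hc, hC, hW⟩ := pair_fn hd
  obtain ⟨l, Cl, hl, hCl, hlE⟩ := diam_drift hd
  obtain ⟨m, hmd⟩ : ∃ m, m = 6*n^100 + 2*d + 27 := ⟨_, rfl⟩
  have hW' : PF W c C := hW
  refine ⟨4*(m+6)/l, by positivity, fun k hk => ?_⟩
  obtain ⟨s1, hs1, hCs1, hstep⟩ := step_thm hd hk hW' hc hC hl hCl hlE (m := m) (by omega)
  obtain ⟨s2, hs2⟩ := log_cond (4*(m+6)/l)
  obtain ⟨a, ha⟩ := exists_nat_ge (max (max s1 s2) (max (8 + k * Real.exp (l*2)) (100*n+1)))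
  have ha1 : s1 ≤ a := le_trans (le_trans (le_max_left _ _) (le_max_left _ _)) ha
  have ha2 : s2 ≤ a := le_trans (le_trans (le_max_right _ _) (le_max_left _ _)) ha
  have ha3 : 8 + k * Real.exp (l*2) ≤ a := le_trans (le_trans (le_max_left _ _) (le_max_right _ _)) ha
  have ha4 : (100*n+1 : ℝ) ≤ a := le_trans (le_trans (le_max_right _ _) (le_max_right _ _)) ha
  have hM : 1 ≤ 2*(m+6) := by omega
  have hm8 : 8 ≤ m := by omega
  have hkE : 0 ≤ k * Real.exp (l*2) := by positivity
  obtain ⟨R, hR, hstart⟩ := start_phi (k := k) hW' hC hl m (s := a) (by linarith) (by linarith)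
  obtain ⟨σ0, hσ0⟩ : ∃ σ0, σ0 = a^(2*(m+6)) := ⟨_, rfl⟩
  have hrt : ∀ t, (a:ℝ) ≤ rt (2*(m+6)) (t+σ0) := fun t => by
    rw [← rt_of_pow hM a, ← hσ0]; exact rt_mono (by omega)
  have hσ1 : 1 ≤ σ0 := by
    rw [hσ0]; apply Nat.one_le_pow
    have : (0:ℝ) < a := by linarith
    exact_mod_cast this
  have hphi : ∀ T t (D : Fin k → Finset (Pt d)), (∀ i, Shp (D i)) → Bd W l m T (t+σ0) D ≤ Phi W l m (rt (2*(m+6)) (t+σ0)) D := by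
    intro T
    induction T with
    | zero =>
      intro t D hD
      have hs := hrt t
      by_cases hg : gd W l m (rt (2*(m+6)) (t+σ0)) D
      · unfold Bd; rw [if_pos hg]; exact Phi_nonneg hW' (by linarith) hD
      · rw [Bd_not _ hg]; exact Phi_not hW' (by linarith) hD hg
    | succ T ih =>
      intro t D hD
      have hs := hrt t
      by_cases hg : gd W l m (rt (2*(m+6)) (t+σ0)) D
      · unfold Bd; rw [if_pos hg]
        refine hstep _ (rt (2*(m+6)) (t+1+σ0)) (by linarith) (rt_mono (by omega)) ?_ (hs2 _ (by linarith)) D hg _ (fun x y => Bd_nonneg (by omega) _ _ _) (fun x y => Bd_le_one hd hk _ _ _) ?_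
        · rw [rt_pow hM, rt_pow hM]; push_cast; ring
        · intro i x y hx hy hy'
          rw [updx_eq (fun i j hij x hx => gd_disj hW' hC hl hm8 (by linarith) (by linarith) (hs2 _ (by linarith)) hg hij hx) hx, add_right_comm]
          refine ih (t+1) _ fun j => ?_
          by_cases hj : j = i
          · subst hj; rw [Function.update_self]; exact (hD j).mv hx hy hy'
          · rw [Function.update_of_ne hj]; exact hD j
      · rw [Bd_not _ hg]; exact Phi_not hW' (by linarith) hD hg
  refine ⟨R, fun t D => gd W l m (rt (2*(m+6)) (t+σ0)) D, fun T t D => Bd W l m T (t+σ0) D, hR, fun T t D => Bd_nonneg (by omega) _ _ _, fun T t D h => (Bd_not T h).ge, ?_, ?_, ?_⟩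
  · intro T t D hg
    have h1 : Bd W l m (T+1) (t+σ0) D = EU (Finset.univ.biUnion D) (fun x y => Bd W l m T (t+σ0+1) (updx D x y)) := by
      conv_lhs => unfold Bd
      exact if_pos hg
    show _ ≤ Bd W l m (T+1) (t+σ0) D
    rw [h1, add_right_comm]
  · intro D hL hD T
    refine (hphi T 0 D fun i => (hL i).shp).trans ?_
    have : rt (2*(m+6)) (0+σ0) = a := by rw [zero_add, hσ0, rt_of_pow hM]
    rw [this]
    exact hstart D hL hD
  · intro t D hg
    refine ⟨hg.1, fun i j hij x hx y hy => ?_⟩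
    have hs := hrt t
    obtain ⟨g1, g2⟩ := gd_geom hW' hC hl hm8 (by linarith) (by linarith) (hs2 _ (by linarith)) hg
    have h1 := g2 i j hij x hx y hy
    have hs1' : 1 ≤ rt (2*(m+6)) (t+σ0) := by linarith
    have h2 : rt (2*(m+6)) (t+σ0)^m / rt (2*(m+6)) (t+σ0)^4 = rt (2*(m+6)) (t+σ0)^(m-4) := by
      rw [div_eq_iff (by positivity), ← pow_add]; congr 1; omega
    rw [h2] at h1
    have h3 : rt (2*(m+6)) (t+σ0) ≤ rt (2*(m+6)) (t+σ0)^(m-4) := le_self_pow₀ hs1' (by omega)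
    refine ⟨(aSep_le hn (by omega) hσ1 (by linarith)).trans h1, (g1 i).trans ?_, by linarith⟩
    exact mul_le_mul_of_nonneg_left (Real.log_le_log (by linarith) (by linarith)) (by positivity)

/-! ### Cylinder estimates -/

def cyl {d : ℕ} (u : ℕ → Conf d) (t : ℕ) : Set (ℕ → Conf d) := {ω | ∀ s ≤ t, ω s = u s}

def ext {d : ℕ} (u : ℕ → Conf d) (t : ℕ) (V : Conf d) : ℕ → Conf d := Function.update u (t+1) V

lemma cyl_ext {d : ℕ} (u : ℕ → Conf d) (t : ℕ) (V : Conf d) : cyl (ext u t V) (t+1) = cyl u t ∩ {ω | ω (t+1) = V} := by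
  ext ω
  simp only [cyl, ext, Set.mem_setOf_eq, Set.mem_inter_iff]
  constructor
  · intro h
    refine ⟨fun s hs => ?_, ?_⟩
    · rw [h s (by omega), Function.update_of_ne (by omega)]
    · rw [h (t+1) le_rfl, Function.update_self]
  · rintro ⟨h1, h2⟩ s hs
    rcases Nat.lt_or_ge t s with h | h
    · obtain rfl : s = t+1 := by omega
      rw [Function.update_self, h2]
    · rw [Function.update_of_ne (by omega), h1 s h]

lemma mu_ext {d : ℕ} {U : Conf d} {μ : Measure (ℕ → Conf d)} (h : IsHATLaw d U μ) (u : ℕ → Conf d) (t : ℕ) (V : Conf d) :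
    μ (cyl (ext u t V) (t+1)) = μ (cyl u t) * ENNReal.ofReal (hatProb d (u t) V) := by
  have h1 := h.2 (t+1) (ext u t V)
  have h2 := h.2 t u
  unfold cyl
  rw [h1, h2, Finset.prod_range_succ]
  have e0 : ext u t V 0 = u 0 := Function.update_of_ne (by omega) _ _
  have e1 : ext u t V t = u t := Function.update_of_ne (by omega) _ _
  have e2 : ext u t V (t+1) = V := Function.update_self _ _ _
  rw [e0, e1, e2, mul_assoc]
  congr 2
  refine Finset.prod_congr rfl fun s hs => ?_
  have := Finset.mem_range.1 hs
  unfold ext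
  rw [Function.update_of_ne (by omega), Function.update_of_ne (by omega)]

lemma hatProb_ne {d : ℕ} (hd : 0 < d) {U V : Finset (Pt d)} (h : hatProb d U V ≠ 0) :
    ∃ x y, x ∈ U ∧ y ∈ nbF (U.erase x) ∧ y ∉ U.erase x ∧ V = mv U x y := by
  by_contra hc
  push Not at hc
  apply h
  rw [hatProb_eq hd, EU_congr hd (g := fun _ _ => 0) fun x y a b c => if_neg (hc x y a b c)]
  simp [EU]

lemma hat_sum {d : ℕ} (hd : 0 < d) (U : Finset (Pt d)) (f : Finset (Pt d) → ℝ) (S : Finset (Finset (Pt d)))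
    (hS : ∀ x y, x ∈ U → y ∈ nbF (U.erase x) → y ∉ U.erase x → mv U x y ∈ S) :
    ∑ V ∈ S, hatProb d U V * f V = EU U (fun x y => f (mv U x y)) := by
  have : ∀ V, hatProb d U V * f V = EU U (fun x y => f V * if V = mv U x y then 1 else 0) := fun V => by
    rw [hatProb_eq hd, EU_mul, mul_comm]
  simp_rw [this]
  rw [← EU_sum]
  refine EU_congr hd fun x y a b c => ?_
  simp [hS x y a b c]

lemma hatProb_nonneg {d : ℕ} (hd : 0 < d) (U V : Finset (Pt d)) : 0 ≤ hatProb d U V := by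
  rw [hatProb_eq hd]
  exact EU_nonneg hd fun x y _ _ _ => by split_ifs <;> norm_num

instance (d : ℕ) : Countable (Conf d) := inferInstanceAs (Countable (Finset (Fin d → ℤ)))

lemma step_le {d : ℕ} (hd : 0 < d) {U0 : Conf d} {μ : Measure (ℕ → Conf d)} (hμ : IsHATLaw d U0 μ) (u : ℕ → Conf d) (t : ℕ) (S : Set (ℕ → Conf d))
    (f : Conf d → ℝ) (hf : ∀ V, 0 ≤ f V)
    (h : ∀ x y, x ∈ u t → y ∈ nbF ((u t).erase x) → y ∉ (u t).erase x →
      μ (cyl (ext u t (mv (u t) x y)) (t+1) ∩ S) ≤ ENNReal.ofReal (f (mv (u t) x y)) * μ (cyl (ext u t (mv (u t) x y)) (t+1))) :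
    μ (cyl u t ∩ S) ≤ ENNReal.ofReal (EU (u t) (fun x y => f (mv (u t) x y))) * μ (cyl u t) := by
  classical
  obtain ⟨Q, hQ⟩ : ∃ Q : Finset (Conf d), ∀ x y, x ∈ u t → y ∈ nbF ((u t).erase x) → y ∉ (u t).erase x → mv (u t) x y ∈ Q := by
    refine ⟨((u t) ×ˢ nbF (u t)).image fun p => mv (u t) p.1 p.2, fun x y hx hy _ => Finset.mem_image.2 ⟨(x,y), Finset.mem_product.2 ⟨hx, nbF_mono (Finset.erase_subset _ _) hy⟩, rfl⟩⟩
  have h1 : cyl u t ∩ S ⊆ (⋃ V ∈ Q, cyl (ext u t V) (t+1) ∩ S) ∪ ⋃ V : {V : Conf d // V ∉ Q}, cyl (ext u t V.1) (t+1) := by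
    rintro ω ⟨h1, h2⟩
    by_cases hV : ω (t+1) ∈ Q
    · left
      simp only [Set.mem_iUnion]
      exact ⟨_, hV, by rw [cyl_ext]; exact ⟨h1, rfl⟩, h2⟩
    · right
      simp only [Set.mem_iUnion]
      exact ⟨⟨_, hV⟩, by rw [cyl_ext]; exact ⟨h1, rfl⟩⟩
  have h2 : μ (⋃ V : {V : Conf d // V ∉ Q}, cyl (ext u t V.1) (t+1)) = 0 := by
    refine measure_iUnion_null fun V => ?_
    rw [mu_ext hμ]
    have : hatProb d (u t) V.1 = 0 := by
      by_contra hc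
      obtain ⟨x, y, a, b, c, e⟩ := hatProb_ne hd hc
      exact V.2 (e ▸ hQ x y a b c)
    rw [this]; simp
  refine (measure_mono h1).trans ((measure_union_le _ _).trans ?_)
  rw [h2, add_zero]
  refine (measure_biUnion_finset_le _ _).trans ?_
  rw [← hat_sum hd (u t) f Q hQ, ENNReal.ofReal_sum_of_nonneg (fun V _ => mul_nonneg (hatProb_nonneg hd _ _) (hf V)), Finset.sum_mul]
  refine Finset.sum_le_sum fun V _ => ?_
  by_cases hV : hatProb d (u t) V = 0
  · refine (measure_mono Set.inter_subset_left).trans ?_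
    rw [mu_ext hμ, hV]; simp
  · obtain ⟨x, y, a, b, c, e⟩ := hatProb_ne hd hV
    rw [e]
    refine (h x y a b c).trans ?_
    rw [mu_ext hμ, ENNReal.ofReal_mul (hatProb_nonneg hd _ _)]
    apply le_of_eq; ring

lemma cyl_card {d n : ℕ} (hd : 0 < d) {U0 : Conf d} (hU : U0.card = n) {μ : Measure (ℕ → Conf d)} (hμ : IsHATLaw d U0 μ) (u : ℕ → Conf d) (t : ℕ) :
    μ (cyl u t) ≠ 0 → (u t).card = n := by
  induction t with
  | zero =>
    intro h
    unfold cyl at h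
    rw [hμ.2 0 u] at h
    by_cases h0 : u 0 = U0
    · rw [h0, hU]
    · simp [h0] at h
  | succ t ih =>
    intro h
    have e : cyl u (t+1) = cyl (ext u t (u (t+1))) (t+1) := by
      unfold ext; rw [Function.update_eq_self]
    rw [e, mu_ext hμ] at h
    have h1 := ih (left_ne_zero_of_mul h)
    have h2 : hatProb d (u t) (u (t+1)) ≠ 0 := fun h3 => h (by rw [h3]; simp)
    obtain ⟨x, y, a, b, c, e⟩ := hatProb_ne hd h2
    rw [e, mv_card a c, h1]

/-- A set which every cylinder meets in at most a fixed fraction is null. -/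
lemma null_of_cyl {d : ℕ} {μ : Measure (ℕ → Conf d)} [IsProbabilityMeasure μ] {S : Set (ℕ → Conf d)} (hS : MeasurableSet S) {q : ℝ} (hq0 : 0 ≤ q) (hq : q < 1)
    (h : ∀ u t, μ (cyl u t ∩ S) ≤ ENNReal.ofReal q * μ (cyl u t)) : μ S = 0 := by
  classical
  have hA : ∀ A ∈ measurableCylinders (fun _ : ℕ => Conf d), μ (A ∩ S) ≤ ENNReal.ofReal q * μ A := by
    intro A hA
    obtain ⟨s, B, hB, rfl⟩ := (mem_measurableCylinders _).1 hA
    obtain ⟨t, ht⟩ : ∃ t, ∀ i ∈ s, i ≤ t := ⟨s.sup id, fun i hi => Finset.le_sup (f := id) hi⟩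
    obtain ⟨r, hr⟩ : ∃ r : (ℕ → Conf d) → (Fin (t+1) → Conf d), r = fun ω i => ω i := ⟨_, rfl⟩
    obtain ⟨e, he⟩ : ∃ e : (Fin (t+1) → Conf d) → (ℕ → Conf d), e = fun v i => if hi : i < t+1 then v ⟨i, hi⟩ else ∅ := ⟨_, rfl⟩
    have hre : ∀ ω v, r ω = v ↔ ω ∈ cyl (e v) t := by
      intro ω v
      subst hr; subst he
      constructor
      · rintro rfl i hi
        simp [Nat.lt_succ_of_le hi]
      · intro hω
        funext i
        have := hω i (by omega)
        simpa [Nat.le_of_lt_succ i.2] using this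
    have hcm : ∀ v, MeasurableSet (cyl (e v) t) := by
      intro v
      have : cyl (e v) t = ⋂ s ≤ t, {ω | ω s = e v s} := by ext ω; simp [cyl]
      rw [this]
      refine MeasurableSet.iInter fun s => MeasurableSet.iInter fun _ => ?_
      have h1 : MeasurableSet ({e v s} : Set (Conf d)) := trivial
      exact (measurable_pi_apply (X := fun _ : ℕ => Conf d) s) h1
    obtain ⟨Q, hQ⟩ : ∃ Q, Q = {v : Fin (t+1) → Conf d | e v ∈ cylinder s B} := ⟨_, rfl⟩
    have hun : cylinder s B = ⋃ v : Q, cyl (e v) t := by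
      ext ω
      have key : ∀ ω ω' : ℕ → Conf d, (∀ i ≤ t, ω i = ω' i) → (ω ∈ cylinder s B ↔ ω' ∈ cylinder s B) := by
        intro ω ω' hw
        have : s.restrict ω = s.restrict ω' := by
          funext i; exact hw i (ht i i.2)
        simp only [mem_cylinder]
        rw [this]
      simp only [Set.mem_iUnion]
      constructor
      · intro hω
        have h1 : ω ∈ cyl (e (r ω)) t := (hre _ _).1 rfl
        refine ⟨⟨r ω, ?_⟩, h1⟩
        rw [hQ]; exact (key _ _ h1).1 hω
      · rintro ⟨⟨v, hv⟩, hω⟩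
        rw [hQ] at hv
        exact (key _ _ hω).2 hv
    have hdis : Pairwise (Function.onFun Disjoint fun v : Q => cyl (e v) t) := by
      intro v v' hv
      rw [Function.onFun, Set.disjoint_left]
      intro ω h1 h2
      exact hv (Subtype.ext (((hre _ _).2 h1).symm.trans ((hre _ _).2 h2)))
    rw [hun, Set.iUnion_inter]
    refine (measure_iUnion_le _).trans ?_
    rw [measure_iUnion hdis fun v => hcm v, ← ENNReal.tsum_mul_left]
    exact ENNReal.tsum_le_tsum fun v => h _ _
  have hden := Measure.MeasureDense.of_generateFrom_isSetAlgebra_finite (μ := μ) (isSetAlgebra_measurableCylinders (α := fun _ : ℕ => Conf d)) generateFrom_measurableCylinders.symm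
  have hfin : μ S ≠ ⊤ := measure_ne_top _ _
  have hr : ∀ ε : ℝ, 0 < ε → μ.real S ≤ q * (μ.real S + ε) + ε := by
    intro ε hε
    obtain ⟨A, hAm, hlt⟩ := hden.approx S hS hfin ε hε
    have h1 := hA A hAm
    have hlt' : μ.real (symmDiff S A) < ε := by
      rw [Measure.real]
      exact (ENNReal.toReal_lt_of_lt_ofReal hlt)
    have h2 : μ.real (A ∩ S) ≤ q * μ.real A := by
      have := ENNReal.toReal_mono (ENNReal.mul_ne_top ENNReal.ofReal_ne_top (measure_ne_top _ _)) h1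
      rwa [ENNReal.toReal_mul, ENNReal.toReal_ofReal hq0] at this
    have h3 : μ.real S ≤ μ.real (A ∩ S) + μ.real (symmDiff S A) :=
      (measureReal_mono (fun x hx => by by_cases hxA : x ∈ A; exacts [Or.inl ⟨hxA, hx⟩, Or.inr (Or.inl ⟨hx, hxA⟩)])).trans (measureReal_union_le _ _)
    have h4 : μ.real A ≤ μ.real S + μ.real (symmDiff S A) :=
      (measureReal_mono (fun x hx => by by_cases hxA : x ∈ S; exacts [Or.inl hxA, Or.inr (Or.inr ⟨hx, hxA⟩)])).trans (measureReal_union_le _ _)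
    nlinarith
  have : μ.real S ≤ 0 := by
    by_contra hc
    push Not at hc
    have := hr ((1-q)*μ.real S/4) (by have : 0 < 1-q := by linarith
                                      positivity)
    nlinarith [mul_pos (sub_pos.2 hq) hc]
  have h0 : μ.real S = 0 := le_antisymm this measureReal_nonneg
  exact (measureReal_eq_zero_iff hfin).1 h0

/-! ### Natural clustering along HAT -/

lemma natClust_shift {d : ℕ} (ω : ℕ → Conf d) (c : ClusteringS d) (s : ℕ) :
    natClust d ω c (s+1) = natClust d (fun r => ω (r+1)) (clustStep d (ω 0) (ω 1) c) s := by
  induction s with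
  | zero => rfl
  | succ s ih =>
    show clustStep d (ω (s+1)) (ω (s+2)) (natClust d ω c (s+1)) = _
    rw [ih]; rfl

lemma union_updx {d k : ℕ} {C : Fin k → Finset (Pt d)} (h : ∀ i j, i ≠ j → ∀ x ∈ C i, x ∉ C j) {x : Pt d} (hx : x ∈ Finset.univ.biUnion C) (y : Pt d) :
    Finset.univ.biUnion (updx C x y) = mv (Finset.univ.biUnion C) x y := by
  obtain ⟨i, _, hi⟩ := Finset.mem_biUnion.1 hx
  rw [updx_eq h hi]
  ext z
  simp only [Finset.mem_biUnion, Finset.mem_univ, true_and, mv, Finset.mem_insert, Finset.mem_erase]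
  constructor
  · rintro ⟨j, hj⟩
    by_cases e : j = i
    · subst e
      rw [Function.update_self, Finset.mem_insert, Finset.mem_erase] at hj
      rcases hj with hj | hj
      · exact Or.inl hj
      · exact Or.inr ⟨hj.1, j, hj.2⟩
    · rw [Function.update_of_ne e] at hj
      exact Or.inr ⟨fun hz => h i j (Ne.symm e) x hi (hz ▸ hj), j, hj⟩
  · rintro (hz | ⟨hz, j, hj⟩)
    · exact ⟨i, by rw [Function.update_self]; exact Finset.mem_insert.2 (Or.inl hz)⟩
    · by_cases e : j = i
      · subst e
        exact ⟨j, by rw [Function.update_self]; exact Finset.mem_insert.2 (Or.inr (Finset.mem_erase.2 ⟨hz, hj⟩))⟩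
      · exact ⟨j, by rw [Function.update_of_ne e]; exact hj⟩

lemma clustStep_eq {d : ℕ} {c : ClusteringS d} (h : ∀ i j, i ≠ j → ∀ x ∈ c.2 i, x ∉ c.2 j) {U : Conf d} (hU : confOf d c = U) {x y : Pt d} (hx : x ∈ U) (hy : y ∉ U.erase x) :
    clustStep d U (mv U x y) c = ⟨c.1, updx c.2 x y⟩ := by
  classical
  have hxU : x ∈ Finset.univ.biUnion c.2 := by rw [← hU] at hx; exact hx
  obtain ⟨i, _, hi⟩ := Finset.mem_biUnion.1 hxU
  by_cases e : y = x
  · have h1 : mv U x y = U := by rw [e]; exact Finset.insert_erase hx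
    have h2 : updx c.2 x y = c.2 := by
      funext j; unfold updx; split_ifs with hj
      · rw [e]; exact Finset.insert_erase hj
      · rfl
    rw [h1, h2]; unfold clustStep; rw [if_pos rfl]
  · have hyU : y ∉ U := fun hyU => hy (Finset.mem_erase.2 ⟨e, hyU⟩)
    have h0 : mv U x y ≠ U := fun h0 => hyU (h0 ▸ Finset.mem_insert_self _ _)
    have h1 : U \ mv U x y = {x} := by
      ext z
      simp only [mv, Finset.mem_sdiff, Finset.mem_insert, Finset.mem_erase, Finset.mem_singleton]
      constructor
      · rintro ⟨a, b⟩; by_contra hz; exact b (Or.inr ⟨hz, a⟩)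
      · intro hz
        subst hz
        exact ⟨hx, by rintro (b | b); exacts [e b.symm, b.1 rfl]⟩
    have h2 : mv U x y \ U = {y} := by
      ext z
      simp only [mv, Finset.mem_sdiff, Finset.mem_insert, Finset.mem_erase, Finset.mem_singleton]
      constructor
      · rintro ⟨a | a, b⟩
        exacts [a, absurd a.2 b]
      · intro hz; rw [hz]; exact ⟨Or.inl rfl, hyU⟩
    have hex : ∃ p : Pt d × Pt d × Fin c.1, U \ mv U x y = {p.1} ∧ mv U x y \ U = {p.2.1} ∧ p.1 ∈ c.2 p.2.2 := ⟨(x, y, i), h1, h2, hi⟩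
    unfold clustStep
    rw [if_neg h0, dif_pos hex]
    have hs := hex.choose_spec
    generalize hex.choose = p at hs ⊢
    obtain ⟨a, b, j⟩ := p
    obtain ⟨q1, q2, q3⟩ := hs
    have e1 : x = a := Finset.singleton_injective (h1.symm.trans q1)
    have e2 : y = b := Finset.singleton_injective (h2.symm.trans q2)
    simp only at q3 ⊢
    subst e1; subst e2
    rw [updx_eq h q3]; rfl

def Ok {d : ℕ} (n : ℕ) (G : (k : ℕ) → ℕ → (Fin k → Finset (Pt d)) → Prop) (ω : ℕ → Conf d) (c : ClusteringS d) (t s : ℕ) : Prop :=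
  G (natClust d ω c s).1 (t+s) (natClust d ω c s).2 ∧ confOf d (natClust d ω c s) = ω s ∧ (ω s).card = n ∧ 0 < (natClust d ω c s).1

lemma tail_le {d n : ℕ} (hd : 5 ≤ d) {U0 : Conf d} {μ : Measure (ℕ → Conf d)} (hμ : IsHATLaw d U0 μ)
    {G : (k : ℕ) → ℕ → (Fin k → Finset (Pt d)) → Prop} {B : (k : ℕ) → ℕ → ℕ → (Fin k → Finset (Pt d)) → ℝ}
    (h0 : ∀ k, 0 < k → ∀ T t C, 0 ≤ B k T t C) (h1 : ∀ k, 0 < k → ∀ T t C, ¬ G k t C → 1 ≤ B k T t C)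
    (h2 : ∀ k, 0 < k → ∀ T t C, G k t C → EU (Finset.univ.biUnion C) (fun x y => B k T (t+1) (updx C x y)) ≤ B k (T+1) t C)
    (h3 : ∀ k, 0 < k → ∀ t C, G k t C → ∀ i j, i ≠ j → ∀ x ∈ C i, x ∉ C j) (T : ℕ) :
    ∀ (t : ℕ) (u : ℕ → Conf d) (τ : ℕ) (c : ClusteringS d), 0 < c.1 → confOf d c = u τ → (u τ).card = n →
      μ (cyl u τ ∩ {ω | ∃ s ≤ T, ¬ Ok n G (fun r => ω (τ+r)) c t s}) ≤ ENNReal.ofReal (B c.1 T t c.2) * μ (cyl u τ) := by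
  induction T with
  | zero =>
    intro t u τ c hc hu hn
    by_cases hG : G c.1 t c.2
    · have : cyl u τ ∩ {ω | ∃ s ≤ 0, ¬ Ok n G (fun r => ω (τ+r)) c t s} = ∅ := by
        rw [Set.eq_empty_iff_forall_notMem]
        rintro ω ⟨hω, s, hs, hno⟩
        obtain rfl : s = 0 := by omega
        have := hω τ le_rfl
        exact hno ⟨hG, by show confOf d c = ω τ; rw [hu, this], by show (ω τ).card = n; rw [this, hn], hc⟩
      rw [this]; simp
    · have : (1 : ENNReal) ≤ ENNReal.ofReal (B c.1 0 t c.2) := by rw [← ENNReal.ofReal_one]; exact ENNReal.ofReal_le_ofReal (h1 _ hc _ _ _ hG)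
      calc _ ≤ 1 * μ (cyl u τ) := by rw [one_mul]; exact measure_mono Set.inter_subset_left
        _ ≤ _ := by gcongr
  | succ T ih =>
    intro t u τ c hc hu hn
    by_cases hG : G c.1 t c.2
    · have hdis := h3 _ hc _ _ hG
      have hU : Finset.univ.biUnion c.2 = u τ := hu
      classical
      have key := step_le (by omega) hμ u τ {ω | ∃ s ≤ T+1, ¬ Ok n G (fun r => ω (τ+r)) c t s} (fun V => if 0 < (clustStep d (u τ) V c).1 then B (clustStep d (u τ) V c).1 T (t+1) (clustStep d (u τ) V c).2 else 0)
        (fun V => by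
          split_ifs with h
          · exact h0 _ h _ _ _
          · exact le_rfl) ?_
      · refine key.trans ?_
        gcongr
        refine le_trans (le_of_eq ?_) (h2 _ hc T t c.2 hG)
        rw [hU]
        refine EU_congr (by omega) fun x y hx hy hy' => ?_
        rw [clustStep_eq hdis hu hx hy', if_pos hc]
      · intro x y hx hy hy'
        have e := clustStep_eq hdis hu hx hy'
        have hx' : x ∈ Finset.univ.biUnion c.2 := by rw [hU]; exact hx
        rw [e, if_pos hc]
        have eV : ext u τ (mv (u τ) x y) (τ+1) = mv (u τ) x y := Function.update_self _ _ _
        refine le_trans (measure_mono ?_) (ih (t+1) (ext u τ (mv (u τ) x y)) (τ+1) ⟨c.1, updx c.2 x y⟩ hc ?_ ?_)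
        · rintro ω ⟨hω, s, hs, hno⟩
          refine ⟨hω, ?_⟩
          have w0 : ω τ = u τ := by rw [hω τ (by omega)]; exact Function.update_of_ne (by omega) _ _
          have w1 : ω (τ+1) = mv (u τ) x y := by rw [hω _ le_rfl, eV]
          cases s with
          | zero => exact absurd ⟨hG, by show confOf d c = ω τ; rw [hu, w0], by show (ω τ).card = n; rw [w0, hn], hc⟩ hno
          | succ s =>
            refine ⟨s, by omega, fun hok => hno ?_⟩
            have hsh : natClust d (fun r => ω (τ+r)) c (s+1) = natClust d (fun r => ω (τ+1+r)) ⟨c.1, updx c.2 x y⟩ s := by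
              rw [natClust_shift]
              have a1 : (fun r => ω (τ+(r+1))) = fun r => ω (τ+1+r) := by funext r; congr 1; omega
              have a2 : clustStep d (ω (τ+0)) (ω (τ+1)) c = ⟨c.1, updx c.2 x y⟩ := by rw [add_zero, w0, w1, e]
              rw [a1, a2]
            have a3 : τ+(s+1) = τ+1+s := by omega
            have a4 : t+(s+1) = t+1+s := by omega
            unfold Ok at hok ⊢
            simp only at hok ⊢
            rw [hsh, a3, a4]
            exact hok
        · rw [eV]
          show Finset.univ.biUnion (updx c.2 x y) = _
          rw [union_updx hdis hx', hU]
        · rw [eV, mv_card hx hy', hn]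
    · have : (1 : ENNReal) ≤ ENNReal.ofReal (B c.1 (T+1) t c.2) := by rw [← ENNReal.ofReal_one]; exact ENNReal.ofReal_le_ofReal (h1 _ hc _ _ _ hG)
      calc _ ≤ 1 * μ (cyl u τ) := by rw [one_mul]; exact measure_mono Set.inter_subset_left
        _ ≤ _ := by gcongr

/-- Reachability with step probabilities at least `c`. -/
def Rn {d : ℕ} (c : ℝ) (S : Conf d → Prop) : ℕ → Conf d → Prop
  | 0, U => S U
  | N+1, U => S U ∨ ∃ x y, c ≤ pHAT d U x y ∧ Rn c S N (mv U x y)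

lemma reach_le {d n : ℕ} (hd : 5 ≤ d) (hn : 2 ≤ n) {U0 : Conf d} {μ : Measure (ℕ → Conf d)} (hμ : IsHATLaw d U0 μ) {c : ℝ} (hc : 0 < c) (hc1 : c ≤ 1) {S : Conf d → Prop} {E : Set (ℕ → Conf d)}
    (hS : ∀ u τ, S (u τ) → (u τ).card = n → μ (cyl u τ ∩ E) ≤ ENNReal.ofReal (1/2) * μ (cyl u τ)) (N : ℕ) :
    ∀ (u : ℕ → Conf d) (τ : ℕ), (u τ).card = n → Rn c S N (u τ) → μ (cyl u τ ∩ E) ≤ ENNReal.ofReal (1 - c^N/2) * μ (cyl u τ) := by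
  induction N with
  | zero =>
    intro u τ hu hR
    have : (1:ℝ) - c^0/2 = 1/2 := by norm_num
    rw [this]; exact hS u τ hR hu
  | succ N ih =>
    intro u τ hu hR
    have hp : c^(N+1) ≤ 1 := pow_le_one₀ hc.le hc1
    have hp' : c^N ≤ 1 := pow_le_one₀ hc.le hc1
    rcases hR with hR | ⟨x, y, hxy, hR⟩
    · refine (hS u τ hR hu).trans ?_
      gcongr; linarith
    · classical
      have key := step_le (by omega) hμ u τ E (fun V => if V = mv (u τ) x y then 1 - c^N/2 else 1) (fun V => by split_ifs <;> linarith) ?_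
      · refine key.trans ?_
        gcongr
        have e1 : EU (u τ) (fun a b => if mv (u τ) a b = mv (u τ) x y then 1 - c^N/2 else 1) ≤ EU (u τ) (fun a b => 1 - (c^N/2) * (if a = x ∧ b = y then 1 else 0)) := by
          refine EU_mono (by omega) fun a b _ _ _ => ?_
          by_cases hab : a = x ∧ b = y
          · rw [hab.1, hab.2]; simp
          · rw [if_neg hab]; split_ifs <;> [nlinarith [pow_pos hc N]; linarith]
        refine e1.trans ?_
        rw [EU_sub, EU_mul, EU_const hd (by omega)]
        have e2 := EU_single (d := d) (by omega) (U := u τ) (f := fun a b => if a = x ∧ b = y then 1 else 0) (fun a b _ _ _ => by split_ifs <;> norm_num) (x := x) (y := y) (by split_ifs <;> norm_num)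
        simp only [and_self, if_true, mul_one] at e2
        rw [pow_succ]
        nlinarith [pow_pos hc N, mul_le_mul_of_nonneg_left (hxy.trans e2) (pow_pos hc N).le]
      · intro a b ha hb hb'
        have eV : ext u τ (mv (u τ) a b) (τ+1) = mv (u τ) a b := Function.update_self _ _ _
        by_cases hab : mv (u τ) a b = mv (u τ) x y
        · simp only [if_pos hab]
          refine ih _ _ ?_ ?_
          · rw [eV, mv_card ha hb', hu]
          · rw [eV, hab]; exact hR
        · simp only [if_neg hab]
          rw [ENNReal.ofReal_one, one_mul]
          exact measure_mono Set.inter_subset_left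

/-! ### The conclusion, given uniform reachability -/

def Tgt {d : ℕ} (R : ℝ) (V : Conf d) : Prop := ∃ cl : ClusteringS d, IsClusteringOf d cl.2 V ∧ (∀ i, Line (cl.2 i)) ∧
  ∀ i j, i ≠ j → ∀ x ∈ cl.2 i, ∀ y ∈ cl.2 j, R ≤ ‖emb x - emb y‖

lemma inC_of {d n : ℕ} (hn : 4 ≤ n) {k : ℕ} {C : Fin k → Finset (Pt d)} {U : Conf d} {a b : ℝ} (hU : Finset.univ.biUnion C = U) (hc : U.card = n)
    (h : (∀ i, Shp (C i)) ∧ ∀ i j, i ≠ j → ∀ x ∈ C i, ∀ y ∈ C j, a ≤ ‖emb x - emb y‖ ∧ diam0 d (C i) ≤ b * Real.log ‖emb x - emb y‖ ∧ 1 ≤ ‖emb x - emb y‖) :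
    InC d U a b ⟨k, C⟩ := by
  classical
  obtain ⟨hs, h⟩ := h
  have hne : ∀ i, ∃ y, y ∈ others d C i := by
    intro i
    by_contra hcon
    push Not at hcon
    have : U ⊆ C i := by
      intro z hz
      rw [← hU] at hz
      obtain ⟨j, _, hj⟩ := Finset.mem_biUnion.1 hz
      by_cases e : j = i
      · rw [← e]; exact hj
      · exact absurd (Finset.mem_biUnion.2 ⟨j, Finset.mem_univ _, by rw [if_neg e]; exact hj⟩) (hcon z)
    have := Finset.card_le_card this
    have := (hs i).card_le
    omega
  have hoth : ∀ i, ∀ y ∈ others d C i, ∃ j, i ≠ j ∧ y ∈ C j := by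
    intro i y hy
    obtain ⟨j, _, hj⟩ := Finset.mem_biUnion.1 hy
    by_cases e : j = i
    · rw [if_pos e] at hj; exact absurd hj (Finset.notMem_empty _)
    · rw [if_neg e] at hj; exact ⟨j, Ne.symm e, hj⟩
  have hatt : ∀ i, ∃ j, i ≠ j ∧ ∃ x ∈ C i, ∃ y ∈ C j, setDist d (C i) (others d C i) = ‖emb x - emb y‖ := by
    intro i
    obtain ⟨y, hy⟩ := hne i
    obtain ⟨x, hx⟩ := (hs i).nonempty
    have hfin : {r : ℝ | ∃ x ∈ C i, ∃ y ∈ others d C i, r = dist0 d x y}.Finite := by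
      refine ((C i ×ˢ others d C i).image (fun p => dist0 d p.1 p.2)).finite_toSet.subset ?_
      rintro r ⟨x, hx, y, hy, rfl⟩
      exact Finset.mem_coe.2 (Finset.mem_image.2 ⟨(x, y), Finset.mem_product.2 ⟨hx, hy⟩, rfl⟩)
    obtain ⟨x, hx, y, hy, e⟩ := Set.Nonempty.csInf_mem (s := {r : ℝ | ∃ x ∈ C i, ∃ y ∈ others d C i, r = dist0 d x y}) ⟨_, x, hx, y, hy, rfl⟩ hfin
    obtain ⟨j, hj, hy'⟩ := hoth i y hy
    exact ⟨j, hj, x, hx, y, hy', by rw [← dist0_eq, ← e]; rfl⟩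
  refine ⟨⟨fun i => (hs i).nonempty, fun i j hij => ?_, hU⟩, fun i => (hs i).1, ?_, fun i => ?_⟩
  · rw [Finset.disjoint_left]
    intro z hz hz'
    have := (h i j hij z hz z hz').2.2
    simp at this
    linarith
  · have : 0 < U.card := by omega
    obtain ⟨z, hz⟩ := Finset.card_pos.1 this
    rw [← hU] at hz
    obtain ⟨j, _, hj⟩ := Finset.mem_biUnion.1 hz
    haveI : Nonempty (Fin k) := ⟨j⟩
    refine le_ciInf fun i => ?_
    obtain ⟨j, hj, x, hx, y, hy, e⟩ := hatt i
    show a ≤ setDist d (C i) (others d C i)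
    rw [e]; exact (h i j hj x hx y hy).1
  · obtain ⟨j, hj, x, hx, y, hy, e⟩ := hatt i
    show diam0 d (C i) ≤ b * Real.log (setDist d (C i) (others d C i))
    rw [e]; exact (h i j hj x hx y hy).2.1

instance (d : ℕ) : MeasurableSpace (ClusteringS d) := ⊤
instance (d : ℕ) : Countable (ClusteringS d) := inferInstanceAs (Countable (Σ k : ℕ, Fin k → Finset (Pt d)))

lemma meas_bad {d n : ℕ} (b : ℝ) : MeasurableSet {ω : ℕ → Conf d | ¬ ∃ (θ : ℕ) (C : ClusteringS d), IsClusteringOf d C.2 (ω θ) ∧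
    ∀ t : ℕ, θ ≤ t → InC d (ω t) (aSep n (t - θ)) b (natClust d (fun s => ω (θ + s)) C (t - θ))} := by
  haveI : DiscreteMeasurableSpace (Conf d) := ⟨fun _ => trivial⟩
  haveI : DiscreteMeasurableSpace (ClusteringS d) := ⟨fun _ => trivial⟩
  have hnat : ∀ (θ : ℕ) (C : ClusteringS d) (s : ℕ), Measurable (fun ω : ℕ → Conf d => natClust d (fun s => ω (θ + s)) C s) := by
    intro θ C s
    induction s with
    | zero => exact measurable_const
    | succ s ih =>
      have h1 : Measurable (fun p : (Conf d × Conf d) × ClusteringS d => clustStep d p.1.1 p.1.2 p.2) := measurable_of_countable _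
      exact h1.comp (((measurable_pi_apply (θ+s)).prodMk (measurable_pi_apply (θ+s+1))).prodMk ih)
  refine MeasurableSet.compl ?_
  have e : {ω : ℕ → Conf d | ∃ (θ : ℕ) (C : ClusteringS d), IsClusteringOf d C.2 (ω θ) ∧
    ∀ t : ℕ, θ ≤ t → InC d (ω t) (aSep n (t - θ)) b (natClust d (fun s => ω (θ + s)) C (t - θ))} =
    ⋃ (θ : ℕ), ⋃ (C : ClusteringS d), ({ω | IsClusteringOf d C.2 (ω θ)} ∩ ⋂ (t : ℕ), {ω | θ ≤ t → InC d (ω t) (aSep n (t - θ)) b (natClust d (fun s => ω (θ + s)) C (t - θ))}) := by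
    ext ω; simp
  refine MeasurableSet.congr ?_ e.symm
  refine MeasurableSet.iUnion fun θ => MeasurableSet.iUnion fun C => MeasurableSet.inter ?_ (MeasurableSet.iInter fun t => ?_)
  · have h2 : MeasurableSet {V : Conf d | IsClusteringOf d C.2 V} := trivial
    have h3 : Measurable (fun ω : ℕ → Conf d => ω θ) := measurable_pi_apply θ
    exact h3 h2
  · exact measurableSet_preimage ((measurable_pi_apply (X := fun _ => Conf d) t).prodMk (hnat θ C (t-θ))) (show MeasurableSet {p : Conf d × ClusteringS d | θ ≤ t → InC d p.1 (aSep n (t - θ)) b p.2} from Set.Countable.measurableSet (Set.to_countable _))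

theorem hat_of_reach {d n : ℕ} (hd : 5 ≤ d) (hn : 4 ≤ n)
    (hA : ∀ R : ℝ, 0 < R → ∃ (c : ℝ) (N : ℕ), 0 < c ∧ c ≤ 1 ∧ ∀ U : Conf d, U.card = n → Rn c (Tgt R) N U) :
    ∃ b : ℝ, 0 < b ∧
      ∀ U0 : Conf d, U0.card = n →
        ∀ μ : Measure (ℕ → Conf d), IsHATLaw d U0 μ →
          μ {ω | ¬ ∃ (θ : ℕ) (C : ClusteringS d),
              IsClusteringOf d C.2 (ω θ) ∧
              ∀ t : ℕ, θ ≤ t →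
                InC d (ω t) (aSep n (t - θ)) b
                  (natClust d (fun s => ω (θ + s)) C (t - θ))} = 0 := by
  classical
  obtain ⟨b, hb, hst⟩ := stay hd hn
  refine ⟨b, hb, fun U0 hU0 μ hμ => ?_⟩
  have hst' : ∀ k, ∃ (R : ℝ) (G : ℕ → (Fin k → Finset (Pt d)) → Prop) (B : ℕ → ℕ → (Fin k → Finset (Pt d)) → ℝ), 0 < R ∧ (0 < k → 
    (∀ T t C, 0 ≤ B T t C) ∧ (∀ T t C, ¬ G t C → 1 ≤ B T t C) ∧
    (∀ T t C, G t C → EU (Finset.univ.biUnion C) (fun x y => B T (t+1) (updx C x y)) ≤ B (T+1) t C) ∧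
    (∀ C, (∀ i, Line (C i)) → (∀ i j, i ≠ j → ∀ x ∈ C i, ∀ y ∈ C j, R ≤ ‖emb x - emb y‖) → ∀ T, B T 0 C ≤ 1/2) ∧
    (∀ t C, G t C → (∀ i, Shp (C i)) ∧ ∀ i j, i ≠ j → ∀ x ∈ C i, ∀ y ∈ C j, aSep n t ≤ ‖emb x - emb y‖ ∧ diam0 d (C i) ≤ b * Real.log ‖emb x - emb y‖ ∧ 1 ≤ ‖emb x - emb y‖)) := by
    intro k
    by_cases hk : 0 < k
    · obtain ⟨R, G, B, hR, h⟩ := hst k hk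
      exact ⟨R, G, B, hR, fun _ => h⟩
    · exact ⟨1, fun _ _ => True, fun _ _ _ => 0, one_pos, fun h => absurd h hk⟩
  choose R G B hR h using hst'
  obtain ⟨c, N, hc, hc1, hreach⟩ := hA (∑ k ∈ Finset.range (n+1), R k) (Finset.sum_pos (fun k _ => hR k) ⟨0, by simp⟩)
  haveI := hμ.1
  have hcN : c^N ≤ 1 := pow_le_one₀ hc.le hc1
  have hcN0 : 0 < c^N := pow_pos hc N
  refine null_of_cyl (meas_bad b) (q := 1 - c^N/2) (by linarith) (by linarith) fun u t => ?_
  by_cases hz : μ (cyl u t) = 0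
  · rw [hz, mul_zero]
    exact le_of_eq (measure_mono_null Set.inter_subset_left hz)
  have hcard := cyl_card (by omega) hU0 hμ u t hz
  refine reach_le hd (by omega) hμ hc hc1 ?_ N u t hcard (hreach _ hcard)
  clear hcard hz
  intro u τ hS hcard
  obtain ⟨cl, hcl, hline, hfar⟩ := hS
  have hk0 : 0 < cl.1 := by
    by_contra h0
    have : 0 < (u τ).card := by omega
    obtain ⟨z, hz⟩ := Finset.card_pos.1 this
    rw [← hcl.2.2] at hz
    obtain ⟨j, _⟩ := Finset.mem_biUnion.1 hz
    have := j.2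
    omega
  have hkn : cl.1 ≤ n := by
    rw [← hcard, ← hcl.2.2, Finset.card_biUnion (fun i _ j _ hij => hcl.2.1 i j hij)]
    calc cl.1 = ∑ i : Fin cl.1, 1 := by simp
      _ ≤ _ := Finset.sum_le_sum fun i _ => Finset.card_pos.2 (hcl.1 i)
  have hRle : R cl.1 ≤ ∑ k ∈ Finset.range (n+1), R k := Finset.single_le_sum (f := R) (fun k _ => (hR k).le) (by simp; omega)
  have h12 := (h cl.1 hk0).2.2.2.1 cl.2 hline (fun i j hij x hx y hy => hRle.trans (hfar i j hij x hx y hy))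
  have htail : ∀ T, μ (cyl u τ ∩ {ω | ∃ s ≤ T, ¬ Ok n G (fun r => ω (τ+r)) cl 0 s}) ≤ ENNReal.ofReal (1/2) * μ (cyl u τ) := by
    intro T
    refine (tail_le hd hμ (G := G) (B := B) (fun k hk => (h k hk).1) (fun k hk => (h k hk).2.1) (fun k hk => (h k hk).2.2.1) ?_ T 0 u τ cl hk0 hcl.2.2 hcard).trans ?_
    · intro k hk t C hG i j hij x hx hx'
      have := (((h k hk).2.2.2.2 t C hG).2 i j hij x hx x hx').2.2
      simp at this
      linarith
    · gcongr; exact h12 T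
  have hun : cyl u τ ∩ {ω | ¬ ∃ (θ : ℕ) (C : ClusteringS d), IsClusteringOf d C.2 (ω θ) ∧
    ∀ t : ℕ, θ ≤ t → InC d (ω t) (aSep n (t - θ)) b (natClust d (fun s => ω (θ + s)) C (t - θ))} ⊆ ⋃ T, (cyl u τ ∩ {ω | ∃ s ≤ T, ¬ Ok n G (fun r => ω (τ+r)) cl 0 s}) := by
    rintro ω ⟨hω, hbad⟩
    rw [Set.mem_iUnion]
    by_contra hcon
    push Not at hcon
    have hok : ∀ s, Ok n G (fun r => ω (τ+r)) cl 0 s := by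
      intro s
      by_contra hs
      exact hcon s ⟨hω, s, le_rfl, hs⟩
    refine hbad ⟨τ, cl, by rw [hω τ le_rfl]; exact hcl, fun t ht => ?_⟩
    obtain ⟨a1, a2, a3, a4⟩ := hok (t - τ)
    have e : τ + (t - τ) = t := by omega
    simp only [e] at a2 a3
    rw [Nat.zero_add] at a1
    exact inC_of hn a2 a3 ((h _ a4).2.2.2.2 _ _ a1)
  refine (measure_mono hun).trans ?_
  rw [Monotone.measure_iUnion]
  · exact iSup_le htail
  · intro T T' hT ω hω
    obtain ⟨h1, s, hs, h2⟩ := hω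
    exact ⟨h1, s, hs.trans hT, h2⟩

/-! ### Reachability: the deterministic part -/

/-- paths above a finite set -/
lemma hs_path {d : ℕ} {W : Set (Pt d)} (k : Stp d) : ∀ (m : ℕ) (x y : Pt d), ∑ i, (y i - x i).natAbs = m → (∀ z ∈ W, sdot z k < sdot x k) → (∀ z ∈ W, sdot z k < sdot y k) → ∃ l, PathA W l x y := by
  intro m
  induction m using Nat.strong_induction_on with
  | _ m ih =>
    intro x y hm hx hy
    by_cases e : x = y
    · exact ⟨0, e⟩
    obtain ⟨i, hi⟩ := Function.ne_iff.1 e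
    obtain ⟨k', hk', hk''⟩ : ∃ k' : Stp d, k'.1 = i ∧ ((x i < y i ∧ stp k' = Pi.single i 1) ∨ (y i < x i ∧ stp k' = Pi.single i (-1))) := by
      rcases lt_or_gt_of_ne hi with h | h
      · exact ⟨(i, true), rfl, Or.inl ⟨h, by simp [stp]⟩⟩
      · exact ⟨(i, false), rfl, Or.inr ⟨h, by simp [stp]⟩⟩
    have hne : ∀ j, j ≠ i → (x + stp k') j = x j := by
      intro j hj
      rcases hk'' with ⟨_, h⟩ | ⟨_, h⟩ <;> rw [h] <;> simp [hj]
    have hii : (x i < y i ∧ (x + stp k') i = x i + 1) ∨ (y i < x i ∧ (x + stp k') i = x i - 1) := by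
      rcases hk'' with ⟨h', h⟩ | ⟨h', h⟩
      · left; rw [h]; simpa using h'
      · right; rw [h]; refine ⟨h', ?_⟩; simp; ring
    have hx' : ∀ z ∈ W, sdot z k < sdot (x + stp k') k := by
      intro z hz
      have h1 := hx z hz
      have h2 := hy z hz
      unfold sdot at h1 h2 ⊢
      by_cases e : k.1 = i
      · rw [e] at h1 h2 ⊢
        split_ifs at h1 h2 ⊢ <;> rcases hii with ⟨a, b⟩ | ⟨a, b⟩ <;> rw [b] <;> omega
      · rw [hne _ e]; exact h1
    obtain ⟨l, hl⟩ := ih (∑ j, (y j - (x + stp k') j).natAbs) (by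
      rw [← hm]
      refine Finset.sum_lt_sum (fun j _ => ?_) ⟨i, Finset.mem_univ _, ?_⟩
      · by_cases e : j = i
        · rw [e]; rcases hii with ⟨a, b⟩ | ⟨a, b⟩ <;> rw [b] <;> omega
        · rw [hne _ e]
      · rcases hii with ⟨a, b⟩ | ⟨a, b⟩ <;> rw [b] <;> omega) (x + stp k') y rfl hx' hy
    exact ⟨l+1, k', fun h => absurd (hx' _ h) (lt_irrefl _), hl⟩

/-- a legal local move -/
def Legal {d : ℕ} (B : Finset (Pt d)) (x y : Pt d) : Prop :=
  x ∈ B ∧ (∃ k, ∀ z ∈ B, sdot (z - x) k ≤ 0) ∧ (∃ l, PathA (↑(B.erase x)) l x y) ∧ y ∈ nbF (B.erase x) ∧ y ∉ B.erase x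

def LStp {d : ℕ} (B B' : Finset (Pt d)) : Prop := ∃ x y, Legal B x y ∧ B' = mv B x y

def GoodC {d : ℕ} (R : ℝ) (B : Finset (Pt d)) : Prop :=
  ∀ x ∈ B, ∃ L, Line L ∧ L ⊆ B ∧ x ∈ L ∧ ∀ z ∈ B, z ∉ L → ∀ w ∈ L, R ≤ ‖emb z - emb w‖

lemma bdd_coord {d : ℕ} (B : Finset (Pt d)) (i : Fin d) : ∃ M : ℤ, ∀ z ∈ B, z i < M := by
  rcases B.eq_empty_or_nonempty with h | h
  · exact ⟨0, by simp [h]⟩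
  · obtain ⟨x, hx, hz⟩ := B.exists_max_image (fun z => z i) h
    exact ⟨x i + 1, fun z hzB => by have := hz z hzB; omega⟩

/-- moving to a point above everything else -/
lemma legal_top {d : ℕ} {i0 i1 : Fin d} (hi : i0 ≠ i1) {B : Finset (Pt d)} {x y : Pt d} (hx : x ∈ B) (hk : ∃ k, ∀ z ∈ B, sdot (z - x) k ≤ 0)
    (hp : ∃ l p, PathA (↑(B.erase x)) l x p ∧ ∀ z ∈ B.erase x, z i1 < p i1)
    (hy : ∀ z ∈ B.erase x, z i0 < y i0) (hyw : y - stp (i0, true) ∈ B.erase x) : Legal B x y := by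
  obtain ⟨l, p, hl, hp⟩ := hp
  obtain ⟨M, hM⟩ := bdd_coord (B.erase x) i0
  have q1 : ∃ l', PathA (↑(B.erase x)) l' p (Function.update p i0 M) :=
    hs_path (i1, true) _ p _ rfl (fun z hz => by simpa [sdot] using hp z hz) (fun z hz => by
      simp only [sdot, if_true, Function.update_of_ne (Ne.symm hi)]; exact hp z hz)
  have q2 : ∃ l', PathA (↑(B.erase x)) l' (Function.update p i0 M) y :=
    hs_path (i0, true) _ _ y rfl (fun z hz => by simp only [sdot, if_true, Function.update_self]; exact hM z hz) (fun z hz => by simpa [sdot] using hy z hz)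
  obtain ⟨l1, q1⟩ := q1
  obtain ⟨l2, q2⟩ := q2
  refine ⟨hx, hk, ⟨_, (hl.trans q1).trans q2⟩, mem_nbF.2 ⟨opp (i0, true), ?_⟩, fun h => absurd (hy _ h) (lt_irrefl _)⟩
  rw [stp_opp]; simpa [sub_eq_add_neg] using hyw

lemma legal_bot {d : ℕ} {i0 i1 : Fin d} (hi : i0 ≠ i1) {B : Finset (Pt d)} {x y : Pt d} (hx : x ∈ B) (hk : ∀ z ∈ B, x i0 ≤ z i0)
    (hy : ∀ z ∈ B.erase x, z i0 < y i0) (hyw : y - stp (i0, true) ∈ B.erase x) : Legal B x y := by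
  refine legal_top hi hx ⟨(i0, false), fun z hz => by have := hk z hz; simp [sdot]; exact this⟩ ?_ hy hyw
  obtain ⟨M, hM⟩ := bdd_coord (B.erase x) i1
  have e : (x + stp (i0, false)) i0 = x i0 - 1 := by simp [stp]; ring
  obtain ⟨l, hl⟩ : ∃ l, PathA (↑(B.erase x)) l (x + stp (i0, false)) (Function.update (x + stp (i0, false)) i1 M) :=
    hs_path (i0, false) _ _ _ rfl (fun z hz => by
      have := hk z (Finset.mem_of_mem_erase hz)
      simp only [sdot, Bool.false_eq_true, if_false]; rw [e]; omega) (fun z hz => by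
      have := hk z (Finset.mem_of_mem_erase hz)
      simp only [sdot, Bool.false_eq_true, if_false, Function.update_of_ne hi]; rw [e]; omega)
  refine ⟨l+1, _, ⟨(i0, false), fun h => ?_, hl⟩, fun z hz => by rw [Function.update_self]; exact hM z hz⟩
  have := hk _ (Finset.mem_of_mem_erase (Finset.mem_coe.1 h))
  omega

lemma legal_line {d : ℕ} {i0 i1 : Fin d} (hi : i0 ≠ i1) {B : Finset (Pt d)} {x y : Pt d} (hx : x ∈ B) (hk : ∀ z ∈ B, z i1 = x i1)
    (hy : ∀ z ∈ B.erase x, z i0 < y i0) (hyw : y - stp (i0, true) ∈ B.erase x) : Legal B x y := by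
  refine legal_top hi hx ⟨(i1, true), fun z hz => by have := hk z hz; simp [sdot, this]⟩ ?_ hy hyw
  have e : (x + stp (i1, true)) i1 = x i1 + 1 := by simp [stp]
  refine ⟨1, x + stp (i1, true), ⟨(i1, true), fun h => ?_, rfl⟩, fun z hz => ?_⟩
  · have := hk _ (Finset.mem_of_mem_erase (Finset.mem_coe.1 h)); omega
  · have := hk _ (Finset.mem_of_mem_erase hz); omega

/-- vertical columns -/
def cl {d : ℕ} (i0 : Fin d) (b : Pt d) (j : ℕ) : Finset (Pt d) := (Finset.range j).image fun i : ℕ => b + (i : ℤ) • stp (i0, true)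

lemma mem_cl {d : ℕ} {i0 : Fin d} {b : Pt d} {j : ℕ} {z : Pt d} : z ∈ cl i0 b j ↔ ∃ i < j, z = b + (i : ℤ) • stp (i0, true) := by
  simp [cl, eq_comm]

lemma up0 {d : ℕ} (i0 : Fin d) (b : Pt d) (a : ℤ) : (b + a • stp (i0, true)) i0 = b i0 + a := by simp [stp]

lemma up1 {d : ℕ} {i0 i1 : Fin d} (hi : i0 ≠ i1) (b : Pt d) (a : ℤ) : (b + a • stp (i0, true)) i1 = b i1 := by simp [stp, Ne.symm hi]

/-- columns climb -/
lemma climb {d : ℕ} {i0 i1 : Fin d} (hi : i0 ≠ i1) {V : Finset (Pt d)} {b : Pt d} {j : ℕ} (hj : 2 ≤ j) (h0 : ∀ z ∈ V, z i0 < b i0) (h1 : ∀ z ∈ V, z i1 = b i1) (t : ℕ) :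
    Relation.ReflTransGen LStp (V ∪ cl i0 b j) (V ∪ cl i0 (b + (t:ℤ) • stp (i0, true)) j) := by
  classical
  induction t with
  | zero => simp; exact Relation.ReflTransGen.refl
  | succ t ih =>
    refine ih.tail ?_
    obtain ⟨b', hb'⟩ : ∃ b', b' = b + (t:ℤ) • stp (i0, true) := ⟨_, rfl⟩
    have e : b + ((t+1:ℕ):ℤ) • stp (i0, true) = b' + stp (i0, true) := by rw [hb']; push_cast; rw [add_smul, one_smul]; abel
    have g0 : ∀ z ∈ V, z i0 < b' i0 := fun z hz => by rw [hb', up0]; have := h0 z hz; omega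
    have g1 : ∀ z ∈ V, z i1 = b' i1 := fun z hz => by rw [hb', up1 hi]; exact h1 z hz
    rw [e, ← hb']
    have hc : ∀ z ∈ cl i0 b' j, b' i0 ≤ z i0 ∧ z i0 < b' i0 + j ∧ z i1 = b' i1 := by
      intro z hz
      obtain ⟨i, hi', rfl⟩ := mem_cl.1 hz
      rw [up0, up1 hi]; omega
    have hbm : b' ∈ V ∪ cl i0 b' j := Finset.mem_union_right _ (mem_cl.2 ⟨0, by omega, by simp⟩)
    refine ⟨b', b' + (j:ℤ) • stp (i0, true), legal_line hi hbm ?_ ?_ ?_, ?_⟩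
    · intro z hz
      rcases Finset.mem_union.1 hz with h | h
      exacts [g1 z h, (hc z h).2.2]
    · intro z hz
      rw [up0]
      rcases Finset.mem_union.1 (Finset.mem_of_mem_erase hz) with h | h
      · have := g0 z h; omega
      · exact (hc z h).2.1
    · refine Finset.mem_erase.2 ⟨fun h => ?_, Finset.mem_union_right _ (mem_cl.2 ⟨j-1, by omega, ?_⟩)⟩
      · have := congrFun h i0
        rw [Pi.sub_apply, up0] at this
        simp [stp] at this; omega
      · rw [Nat.cast_sub (by omega), sub_smul]; simp [sub_eq_add_neg, add_assoc]
    · ext z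
      unfold mv
      rw [Finset.mem_insert, Finset.mem_erase, Finset.mem_union, Finset.mem_union, mem_cl, mem_cl]
      constructor
      · rintro (h | ⟨i, hi', rfl⟩)
        · exact Or.inr ⟨fun hz => absurd (g0 z h) (by rw [hz]; omega), Or.inl h⟩
        · by_cases e : i + 1 = j
          · left; rw [← e]; push_cast; rw [add_smul, one_smul]; abel
          · right
            refine ⟨fun h => ?_, Or.inr ⟨i+1, by omega, by push_cast; rw [add_smul, one_smul]; abel⟩⟩
            have := congrFun h i0
            rw [up0] at this; simp [stp] at this; omega
      · rintro (h | ⟨hz, h | ⟨i, hi', rfl⟩⟩)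
        · right; exact ⟨j-1, by omega, by rw [h, Nat.cast_sub (by omega), sub_smul]; simp⟩
        · exact Or.inl h
        · right
          have : i ≠ 0 := by rintro rfl; simp at hz
          exact ⟨i-1, by omega, by rw [Nat.cast_sub (by omega), sub_smul]; simp⟩

lemma coord_le_norm {d : ℕ} (x y : Pt d) (i : Fin d) : ((x i - y i : ℤ) : ℝ) ≤ ‖emb x - emb y‖ := by
  have h := sdot_sq_le (x - y) (i, true)
  rw [nsq_eq, emb_sub] at h
  have := abs_le_of_sq_le_sq h (norm_nonneg _)
  refine le_trans (le_of_eq ?_) ((le_abs_self _).trans this)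
  simp [sdot]

lemma goodC_union {d : ℕ} {R : ℝ} {V P : Finset (Pt d)} (hV : GoodC R V) (hP : GoodC R P) (h : ∀ x ∈ V, ∀ y ∈ P, R ≤ ‖emb x - emb y‖) : GoodC R (V ∪ P) := by
  classical
  intro x hx
  rcases Finset.mem_union.1 hx with hx | hx
  · obtain ⟨L, a, b, c, e⟩ := hV x hx
    refine ⟨L, a, b.trans Finset.subset_union_left, c, fun z hz hzL w hw => ?_⟩
    rcases Finset.mem_union.1 hz with hz | hz
    · exact e z hz hzL w hw
    · rw [norm_sub_rev]; exact h w (b hw) z hz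
  · obtain ⟨L, a, b, c, e⟩ := hP x hx
    refine ⟨L, a, b.trans Finset.subset_union_right, c, fun z hz hzL w hw => ?_⟩
    rcases Finset.mem_union.1 hz with hz | hz
    · exact h z hz w (b hw)
    · exact e z hz hzL w hw

lemma goodC_line {d : ℕ} {R : ℝ} {L : Finset (Pt d)} (h : Line L) : GoodC R L :=
  fun x hx => ⟨L, h, le_rfl, hx, fun z hz hz' => absurd hz hz'⟩

lemma cl2 {d : ℕ} (i0 : Fin d) (b : Pt d) : Line (cl i0 b 2) := by
  left; refine ⟨b, (i0, true), ?_⟩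
  simp [cl, Finset.range_add_one, Finset.image_insert]
  rw [Finset.pair_comm]

lemma cl3 {d : ℕ} (i0 : Fin d) (b : Pt d) : Line (cl i0 b 3) := by
  right; refine ⟨b + stp (i0, true), (i0, true), ?_⟩
  ext z
  rw [mem_cl]
  simp only [Finset.mem_insert, Finset.mem_singleton, add_sub_cancel_right]
  constructor
  · rintro ⟨i, hi, rfl⟩
    interval_cases i
    · simp
    · simp
    · right; right; simp [add_assoc, two_smul]
  · rintro (rfl | rfl | rfl)
    exacts [⟨0, by simp⟩, ⟨1, by simp⟩, ⟨2, by omega, by simp [add_assoc, two_smul]⟩]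

/-- a column splits into dimers and trimers -/
lemma split {d : ℕ} {i0 i1 : Fin d} (hi : i0 ≠ i1) (R : ℕ) : ∀ (j : ℕ) (V : Finset (Pt d)) (b : Pt d), 2 ≤ j → (∀ z ∈ V, z i0 + R ≤ b i0) → (∀ z ∈ V, z i0 < b i0) → (∀ z ∈ V, z i1 = b i1) → GoodC R V →
    ∃ B', Relation.ReflTransGen LStp (V ∪ cl i0 b j) B' ∧ GoodC R B' := by
  classical
  intro j
  induction j using Nat.strong_induction_on with
  | _ j ih =>
    intro V b hj h0 h0' h1 hV
    have hfar : ∀ j' : ℕ, ∀ x ∈ V, ∀ y ∈ cl i0 b j', (R:ℝ) ≤ ‖emb x - emb y‖ := by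
      intro j' x hx y hy
      obtain ⟨i, hi', rfl⟩ := mem_cl.1 hy
      rw [norm_sub_rev]
      refine le_trans ?_ (coord_le_norm _ _ i0)
      rw [up0]
      have := h0 x hx
      have : (R:ℤ) ≤ b i0 + i - x i0 := by omega
      exact_mod_cast this
    by_cases h2 : j = 2
    · subst h2; exact ⟨_, Relation.ReflTransGen.refl, goodC_union hV (goodC_line (cl2 _ _)) (hfar _)⟩
    by_cases h3 : j = 3
    · subst h3; exact ⟨_, Relation.ReflTransGen.refl, goodC_union hV (goodC_line (cl3 _ _)) (hfar _)⟩
    have e : V ∪ cl i0 b j = (V ∪ cl i0 b 2) ∪ cl i0 (b + (2:ℤ) • stp (i0, true)) (j-2) := by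
      ext z
      simp only [Finset.mem_union, mem_cl, or_assoc]
      refine or_congr Iff.rfl ?_
      constructor
      · rintro ⟨i, hi', rfl⟩
        by_cases h : i < 2
        · exact Or.inl ⟨i, h, rfl⟩
        · exact Or.inr ⟨i-2, by omega, by rw [Nat.cast_sub (by omega), sub_smul]; simp⟩
      · rintro (⟨i, hi', rfl⟩ | ⟨i, hi', rfl⟩)
        · exact ⟨i, by omega, rfl⟩
        · exact ⟨i+2, by omega, by push_cast; rw [add_smul]; abel⟩
    have g : ∀ z ∈ V ∪ cl i0 b 2, z i0 < b i0 + 2 ∧ z i1 = b i1 := by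
      intro z hz
      rcases Finset.mem_union.1 hz with h | h
      · have := h0' z h; exact ⟨by omega, h1 z h⟩
      · obtain ⟨i, hi', rfl⟩ := mem_cl.1 h
        rw [up0, up1 hi]; omega
    have c1 := climb hi (V := V ∪ cl i0 b 2) (b := b + (2:ℤ) • stp (i0, true)) (j := j-2) (by omega) (fun z hz => by rw [up0]; exact (g z hz).1) (fun z hz => by rw [up1 hi]; exact (g z hz).2) R
    obtain ⟨B', r, hBB⟩ := ih (j-2) (by omega) (V ∪ cl i0 b 2) (b + (2:ℤ) • stp (i0, true) + (R:ℤ) • stp (i0, true)) (by omega)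
      (fun z hz => by rw [up0, up0]; have := (g z hz).1; omega) (fun z hz => by rw [up0, up0]; have := (g z hz).1; omega)
      (fun z hz => by rw [up1 hi, up1 hi]; exact (g z hz).2) (goodC_union hV (goodC_line (cl2 _ _)) (hfar _))
    rw [e]
    exact ⟨B', c1.trans r, hBB⟩

/-- every finite set with two elements can be disassembled -/
lemma gather {d : ℕ} {i0 i1 : Fin d} (hi : i0 ≠ i1) (R : ℕ) : ∀ (m : ℕ) (V : Finset (Pt d)) (b : Pt d) (j : ℕ), V.card = m → 1 ≤ j → 2 ≤ m + j → (∀ z ∈ V, z i0 ≤ b i0) → b ∉ V →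
    ∃ B', Relation.ReflTransGen LStp (V ∪ cl i0 b j) B' ∧ GoodC R B' := by
  classical
  intro m
  induction m with
  | zero =>
    intro V b j hV hj hj2 _ _
    rw [Finset.card_eq_zero.1 hV]
    exact split hi R j ∅ b (by omega) (by simp) (by simp) (by simp) (by intro x hx; simp at hx)
  | succ m ih =>
    intro V b j hV hj hj2 h0 hb
    obtain ⟨x, hx, hmin⟩ := V.exists_min_image (fun z => z i0) (Finset.card_pos.1 (by omega))
    have hxc : ∀ i : ℕ, x ≠ b + (i:ℤ) • stp (i0, true) := by
      rintro i h
      have h2 := congrFun h i0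
      rw [up0] at h2
      have := h0 x hx
      obtain rfl : i = 0 := by omega
      simp at h; exact hb (h ▸ hx)
    have hlt : ∀ z ∈ V ∪ cl i0 b j, z i0 < b i0 + j := by
      intro z hz
      rcases Finset.mem_union.1 hz with h | h
      · have := h0 z h; omega
      · obtain ⟨i, hi', rfl⟩ := mem_cl.1 h
        rw [up0]; omega
    have hleg : Legal (V ∪ cl i0 b j) x (b + (j:ℤ) • stp (i0, true)) := by
      refine legal_bot hi (Finset.mem_union_left _ hx) (fun z hz => ?_) (fun z hz => ?_) ?_
      · rcases Finset.mem_union.1 hz with h | h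
        · exact hmin z h
        · obtain ⟨i, hi', rfl⟩ := mem_cl.1 h
          rw [up0]; have := h0 x hx; omega
      · rw [up0]; exact hlt z (Finset.mem_of_mem_erase hz)
      · have e : b + (j:ℤ) • stp (i0, true) - stp (i0, true) = b + ((j-1:ℕ):ℤ) • stp (i0, true) := by
          rw [Nat.cast_sub (by omega), sub_smul]; simp [sub_eq_add_neg, add_assoc]
        rw [e]
        exact Finset.mem_erase.2 ⟨Ne.symm (hxc _), Finset.mem_union_right _ (mem_cl.2 ⟨j-1, by omega, rfl⟩)⟩
    have e : mv (V ∪ cl i0 b j) x (b + (j:ℤ) • stp (i0, true)) = V.erase x ∪ cl i0 b (j+1) := by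
      ext z
      unfold mv
      simp only [Finset.mem_insert, Finset.mem_erase, Finset.mem_union, mem_cl]
      constructor
      · rintro (h | ⟨h, h' | ⟨i, hi', h'⟩⟩)
        · exact Or.inr ⟨j, by omega, h⟩
        · exact Or.inl ⟨h, h'⟩
        · exact Or.inr ⟨i, by omega, h'⟩
      · rintro (h | ⟨i, hi', h⟩)
        · exact Or.inr ⟨h.1, Or.inl h.2⟩
        · by_cases e : i = j
          · left; rw [h, e]
          · right; exact ⟨by rw [h]; exact Ne.symm (hxc i), Or.inr ⟨i, by omega, h⟩⟩
    obtain ⟨B', r, hB'⟩ := ih (V.erase x) b (j+1) (by rw [Finset.card_erase_of_mem hx]; omega) (by omega) (by omega)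
      (fun z hz => h0 z (Finset.mem_of_mem_erase hz)) (fun h => hb (Finset.mem_of_mem_erase h))
    exact ⟨B', Relation.ReflTransGen.head ⟨x, _, hleg, e.symm⟩ r, hB'⟩

lemma disassemble {d : ℕ} (hd : 5 ≤ d) (R : ℕ) {B : Finset (Pt d)} (hB : 2 ≤ B.card) : ∃ B', Relation.ReflTransGen LStp B B' ∧ GoodC R B' := by
  classical
  obtain ⟨b, hb, hmax⟩ := B.exists_max_image (fun z => z ⟨0, by omega⟩) (Finset.card_pos.1 (by omega))
  have h := gather (d := d) (i0 := ⟨0, by omega⟩) (i1 := ⟨1, by omega⟩) (by simp) R (B.card - 1) (B.erase b) b 1 (Finset.card_erase_of_mem hb) le_rfl (by omega)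
    (fun z hz => hmax z (Finset.mem_of_mem_erase hz)) (by simp)
  have e : B.erase b ∪ cl ⟨0, by omega⟩ b 1 = B := by
    ext z
    simp only [Finset.mem_union, Finset.mem_erase, mem_cl]
    constructor
    · rintro (h | ⟨i, hi, rfl⟩)
      · exact h.2
      · obtain rfl : i = 0 := by omega
        simpa using hb
    · intro hz
      by_cases e : z = b
      · exact Or.inr ⟨0, by omega, by simpa using e⟩
      · exact Or.inl ⟨e, hz⟩
  rwa [e] at h

/-! ### Reachability: uniform bounds -/

def tr {d : ℕ} (v : Pt d) (B : Finset (Pt d)) : Finset (Pt d) := B.image (· + v)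

lemma mem_tr {d : ℕ} {v : Pt d} {B : Finset (Pt d)} {z : Pt d} : z ∈ tr v B ↔ z - v ∈ B := by
  unfold tr
  rw [Finset.mem_image]
  constructor
  · rintro ⟨a, ha, rfl⟩; simpa using ha
  · intro h; exact ⟨_, h, by simp⟩

lemma tr_card {d : ℕ} (v : Pt d) (B : Finset (Pt d)) : (tr v B).card = B.card := Finset.card_image_of_injective _ (add_left_injective v)

lemma add_mem_tr {d : ℕ} {v : Pt d} {B : Finset (Pt d)} {z : Pt d} : z + v ∈ tr v B ↔ z ∈ B := by rw [mem_tr, add_sub_cancel_right]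

lemma PathA_tr {d : ℕ} {W W2 : Set (Pt d)} {v : Pt d} {l : ℕ} {x y : Pt d} (h : PathA W l x y) (h2 : ∀ z ∈ W2, z - v ∈ W ∨ (l:ℝ) < ‖emb z - emb (x+v)‖) :
    PathA W2 l (x+v) (y+v) := by
  induction l generalizing x with
  | zero => cases h; rfl
  | succ l ih =>
    obtain ⟨k, hk, hp⟩ := h
    have e : x + v + stp k = x + stp k + v := by abel
    refine ⟨k, fun hW => ?_, ?_⟩
    · rcases h2 _ hW with h | h
      · rw [e, add_sub_cancel_right] at h; exact hk h
      · rw [← emb_sub, add_sub_cancel_left, norm_stp] at h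
        push_cast at h
        have : (0:ℝ) ≤ l := by positivity
        linarith
    · rw [e]
      refine ih hp fun z hz => (h2 z hz).imp id fun h => ?_
      have h3 : ‖emb z - emb (x+v)‖ ≤ ‖emb z - emb (x + stp k + v)‖ + 1 := by
        rw [← norm_stp k]
        refine le_trans (le_of_eq ?_) (norm_add_le _ _)
        rw [← e, emb_add (x+v)]; congr 1; abel
      push_cast at h
      linarith

lemma legal_prob {d : ℕ} (hd : 5 ≤ d) (n : ℕ) {B : Finset (Pt d)} {x y : Pt d} (h : Legal B x y) : ∃ M : ℕ, ∀ (v : Pt d) (W : Finset (Pt d)),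
    (∀ z ∈ W, ∀ b ∈ B, (M:ℝ) ≤ ‖emb z - emb (b+v)‖) → B.card + W.card ≤ n →
    1/((M:ℝ)+1) ≤ pHAT d (tr v B ∪ W) (x+v) (y+v) ∧ mv (tr v B ∪ W) (x+v) (y+v) = tr v (mv B x y) ∪ W := by
  classical
  obtain ⟨hx, ⟨k, hk⟩, ⟨l, hl⟩, hy, hy'⟩ := h
  obtain ⟨L, c, hc, hL, hesc⟩ := esc_ray hd n
  rcases Nat.eq_zero_or_pos n with rfl | hn
  · exact ⟨0, fun v W _ h => absurd (Finset.card_pos.2 ⟨x, hx⟩) (by omega)⟩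
  obtain ⟨ε, hε⟩ : ∃ ε, ε = c / n * (1 / (2 * d : ℝ))^(l+1) := ⟨_, rfl⟩
  have hd0 : (0:ℝ) < d := by exact_mod_cast (by omega : 0 < d)
  have hn0 : (0:ℝ) < n := by exact_mod_cast hn
  have hε0 : 0 < ε := by rw [hε]; positivity
  obtain ⟨M, hM⟩ := exists_nat_gt (2*(L:ℝ) + l + 1/ε)
  have i1 : (0:ℝ) ≤ l := by positivity
  have i2 : (1:ℝ) ≤ L := by exact_mod_cast hL
  have i3 : 0 < 1/ε := by positivity
  refine ⟨M, fun v W hW hcard => ?_⟩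
  have hxW : x + v ∉ W := by
    intro h
    have := hW _ h x hx
    simp at this
    have : (M:ℝ) ≤ 0 := by exact_mod_cast this.le
    linarith
  have hxm : x + v ∈ tr v B ∪ W := Finset.mem_union_left _ (add_mem_tr.2 hx)
  constructor
  · have h1 : 1/((M:ℝ)+1) ≤ ε := by
      rw [div_le_iff₀ (by positivity)]
      have : 1/ε ≤ M + 1 := by linarith
      rw [div_le_iff₀ hε0] at this
      linarith
    refine h1.trans ?_
    rw [hε]
    have hcard' : (tr v B ∪ W).card ≤ n := (Finset.card_union_le _ _).trans (by rw [tr_card]; exact hcard)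
    refine move_lower (by omega) hc.le hcard' hxm (hesc _ _ k hcard' hxm fun z hz => ?_) ?_ ?_
    · rcases Finset.mem_union.1 hz with h | h
      · left
        have := hk _ (mem_tr.1 h)
        rwa [sub_sub, add_comm v x] at this
      · right; rw [dist0_eq]; have := hW z h x hx; linarith
    · refine PathA_tr hl fun z hz => ?_
      have hz := Finset.mem_coe.1 hz
      rw [Finset.mem_erase, Finset.mem_union] at hz
      obtain ⟨h1, h2 | h2⟩ := hz
      · left
        refine Finset.mem_coe.2 (Finset.mem_erase.2 ⟨fun h => h1 ?_, mem_tr.1 h2⟩)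
        rw [← h]; abel
      · right; have := hW z h2 x hx; linarith
    · obtain ⟨k', hk'⟩ := mem_nbF.1 hy
      rw [Finset.mem_erase] at hk'
      refine mem_nbF.2 ⟨k', Finset.mem_erase.2 ⟨fun h => hk'.1 ?_, Finset.mem_union_left _ ?_⟩⟩
      · apply add_right_cancel (b := v); rw [← h]; abel
      · rw [show y + v + stp k' = y + stp k' + v by abel, add_mem_tr]; exact hk'.2
  · ext z
    simp only [mv, Finset.mem_insert, Finset.mem_erase, Finset.mem_union, mem_tr, sub_eq_iff_eq_add]
    constructor
    · rintro (h | ⟨h, h' | h'⟩)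
      · exact Or.inl (Or.inl h)
      · exact Or.inl (Or.inr ⟨fun e => h (by rw [← sub_eq_iff_eq_add]; exact e), h'⟩)
      · exact Or.inr h'
    · rintro ((h | h) | h)
      · exact Or.inl h
      · exact Or.inr ⟨fun e => h.1 (by rw [e]; simp), Or.inl h.2⟩
      · exact Or.inr ⟨fun e => hxW (e ▸ h), Or.inr h⟩

lemma Rn_mono {d : ℕ} {c c' : ℝ} {S : Conf d → Prop} {N N' : ℕ} {U : Conf d} (hc : c' ≤ c) (hN : N ≤ N') (h : Rn c S N U) : Rn c' S N' U := by
  induction N' generalizing N U with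
  | zero => obtain rfl : N = 0 := by omega
            exact h
  | succ N' ih =>
    cases N with
    | zero => exact Or.inl h
    | succ N =>
      rcases h with h | ⟨x, y, hxy, h⟩
      · exact Or.inl h
      · exact Or.inr ⟨x, y, hc.trans hxy, ih (by omega) h⟩

lemma Rn_trans {d : ℕ} {c : ℝ} {S S' : Conf d → Prop} {N N' : ℕ} {U : Conf d} (h : Rn c S N U) (h' : ∀ V, S V → Rn c S' N' V) : Rn c S' (N + N') U := by
  induction N generalizing U with
  | zero => rw [Nat.zero_add]; exact h' _ h
  | succ N ih =>
    rw [Nat.succ_add]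
    rcases h with h | ⟨x, y, hxy, h⟩
    · exact Rn_mono le_rfl (by omega) (h' _ h)
    · exact Or.inr ⟨x, y, hxy, ih h⟩

lemma inv_mono {M M' : ℕ} (h : M ≤ M') : 1/((M':ℝ)+1) ≤ 1/((M:ℝ)+1) := by gcongr

lemma reach_unif {d : ℕ} (hd : 5 ≤ d) (n : ℕ) {B B' : Finset (Pt d)} (h : Relation.ReflTransGen LStp B B') : B'.card = B.card ∧ ∃ M : ℕ, ∀ (v : Pt d) (W : Finset (Pt d)),
    (∀ z ∈ W, ∀ b ∈ B, (M:ℝ) ≤ ‖emb z - emb (b+v)‖) → B.card + W.card ≤ n → Rn (1/((M:ℝ)+1)) (fun V => V = tr v B' ∪ W) M (tr v B ∪ W) := by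
  classical
  induction h using Relation.ReflTransGen.head_induction_on with
  | refl => exact ⟨rfl, 0, fun v W _ _ => rfl⟩
  | head h _ ih =>
    rename_i B B1
    obtain ⟨x, y, hl, rfl⟩ := h
    obtain ⟨hc, M1, h1⟩ := ih
    obtain ⟨M0, h0⟩ := legal_prob hd n hl
    obtain ⟨Q, hQ⟩ := exists_nat_gt ‖emb x - emb y‖
    have hcard := mv_card hl.1 hl.2.2.2.2
    refine ⟨hc.trans hcard, M0 + M1 + Q + 1, fun v W hW hWc => ?_⟩
    push_cast at hW
    have p0 : (0:ℝ) ≤ M0 := by positivity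
    have p1 : (0:ℝ) ≤ M1 := by positivity
    have p2 : (0:ℝ) ≤ Q := by positivity
    obtain ⟨a1, a2⟩ := h0 v W (fun z hz b hb => by have := hW z hz b hb; linarith) hWc
    refine Or.inr ⟨x+v, y+v, (inv_mono (by omega)).trans a1, ?_⟩
    rw [a2]
    refine Rn_mono (inv_mono (by omega)) (by omega) (h1 v W (fun z hz b hb => ?_) (by rw [hcard]; exact hWc))
    unfold mv at hb
    rcases Finset.mem_insert.1 hb with rfl | hb
    · have := hW z hz x hl.1
      have h3 : ‖emb z - emb (x+v)‖ ≤ ‖emb z - emb (b + v)‖ + ‖emb x - emb b‖ := by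
        rw [norm_sub_rev (emb x)]
        refine le_trans (le_of_eq ?_) (norm_add_le _ _)
        rw [emb_add, emb_add]; congr 1; abel
      linarith
    · have := hW z hz b (Finset.mem_of_mem_erase hb); linarith

lemma Line_tr {d : ℕ} {L : Finset (Pt d)} (h : Line L) (v : Pt d) : Line (tr v L) := by
  rcases h with ⟨o, k, rfl⟩ | ⟨o, k, rfl⟩
  · left; refine ⟨o+v, k, ?_⟩
    simp only [tr, Finset.image_insert, Finset.image_singleton]; rw [add_right_comm]
  · right; refine ⟨o+v, k, ?_⟩
    simp only [tr, Finset.image_insert, Finset.image_singleton]; rw [add_right_comm, sub_add_eq_add_sub]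

lemma GoodC_tr {d : ℕ} {R : ℝ} {B : Finset (Pt d)} (h : GoodC R B) (v : Pt d) : GoodC R (tr v B) := by
  intro x hx
  obtain ⟨L, a, b, c, e⟩ := h _ (mem_tr.1 hx)
  refine ⟨tr v L, Line_tr a v, Finset.image_subset_image b, mem_tr.2 c, fun z hz hzL w hw => ?_⟩
  have := e _ (mem_tr.1 hz) (fun h => hzL (mem_tr.2 h)) _ (mem_tr.1 hw)
  rwa [← emb_sub, sub_sub_sub_cancel_right, emb_sub] at this

/-- uniform disassembly of sets of bounded diameter -/
lemma unif_D {d : ℕ} (hd : 5 ≤ d) (n R D : ℕ) : ∃ M : ℕ, ∀ B : Finset (Pt d), 2 ≤ B.card → (∀ x ∈ B, ∀ y ∈ B, ‖emb x - emb y‖ ≤ D) →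
    ∃ B', GoodC R B' ∧ B'.card = B.card ∧ (∀ y ∈ B', ∀ x ∈ B, ‖emb y - emb x‖ ≤ M) ∧ ∀ W, (∀ z ∈ W, ∀ b ∈ B, (M:ℝ) ≤ ‖emb z - emb b‖) → B.card + W.card ≤ n →
      Rn (1/((M:ℝ)+1)) (fun V => V = B' ∪ W) M (B ∪ W) := by
  classical
  have h : ∀ B0 : Finset (Pt d), ∃ M : ℕ, 2 ≤ B0.card → ∃ B', GoodC R B' ∧ B'.card = B0.card ∧ (∀ y ∈ B', ∀ x ∈ B0, ‖emb y - emb x‖ ≤ M) ∧ ∀ v W, (∀ z ∈ W, ∀ b ∈ B0, (M:ℝ) ≤ ‖emb z - emb (b+v)‖) → B0.card + W.card ≤ n →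
      Rn (1/((M:ℝ)+1)) (fun V => V = tr v B' ∪ W) M (tr v B0 ∪ W) := by
    intro B0
    by_cases h2 : 2 ≤ B0.card
    · obtain ⟨B', hr, hg⟩ := disassemble hd R h2
      obtain ⟨hc, M, hM⟩ := reach_unif hd n hr
      obtain ⟨Q, hQ⟩ := exists_nat_gt (∑ y ∈ B', ∑ x ∈ B0, ‖emb y - emb x‖)
      refine ⟨M + Q, fun _ => ⟨B', hg, hc, fun y hy x hx => ?_, fun v W hW hcW => ?_⟩⟩
      · have h1 := Finset.single_le_sum (f := fun x => ‖emb y - emb x‖) (fun _ _ => norm_nonneg _) hx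
        have h2 := Finset.single_le_sum (f := fun y => ∑ x ∈ B0, ‖emb y - emb x‖) (fun _ _ => Finset.sum_nonneg fun _ _ => norm_nonneg _) hy
        have : (0:ℝ) ≤ M := by positivity
        push_cast; linarith
      · exact Rn_mono (inv_mono (by omega)) (by omega) (hM v W (fun z hz b hb => le_trans (by push_cast; simp) (hW z hz b hb)) hcW)
    · exact ⟨0, fun h => absurd h h2⟩
  choose M hM using h
  refine ⟨∑ B0 ∈ (Finset.Icc (fun _ => -(D:ℤ)) (fun _ => (D:ℤ)) : Finset (Pt d)).powerset, M B0, fun B hB hD => ?_⟩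
  obtain ⟨v, hv⟩ := Finset.card_pos.1 (show 0 < B.card by omega)
  obtain ⟨B0, hB0⟩ : ∃ B0, B0 = tr (-v) B := ⟨_, rfl⟩
  have e : B = tr v B0 := by
    ext z; rw [hB0, mem_tr, mem_tr]; simp
  have hmem : B0 ∈ (Finset.Icc (fun _ => -(D:ℤ)) (fun _ => (D:ℤ)) : Finset (Pt d)).powerset := by
    rw [Finset.mem_powerset]
    intro z hz
    rw [hB0, mem_tr, sub_neg_eq_add] at hz
    rw [Finset.mem_Icc]
    refine ⟨fun i => ?_, fun i => ?_⟩
    · have := (coord_le_norm v (z+v) i).trans (hD _ hv _ hz)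
      have h2 : v i - (z+v) i ≤ D := by exact_mod_cast this
      rw [Pi.add_apply] at h2
      simp only; omega
    · have := (coord_le_norm (z+v) v i).trans (hD _ hz _ hv)
      have h2 : (z+v) i - v i ≤ D := by exact_mod_cast this
      rw [Pi.add_apply] at h2
      simp only; omega
  have hle := Finset.single_le_sum (f := M) (fun _ _ => Nat.zero_le _) hmem
  generalize (∑ B0 ∈ (Finset.Icc (fun _ => -(D:ℤ)) (fun _ => (D:ℤ)) : Finset (Pt d)).powerset, M B0) = T at hle ⊢
  have hle' : (M B0 : ℝ) ≤ T := by exact_mod_cast hle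
  have hc0 : B.card = B0.card := by rw [e, tr_card]
  obtain ⟨B', g1, g2, g3, g4⟩ := hM B0 (by omega)
  refine ⟨tr v B', GoodC_tr g1 v, by rw [tr_card, g2, hc0], fun y hy x hx => ?_, fun W hW hcW => ?_⟩
  · rw [e] at hx
    have := g3 _ (mem_tr.1 hy) _ (mem_tr.1 hx)
    rw [← emb_sub, sub_sub_sub_cancel_right, emb_sub] at this
    linarith
  · rw [e] at hW ⊢
    exact Rn_mono (inv_mono hle) hle (g4 v W (fun z hz b hb => hle'.trans (hW z hz _ (add_mem_tr.2 hb))) (by rw [← hc0]; exact hcW))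

/-! ### Reachability: assembling the blocks -/

lemma clust_blocks {d : ℕ} (hd : 5 ≤ d) (n R D : ℕ) : ∃ Λ M : ℕ, ∀ (m : ℕ) (V P : Finset (Pt d)), V.card = m →
    (∀ x ∈ V, ∀ y ∈ V, ‖emb x - emb y‖ ≤ D ∨ (Λ:ℝ) ≤ ‖emb x - emb y‖) → (∀ x ∈ V, ∃ y ∈ V, y ≠ x ∧ ‖emb x - emb y‖ ≤ D) →
    (∀ x ∈ V, ∀ y ∈ P, (Λ:ℝ) - M ≤ ‖emb x - emb y‖) → GoodC R P → V.card + P.card ≤ n → Rn (1/((M:ℝ)+1)) (GoodC R) (M*m) (V ∪ P) := by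
  classical
  obtain ⟨M, hM⟩ := unif_D hd n R D
  refine ⟨2*M + R + 2*D + 1, M, fun m => ?_⟩
  have pM : (0:ℝ) ≤ M := by positivity
  have pR : (0:ℝ) ≤ R := by positivity
  have pD : (0:ℝ) ≤ D := by positivity
  push_cast
  induction m using Nat.strong_induction_on with
  | _ m ih =>
    intro V P hm hsep htwo hVP hP hn
    rcases V.eq_empty_or_nonempty with rfl | ⟨x, hx⟩
    · rw [Finset.empty_union]; exact Rn_mono le_rfl (Nat.zero_le _) (show Rn _ _ 0 P from hP)
    have tri : ∀ a b c : Pt d, ‖emb a - emb c‖ ≤ ‖emb a - emb b‖ + ‖emb b - emb c‖ := fun a b c => norm_sub_le_norm_sub_add_norm_sub _ _ _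
    obtain ⟨B, hB⟩ : ∃ B, B = V.filter (fun z => ‖emb x - emb z‖ ≤ D) := ⟨_, rfl⟩
    have mB : ∀ z, z ∈ B ↔ z ∈ V ∧ ‖emb x - emb z‖ ≤ D := fun z => by rw [hB, Finset.mem_filter]
    have hxB : x ∈ B := (mB x).2 ⟨hx, by simp⟩
    have hBV : B ⊆ V := by rw [hB]; exact Finset.filter_subset _ _
    have hBd : ∀ a ∈ B, ∀ b ∈ B, ‖emb a - emb b‖ ≤ D := by
      intro a ha b hb
      rw [mB] at ha hb
      have h1 := tri a x b
      rw [norm_sub_rev (emb a) (emb x)] at h1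
      rcases hsep a ha.1 b hb.1 with h | h
      · exact h
      · linarith [ha.2, hb.2]
    have hfar : ∀ a ∈ V \ B, ∀ b ∈ B, 2*(M:ℝ) + R + 2*D + 1 ≤ ‖emb a - emb b‖ := by
      intro a ha b hb
      rw [Finset.mem_sdiff] at ha
      rcases hsep a ha.1 b (hBV hb) with h | h
      · exfalso
        have h1 := tri x b a
        rw [norm_sub_rev (emb b) (emb a)] at h1
        have h2 := ((mB b).1 hb).2
        rcases hsep x hx a ha.1 with h3 | h3
        · exact ha.2 ((mB a).2 ⟨ha.1, h3⟩)
        · linarith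
      · exact h
    have hB2 : 2 ≤ B.card := by
      obtain ⟨y, hy, hne, hxy⟩ := htwo x hx
      have : ({x, y} : Finset (Pt d)) ⊆ B := by
        intro z hz
        rw [Finset.mem_insert, Finset.mem_singleton] at hz
        rcases hz with rfl | rfl
        · exact hxB
        · exact (mB _).2 ⟨hy, hxy⟩
      have h2 := Finset.card_le_card this
      rwa [Finset.card_pair (Ne.symm hne)] at h2
    have hsd := Finset.card_sdiff_add_card_eq_card hBV
    have hu := Finset.card_union_le (V \ B) P
    obtain ⟨B', g1, g2, g3, g4⟩ := hM B hB2 hBd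
    have e : V ∪ P = B ∪ ((V \ B) ∪ P) := by rw [← Finset.union_assoc, Finset.union_sdiff_of_subset hBV]
    have r1 := g4 ((V \ B) ∪ P) (fun z hz b hb => by
      rcases Finset.mem_union.1 hz with h | h
      · linarith [hfar z h b hb]
      · have := hVP b (hBV hb) z h
        rw [norm_sub_rev] at this; linarith) (by omega)
    rw [e]
    refine Rn_mono le_rfl ?_ (Rn_trans r1 (N' := M * (V \ B).card) (S' := GoodC R) ?_)
    · rw [← hm, ← hsd]; nlinarith
    rintro U rfl
    have e2 : B' ∪ ((V \ B) ∪ P) = (V \ B) ∪ (B' ∪ P) := by rw [← Finset.union_assoc, ← Finset.union_assoc, Finset.union_comm B']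
    rw [e2]
    have hu' := Finset.card_union_le B' P
    refine ih _ (by omega) (V \ B) (B' ∪ P) rfl ?_ ?_ ?_ ?_ (by omega)
    · intro a ha b hb
      exact hsep a (Finset.mem_sdiff.1 ha).1 b (Finset.mem_sdiff.1 hb).1
    · intro a ha
      obtain ⟨y, hy, hne, hay⟩ := htwo a (Finset.mem_sdiff.1 ha).1
      refine ⟨y, Finset.mem_sdiff.2 ⟨hy, fun hyB => ?_⟩, hne, hay⟩
      linarith [hfar a ha y hyB]
    · intro a ha b hb
      rcases Finset.mem_union.1 hb with hb | hb
      · have h1 := hfar a ha x hxB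
        have h2 := g3 b hb x hxB
        linarith [tri a b x]
      · exact hVP a (Finset.mem_sdiff.1 ha).1 b hb
    · refine goodC_union g1 hP fun a ha b hb => ?_
      have h1 := hVP x hx b hb
      have h2 := g3 a ha x hxB
      have h3 := tri x a b
      rw [norm_sub_rev (emb x) (emb a)] at h3
      linarith

lemma iso_move {d n : ℕ} (hd : 5 ≤ d) (hn : 2 ≤ n) : ∃ L M : ℕ, ∀ (U : Conf d) (x : Pt d), U.card = n → x ∈ U → (∀ z ∈ U, z ≠ x → (L:ℝ) ≤ ‖emb z - emb x‖) →
    ∃ y ∈ nbF (U.erase x), y ∉ U.erase x ∧ 1/((M:ℝ)+1) ≤ pHAT d U x y := by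
  classical
  obtain ⟨L, c, hc, hL, hesc⟩ := esc_ray hd n
  have hd0 : (0:ℝ) < d := by exact_mod_cast (by omega : 0 < d)
  have hn0 : (0:ℝ) < n := by exact_mod_cast (by omega : 0 < n)
  obtain ⟨ε, hε⟩ : ∃ ε, ε = c / n / (2*d*n+1) := ⟨_, rfl⟩
  have hε0 : 0 < ε := by rw [hε]; positivity
  obtain ⟨M, hM⟩ := exists_nat_gt (1/ε)
  have h1 : 1/((M:ℝ)+1) ≤ ε := by
    rw [div_le_iff₀ (by positivity)]
    rw [div_lt_iff₀ hε0] at hM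
    nlinarith
  refine ⟨2*L, M, fun U x hU hx hz => ?_⟩
  have he : c ≤ esc d (↑U) x := hesc U x (⟨0, by omega⟩, true) hU.le hx fun z hzU => by
    by_cases e : z = x
    · left; rw [e]; simp [sdot]
    · right; rw [dist0_eq]; have := hz z hzU e; push_cast at this; exact this
  have hs := sum_pHAT_y hd (by omega : 2 ≤ U.card) hx (Finset.Subset.refl (nbF (U.erase x)))
  have hcap := capa_le (d := d) (by omega) U
  have hcap0 := capa_pos hd (Finset.card_pos.1 (by omega : 0 < U.card))
  have hlow : c / n ≤ ∑ y ∈ nbF (U.erase x), pHAT d U x y := by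
    rw [hs, ← hU]
    gcongr
    exact hc.le.trans he
  by_contra hcon
  push Not at hcon
  have hall : ∀ y ∈ nbF (U.erase x), pHAT d U x y ≤ ε := by
    intro y hy
    by_cases hyU : y ∉ U.erase x
    · exact ((hcon y hy hyU).le).trans h1
    · by_contra hp
      have hne : pHAT d U x y ≠ 0 := by intro h; rw [h] at hp; exact hp hε0.le
      exact hyU (pHAT_ne_zero (by omega) hne).2.2
  have h2 := Finset.sum_le_card_nsmul _ _ _ hall
  have h3 : (nbF (U.erase x)).card ≤ 2*d*n := (nbF_card _).trans (Nat.mul_le_mul_left _ (by rw [← hU]; exact Finset.card_erase_le))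
  have h4 : ((nbF (U.erase x)).card : ℝ) ≤ 2*d*n := by exact_mod_cast h3
  rw [nsmul_eq_mul] at h2
  have h5 : ε * (2*d*n+1) = c / n := by rw [hε]; field_simp
  nlinarith

lemma colors {d n : ℕ} (hd : 5 ≤ d) (hn : 2 ≤ n) (R : ℕ) (k : ℕ) : ∀ D : ℕ, ∃ M : ℕ, ∀ U : Conf d, U.card = n →
    (∃ col : Pt d → Pt d, (U.image col).card ≤ k ∧ ∀ x ∈ U, ∀ y ∈ U, col x = col y → ‖emb x - emb y‖ ≤ D) → Rn (1/((M:ℝ)+1)) (GoodC R) M U := by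
  classical
  induction k with
  | zero =>
    intro D
    refine ⟨0, fun U hU ⟨col, h, _⟩ => ?_⟩
    have h1 : U.image col = ∅ := Finset.card_eq_zero.1 (by omega)
    rw [Finset.image_eq_empty] at h1
    rw [h1] at hU; simp at hU; omega
  | succ k ih =>
    intro D
    obtain ⟨Λ, M0, hpr⟩ := clust_blocks hd n R D
    obtain ⟨L, M2, hiso⟩ := iso_move hd hn
    obtain ⟨M1, hM1⟩ := ih (2*D + Λ + L + 1)
    have tri : ∀ a b c : Pt d, ‖emb a - emb c‖ ≤ ‖emb a - emb b‖ + ‖emb b - emb c‖ := fun a b c => norm_sub_le_norm_sub_add_norm_sub _ _ _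
    have pL : (0:ℝ) ≤ L := by positivity
    have pD : (0:ℝ) ≤ D := by positivity
    have pΛ : (0:ℝ) ≤ Λ := by positivity
    push_cast at hM1
    refine ⟨M0*n + M0 + M1 + M2 + 1, fun U hU ⟨col, hk, hcol⟩ => ?_⟩
    by_cases ha : ∃ x ∈ U, ∃ y ∈ U, col x ≠ col y ∧ ‖emb x - emb y‖ ≤ Λ + L
    · obtain ⟨x, hx, y, hy, hxy, hd'⟩ := ha
      refine Rn_mono (inv_mono (by omega)) (by omega) (hM1 U hU ⟨fun z => if col z = col x then col y else col z, ?_, ?_⟩)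
      · have : U.image (fun z => if col z = col x then col y else col z) ⊆ (U.image col).erase (col x) := by
          intro w hw
          obtain ⟨z, hz, rfl⟩ := Finset.mem_image.1 hw
          split_ifs with h
          · exact Finset.mem_erase.2 ⟨Ne.symm hxy, Finset.mem_image_of_mem _ hy⟩
          · exact Finset.mem_erase.2 ⟨h, Finset.mem_image_of_mem _ hz⟩
        have h2 := Finset.card_le_card this
        rw [Finset.card_erase_of_mem (Finset.mem_image_of_mem _ hx)] at h2
        omega
      · intro a ha b hb hab
        simp only at hab
        split_ifs at hab with h1 h2 h2
        · have := hcol a ha b hb (h1.trans h2.symm); linarith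
        · have q1 := hcol a ha x hx h1
          have q2 := hcol y hy b hb hab
          linarith [tri a x b, tri x y b]
        · have q1 := hcol a ha y hy hab
          have q2 := hcol x hx b hb h2.symm
          rw [norm_sub_rev] at hd'
          linarith [tri a y b, tri y x b]
        · have := hcol a ha b hb hab; linarith
    push Not at ha
    by_cases hb : ∃ x ∈ U, ∀ y ∈ U, y ≠ x → col y ≠ col x
    · obtain ⟨x, hx, hxa⟩ := hb
      obtain ⟨y, hy, hy', hp⟩ := hiso U x hU hx (fun z hz hzx => by have := ha z hz x hx (hxa z hz hzx); linarith)
      refine Or.inr ⟨x, y, (inv_mono (by omega)).trans hp, ?_⟩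
      obtain ⟨k', hw⟩ := mem_nbF.1 hy
      obtain ⟨w, hwd⟩ : ∃ w, w = y + stp k' := ⟨_, rfl⟩
      rw [← hwd] at hw
      rw [Finset.mem_erase] at hw
      have hyw : ‖emb y - emb w‖ = 1 := by rw [norm_sub_rev, hwd, ← emb_sub, add_sub_cancel_left, norm_stp]
      refine Rn_mono (inv_mono (by omega)) (by omega) (hM1 (mv U x y) (by rw [mv_card hx hy', hU]) ⟨fun z => if z = y then col w else col z, ?_, ?_⟩)
      · have : (mv U x y).image (fun z => if z = y then col w else col z) ⊆ (U.image col).erase (col x) := by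
          intro q hq
          obtain ⟨z, hz, rfl⟩ := Finset.mem_image.1 hq
          split_ifs with h
          · exact Finset.mem_erase.2 ⟨hxa w hw.2 hw.1, Finset.mem_image_of_mem _ hw.2⟩
          · have hz' := Finset.mem_erase.1 (Finset.mem_of_mem_insert_of_ne hz h)
            exact Finset.mem_erase.2 ⟨hxa z hz'.2 hz'.1, Finset.mem_image_of_mem _ hz'.2⟩
        have h2 := Finset.card_le_card this
        rw [Finset.card_erase_of_mem (Finset.mem_image_of_mem _ hx)] at h2
        omega
      · intro a ha' b hb' hab
        simp only at hab
        have hm : ∀ z ∈ mv U x y, z ≠ y → z ∈ U := fun z hz h => Finset.mem_of_mem_erase (Finset.mem_of_mem_insert_of_ne hz h)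
        split_ifs at hab with h1 h2 h2
        · rw [h1, h2, sub_self, norm_zero]; linarith
        · have q := hcol w hw.2 b (hm b hb' h2) hab
          rw [h1]; linarith [tri y w b]
        · have q := hcol a (hm a ha' h1) w hw.2 hab
          rw [norm_sub_rev] at hyw
          rw [h2]; linarith [tri a w y]
        · have := hcol a (hm a ha' h1) b (hm b hb' h2) hab; linarith
    · push Not at hb
      have h := hpr n U ∅ hU (fun x hx y hy => ?_) (fun x hx => ?_) (by simp) (by intro x hx; simp at hx) (by simp [hU])
      · rw [Finset.union_empty] at h
        exact Rn_mono (inv_mono (by omega)) (by omega) h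
      · by_cases e : col x = col y
        · exact Or.inl (hcol x hx y hy e)
        · have := ha x hx y hy e; right; linarith
      · obtain ⟨y, hy, h1, h2⟩ := hb x hx
        exact ⟨y, hy, h1, hcol x hx y hy h2.symm⟩

lemma tgt_of_good {d : ℕ} {R : ℝ} (hR : 2 < R) {U : Conf d} (h : GoodC R U) : Tgt R U := by
  classical
  obtain ⟨F, hF⟩ : ∃ F : Finset (Finset (Pt d)), F = U.powerset.filter (fun L => Line L ∧ ∀ z ∈ U, z ∉ L → ∀ w ∈ L, R ≤ ‖emb z - emb w‖) := ⟨_, rfl⟩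
  have mF : ∀ L, L ∈ F ↔ L ⊆ U ∧ Line L ∧ ∀ z ∈ U, z ∉ L → ∀ w ∈ L, R ≤ ‖emb z - emb w‖ := fun L => by rw [hF, Finset.mem_filter, Finset.mem_powerset]
  have hsub : ∀ L ∈ F, ∀ L' ∈ F, ∀ z ∈ L, z ∈ L' → L ⊆ L' := by
    intro L hL L' hL' z hz hz' w hw
    by_contra hw'
    have h1 := ((mF L').1 hL').2.2 w (((mF L).1 hL).1 hw) hw' z hz'
    have h2 := le_diam (A := L) hw hz
    have h3 := line_diam ((mF L).1 hL).2.1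
    linarith
  have hdis : ∀ L ∈ F, ∀ L' ∈ F, L ≠ L' → ∀ z ∈ L, z ∉ L' := fun L hL L' hL' hne z hz hz' =>
    hne (Finset.Subset.antisymm (hsub L hL L' hL' z hz hz') (hsub L' hL' L hL z hz' hz))
  have hinj : ∀ i j : Fin F.card, i ≠ j → ((F.equivFin.symm i : F) : Finset (Pt d)) ≠ (F.equivFin.symm j : F) := by
    intro i j hij h
    exact hij (F.equivFin.symm.injective (Subtype.ext h))
  refine ⟨⟨F.card, fun i => (F.equivFin.symm i : F)⟩, ⟨fun i => ?_, fun i j hij => ?_, ?_⟩, fun i => ((mF _).1 (F.equivFin.symm i).2).2.1, fun i j hij x hx y hy => ?_⟩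
  · exact (((mF _).1 (F.equivFin.symm i).2).2.1).shp.nonempty
  · rw [Finset.disjoint_left]
    exact hdis _ (F.equivFin.symm i).2 _ (F.equivFin.symm j).2 (hinj i j hij)
  · ext z
    simp only [Finset.mem_biUnion, Finset.mem_univ, true_and]
    constructor
    · rintro ⟨i, hi⟩
      exact ((mF _).1 (F.equivFin.symm i).2).1 hi
    · intro hz
      obtain ⟨L, a, b, c, e⟩ := h z hz
      exact ⟨F.equivFin ⟨L, (mF L).2 ⟨b, a, e⟩⟩, by simpa using c⟩
  · exact ((mF _).1 (F.equivFin.symm j).2).2.2 x (((mF _).1 (F.equivFin.symm i).2).1 hx) (hdis _ (F.equivFin.symm i).2 _ (F.equivFin.symm j).2 (hinj i j hij) x hx) y hy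

theorem uniform_reach {d n : ℕ} (hd : 5 ≤ d) (hn : 4 ≤ n) : ∀ R : ℝ, 0 < R → ∃ (c : ℝ) (N : ℕ), 0 < c ∧ c ≤ 1 ∧ ∀ U : Conf d, U.card = n → Rn c (Tgt R) N U := by
  classical
  intro R hR
  obtain ⟨Q, hQ⟩ := exists_nat_gt (R + 2)
  obtain ⟨M, hM⟩ := colors hd (by omega : 2 ≤ n) Q n 0
  refine ⟨1/((M:ℝ)+1), M, by positivity, ?_, fun U hU => ?_⟩
  · rw [div_le_one (by positivity)]; linarith [(Nat.cast_nonneg M : (0:ℝ) ≤ M)]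
  have h := hM U hU ⟨id, by rw [Finset.image_id, hU], fun x _ y _ h => by rw [show x = y from h]; simp⟩
  have := Rn_trans h (N' := 0) (S' := Tgt R) fun V hV => by
    obtain ⟨cl, a, b, c⟩ := tgt_of_good (by linarith) hV
    exact ⟨cl, a, b, fun i j hij x hx y hy => by have := c i j hij x hx y hy; linarith⟩
  exact this

/-- **The mechanism which produces transience.** For `d ≥ 5`, `n ≥ 4`, there is `b = b(n) > 0`
such that, from any `n`-element configuration, almost surely there is a (finite) time `θ`
and a clustering `C` of `U_θ` for which the natural clustering of `(U_θ, U_{θ+1}, …)` with `C`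
is an `(a_{t−θ}, b)` separated DOT clustering of `U_t` for every `t ≥ θ`,
where `a_s = s^{1/2 − n^{−100}} + 100 n`. -/
theorem hat_fate (d n : ℕ) (hd : 5 ≤ d) (hn : 4 ≤ n) :
    ∃ b : ℝ, 0 < b ∧
      ∀ U0 : Conf d, U0.card = n →
        ∀ μ : Measure (ℕ → Conf d), IsHATLaw d U0 μ →
          μ {ω | ¬ ∃ (θ : ℕ) (C : ClusteringS d),
              IsClusteringOf d C.2 (ω θ) ∧
              ∀ t : ℕ, θ ≤ t →
                InC d (ω t) (aSep n (t - θ)) b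
                  (natClust d (fun s => ω (θ + s)) C (t - θ))} = 0 := by
  exact hat_of_reach hd hn (uniform_reach hd hn)

end HATFormal
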